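/- Let n ≥ 5 and let φ be an automorphism of A[B_n]. Then there exist x ∈ A[B_n], ε ∈ {1,−1} and p ∈ ℤ such that ψ = conj_x ∘ φ is given on the standard generators by either (IIa) ψ(r_i) = r_i^ε Δ_B^p for all 1 ≤ i ≤ n−1 and ψ(r_n) = r_n^ε Δ_B^{−p(n−1)}, or (IIb) ψ(r_i) = r_i^ε Δ_B^p for all 1 ≤ i ≤ n−1 and ψ(r_n) = δ^{−ε} r_n^{−ε} Δ_B^{−p(n−1)}. Moreover, in the standard generators (for 1 ≤ i ≤ n−1): T(r_i) = r_i Δ_B and T(r_n) = r_n Δ_B^{−(n−1)}; τ(r_i) = r_{n−i}^{−1} and τ(r_n) = r_1 ⋯ r_{n−1} r_n^{−1} r_{n−1}^{−1} ⋯ r_1^{−1}; μ(r_i) = r_i^{−1} and μ(r_n) = δ r_n. -/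

import Mathlib

/-- The defining relators of the Artin group of type `Bₙ`, as elements of the free
group on `n` generators (0-indexed: generator `i` corresponds to `r_{i+1}`). -/
def BnRels (n : ℕ) : Set (FreeGroup (Fin n)) :=
  {w | (∃ i j : Fin n, (i : ℕ) + 1 = (j : ℕ) ∧ (j : ℕ) + 1 < n ∧
          w = FreeGroup.of i * FreeGroup.of j * FreeGroup.of i *
              (FreeGroup.of j * FreeGroup.of i * FreeGroup.of j)⁻¹) ∨
       (∃ i j : Fin n, (i : ℕ) + 2 = n ∧ (j : ℕ) + 1 = n ∧
          w = FreeGroup.of i * FreeGroup.of j * FreeGroup.of i * FreeGroup.of j *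
              (FreeGroup.of j * FreeGroup.of i * FreeGroup.of j * FreeGroup.of i)⁻¹) ∨
       (∃ i j : Fin n, (i : ℕ) + 2 ≤ (j : ℕ) ∧
          w = FreeGroup.of i * FreeGroup.of j * (FreeGroup.of j * FreeGroup.of i)⁻¹)}

/-- The Artin group `A[Bₙ]` of type `Bₙ`. -/
abbrev ArtinB (n : ℕ) := PresentedGroup (BnRels n)

/-- The standard generator `r_i` (1-indexed, `1 ≤ i ≤ n`). -/
def rB (n i : ℕ) : ArtinB n :=
  if h : i - 1 < n then PresentedGroup.of ⟨i - 1, h⟩ else 1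

/-- `ρ_B = r_1 r_2 ⋯ r_n`. -/
def ρB (n : ℕ) : ArtinB n := ((List.range n).map fun i => rB n (i + 1)).prod

/-- `Δ_B = ρ_B ^ n`, the generator of the center. -/
def ΔB (n : ℕ) : ArtinB n := ρB n ^ n

/-- `t_i` for `i` read modulo `n`: `t_i = r_i` for `1 ≤ i ≤ n-1`,
and `t_0 = ρ_B r_{n-1} ρ_B⁻¹`. -/
def tB (n i : ℕ) : ArtinB n :=
  if i % n = 0 then ρB n * rB n (n - 1) * (ρB n)⁻¹ else rB n (i % n)

/-- `Δ_Y = (t_1⋯t_{n-1})(t_1⋯t_{n-2})⋯(t_1t_2)t_1`, the Garside element of the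
parabolic subgroup of type `A_{n-1}`. -/
def ΔY (n : ℕ) : ArtinB n :=
  ((List.range (n - 1)).map fun k =>
    ((List.range (n - 1 - k)).map fun i => rB n (i + 1)).prod).prod

/-- `ρ_0 = t_1 t_2 ⋯ t_{n-1}`. -/
def ρ₀B (n : ℕ) : ArtinB n := ((List.range (n - 1)).map fun i => rB n (i + 1)).prod

/-- `ρ_1 = t_1⁻¹ t_2⁻¹ ⋯ t_{n-1}⁻¹`. -/
def ρ₁B (n : ℕ) : ArtinB n := ((List.range (n - 1)).map fun i => (rB n (i + 1))⁻¹).prod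

/-- `ρ_k` for `k ∈ {0,1}`. -/
def ρkB (n k : ℕ) : ArtinB n := if k = 0 then ρ₀B n else ρ₁B n

/-- `v_k = ρ_k t_{n-1} ρ_k⁻¹` for `k ∈ {0,1}`. -/
def vB (n k : ℕ) : ArtinB n := ρkB n k * rB n (n - 1) * (ρkB n k)⁻¹

/-- `δ = r_{n-1} r_{n-2} ⋯ r_2 r_1² r_2 ⋯ r_{n-2} r_{n-1}`. -/
def δB (n : ℕ) : ArtinB n :=
  ((List.range (n - 2)).map fun i => rB n (n - 1 - i)).prod * rB n 1 ^ 2 *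
  ((List.range (n - 2)).map fun i => rB n (i + 2)).prod

/-- The quotient `Ā = A[Bₙ]/Z(A[Bₙ])`. -/
abbrev AbarB (n : ℕ) := ArtinB n ⧸ Subgroup.center (ArtinB n)

/-- The canonical projection `π : A[Bₙ] → Ā`. -/
def πB (n : ℕ) : ArtinB n →* AbarB n := QuotientGroup.mk' (Subgroup.center (ArtinB n))

/-- `t̄_i = π(t_i)`. -/
def tbar (n i : ℕ) : AbarB n := πB n (tB n i)

/-- `ρ̄_B = π(ρ_B)`. -/
def ρbar (n : ℕ) : AbarB n := πB n (ρB n)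

/-- The composition `conj_x ∘ φ` of an endomorphism with an inner automorphism. -/
def conjComp {G : Type*} [Group G] (x : G) (φ : G →* G) : G →* G :=
  (MulAut.conj x).toMonoidHom.comp φ

/-- Type (1): there are commuting `g, h` with `φ(t_i) = g` for all `0 ≤ i ≤ n-1`
and `φ(ρ_B) = h`. -/
def IsType1 (n : ℕ) (φ : ArtinB n →* ArtinB n) : Prop :=
  ∃ g h : ArtinB n, g * h = h * g ∧ (∀ i < n, φ (tB n i) = g) ∧ φ (ρB n) = h

/-- Type (2a) with parameters `ε ∈ {1,-1}`, `p q : ℤ`. -/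
def IsType2a (n : ℕ) (ε p q : ℤ) (φ : ArtinB n →* ArtinB n) : Prop :=
  (ε = 1 ∨ ε = -1) ∧ (∀ i < n, φ (tB n i) = tB n i ^ ε * ΔB n ^ p) ∧
    φ (ρB n) = ρB n * ΔB n ^ q

/-- Type (2b) with parameters `ε ∈ {1,-1}`, `p q : ℤ`. -/
def IsType2b (n : ℕ) (ε p q : ℤ) (φ : ArtinB n →* ArtinB n) : Prop :=
  (ε = 1 ∨ ε = -1) ∧ (∀ i < n, φ (tB n i) = tB n (n - i) ^ ε * ΔB n ^ p) ∧
    φ (ρB n) = (ρB n)⁻¹ * ΔB n ^ q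

/-- Type (3) with parameters `ε ∈ {1,-1}`, `k ∈ {0,1}`, `p q r s : ℤ`. -/
def IsType3 (n : ℕ) (ε : ℤ) (k : ℕ) (p q r s : ℤ) (φ : ArtinB n →* ArtinB n) : Prop :=
  (ε = 1 ∨ ε = -1) ∧ (k = 0 ∨ k = 1) ∧
    (∀ i, 1 ≤ i → i ≤ n - 1 → φ (tB n i) = tB n i ^ ε * ΔY n ^ (2 * p) * ΔB n ^ q) ∧
    φ (tB n 0) = vB n k ^ ε * ΔY n ^ (2 * p) * ΔB n ^ q ∧
    φ (ρB n) = ρkB n k * ΔY n ^ (2 * r) * ΔB n ^ s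

/-! ### Free groups -/

namespace FreeGroupAux

open FreeGroup (of)

theorem subsingleton_generators {G : Type*} [Group G] [IsFreeGroup G]
    (h : ∀ x y : G, x * y = y * x) : Subsingleton (IsFreeGroup.Generators G) := by
  classical
  refine ⟨fun a b => ?_⟩
  by_contra hab
  let f : G →* Equiv.Perm (Fin 3) :=
    IsFreeGroup.lift fun c => if c = a then Equiv.swap 0 1 else Equiv.swap 1 2
  have h1 : f (IsFreeGroup.of a) = Equiv.swap 0 1 := by simp [f]
  have h2 : f (IsFreeGroup.of b) = Equiv.swap 1 2 := by simp [f, Ne.symm hab]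
  have h3 := congrArg f (h (IsFreeGroup.of a) (IsFreeGroup.of b))
  rw [map_mul, map_mul, h1, h2] at h3
  revert h3
  decide

theorem isCyclic_of_subsingleton {G : Type*} [Group G] [IsFreeGroup G]
    [Subsingleton (IsFreeGroup.Generators G)] : IsCyclic G := by
  rcases isEmpty_or_nonempty (IsFreeGroup.Generators G) with h | ⟨⟨a⟩⟩
  · have : Subsingleton G := (IsFreeGroup.toFreeGroup G).toEquiv.subsingleton
    infer_instance
  · refine ⟨⟨IsFreeGroup.of a, fun x => ?_⟩⟩
    have h : (Subgroup.zpowers (IsFreeGroup.of a)) = ⊤ := by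
      have h2 : (MonoidHom.id G) = (Subgroup.zpowers (IsFreeGroup.of a)).subtype.comp
          (IsFreeGroup.lift fun _ => ⟨IsFreeGroup.of a, Subgroup.mem_zpowers _⟩) := by
        apply IsFreeGroup.ext_hom
        intro b
        simp [Subsingleton.elim b a]
      rw [eq_top_iff]
      intro y _
      have h3 := DFunLike.congr_fun h2 y
      simp only [MonoidHom.id_apply, MonoidHom.comp_apply] at h3
      rw [h3]
      exact Subtype.prop _
    exact Subgroup.mem_zpowers_iff.1 (h ▸ Subgroup.mem_top x)

theorem exists_zpow_of_commute {G : Type*} [Group G] [IsFreeGroup G] {x y : G}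
    (h : x * y = y * x) : ∃ (g : G) (k l : ℤ), x = g ^ k ∧ y = g ^ l := by
  let H := Subgroup.closure ({x, y} : Set G)
  have hc : ∀ a b : H, a * b = b * a := by
    have := Subgroup.isMulCommutative_closure (k := ({x, y} : Set G)) (by
      rintro a (rfl | rfl) b (rfl | rfl) <;> simp [h])
    exact fun a b => mul_comm' a b
  have := subsingleton_generators hc
  obtain ⟨g, hg⟩ := (isCyclic_of_subsingleton (G := H)).exists_generator
  obtain ⟨k, hk⟩ := hg ⟨x, Subgroup.subset_closure (by simp)⟩
  obtain ⟨l, hl⟩ := hg ⟨y, Subgroup.subset_closure (by simp)⟩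
  refine ⟨g, k, l, ?_, ?_⟩
  · have := congrArg Subtype.val hk; simpa using this.symm
  · have := congrArg Subtype.val hl; simpa using this.symm

theorem eq_zpow_of_commute {G : Type*} [Group G] [IsFreeGroup G] {x y : G}
    (χ : G →* Multiplicative ℤ) (hχ : χ x = Multiplicative.ofAdd 1)
    (h : x * y = y * x) : y = x ^ (χ y).toAdd := by
  obtain ⟨g, k, l, rfl, rfl⟩ := exists_zpow_of_commute h
  rw [map_zpow] at hχ
  have h1 : k * (χ g).toAdd = 1 := by
    have := congrArg Multiplicative.toAdd hχ
    simpa using this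
  have h2 : (χ (g ^ l)).toAdd = l * (χ g).toAdd := by simp
  rw [h2, ← zpow_mul]
  congr 1
  linear_combination (-l) * h1

variable {α : Type*}

/-- The exponent sum of a letter in an element of a free group. -/
def expo [DecidableEq α] (a : α) : FreeGroup α →* Multiplicative ℤ :=
  FreeGroup.lift fun b => Multiplicative.ofAdd (if b = a then 1 else 0)

theorem expo_of [DecidableEq α] (a b : α) :
    expo a (of b) = Multiplicative.ofAdd (if b = a then 1 else 0) := by simp [expo]

theorem zpow_eq_one {x : FreeGroup α} {k : ℤ} (h : x ^ k = 1) (hk : k ≠ 0) : x = 1 :=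
  (zpow_left_injective hk) (by simpa using h)

theorem commute_trans {x y z : FreeGroup α} (hy : y ≠ 1) (h1 : x * y = y * x)
    (h2 : y * z = z * y) : x * z = z * x := by
  classical
  let C := Subgroup.centralizer ({y} : Set (FreeGroup α))
  have hmem : ∀ a : FreeGroup α, a * y = y * a → a ∈ C := fun a ha => by
    rw [Subgroup.mem_centralizer_singleton_iff]; exact ha
  let e := IsFreeGroup.toFreeGroup C
  have hs : Subsingleton (IsFreeGroup.Generators C) := by
    refine ⟨fun a b => ?_⟩
    by_contra hab
    let y' : C := ⟨y, hmem y rfl⟩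
    have hcomm : ∀ c : FreeGroup (IsFreeGroup.Generators C), c * e y' = e y' * c := by
      intro c
      have h3 : e.symm c * y' = y' * e.symm c := by
        apply Subtype.ext
        exact Subgroup.mem_centralizer_singleton_iff.1 (e.symm c).2
      simpa using congrArg e h3
    have ha := eq_zpow_of_commute (expo a) (by rw [expo_of]; simp) (hcomm (of a))
    have hb := eq_zpow_of_commute (expo b) (by rw [expo_of]; simp) (hcomm (of b))
    have h4 : (expo a (e y')).toAdd = 0 := by
      have := congrArg (fun w => (expo a w).toAdd) hb
      simpa [expo_of, Ne.symm hab] using this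
    rw [h4, zpow_zero] at ha
    have : y' = 1 := by simpa using ha
    exact hy (congrArg Subtype.val this)
  have hcy := isCyclic_of_subsingleton (G := C)
  obtain ⟨g, hg⟩ := hcy.exists_generator
  obtain ⟨k, hk⟩ := hg ⟨x, hmem x h1⟩
  obtain ⟨l, hl⟩ := hg ⟨z, hmem z h2.symm⟩
  have hk' : (g : FreeGroup α) ^ k = x := by simpa using congrArg Subtype.val hk
  have hl' : (g : FreeGroup α) ^ l = z := by simpa using congrArg Subtype.val hl
  rw [← hk', ← hl', ← zpow_add, ← zpow_add, add_comm]

/-- Two noncommuting elements of a free group are independent in the abelianization of the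
subgroup they generate. -/
theorem exists_det_ne_zero {u v : FreeGroup α} (h : u * v ≠ v * u) :
    ∃ d₁ d₂ : Subgroup.closure ({u, v} : Set (FreeGroup α)) →* Multiplicative ℤ,
      (d₁ ⟨u, Subgroup.subset_closure (by simp)⟩).toAdd *
        (d₂ ⟨v, Subgroup.subset_closure (by simp)⟩).toAdd -
      (d₁ ⟨v, Subgroup.subset_closure (by simp)⟩).toAdd *
        (d₂ ⟨u, Subgroup.subset_closure (by simp)⟩).toAdd ≠ 0 := by
  classical
  set H := Subgroup.closure ({u, v} : Set (FreeGroup α)) with hH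
  set u' : H := ⟨u, Subgroup.subset_closure (by simp)⟩
  set v' : H := ⟨v, Subgroup.subset_closure (by simp)⟩
  have hns : ¬ Subsingleton (IsFreeGroup.Generators H) := by
    intro hs
    have := isCyclic_of_subsingleton (G := H)
    have hc : u' * v' = v' * u' := by
      let _ := IsCyclic.commGroup (α := H)
      exact mul_comm u' v'
    exact h (congrArg Subtype.val hc)
  rw [not_subsingleton_iff_nontrivial] at hns
  obtain ⟨a, b, hab⟩ := hns.exists_pair_ne
  let D : IsFreeGroup.Generators H → H →* Multiplicative ℤ := fun c =>
    IsFreeGroup.lift fun b => Multiplicative.ofAdd (if b = c then 1 else 0)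
  have hD : ∀ c d, D c (IsFreeGroup.of d) = Multiplicative.ofAdd (if d = c then 1 else 0) := by
    intro c d; simp [D]
  refine ⟨D a, D b, fun h0 => ?_⟩
  have key : ∀ x : H, ∃ m k : ℤ, ∀ c, (D c x).toAdd = m * (D c u').toAdd + k * (D c v').toAdd := by
    rintro ⟨x, hx⟩
    refine Subgroup.closure_induction (p := fun x hx => ∃ m k : ℤ, ∀ c, (D c ⟨x, hx⟩).toAdd =
      m * (D c u').toAdd + k * (D c v').toAdd) ?_ ?_ ?_ ?_ hx
    · rintro y (rfl | rfl)
      · exact ⟨1, 0, fun c => by simp [u']⟩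
      · exact ⟨0, 1, fun c => by simp [v']⟩
    · exact ⟨0, 0, fun c => by
        have : (⟨1, one_mem _⟩ : H) = 1 := rfl
        rw [this]; simp⟩
    · rintro y z hy hz ⟨m, k, h1⟩ ⟨m', k', h2⟩
      refine ⟨m + m', k + k', fun c => ?_⟩
      have : (⟨y * z, mul_mem hy hz⟩ : H) = ⟨y, hy⟩ * ⟨z, hz⟩ := rfl
      rw [this, map_mul, toAdd_mul, h1, h2]; ring
    · rintro y hy ⟨m, k, h1⟩
      refine ⟨-m, -k, fun c => ?_⟩
      have : (⟨y⁻¹, inv_mem hy⟩ : H) = (⟨y, hy⟩ : H)⁻¹ := rfl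
      rw [this, map_inv, toAdd_inv, h1]; ring
  obtain ⟨m, k, h1⟩ := key (IsFreeGroup.of a)
  obtain ⟨m', k', h2⟩ := key (IsFreeGroup.of b)
  have e1 := h1 a; have e2 := h1 b; have e3 := h2 a; have e4 := h2 b
  rw [hD] at e1 e2 e3 e4
  simp only [if_true, if_neg hab, if_neg (Ne.symm hab), toAdd_ofAdd] at e1 e2 e3 e4
  have : (1 : ℤ) = (m * k' - k * m') * 0 := by
    rw [← h0]
    calc (1 : ℤ) = 1 * 1 - 0 * 0 := by norm_num
      _ = _ := by nth_rewrite 1 [e1]; nth_rewrite 1 [e4]; nth_rewrite 1 [e2]; rw [e3]; ring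
  simp at this

theorem exists_take_of_step {L L' : List (α × Bool)} (h : FreeGroup.Red.Step L L') (k : ℕ) :
    ∃ k', FreeGroup.mk (L'.take k) = FreeGroup.mk (L.take k') := by
  cases h with
  | @not L₁ L₂ x b =>
    by_cases hk : k ≤ L₁.length
    · refine ⟨k, ?_⟩
      rw [List.take_append_of_le_length hk, List.take_append_of_le_length hk]
    · refine ⟨k + 2, ?_⟩
      push Not at hk
      rw [List.take_append, List.take_append, List.take_of_length_le hk.le,
        List.take_of_length_le (by omega : L₁.length ≤ k + 2),
        show k + 2 - L₁.length = (k - L₁.length) + 1 + 1 by omega]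
      simp only [List.take_succ_cons]
      exact (Quot.sound FreeGroup.Red.Step.not).symm

theorem exists_take_of_red {L L' : List (α × Bool)} (h : FreeGroup.Red L L') (k : ℕ) :
    ∃ k', FreeGroup.mk (L'.take k) = FreeGroup.mk (L.take k') := by
  induction h generalizing k with
  | refl => exact ⟨k, rfl⟩
  | tail h hs ih =>
    obtain ⟨k₁, h₁⟩ := exists_take_of_step hs k
    rw [h₁]
    exact ih k₁

theorem take_toWord_mul [DecidableEq α] (u v : FreeGroup α) (k : ℕ) :
    (∃ k', FreeGroup.mk ((u * v).toWord.take k) = FreeGroup.mk (u.toWord.take k')) ∨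
    (∃ k', FreeGroup.mk ((u * v).toWord.take k) = u * FreeGroup.mk (v.toWord.take k')) := by
  rw [FreeGroup.toWord_mul]
  obtain ⟨k', h⟩ := exists_take_of_red (FreeGroup.reduce.red (L := u.toWord ++ v.toWord)) k
  rw [h, List.take_append, ← FreeGroup.mul_mk]
  by_cases hk : k' ≤ u.toWord.length
  · left; exact ⟨k', by simp [Nat.sub_eq_zero_of_le hk, ← FreeGroup.one_eq_mk]⟩
  · right; exact ⟨k' - u.toWord.length, by
      rw [List.take_of_length_le (by omega), FreeGroup.mk_toWord]⟩

theorem take_toWord_inv [DecidableEq α] (u : FreeGroup α) (k : ℕ) :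
    ∃ k', FreeGroup.mk (u⁻¹.toWord.take k) = u⁻¹ * FreeGroup.mk (u.toWord.take k') := by
  rw [FreeGroup.toWord_inv]
  refine ⟨u.toWord.length - k, ?_⟩
  have h1 : (FreeGroup.invRev u.toWord).take k =
      FreeGroup.invRev (u.toWord.drop (u.toWord.length - k)) := by
    simp [FreeGroup.invRev, List.take_reverse]
  rw [h1, ← FreeGroup.inv_mk]
  have h2 : u = FreeGroup.mk (u.toWord.take (u.toWord.length - k)) *
      FreeGroup.mk (u.toWord.drop (u.toWord.length - k)) := by
    rw [FreeGroup.mul_mk, List.take_append_drop, FreeGroup.mk_toWord]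
  nth_rewrite 3 [h2]
  group

theorem snd_eq_of_ne {x y : α × Bool} (h : x.1 = y.1) (h' : x ≠ (y.1, !y.2)) : x.2 = y.2 := by
  obtain ⟨x₁, x₂⟩ := x
  obtain ⟨y₁, y₂⟩ := y
  obtain rfl : x₁ = y₁ := h
  cases x₂ <;> cases y₂ <;> simp_all

/-- A nontrivial finitely generated subgroup of a free group which is normalised by two letters
contains a positive power of the first one. -/
theorem exists_pow_mem_of_fg [DecidableEq α] {N : Subgroup (FreeGroup α)} (hfg : N.FG) {p q : α}
    (hpq : p ≠ q) (hp : ∀ w ∈ N, of p * w * (of p)⁻¹ ∈ N) (hq : ∀ w ∈ N, of q * w * (of q)⁻¹ ∈ N)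
    (hq' : ∀ w ∈ N, (of q)⁻¹ * w * of q ∈ N) {a : FreeGroup α} (ha : a ∈ N) (ha1 : a ≠ 1) :
    ∃ j : ℕ, 0 < j ∧ of p ^ j ∈ N := by
  obtain ⟨S, rfl⟩ := hfg
  set N := Subgroup.closure (S : Set (FreeGroup α))
  let P : Finset (FreeGroup α) := insert 1 (S.biUnion fun s =>
    (Finset.range (s.toWord.length + 1)).image fun k => FreeGroup.mk (s.toWord.take k))
  have key : ∀ w ∈ N, ∀ k, ∃ r ∈ P, FreeGroup.mk (w.toWord.take k) * r⁻¹ ∈ N := by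
    intro w hw
    refine Subgroup.closure_induction (p := fun w _ => ∀ k, ∃ r ∈ P,
      FreeGroup.mk (w.toWord.take k) * r⁻¹ ∈ N) ?_ ?_ ?_ ?_ hw
    · intro s hs k
      refine ⟨FreeGroup.mk (s.toWord.take k), ?_, by rw [mul_inv_cancel]; exact one_mem _⟩
      refine Finset.mem_insert_of_mem (Finset.mem_biUnion.2 ⟨s, hs, Finset.mem_image.2 ?_⟩)
      by_cases hk : k ≤ s.toWord.length
      · exact ⟨k, by simpa [Nat.lt_succ_iff] using hk, rfl⟩
      · refine ⟨s.toWord.length, by simp, ?_⟩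
        rw [List.take_of_length_le le_rfl, List.take_of_length_le (by omega)]
    · intro k
      exact ⟨1, Finset.mem_insert_self _ _, by simp [← FreeGroup.one_eq_mk]⟩
    · intro u v hu hv h1 h2 k
      rcases take_toWord_mul u v k with ⟨k', h⟩ | ⟨k', h⟩
      · rw [h]; exact h1 k'
      · rw [h]
        obtain ⟨r, hr, h3⟩ := h2 k'
        exact ⟨r, hr, by rw [mul_assoc]; exact mul_mem hu h3⟩
    · intro u hu h1 k
      obtain ⟨k', h⟩ := take_toWord_inv u k
      rw [h]
      obtain ⟨r, hr, h3⟩ := h1 k'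
      exact ⟨r, hr, by rw [mul_assoc]; exact mul_mem (inv_mem hu) h3⟩
  obtain ⟨h, hh1, hh2, hh3, hhN⟩ : ∃ h : α × Bool, h ≠ (p, false) ∧
      (∀ x ∈ a.toWord.head?, h ≠ (x.1, !x.2)) ∧ (∀ y ∈ a.toWord.getLast?, y ≠ h) ∧
      FreeGroup.mk [h] * a * (FreeGroup.mk [h])⁻¹ ∈ N := by
    have hw : a.toWord ≠ [] := by simpa using ha1
    have hx := List.head?_eq_some_head hw
    have hy := List.getLast?_eq_some_getLast hw
    set x := a.toWord.head hw
    set y := a.toWord.getLast hw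
    have : ∃ h : α × Bool, h ≠ (p, false) ∧ h ≠ (x.1, !x.2) ∧ y ≠ h ∧
        (h = (p, true) ∨ h = (q, true) ∨ h = (q, false)) := by
      by_contra hcon
      push Not at hcon
      have h1 := hcon (p, true)
      have h2 := hcon (q, true)
      have h3 := hcon (q, false)
      clear_value x y
      obtain ⟨x₁, x₂⟩ := x
      obtain ⟨y₁, y₂⟩ := y
      cases x₂ <;> cases y₂ <;> simp [Prod.ext_iff, hpq, hpq.symm] at h1 h2 h3 <;> grind
    obtain ⟨h, h1, h2, h3, h4⟩ := this
    refine ⟨h, h1, ?_, ?_, ?_⟩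
    · intro z hz; rw [hx] at hz; cases hz; exact h2
    · intro z hz; rw [hy] at hz; cases hz; exact h3
    · rcases h4 with rfl | rfl | rfl
      · exact hp a ha
      · exact hq a ha
      · have := hq' a ha
        simpa [FreeGroup.inv_mk, FreeGroup.invRev, FreeGroup.of] using this
  have hpow : ∀ (j : ℕ) (w), w ∈ N → of p ^ j * w * (of p ^ j)⁻¹ ∈ N := by
    intro j
    induction j with
    | zero => simp
    | succ j ih =>
      intro w hw
      have := ih _ (hp w hw)
      rw [pow_succ]
      simpa [mul_assoc] using this
  have hred : ∀ j : ℕ, FreeGroup.IsReduced (List.replicate j (p, true) ++ ([h] ++ (a.toWord ++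
      ([(h.1, !h.2)] ++ List.replicate j (p, false))))) := by
    intro j
    have hne : a.toWord ≠ [] := by simpa using ha1
    have hrep : ∀ (b : Bool), List.IsChain (fun a b : α × Bool => a.1 = b.1 → a.2 = b.2)
        (List.replicate j (p, b)) := fun b => by
      induction j with
      | zero => simp
      | succ j ih => cases j <;> simp_all [List.replicate_succ]
    unfold FreeGroup.IsReduced
    rw [List.isChain_append]
    refine ⟨hrep _, ?_, ?_⟩
    · rw [List.isChain_append]
      refine ⟨by simp, ?_, ?_⟩
      · rw [List.isChain_append]
        refine ⟨FreeGroup.isReduced_toWord, ?_, ?_⟩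
        · rw [List.isChain_append]
          refine ⟨by simp, hrep _, ?_⟩
          intro x hx y hy h1
          obtain rfl : (h.1, !h.2) = x := by simpa using hx
          have hy' : y = (p, false) := (List.mem_replicate.1 (List.mem_of_mem_head? hy)).2
          subst hy'
          refine snd_eq_of_ne h1 fun e => hh1 ?_
          have e1 := congrArg Prod.fst e
          have e2 := congrArg Prod.snd e
          simp only [Bool.not_false, Bool.not_eq_true'] at e1 e2
          exact Prod.ext e1 e2
        · intro x hx y hy h1
          obtain rfl : (h.1, !h.2) = y := by simpa using hy
          exact snd_eq_of_ne h1 (by simpa using hh3 x hx)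
      · intro x hx y hy h1
        rw [List.head?_append_of_ne_nil _ hne] at hy
        obtain rfl : h = x := by simpa using hx
        exact snd_eq_of_ne h1 (hh2 y hy)
    · intro x hx y hy h1
      obtain rfl : x = (p, true) := (List.mem_replicate.1 (List.mem_of_mem_getLast? hx)).2
      obtain rfl : h = y := by simpa using hy
      exact (snd_eq_of_ne h1.symm (by simpa using hh1)).symm
  have hmem : ∀ j : ℕ, ∃ r ∈ P, of p ^ j * r⁻¹ ∈ N := by
    intro j
    have h1 := hpow j _ hhN
    have h2 : of p ^ j * (FreeGroup.mk [h] * a * (FreeGroup.mk [h])⁻¹) * (of p ^ j)⁻¹ =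
        FreeGroup.mk (List.replicate j (p, true) ++ ([h] ++ (a.toWord ++
      ([(h.1, !h.2)] ++ List.replicate j (p, false))))) := by
      have e1 : ∀ j : ℕ, of p ^ j = FreeGroup.mk (List.replicate j (p, true)) := fun j => by
        rw [← FreeGroup.mk_toWord (x := of p ^ j), FreeGroup.toWord_of_pow]
      simp only [← FreeGroup.mul_mk, FreeGroup.mk_toWord, e1, FreeGroup.inv_mk,
        FreeGroup.invRev, List.map_replicate, List.reverse_replicate]
      simp [mul_assoc]
    rw [h2] at h1
    obtain ⟨r, hr, h3⟩ := key _ h1 j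
    refine ⟨r, hr, ?_⟩
    rw [FreeGroup.toWord_mk, (FreeGroup.isReduced_iff_reduce_eq.1 (hred j)),
      List.take_append_of_le_length (by simp)] at h3
    rw [← FreeGroup.mk_toWord (x := of p ^ j), FreeGroup.toWord_of_pow]
    simpa using h3
  choose r hr hrN using hmem
  obtain ⟨i, j, hij, he⟩ := Finite.exists_ne_map_eq_of_infinite (fun j => (⟨r j, hr j⟩ : P))
  wlog hlt : i < j generalizing i j
  · exact this j i hij.symm he.symm (by omega)
  simp only [Subtype.mk.injEq] at he
  refine ⟨j - i, by omega, ?_⟩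
  have h3 := mul_mem (hrN j) (inv_mem (hrN i))
  rw [he] at h3
  have h4 : of p ^ j = of p ^ (j - i) * of p ^ i := by rw [← pow_add]; congr 1; omega
  rw [h4] at h3
  simpa [mul_assoc] using h3

end FreeGroupAux

namespace BnAux

open FreeGroup (of)
open FreeGroupAux

/-! ### The standard generators and the action on the free group -/

/-- The standard generators, indexed from `0`. -/
def s (n i : ℕ) : ArtinB n := rB n (i + 1)

theorem s_eq_of {n i : ℕ} (h : i < n) : s n i = PresentedGroup.of ⟨i, h⟩ := by
  simp [s, rB, h]

theorem s_eq_one {n i : ℕ} (h : n ≤ i) : s n i = 1 := by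
  simp [s, rB, not_lt.2 h]

section relations
variable {n i j : ℕ}

theorem braid (h : i + 2 < n) : s n i * s n (i + 1) * s n i = s n (i + 1)
    * s n i * s n (i + 1) := by
  rw [s_eq_of (by omega : i < n), s_eq_of (by omega : i + 1 < n)]
  have : PresentedGroup.mk (BnRels n) _ = 1 :=
    PresentedGroup.one_of_mem (rels := BnRels n)
      (Or.inl ⟨⟨i, by omega⟩, ⟨i + 1, by omega⟩, rfl, h, rfl⟩)
  rw [map_mul, map_inv, mul_inv_eq_one] at this
  simp only [map_mul] at this
  exact this

theorem braid4 (h : i + 2 = n) : s n i * s n (i + 1) * s n i * s n (i + 1) =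
    s n (i + 1) * s n i * s n (i + 1) * s n i := by
  rw [s_eq_of (by omega : i < n), s_eq_of (by omega : i + 1 < n)]
  have : PresentedGroup.mk (BnRels n) _ = 1 :=
    PresentedGroup.one_of_mem (rels := BnRels n)
      (Or.inr (Or.inl ⟨⟨i, by omega⟩, ⟨i + 1, by omega⟩, h, by simpa using h, rfl⟩))
  rw [map_mul, map_inv, mul_inv_eq_one] at this
  simp only [map_mul] at this
  exact this

theorem s_comm (h : i + 2 ≤ j) : s n i * s n j = s n j * s n i := by
  by_cases hj : j < n
  · rw [s_eq_of (by omega : i < n), s_eq_of hj]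
    have : PresentedGroup.mk (BnRels n) _ = 1 :=
      PresentedGroup.one_of_mem (rels := BnRels n)
        (Or.inr (Or.inr ⟨⟨i, by omega⟩, ⟨j, hj⟩, h, rfl⟩))
    rw [map_mul, map_inv, mul_inv_eq_one] at this
    simp only [map_mul] at this
    exact this
  · rw [s_eq_one (not_lt.1 hj)]; simp

end relations

section lift
variable {n : ℕ} {H : Type*} [Group H]

/-- The relations of the Artin group of type `B`. -/
structure IsBSeq (n : ℕ) (f : ℕ → H) : Prop where
  braid : ∀ i, i + 2 < n → f i * f (i + 1) * f i = f (i + 1) * f i * f (i + 1)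
  braid4 : ∀ i, i + 2 = n → f i * f (i + 1) * f i * f (i + 1) = f (i + 1) * f i * f (i + 1) * f i
  comm : ∀ i j, i + 2 ≤ j → j < n → f i * f j = f j * f i

/-- The universal property of the Artin group. -/
noncomputable def liftB (f : ℕ → H) (hf : IsBSeq n f) : ArtinB n →* H :=
  PresentedGroup.toGroup (f := fun i : Fin n => f i) (by
    rintro r (⟨i, j, h1, h2, rfl⟩ | ⟨i, j, h1, h2, rfl⟩ | ⟨i, j, h1, rfl⟩)
    · have := hf.braid i (by omega)
      rw [h1] at this
      simp only [map_mul, map_inv, FreeGroup.lift_apply_of]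
      rw [mul_inv_eq_one, this]
    · have := hf.braid4 i h1
      rw [show (i : ℕ) + 1 = j by omega] at this
      simp only [map_mul, map_inv, FreeGroup.lift_apply_of]
      rw [mul_inv_eq_one, this]
    · have := hf.comm i j h1 j.2
      simp only [map_mul, map_inv, FreeGroup.lift_apply_of]
      rw [this]; group)

theorem liftB_s (f : ℕ → H) (hf : IsBSeq n f) {i : ℕ} (h : i < n) : liftB f hf (s n i) = f i := by
  rw [s_eq_of h]; simp [liftB]

theorem hom_ext {f g : ArtinB n →* H} (h : ∀ i < n, f (s n i) = g (s n i)) : f = g := by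
  apply PresentedGroup.ext
  rintro ⟨i, hi⟩
  have := h i hi
  rwa [s_eq_of hi] at this

theorem closure_s (n : ℕ) : Subgroup.closure {g | ∃ i < n, g = s n i} = ⊤ := by
  rw [← PresentedGroup.closure_range_of (BnRels n)]
  congr 1
  ext g
  constructor
  · rintro ⟨i, hi, rfl⟩; exact ⟨⟨i, hi⟩, (s_eq_of hi).symm⟩
  · rintro ⟨i, rfl⟩; exact ⟨i, i.2, (s_eq_of i.2).symm⟩

/-- Induction on elements of the Artin group. -/
theorem induction_s {p : ArtinB n → Prop} (h1 : p 1) (hs : ∀ i < n, p (s n i))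
    (hm : ∀ g h, p g → p h → p (g * h)) (hi : ∀ g, p g → p g⁻¹) (g : ArtinB n) : p g := by
  have : g ∈ Subgroup.closure {g | ∃ i < n, g = s n i} := by rw [closure_s]; trivial
  refine Subgroup.closure_induction (p := fun g _ => p g) ?_ h1 (fun _ _ _ _ => hm _ _)
    (fun _ _ => hi _) this
  rintro _ ⟨i, hi, rfl⟩
  exact hs i hi

end lift

/-- The ambient free group. -/
abbrev F := FreeGroup ℕ

/-- The letters. -/
abbrev x (i : ℕ) : F := of i

theorem aut_ext {a b : MulAut F} (h : ∀ i, a (x i) = b (x i)) : a = b := by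
  have : a.toMonoidHom = b.toMonoidHom := FreeGroup.ext_hom _ _ h
  ext w
  exact DFunLike.congr_fun this w

theorem fhom_ext {H : Type*} [Monoid H] {a b : F →* H} (h : ∀ i, a (x i) = b (x i)) : a = b :=
  FreeGroup.ext_hom _ _ h

/-- The Artin automorphism. -/
def hur (i : ℕ) : MulAut F :=
  MonoidHom.toMulEquiv
    (FreeGroup.lift fun j => if j = i then x (i + 1) else
      if j = i + 1 then (x (i + 1))⁻¹ * x i * x (i + 1) else x j)
    (FreeGroup.lift fun j => if j = i then x i * x (i + 1) * (x i)⁻¹ else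
      if j = i + 1 then x i else x j)
    (by
      apply fhom_ext; intro j
      simp only [MonoidHom.comp_apply, FreeGroup.lift_apply_of, MonoidHom.id_apply]
      split_ifs with h1 h2 <;> simp [*, mul_assoc])
    (by
      apply fhom_ext; intro j
      simp only [MonoidHom.comp_apply, FreeGroup.lift_apply_of, MonoidHom.id_apply]
      split_ifs with h1 h2 <;> simp [*, mul_assoc])

theorem hur_apply (i j : ℕ) : hur i (x j) = if j = i then x (i + 1) else
      if j = i + 1 then (x (i + 1))⁻¹ * x i * x (i + 1) else x j := by
  simp [hur]

theorem hur_self (i : ℕ) : hur i (x i) = x (i + 1) := by simp [hur_apply]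
theorem hur_succ (i : ℕ) : hur i (x (i + 1)) = (x (i + 1))⁻¹ * x i * x (i + 1) := by
  simp [hur_apply]
theorem hur_ne {i j : ℕ} (h1 : j ≠ i) (h2 : j ≠ i + 1) : hur i (x j) = x j := by
  simp [hur_apply, h1, h2]

theorem hur_braid (i : ℕ) : hur i * hur (i + 1) * hur i = hur (i + 1) * hur i * hur (i + 1) := by
  apply aut_ext; intro j
  simp only [MulAut.mul_apply]
  have a1 := hur_self i
  have a2 := hur_succ i
  have a3 : hur i (x (i + 1 + 1)) = x (i + 1 + 1) := hur_ne (by omega) (by omega)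
  have b1 := hur_self (i + 1)
  have b2 := hur_succ (i + 1)
  have b3 : hur (i + 1) (x i) = x i := hur_ne (by omega) (by omega)
  by_cases h1 : j = i
  · subst h1; simp only [a1, a3, b1, b3]
  by_cases h2 : j = i + 1
  · subst h2; simp only [a1, a2, a3, b1, b2, b3, map_mul, map_inv]
  by_cases h3 : j = i + 1 + 1
  · subst h3; simp only [a2, a3, b1, b2, b3, map_mul, map_inv]; group
  · rw [hur_ne h1 h2, hur_ne h2 h3, hur_ne h1 h2, hur_ne h2 h3]

theorem hur_comm {i j : ℕ} (h : i + 2 ≤ j) : hur i * hur j = hur j * hur i := by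
  apply aut_ext; intro k
  simp only [MulAut.mul_apply]
  by_cases h1 : k = i
  · subst h1; rw [hur_self, hur_ne, hur_self, hur_ne] <;> omega
  by_cases h2 : k = i + 1
  · subst h2; rw [hur_succ, hur_ne, hur_succ]
    · simp only [map_mul, map_inv]
      rw [hur_ne, hur_ne] <;> omega
    all_goals omega
  rw [hur_ne h1 h2]
  by_cases h3 : k = j
  · subst h3; rw [hur_self, hur_ne] <;> omega
  by_cases h4 : k = j + 1
  · subst h4; rw [hur_succ]
    simp only [map_mul, map_inv]
    rw [hur_ne, hur_ne] <;> omega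
  · rw [hur_ne h3 h4, hur_ne h1 h2]

theorem aut_conj (a : MulAut F) (w : F) : a * MulAut.conj w = MulAut.conj (a w) * a := by
  ext v; simp

/-- The images of the standard generators in `Aut F`. -/
def thetaSeq (n : ℕ) (i : ℕ) : MulAut F := if i + 1 < n then hur i else MulAut.conj (x i)

theorem isBSeq_theta (n : ℕ) : IsBSeq n (thetaSeq n) where
  braid i h := by
    simp only [thetaSeq, if_pos (show i + 1 < n by omega), if_pos (show i + 1 + 1 < n by omega)]
    exact hur_braid i
  braid4 i h := by
    simp only [thetaSeq, if_pos (show i + 1 < n by omega), if_neg (show ¬ i + 1 + 1 < n by omega)]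
    have e1 : hur i * MulAut.conj (x (i + 1)) * hur i * MulAut.conj (x (i + 1)) =
        MulAut.conj (hur i (x (i + 1)) * hur i (hur i (x (i + 1)))) * (hur i * hur i) := by
      ext w; simp [mul_assoc]
    have e2 : MulAut.conj (x (i + 1)) * hur i * MulAut.conj (x (i + 1)) * hur i =
        MulAut.conj (x (i + 1) * hur i (x (i + 1))) * (hur i * hur i) := by
      ext w; simp [mul_assoc]
    rw [e1, e2]
    congr 2
    rw [hur_succ]
    simp only [map_mul, map_inv]
    rw [hur_succ, hur_self]
    group
  comm i j h hj := by
    simp only [thetaSeq, if_pos (show i + 1 < n by omega)]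
    split_ifs
    · exact hur_comm h
    · rw [aut_conj, hur_ne (by omega) (by omega)]

/-- The action of the Artin group on the free group. -/
noncomputable def Θ (n : ℕ) : ArtinB n →* MulAut F := liftB (thetaSeq n) (isBSeq_theta n)

theorem Θ_s {n i : ℕ} (h : i + 1 < n) : Θ n (s n i) = hur i := by
  rw [Θ, liftB_s _ _ (by omega)]; simp [thetaSeq, h]

theorem Θ_last {n i : ℕ} (h : i + 1 = n) : Θ n (s n i) = MulAut.conj (x i) := by
  rw [Θ, liftB_s _ _ (by omega)]; simp [thetaSeq, h]

/-- The images of the letters in the Artin group; `iotaRev n k` is the image of the letter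
`n - 1 - k`. -/
noncomputable def iotaRev (n : ℕ) : ℕ → ArtinB n
  | 0 => s n (n - 1)
  | k + 1 => (s n (n - 1 - (k + 1)))⁻¹ * iotaRev n k * s n (n - 1 - (k + 1))

/-- The embedding of the free group. -/
noncomputable def ι (n : ℕ) : F →* ArtinB n :=
  FreeGroup.lift fun i => if i < n then iotaRev n (n - 1 - i) else 1

theorem ι_last {n i : ℕ} (h : i + 1 = n) : ι n (x i) = s n i := by
  subst h; simp [ι, iotaRev]

theorem ι_ge {n i : ℕ} (h : n ≤ i) : ι n (x i) = 1 := by simp [ι, not_lt.2 h]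

theorem ι_succ {n i : ℕ} (h : i + 1 < n) : ι n (x i) = (s n i)⁻¹ * ι n (x (i + 1)) * s n i := by
  simp only [ι, FreeGroup.lift_apply_of, if_pos h, if_pos (show i < n by omega)]
  rw [show n - 1 - i = (n - 1 - (i + 1)) + 1 by omega, iotaRev,
    show n - 1 - (n - 1 - (i + 1) + 1) = i by omega]

/-! ### Equivariance -/

variable {n : ℕ}

theorem ι_comm_gt {i j : ℕ} (h : i + 1 < j) : s n i * ι n (x j) = ι n (x j) * s n i := by
  by_cases hj : n ≤ j
  · simp [ι_ge hj]
  obtain ⟨k, hk⟩ : ∃ k, j + k + 1 = n := ⟨n - j - 1, by omega⟩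
  induction k generalizing j with
  | zero => rw [ι_last (by omega)]; exact s_comm h
  | succ k ih =>
    rw [ι_succ (by omega)]
    have h1 : Commute (s n i) (s n j) := s_comm h
    have h2 : Commute (s n i) (ι n (x (j + 1))) := ih (by omega) (by omega) (by omega)
    exact (h1.inv_right.mul_right h2).mul_right h1

theorem ι_comm_lt {i j : ℕ} (h : j < i) (hi : i + 1 < n) :
    s n i * ι n (x j) = ι n (x j) * s n i := by
  obtain ⟨k, hk⟩ : ∃ k, j + k + 1 = i := ⟨i - j - 1, by omega⟩
  induction k generalizing j with
  | zero =>
    obtain rfl : i = j + 1 := by omega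
    rw [ι_succ (by omega : j + 1 < n), ι_succ (by omega : j + 1 + 1 < n)]
    have h1 : Commute (s n j) (ι n (x (j + 1 + 1))) := ι_comm_gt (by omega)
    have h2 := braid (n := n) (i := j) (by omega)
    set a := s n j
    set b := s n (j + 1)
    set X := ι n (x (j + 1 + 1))
    have h3 : b * (a⁻¹ * b⁻¹) = (a⁻¹ * b⁻¹) * a := by
      calc b * (a⁻¹ * b⁻¹) = a⁻¹ * b⁻¹ * (b * a * b) * (a⁻¹ * b⁻¹) := by group
        _ = a⁻¹ * b⁻¹ * (a * b * a) * (a⁻¹ * b⁻¹) := by rw [h2]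
        _ = _ := by group
    have h4 : (b * a) * b = a * (b * a) := by simpa [mul_assoc] using h2.symm
    calc b * (a⁻¹ * (b⁻¹ * X * b) * a) = (b * (a⁻¹ * b⁻¹)) * X * (b * a) := by group
      _ = a⁻¹ * b⁻¹ * (a * X) * (b * a) := by rw [h3]; group
      _ = a⁻¹ * b⁻¹ * X * (a * (b * a)) := by rw [h1.eq]; group
      _ = _ := by rw [← h4]; group
  | succ k ih =>
    rw [ι_succ (by omega)]
    have h1 : Commute (s n i) (s n j) := (s_comm (by omega)).symm
    have h2 : Commute (s n i) (ι n (x (j + 1))) := ih (by omega) (by omega)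
    exact (h1.inv_right.mul_right h2).mul_right h1

theorem conj_braid4 {H : Type*} [Group H] {a X b Y z : H} (h1 : a = z⁻¹ * b * z)
    (h2 : X = z⁻¹ * Y * z) (h : b * Y * b * Y = Y * b * Y * b) : a * X * a * X = X * a * X * a := by
  calc a * X * a * X = z⁻¹ * (b * Y * b * Y) * z := by rw [h1, h2]; group
    _ = z⁻¹ * (Y * b * Y * b) * z := by rw [h]
    _ = _ := by rw [h1, h2]; group

theorem ι_braid4 {i : ℕ} (h : i + 1 < n) :
    s n i * ι n (x (i + 1)) * s n i * ι n (x (i + 1)) =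
      ι n (x (i + 1)) * s n i * ι n (x (i + 1)) * s n i := by
  obtain ⟨k, hk⟩ : ∃ k, i + k + 2 = n := ⟨n - i - 2, by omega⟩
  induction k generalizing i with
  | zero =>
    rw [ι_last (by omega)]; exact braid4 (by omega)
  | succ k ih =>
    have h0 := ih (i := i + 1) (by omega) (by omega)
    have h1 : Commute (s n i) (ι n (x (i + 1 + 1))) := ι_comm_gt (by omega)
    have h2 := braid (n := n) (i := i) (by omega)
    rw [ι_succ (by omega : i + 1 + 1 < n)]
    refine conj_braid4 (z := s n i * s n (i + 1)) ?_ ?_ h0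
    · rw [mul_assoc, ← mul_assoc (s n (i + 1)), ← h2]; group
    · have := h1.eq
      calc (s n (i + 1))⁻¹ * ι n (x (i + 1 + 1)) * s n (i + 1)
          = (s n (i + 1))⁻¹ * (s n i)⁻¹ * (s n i * ι n (x (i + 1 + 1))) * s n (i + 1) := by group
        _ = _ := by rw [this]; group

theorem ι_Θ (g : ArtinB n) : ∀ w : F, ι n (Θ n g w) = g * ι n w * g⁻¹ := by
  refine induction_s (p := fun g => ∀ w : F, ι n (Θ n g w) = g * ι n w * g⁻¹) ?_ ?_ ?_ ?_ g
  · simp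
  · intro i hi w
    by_cases h : i + 1 < n
    · rw [Θ_s h]
      have : (ι n).comp (hur i).toMonoidHom =
          (MulAut.conj (s n i)).toMonoidHom.comp (ι n) := by
        apply fhom_ext
        intro j
        change ι n (hur i (x j)) = s n i * ι n (x j) * (s n i)⁻¹
        by_cases h1 : j = i
        · subst h1; rw [hur_self, ι_succ h]; group
        by_cases h2 : j = i + 1
        · subst h2
          rw [hur_succ]
          simp only [map_mul, map_inv]
          rw [ι_succ h]
          have := ι_braid4 h
          set X := ι n (x (i + 1))
          set a := s n i
          calc X⁻¹ * (a⁻¹ * X * a) * X = X⁻¹ * a⁻¹ * (X * a * X * a) * a⁻¹ := by group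
            _ = _ := by rw [← this]; group
        · rw [hur_ne h1 h2, eq_mul_inv_iff_mul_eq, eq_comm]
          by_cases h3 : j < i
          · exact ι_comm_lt h3 h
          · exact ι_comm_gt (by omega)
      exact DFunLike.congr_fun this w
    · rw [Θ_last (by omega), MulAut.conj_apply]
      simp only [map_mul, map_inv]
      rw [ι_last (by omega)]
  · intro g h hg hh w
    rw [map_mul, MulAut.mul_apply, hg, hh]; group
  · intro g hg w
    have := hg ((Θ n g)⁻¹ w)
    rw [MulAut.apply_inv_self] at this
    rw [map_inv, this]; group

/-! ### Subgroups generated by the first letters -/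

/-- The endomorphism killing the letters with index at least `k`. -/
def κ (k : ℕ) : F →* F := FreeGroup.lift fun i => if i < k then x i else 1

theorem κ_lt {k i : ℕ} (h : i < k) : κ k (x i) = x i := by simp [κ, h]
theorem κ_ge {k i : ℕ} (h : k ≤ i) : κ k (x i) = 1 := by simp [κ, not_lt.2 h]

/-- The free factor generated by the first `k` letters. -/
def Fs (k : ℕ) : Subgroup F := Subgroup.closure {w | ∃ i < k, w = x i}

theorem x_mem_Fs {i k : ℕ} (h : i < k) : x i ∈ Fs k := Subgroup.subset_closure ⟨i, h, rfl⟩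

theorem Fs_eqOn {H : Type*} [Group H] {k : ℕ} {f g : F →* H} (h : ∀ i < k, f (x i) = g (x i))
    {w : F} (hw : w ∈ Fs k) : f w = g w :=
  MonoidHom.eqOn_closure (s := {w | ∃ i < k, w = x i})
    (by rintro _ ⟨i, hi, rfl⟩; exact h i hi) hw

theorem Fs_le {k : ℕ} {K : Subgroup F} (h : ∀ i < k, x i ∈ K) : Fs k ≤ K := by
  rw [Fs, Subgroup.closure_le]; rintro _ ⟨i, hi, rfl⟩; exact h i hi

theorem map_mem_Fs {k m : ℕ} {f : F →* F} (h : ∀ i < k, f (x i) ∈ Fs m) {w : F} (hw : w ∈ Fs k) :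
    f w ∈ Fs m :=
  (Fs_le (K := (Fs m).comap f) h) hw

theorem Fs_mono {k m : ℕ} (h : k ≤ m) : Fs k ≤ Fs m := Fs_le fun i hi => x_mem_Fs (by omega)

theorem κ_of_mem {k : ℕ} {w : F} (hw : w ∈ Fs k) : κ k w = w :=
  Fs_eqOn (f := κ k) (g := MonoidHom.id F) (fun _ hi => κ_lt hi) hw

theorem κ_mem (k : ℕ) (w : F) : κ k w ∈ Fs k := by
  induction w using FreeGroup.induction_on with
  | C1 => simp
  | of i =>
    by_cases h : i < k
    · rw [show FreeGroup.of i = x i from rfl, κ_lt h]; exact x_mem_Fs h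
    · rw [show FreeGroup.of i = x i from rfl, κ_ge (not_lt.1 h)]; exact one_mem _
  | inv_of i h => rw [map_inv]; exact inv_mem h
  | mul a b ha hb => rw [map_mul]; exact mul_mem ha hb

theorem κ_κ {k m : ℕ} (h : k ≤ m) (w : F) : κ k (κ m w) = κ k w := by
  have : (κ k).comp (κ m) = κ k := by
    apply fhom_ext; intro i
    rw [MonoidHom.comp_apply]
    by_cases h1 : i < m
    · rw [κ_lt h1]
    · rw [κ_ge (not_lt.1 h1), κ_ge (by omega), map_one]
  exact DFunLike.congr_fun this w

theorem ι_κ (w : F) : ι n (κ n w) = ι n w := by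
  have : (ι n).comp (κ n) = ι n := by
    apply fhom_ext; intro i
    rw [MonoidHom.comp_apply]
    by_cases h1 : i < n
    · rw [κ_lt h1]
    · rw [κ_ge (not_lt.1 h1), map_one, ι_ge (not_lt.1 h1)]
  exact DFunLike.congr_fun this w

theorem Θ_ι_x {i : ℕ} (h : i < n) : Θ n (ι n (x i)) = MulAut.conj (x i) := by
  obtain ⟨k, hk⟩ : ∃ k, i + k + 1 = n := ⟨n - i - 1, by omega⟩
  induction k generalizing i with
  | zero => rw [ι_last (by omega), Θ_last (by omega)]
  | succ k ih =>
    rw [ι_succ (by omega), map_mul, map_mul, ih (by omega) (by omega), map_inv, Θ_s (by omega),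
      mul_assoc, inv_mul_eq_iff_eq_mul, aut_conj, hur_self]

theorem Θ_ι {w : F} (hw : w ∈ Fs n) : Θ n (ι n w) = MulAut.conj w :=
  Fs_eqOn (f := (Θ n).comp (ι n)) (g := MulAut.conj) (fun _ hi => Θ_ι_x hi) hw

theorem Fs_center {k m : ℕ} (hm : k ≤ m) {w : F} (hw : w ∈ Fs k) (h : x m * w = w * x m) : w =
    1 := by
  have h1 := eq_zpow_of_commute (expo m) (by rw [expo_of]; simp) h
  have h2 := κ_of_mem hw
  rw [← h2, h1, map_zpow, κ_ge hm, one_zpow]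

theorem ι_injOn {w : F} (hw : w ∈ Fs n) (h : ι n w = 1) : w = 1 := by
  have h1 := Θ_ι hw
  rw [h, map_one] at h1
  have h2 := DFunLike.congr_fun h1 (x n)
  rw [MulAut.one_apply, MulAut.conj_apply, eq_mul_inv_iff_mul_eq] at h2
  exact Fs_center le_rfl hw h2

theorem autInv_eq_iff {a : MulAut F} {v w : F} : a⁻¹ v = w ↔ v = a w :=
  ⟨fun h => by rw [← h, MulAut.apply_inv_self], fun h => by rw [h, MulAut.inv_apply_self]⟩

theorem hur_mem_Fs {i k j : ℕ} (hi : i + 1 < k) (hj : j < k) : hur i (x j) ∈ Fs k := by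
  have h1 : x i ∈ Fs k := x_mem_Fs (by omega)
  have h2 : x (i + 1) ∈ Fs k := x_mem_Fs hi
  rw [hur_apply]
  split_ifs
  · exact h2
  · exact mul_mem (mul_mem (inv_mem h2) h1) h2
  · exact x_mem_Fs hj

theorem hur_symm_mem_Fs {i k j : ℕ} (hi : i + 1 < k) (hj : j < k) : (hur i)⁻¹ (x j) ∈ Fs k := by
  have h1 : x i ∈ Fs k := x_mem_Fs (by omega)
  have h2 : x (i + 1) ∈ Fs k := x_mem_Fs hi
  by_cases e1 : j = i
  · subst e1
    have : (hur j)⁻¹ (x j) = x j * x (j + 1) * (x j)⁻¹ := by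
      rw [autInv_eq_iff]
      simp only [map_mul, map_inv, hur_self, hur_succ]; group
    rw [this]; exact mul_mem (mul_mem h1 h2) (inv_mem h1)
  by_cases e2 : j = i + 1
  · subst e2
    rwa [show (hur i)⁻¹ (x (i + 1)) = x i by rw [autInv_eq_iff, hur_self]]
  · rw [show (hur i)⁻¹ (x j) = x j by rw [autInv_eq_iff, hur_ne e1 e2]]
    exact x_mem_Fs hj

theorem Θ_mem_Fs (g : ArtinB n) {w : F} (hw : w ∈ Fs n) : Θ n g w ∈ Fs n := by
  suffices h : (∀ w ∈ Fs n, Θ n g w ∈ Fs n) ∧ (∀ w ∈ Fs n, (Θ n g)⁻¹ w ∈ Fs n) from h.1 w hw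
  clear hw w
  refine induction_s (p := fun g => (∀ w ∈ Fs n, Θ n g w ∈ Fs n) ∧
    (∀ w ∈ Fs n, (Θ n g)⁻¹ w ∈ Fs n)) ?_ ?_ ?_ ?_ g
  · simp
  · intro i hi
    by_cases h : i + 1 < n
    · rw [Θ_s h]
      exact ⟨fun w hw => map_mem_Fs (f := (hur i).toMonoidHom) (fun j hj => hur_mem_Fs h hj) hw,
        fun w hw => map_mem_Fs (f := (hur i)⁻¹.toMonoidHom) (fun j hj => hur_symm_mem_Fs h hj) hw⟩
    · rw [Θ_last (by omega)]
      have := x_mem_Fs hi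
      exact ⟨fun w hw => mul_mem (mul_mem this hw) (inv_mem this),
        fun w hw => by
          rw [← map_inv]; exact mul_mem (mul_mem (inv_mem this) hw) (inv_mem (inv_mem this))⟩
  · rintro g h ⟨hg, hg'⟩ ⟨hh, hh'⟩
    rw [map_mul]
    exact ⟨fun w hw => hg _ (hh _ hw), fun w hw => by
      rw [mul_inv_rev]; exact hh' _ (hg' _ hw)⟩
  · rintro g ⟨hg, hg'⟩
    rw [map_inv]
    exact ⟨hg', by simpa using hg⟩

/-! ### The projection onto the braid subgroup and the permutation -/

theorem isBSeq_pi (n : ℕ) : IsBSeq n fun i => if i + 1 < n then s n i else 1 where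
  braid i h := by
    simp only [if_pos (show i + 1 < n by omega), if_pos (show i + 1 + 1 < n by omega)]
    exact braid h
  braid4 i h := by
    simp only [if_pos (show i + 1 < n by omega), if_neg (show ¬ i + 1 + 1 < n by omega)]
    simp
  comm i j h hj := by
    split_ifs
    · exact s_comm h
    all_goals simp

/-- The retraction onto the braid subgroup, killing the last generator. -/
noncomputable def pr (n : ℕ) : ArtinB n →* ArtinB n := liftB _ (isBSeq_pi n)

theorem pr_s {i : ℕ} (h : i + 1 < n) : pr n (s n i) = s n i := by
  rw [pr, liftB_s _ _ (by omega)]; simp [h]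

theorem pr_last {i : ℕ} (h : i + 1 = n) : pr n (s n i) = 1 := by
  rw [pr, liftB_s _ _ (by omega)]; simp [h]

theorem pr_pr (g : ArtinB n) : pr n (pr n g) = pr n g := by
  have : (pr n).comp (pr n) = pr n := by
    apply hom_ext
    intro i hi
    by_cases h : i + 1 < n
    · simp only [MonoidHom.comp_apply, pr_s h]
    · simp only [MonoidHom.comp_apply, pr_last (show i + 1 = n by omega), map_one]
  exact DFunLike.congr_fun this g

theorem pr_ι (w : F) : pr n (ι n w) = 1 := by
  have : (pr n).comp (ι n) = 1 := by
    apply fhom_ext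
    intro i
    simp only [MonoidHom.comp_apply, MonoidHom.one_apply]
    by_cases hi : n ≤ i
    · rw [ι_ge hi, map_one]
    obtain ⟨k, hk⟩ : ∃ k, i + k + 1 = n := ⟨n - i - 1, by omega⟩
    clear hi
    induction k generalizing i with
    | zero => rw [ι_last (by omega), pr_last (by omega)]
    | succ k ih =>
      rw [ι_succ (by omega), map_mul, map_mul, ih _ (by omega)]; simp
  exact DFunLike.congr_fun this w

/-- The pole subgroup. -/
noncomputable def U (n : ℕ) : Subgroup (ArtinB n) := (ι n).range

theorem ι_mem_U (w : F) : ι n w ∈ U n := ⟨w, rfl⟩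

instance U_normal : (U n).Normal where
  conj_mem := by
    rintro _ ⟨w, rfl⟩ g
    exact ⟨Θ n g w, ι_Θ g w⟩

theorem exists_ι_of_mem_U {g : ArtinB n} (h : g ∈ U n) : ∃ w ∈ Fs n, g = ι n w := by
  obtain ⟨w, rfl⟩ := h
  exact ⟨κ n w, κ_mem n w, (ι_κ w).symm⟩

theorem mul_pr_inv_mem (g : ArtinB n) : g * (pr n g)⁻¹ ∈ U n := by
  refine induction_s (p := fun g => g * (pr n g)⁻¹ ∈ U n) ?_ ?_ ?_ ?_ g
  · simp
  · intro i hi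
    by_cases h : i + 1 < n
    · rw [pr_s h, mul_inv_cancel]; exact one_mem _
    · rw [pr_last (by omega), ← ι_last (by omega), inv_one, mul_one]; exact ι_mem_U _
  · intro g h hg hh
    have := mul_mem (U_normal.conj_mem _ hh g) hg
    rw [map_mul]
    convert this using 1; group
  · intro g hg
    have := U_normal.conj_mem _ (inv_mem hg) g⁻¹
    rw [map_inv]
    convert this using 1; group

theorem mem_U_iff {g : ArtinB n} : g ∈ U n ↔ pr n g = 1 := by
  constructor
  · rintro ⟨w, rfl⟩; exact pr_ι w
  · intro h; have := mul_pr_inv_mem g; rwa [h, inv_one, mul_one] at this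

/-- The adjacent transpositions. -/
def sigSeq (n i : ℕ) : Equiv.Perm (Fin n) :=
  if h : i + 1 < n then Equiv.swap ⟨i, by omega⟩ ⟨i + 1, h⟩ else 1

theorem isBSeq_sig (n : ℕ) : IsBSeq n (sigSeq n) where
  braid i h := by
    simp only [sigSeq, dif_pos (show i + 1 < n by omega), dif_pos (show i + 1 + 1 < n by omega)]
    have key : ∀ a b c : Fin n, a ≠ b → a ≠ c → b ≠ c →
        Equiv.swap a b * Equiv.swap b c * Equiv.swap a b =
          Equiv.swap b c * Equiv.swap a b * Equiv.swap b c := by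
      intro a b c hab hac hbc
      rw [Equiv.swap_mul_swap_mul_swap hab hac, Equiv.swap_comm a b, Equiv.swap_comm b c,
        Equiv.swap_mul_swap_mul_swap hbc.symm hac.symm, Equiv.swap_comm]
    apply key <;> simp [Fin.ext_iff]
    omega
  braid4 i h := by
    simp [sigSeq, show ¬ i + 1 + 1 < n by omega]
  comm i j h hj := by
    simp only [sigSeq]
    split_ifs
    · apply Equiv.Perm.Disjoint.commute
      intro a
      by_cases h1 : a.1 = i ∨ a.1 = i + 1
      · right; apply Equiv.swap_apply_of_ne_of_ne <;> (intro h2; simp [h2] at h1; omega)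
      · left; apply Equiv.swap_apply_of_ne_of_ne <;> (intro h2; simp [h2] at h1)
    all_goals simp

/-- The permutation of the strands. -/
noncomputable def σ (n : ℕ) : ArtinB n →* Equiv.Perm (Fin n) := liftB _ (isBSeq_sig n)

theorem σ_s {i : ℕ} (h : i + 1 < n) :
    σ n (s n i) = Equiv.swap ⟨i, by omega⟩ ⟨i + 1, h⟩ := by
  rw [σ, liftB_s _ _ (by omega)]; simp [sigSeq, h]

theorem σ_last {i : ℕ} (h : i + 1 = n) : σ n (s n i) = 1 := by
  rw [σ, liftB_s _ _ (by omega)]; simp [sigSeq, h]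

/-- The pure subgroup. -/
noncomputable def P (n : ℕ) : Subgroup (ArtinB n) := (σ n).ker

instance P_normal : (P n).Normal := MonoidHom.normal_ker _

theorem mem_P {g : ArtinB n} : g ∈ P n ↔ σ n g = 1 := MonoidHom.mem_ker

theorem σ_pr (g : ArtinB n) : σ n (pr n g) = σ n g := by
  have : (σ n).comp (pr n) = σ n := by
    apply hom_ext
    intro i hi
    by_cases h : i + 1 < n
    · simp only [MonoidHom.comp_apply, pr_s h]
    · simp only [MonoidHom.comp_apply, pr_last (show i + 1 = n by omega),
        σ_last (show i + 1 = n by omega), map_one]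
  exact DFunLike.congr_fun this g

theorem U_le_P : U n ≤ P n := fun g hg => by
  rw [mem_P, ← σ_pr, mem_U_iff.1 hg, map_one]

theorem Θ_x (g : ArtinB n) : ∀ (i : ℕ) (hi : i < n),
    ∃ v ∈ Fs n, Θ n g (x i) = v * x (σ n g ⟨i, hi⟩) * v⁻¹ := by
  refine induction_s (p := fun g => ∀ (i : ℕ) (hi : i < n),
    ∃ v ∈ Fs n, Θ n g (x i) = v * x (σ n g ⟨i, hi⟩) * v⁻¹) ?_ ?_ ?_ ?_ g
  · intro i hi; exact ⟨1, one_mem _, by simp⟩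
  · intro j hj i hi
    by_cases h : j + 1 < n
    · rw [Θ_s h, σ_s h]
      by_cases h1 : i = j
      · subst h1; exact ⟨1, one_mem _, by simp [hur_self]⟩
      by_cases h2 : i = j + 1
      · subst h2; exact ⟨(x (j + 1))⁻¹, inv_mem (x_mem_Fs h), by simp [hur_succ]⟩
      · refine ⟨1, one_mem _, ?_⟩
        rw [hur_ne h1 h2, Equiv.swap_apply_of_ne_of_ne (by simpa using h1) (by simpa using h2)]
        simp
    · rw [Θ_last (by omega), σ_last (by omega)]
      exact ⟨x j, x_mem_Fs hj, by simp⟩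
  · intro g h hg hh i hi
    obtain ⟨v, hv, h1⟩ := hh i hi
    obtain ⟨u, hu, h2⟩ := hg _ (σ n h ⟨i, hi⟩).2
    refine ⟨Θ n g v * u, mul_mem (Θ_mem_Fs g hv) hu, ?_⟩
    rw [map_mul, MulAut.mul_apply, h1, map_mul, map_mul, h2]
    simp [mul_assoc]
  · intro g hg i hi
    obtain ⟨v, hv, h1⟩ := hg _ ((σ n g)⁻¹ ⟨i, hi⟩).2
    refine ⟨Θ n g⁻¹ v⁻¹, Θ_mem_Fs _ (inv_mem hv), ?_⟩
    have h2 : σ n g ((σ n g)⁻¹ ⟨i, hi⟩) = ⟨i, hi⟩ := by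
      rw [← Equiv.Perm.mul_apply, mul_inv_cancel, Equiv.Perm.one_apply]
    rw [Fin.eta, h2] at h1
    rw [map_inv, map_inv, autInv_eq_iff]
    simp only [map_mul, map_inv, MulAut.apply_inv_self, h1]
    simp [mul_assoc]

/-! ### Products of consecutive letters and twists -/

/-- The product of `m` consecutive letters starting at `a`. -/
def cp (a : ℕ) : ℕ → F
  | 0 => 1
  | m + 1 => cp a m * x (a + m)

theorem cp_zero (a : ℕ) : cp a 0 = 1 := rfl
theorem cp_succ (a m : ℕ) : cp a (m + 1) = cp a m * x (a + m) := rfl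

theorem cp_succ' (a m : ℕ) : cp a (m + 1) = x a * cp (a + 1) m := by
  induction m with
  | zero => simp [cp_succ, cp_zero]
  | succ m ih => rw [cp_succ, ih, cp_succ, mul_assoc]; congr 3; omega

theorem cp_mem (a m : ℕ) : cp a m ∈ Fs (a + m) := by
  induction m with
  | zero => exact one_mem _
  | succ m ih => exact mul_mem (Fs_mono (by omega) ih) (x_mem_Fs (by omega))

theorem hur_cp_lt {i a m : ℕ} (h : a + m ≤ i ∨ i + 1 < a ) : hur i (cp a m) = cp a m := by
  induction m with
  | zero => simp [cp_zero]
  | succ m ih => rw [cp_succ, map_mul, ih (by omega), hur_ne] <;> omega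

theorem hur_cp {i a m : ℕ} (h1 : i + 1 ≠ a) (h2 : i + 1 ≠ a + m) : hur i (cp a m) = cp a m := by
  induction m with
  | zero => simp [cp_zero]
  | succ m ih =>
    by_cases h3 : i + 1 = a + m
    · obtain _ | m := m
      · omega
      · rw [cp_succ, cp_succ, map_mul, map_mul, hur_cp_lt (by omega), show a + m = i by omega,
          show a + (m + 1) = i + 1 by omega, hur_self, hur_succ]
        group
    · rw [cp_succ, map_mul, ih h3, hur_ne] <;> omega

theorem Θ_pr_cp (g : ArtinB n) : Θ n (pr n g) (cp 0 n) = cp 0 n := by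
  refine induction_s (p := fun g => Θ n (pr n g) (cp 0 n) = cp 0 n) ?_ ?_ ?_ ?_ g
  · simp
  · intro i hi
    by_cases h : i + 1 < n
    · rw [pr_s h, Θ_s h, hur_cp (by omega) (by omega)]
    · rw [pr_last (by omega)]; simp
  · intro g h hg hh
    rw [map_mul, map_mul, MulAut.mul_apply, hh, hg]
  · intro g hg
    rw [map_inv, map_inv, autInv_eq_iff, hg]

/-- The product of `m` consecutive generators starting at `a`. -/
noncomputable def blk (n a : ℕ) : ℕ → ArtinB n
  | 0 => 1
  | m + 1 => blk n a m * s n (a + m)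

theorem blk_succ (a m : ℕ) : blk n a (m + 1) = blk n a m * s n (a + m) := rfl

theorem pr_blk {a m : ℕ} (h : a + m < n) : pr n (blk n a m) = blk n a m := by
  induction m with
  | zero => simp [blk]
  | succ m ih => rw [blk_succ, map_mul, ih (by omega), pr_s (by omega)]

theorem Θ_blk_out {a m i : ℕ} (h : a + m < n) (hi : i < a ∨ a + m < i) :
    Θ n (blk n a m) (x i) = x i := by
  induction m with
  | zero => simp [blk]
  | succ m ih =>
    rw [blk_succ, map_mul, MulAut.mul_apply, Θ_s (by omega), hur_ne (by omega) (by omega),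
      ih (by omega) (by omega)]

theorem Θ_blk_lt {a m i : ℕ} (h : a + m < n) (h1 : a ≤ i) (h2 : i < a + m) :
    Θ n (blk n a m) (x i) = x (i + 1) := by
  induction m with
  | zero => omega
  | succ m ih =>
    rw [blk_succ, map_mul, MulAut.mul_apply, Θ_s (by omega)]
    by_cases h3 : i = a + m
    · subst h3; rw [hur_self, Θ_blk_out (by omega) (by omega)]
    · rw [hur_ne (by omega) (by omega), ih (by omega) (by omega)]

theorem Θ_blk_last {a m : ℕ} (h : a + m < n) :
    Θ n (blk n a m) (x (a + m)) = (cp a (m + 1))⁻¹ * x a * cp a (m + 1) := by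
  rw [cp_succ']
  suffices Θ n (blk n a m) (x (a + m)) = (cp (a + 1) m)⁻¹ * x a * cp (a + 1) m by
    rw [this]; group
  induction m with
  | zero => simp [blk, cp_zero]
  | succ m ih =>
    rw [blk_succ, map_mul, MulAut.mul_apply, Θ_s (by omega), ← add_assoc, hur_succ]
    simp only [map_mul, map_inv]
    rw [ih (by omega), Θ_blk_out (by omega) (by omega), cp_succ,
      show a + 1 + m = a + m + 1 by omega]
    group

theorem Θ_blk_cp {a m : ℕ} (h : a + m < n) :
    Θ n (blk n a m) (cp a (m + 1)) = cp a (m + 1) := by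
  suffices ∀ k ≤ m, Θ n (blk n a k) (cp a (m + 1)) = cp a (m + 1) from this m le_rfl
  intro k hk
  induction k with
  | zero => simp [blk]
  | succ k ih =>
    rw [blk_succ, map_mul, MulAut.mul_apply, Θ_s (by omega), hur_cp (by omega) (by omega),
      ih (by omega)]

theorem Θ_blk_pow_lt {a m i j : ℕ} (h : a + m < n) (h1 : a ≤ i) (h2 : i + j ≤ a + m) :
    (Θ n (blk n a m) ^ j) (x i) = x (i + j) := by
  induction j with
  | zero => simp
  | succ j ih =>
    rw [pow_succ', MulAut.mul_apply, ih (by omega), Θ_blk_lt h (by omega) (by omega), add_assoc]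

theorem Θ_blk_pow_cp {a m : ℕ} (h : a + m < n) (j : ℕ) :
    (Θ n (blk n a m) ^ j) (cp a (m + 1)) = cp a (m + 1) := by
  induction j with
  | zero => simp
  | succ j ih => rw [pow_succ, MulAut.mul_apply, Θ_blk_cp h, ih]

/-- The full twist on `m + 1` consecutive strands. -/
noncomputable def tw (n a m : ℕ) : ArtinB n := blk n a m ^ (m + 1)

theorem pr_tw {a m : ℕ} (h : a + m < n) : pr n (tw n a m) = tw n a m := by
  rw [tw, map_pow, pr_blk h]

theorem Θ_tw {a m i : ℕ} (h : a + m < n) (h1 : a ≤ i) (h2 : i ≤ a + m) :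
    Θ n (tw n a m) (x i) = (cp a (m + 1))⁻¹ * x i * cp a (m + 1) := by
  rw [tw, map_pow, show m + 1 = (i - a) + (1 + (a + m - i)) by omega, pow_add, pow_add,
    MulAut.mul_apply, MulAut.mul_apply, Θ_blk_pow_lt h h1 (by omega),
    show i + (a + m - i) = a + m by omega, pow_one, Θ_blk_last h]
  simp only [map_mul, map_inv]
  rw [Θ_blk_pow_cp h, Θ_blk_pow_lt h le_rfl (by omega), show a + (i - a) = i by omega,
    show (i - a) + (1 + (a + m - i)) = m + 1 by omega]

theorem Θ_tw_out {a m i : ℕ} (h : a + m < n) (hi : i < a ∨ a + m < i) :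
    Θ n (tw n a m) (x i) = x i := by
  rw [tw, map_pow]
  generalize m + 1 = k
  induction k with
  | zero => simp
  | succ k ih => rw [pow_succ, MulAut.mul_apply, Θ_blk_out h hi, ih]

theorem ρB_eq_blk : ρB n = blk n 0 n := by
  have : ∀ m, ((List.range m).map fun i => rB n (i + 1)).prod = blk n 0 m := by
    intro m
    induction m with
    | zero => simp [blk]
    | succ m ih => rw [List.range_succ, List.map_append, List.prod_append, ih, blk_succ]; simp [s]
  exact this n

theorem ΔB_eq : ΔB (n + 1) = ι (n + 1) (cp 0 (n + 1)) * tw (n + 1) 0 n := by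
  set c := cp 0 (n + 1) with hc
  have h0 : ρB (n + 1) = ι (n + 1) (c⁻¹ * x 0 * c) * blk (n + 1) 0 n := by
    rw [ρB_eq_blk, blk_succ, ← Θ_blk_last (n := n + 1) (by omega), ι_Θ, ι_last (by omega)]; group
  have h1 : ∀ m ≤ n + 1, ρB (n + 1) ^ m =
      ι (n + 1) (c⁻¹ * cp 0 m * c) * blk (n + 1) 0 n ^ m := by
    intro m
    induction m with
    | zero => simp [cp_zero]
    | succ m ih =>
      intro hm
      rw [pow_succ, ih (by omega), h0, cp_succ]
      have h2 : ι (n + 1) (c⁻¹ * x m * c) =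
          blk (n + 1) 0 n ^ m * ι (n + 1) (c⁻¹ * x 0 * c) * (blk (n + 1) 0 n ^ m)⁻¹ := by
        rw [← ι_Θ, map_pow]
        simp only [map_mul, map_inv]
        have h3 : (Θ (n + 1) (blk (n + 1) 0 n) ^ m) c = c := Θ_blk_pow_cp (by omega) m
        have h4 := Θ_blk_pow_lt (n := n + 1) (a := 0) (m := n) (i := 0) (j := m) (by omega)
          le_rfl (by omega)
        rw [h3, h4, zero_add]
      rw [zero_add, show c⁻¹ * (cp 0 m * x m) * c = (c⁻¹ * cp 0 m * c) * (c⁻¹ * x m * c) by group,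
        map_mul (ι (n + 1)) (c⁻¹ * cp 0 m * c) (c⁻¹ * x m * c), h2, pow_succ]
      group
  rw [ΔB, h1 _ le_rfl, tw, ← hc]
  simp

theorem Θ_ΔB {i : ℕ} (hi : i < n) : Θ n (ΔB n) (x i) = x i := by
  obtain _ | n := n
  · omega
  rw [ΔB_eq, map_mul, MulAut.mul_apply, Θ_tw (by omega) (by omega) (by omega),
    Θ_ι (by simpa using cp_mem 0 (n + 1)), MulAut.conj_apply]
  group

/-! ### Pure generators -/

theorem isBSeq_j (n q : ℕ) : IsBSeq q fun i =>
    if q ≤ n then (if i + 1 < q then s n i else if q < n then s n i ^ 2 else s n i) else 1 where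
  braid i h := by
    split_ifs
    any_goals omega
    · exact braid (by omega)
    · rfl
  braid4 i h := by
    split_ifs
    any_goals omega
    · have h1 := braid (n := n) (i := i) (by omega)
      generalize s n i = a at *
      generalize s n (i + 1) = b at *
      calc a * b ^ 2 * a * b ^ 2 = a * b * (b * a * b) * b := by simp [pow_two, mul_assoc]
        _ = (a * b * a) * b * a * b := by rw [← h1]; simp [mul_assoc]
        _ = b * (a * b) * (b * a * b) := by rw [h1]; simp [mul_assoc]
        _ = b * (a * b * a) * b * a := by rw [← h1]; simp [mul_assoc]
        _ = b ^ 2 * a * b ^ 2 * a := by rw [h1]; simp [pow_two, mul_assoc]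
    · exact braid4 (by omega)
    · rfl
  comm i j h hj := by
    have := s_comm (n := n) h
    split_ifs
    any_goals omega
    all_goals first | exact this | rfl | exact (Commute.pow_right this 2)

/-- The homomorphism from the group on `q` strands (and a pole), replacing the pole
by the strand `q` (or the identity for `q = n`). -/
noncomputable def jh (n q : ℕ) : ArtinB q →* ArtinB n := liftB _ (isBSeq_j n q)

theorem jh_s {q i : ℕ} (hq : q ≤ n) (h : i + 1 < q) : jh n q (s q i) = s n i := by
  rw [jh, liftB_s _ _ (by omega)]; simp [hq, h]

theorem jh_last {q i : ℕ} (hq : q < n) (h : i + 1 = q) : jh n q (s q i) = s n i ^ 2 := by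
  rw [jh, liftB_s _ _ (by omega)]; simp [hq, hq.le, show ¬ i + 1 < q by omega]

theorem jh_self (g : ArtinB n) : jh n n g = g := by
  have : jh n n = MonoidHom.id _ := by
    apply hom_ext
    intro i hi
    rw [jh, liftB_s _ _ hi]; simp
  rw [this]; rfl

/-- The pure generators. -/
noncomputable def A (n p q : ℕ) : ArtinB n := jh n q (ι q (x p))

theorem A_last {p : ℕ} (h : p + 1 < n) : A n p (p + 1) = s n p ^ 2 := by
  rw [A, ι_last rfl, jh_last h rfl]

theorem A_pole (p : ℕ) : A n p n = ι n (x p) := jh_self _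

theorem A_succ {p q : ℕ} (h : p + 1 < q) (hq : q ≤ n) :
    A n p q = (s n p)⁻¹ * A n (p + 1) q * s n p := by
  rw [A, ι_succ h, map_mul, map_mul, map_inv, jh_s hq h]; rfl

theorem jh_A {p q k : ℕ} (hp : p < q) (hq : q < k) (hk : k ≤ n) : jh n k (A k p q) = A n p q := by
  obtain ⟨m, rfl⟩ : ∃ m, q = p + m + 1 := ⟨q - p - 1, by omega⟩
  clear hp
  induction m generalizing p with
  | zero => rw [add_zero] at *; rw [A_last hq, A_last (by omega), map_pow, jh_s hk (by omega)]
  | succ m ih =>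
    rw [A_succ (by omega) (by omega), map_mul, map_mul, map_inv, jh_s hk (by omega),
      A_succ (n := n) (by omega) (by omega), show p + (m + 1) + 1 = p + 1 + m + 1 by omega,
      ih (by omega)]

theorem jh_ι_conj (q : ℕ) (g : ArtinB q) (w : F) :
    jh n q g * jh n q (ι q w) * (jh n q g)⁻¹ = jh n q (ι q (Θ q g w)) := by
  rw [ι_Θ]; simp

theorem s_conj_jh {q i : ℕ} (hq : q ≤ n) (h : i + 1 < q) (w : F) :
    s n i * jh n q (ι q w) * (s n i)⁻¹ = jh n q (ι q (hur i w)) := by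
  rw [← jh_s hq h, jh_ι_conj, Θ_s h]

theorem s_comm_A {p q i : ℕ} (hp : p < q) (hq : q < i) (hi : i < n) :
    s n i * A n p q = A n p q * s n i := by
  obtain ⟨m, rfl⟩ : ∃ m, q = p + m + 1 := ⟨q - p - 1, by omega⟩
  clear hp
  induction m generalizing p with
  | zero =>
    rw [add_zero] at *
    rw [A_last (by omega)]
    exact Commute.pow_right (s_comm (show p + 2 ≤ i by omega)).symm 2
  | succ m ih =>
    have h1 : Commute (s n i) (s n p) := (s_comm (show p + 2 ≤ i by omega)).symm
    have h2 := ih (p := p + 1) (by omega)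
    rw [show p + 1 + m + 1 = p + (m + 1) + 1 by omega] at h2
    rw [A_succ (by omega) (by omega)]
    exact (h1.inv_right.mul_right h2).mul_right h1

theorem s_conj_A {p q : ℕ} (hp : p < q) (hq : q + 1 < n) :
    s n q * A n p q * (s n q)⁻¹ = A n p (q + 1) := by
  obtain ⟨m, rfl⟩ : ∃ m, q = p + m + 1 := ⟨q - p - 1, by omega⟩
  clear hp
  induction m generalizing p with
  | zero =>
    rw [add_zero] at *
    rw [A_last (by omega), A_succ (by omega) (by omega), A_last (by omega)]
    have h1 := braid (n := n) (i := p) (by omega)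
    generalize s n p = a at *
    generalize s n (p + 1) = b at *
    have h2 : b * a * b⁻¹ = a⁻¹ * b * a := by
      rw [mul_inv_eq_iff_eq_mul, mul_assoc, mul_assoc, eq_inv_mul_iff_mul_eq, ← mul_assoc, h1,
        mul_assoc]
    calc b * a ^ 2 * b⁻¹ = (b * a * b⁻¹) ^ 2 := by simp
      _ = _ := by rw [h2]; simp [pow_two, mul_assoc]
  | succ m ih =>
    have h1 : s n (p + (m + 1) + 1) * s n p = s n p * s n (p + (m + 1) + 1) :=
      (s_comm (show p + 2 ≤ _ by omega)).symm
    have h2 := ih (p := p + 1) (by omega)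
    rw [show p + 1 + m + 1 = p + (m + 1) + 1 by omega] at h2
    rw [A_succ (by omega) (by omega), A_succ (q := p + (m + 1) + 1 + 1) (by omega) (by omega), ← h2]
    generalize s n (p + (m + 1) + 1) = b at *
    generalize s n p = a at *
    have h3 : b * a⁻¹ = a⁻¹ * b := (Commute.inv_right h1).eq
    have h4 : b⁻¹ * a = a * b⁻¹ := (Commute.inv_left h1).eq
    calc _ = (b * a⁻¹) * A n (p + 1) (p + (m + 1) + 1) * (a * b⁻¹) := by group
      _ = _ := by rw [h3, ← h4]; group

/-- The subgroup generated by the generators joining `q` to smaller points. -/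
noncomputable def V (n q : ℕ) : Subgroup (ArtinB n) := ((jh n q).comp (ι q)).range

theorem jh_mem_V (q : ℕ) (w : F) : jh n q (ι q w) ∈ V n q := ⟨w, rfl⟩

theorem exists_of_mem_V {q : ℕ} {g : ArtinB n} (h : g ∈ V n q) : ∃ w ∈ Fs q, g =
    jh n q (ι q w) := by
  obtain ⟨w, rfl⟩ := h
  exact ⟨κ q w, κ_mem q w, by rw [ι_κ]; rfl⟩

/-- The subgroup generated by the pure generators on the points `0, …, m`. -/
noncomputable def PA (n m : ℕ) : Subgroup (ArtinB n) :=
  Subgroup.closure {g | ∃ p q, p < q ∧ q ≤ m ∧ g = A n p q}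

theorem A_mem_PA {p q m : ℕ} (h : p < q) (hq : q ≤ m) : A n p q ∈ PA n m :=
  Subgroup.subset_closure ⟨p, q, h, hq, rfl⟩

theorem PA_mono {m k : ℕ} (h : m ≤ k) : PA n m ≤ PA n k :=
  Subgroup.closure_mono fun _ ⟨p, q, h1, h2, h3⟩ => ⟨p, q, h1, h2.trans h, h3⟩

theorem V_le_PA {q m : ℕ} (h : q ≤ m) : V n q ≤ PA n m := by
  intro g hg
  obtain ⟨w, hw, rfl⟩ := exists_of_mem_V hg
  have : Fs q ≤ (PA n m).comap ((jh n q).comp (ι q)) := Fs_le fun i hi => A_mem_PA hi h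
  exact this hw

theorem exists_jh_of_mem_PA {m k : ℕ} (h : m < k) (hk : k ≤ n) {g : ArtinB n} (hg : g ∈ PA n m) :
    ∃ g' ∈ PA k m, jh n k g' = g := by
  have : PA n m ≤ (PA k m).map (jh n k) := by
    refine (Subgroup.closure_le _).2 ?_
    rintro _ ⟨p, q, h1, h2, rfl⟩
    exact ⟨A k p q, A_mem_PA h1 h2, jh_A h1 (by omega) hk⟩
  obtain ⟨g', h1, h2⟩ := this hg
  exact ⟨g', h1, h2⟩

theorem V_conj {m k : ℕ} (h : m < k) (hk : k ≤ n) {g v : ArtinB n} (hg : g ∈ PA n m)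
    (hv : v ∈ V n k) : g * v * g⁻¹ ∈ V n k := by
  obtain ⟨g', -, rfl⟩ := exists_jh_of_mem_PA h hk hg
  obtain ⟨w, rfl⟩ := hv
  exact ⟨Θ k g' w, (jh_ι_conj k g' w).symm⟩

theorem PA_comb {m : ℕ} (hm : m + 1 ≤ n) {g : ArtinB n} (hg : g ∈ PA n (m + 1)) :
    ∃ w ∈ Fs (m + 1), ∃ u ∈ PA n m, g = jh n (m + 1) (ι (m + 1) w) * u := by
  suffices ∃ v ∈ V n (m + 1), ∃ u ∈ PA n m, g = v * u by
    obtain ⟨v, hv, u, hu, rfl⟩ := this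
    obtain ⟨w, hw, rfl⟩ := exists_of_mem_V hv
    exact ⟨w, hw, u, hu, rfl⟩
  induction hg using Subgroup.closure_induction with
  | mem g h =>
    obtain ⟨p, q, h1, h2, rfl⟩ := h
    by_cases h3 : q ≤ m
    · exact ⟨1, one_mem _, _, A_mem_PA h1 h3, (one_mul _).symm⟩
    · obtain rfl : q = m + 1 := by omega
      exact ⟨_, jh_mem_V _ _, 1, one_mem _, (mul_one _).symm⟩
  | one => exact ⟨1, one_mem _, 1, one_mem _, (one_mul _).symm⟩
  | mul a b _ _ ha hb =>
    obtain ⟨v, hv, u, hu, rfl⟩ := ha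
    obtain ⟨v', hv', u', hu', rfl⟩ := hb
    exact ⟨v * (u * v' * u⁻¹), mul_mem hv (V_conj (by omega) hm hu hv'), u * u', mul_mem hu hu',
      by group⟩
  | inv a _ ha =>
    obtain ⟨v, hv, u, hu, rfl⟩ := ha
    refine ⟨u⁻¹ * v⁻¹ * u, ?_, u⁻¹, inv_mem hu, by group⟩
    have := V_conj (by omega) hm (inv_mem hu) (inv_mem hv)
    rwa [inv_inv] at this

theorem s_sq_mem_PA {i : ℕ} (h : i + 1 < n) : s n i ^ 2 ∈ PA n n := by
  rw [← A_last h]; exact A_mem_PA (by omega) (by omega)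

theorem s_last_mem_PA {i : ℕ} (h : i + 1 = n) : s n i ∈ PA n n := by
  rw [← ι_last h, ← A_pole]; exact A_mem_PA (by omega) le_rfl

theorem s_conj_mem_PA {i : ℕ} (hi : i < n) {g : ArtinB n} (hg : g ∈ PA n n) :
    s n i * g * (s n i)⁻¹ ∈ PA n n := by
  by_cases hin : i + 1 = n
  · have := s_last_mem_PA hin
    exact mul_mem (mul_mem this hg) (inv_mem this)
  suffices PA n n ≤ (PA n n).comap (MulAut.conj (s n i)).toMonoidHom from this hg
  refine (Subgroup.closure_le _).2 ?_
  rintro _ ⟨p, q, h1, h2, rfl⟩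
  show s n i * A n p q * (s n i)⁻¹ ∈ PA n n
  by_cases c1 : i + 1 < q
  · rw [A, s_conj_jh h2 c1]
    exact V_le_PA h2 (jh_mem_V _ _)
  by_cases c2 : i + 1 = q
  · subst c2
    by_cases c3 : p = i
    · subst c3; rw [A_last (by omega)]
      convert s_sq_mem_PA (n := n) (i := p) (by omega) using 1; group
    · rw [← s_conj_A (by omega) (by omega)]
      have := s_sq_mem_PA (n := n) (i := i) (by omega)
      have := mul_mem (mul_mem this (A_mem_PA (n := n) (show p < i by omega) (show i ≤ n by omega)))
        (inv_mem this)
      convert this using 1; simp [pow_two, mul_assoc]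
  by_cases c3 : i = q
  · subst c3
    rw [s_conj_A h1 (by omega)]; exact A_mem_PA (by omega) (by omega)
  · rw [s_comm_A h1 (by omega) hi, mul_inv_cancel_right]; exact A_mem_PA h1 h2

theorem s_inv_conj_mem_PA {i : ℕ} (hi : i < n) {g : ArtinB n} (hg : g ∈ PA n n) :
    (s n i)⁻¹ * g * s n i ∈ PA n n := by
  by_cases hin : i + 1 = n
  · have := s_last_mem_PA hin
    exact mul_mem (mul_mem (inv_mem this) hg) this
  have h2 := s_sq_mem_PA (n := n) (i := i) (by omega)
  have := s_conj_mem_PA hi (mul_mem (mul_mem (inv_mem h2) hg) h2)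
  convert this using 1; group

theorem normal_of_s {N : Subgroup (ArtinB n)} (h1 : ∀ i < n, ∀ g ∈ N, s n i * g * (s n i)⁻¹ ∈ N)
    (h2 : ∀ i < n, ∀ g ∈ N, (s n i)⁻¹ * g * s n i ∈ N) : N.Normal := by
  rw [← Subgroup.normalizer_eq_top_iff, eq_top_iff]
  rintro g -
  refine induction_s (p := fun g => g ∈ Subgroup.normalizer (N : Set (ArtinB n))) (one_mem _)
    (fun i hi => ?_) (fun _ _ => mul_mem) (fun _ => inv_mem) g
  rw [Subgroup.mem_normalizer_iff]
  refine fun g => ⟨fun h => h1 i hi g h, fun h => ?_⟩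
  have := h2 i hi _ h
  convert this using 1; group

instance PA_normal : (PA n n).Normal :=
  normal_of_s (fun _ hi _ hg => s_conj_mem_PA hi hg) (fun _ hi _ hg => s_inv_conj_mem_PA hi hg)

/-! ### The pure subgroup as a normal closure -/

section Coset

variable {Q : Type*} [Group Q] (S : ℕ → Q)

/-- The product `S (j + m - 1) ⋯ S j`. -/
def desc : ℕ → ℕ → Q
  | 0, _ => 1
  | m + 1, j => desc m (j + 1) * S j

/-- The subgroup generated by the first `k` elements. -/
def Hs (k : ℕ) : Subgroup Q := Subgroup.closure (S '' Set.Iio k)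

variable {S}

theorem mem_Hs {i k : ℕ} (h : i < k) : S i ∈ Hs S k := Subgroup.subset_closure ⟨i, h, rfl⟩

theorem desc_comm_lt {K : ℕ} (hc : ∀ i j, i + 2 ≤ j → j < K → S i * S j = S j * S i) {m j i : ℕ}
    (h : i + 2 ≤ j) (hK : j + m ≤ K) : desc S m j * S i = S i * desc S m j := by
  induction m generalizing j with
  | zero => simp [desc]
  | succ m ih =>
    rw [desc, mul_assoc, ← hc i j h (by omega), ← mul_assoc, ih (by omega) (by omega), mul_assoc]

theorem desc_shift {K : ℕ} (hb : ∀ i, i + 1 < K → S i * S (i + 1) * S i = S (i + 1)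
    * S i * S (i + 1))
    (hc : ∀ i j, i + 2 ≤ j → j < K → S i * S j = S j * S i) {m j i : ℕ}
    (h : j ≤ i) (him : i + 1 < j + m) (hK : j + m ≤ K) :
    desc S m j * S (i + 1) = S i * desc S m j := by
  induction m generalizing j with
  | zero => omega
  | succ m ih =>
    by_cases hij : i = j
    · subst hij
      obtain _ | m := m
      · omega
      · have := desc_comm_lt hc (m := m) (j := i + 2) (i := i) le_rfl (by omega)
        rw [desc, desc]
        calc _ = desc S m (i + 2) * (S (i + 1) * S i * S (i + 1)) := by simp [mul_assoc]
          _ = desc S m (i + 2) * S i * (S (i + 1) * S i) := by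
            rw [← hb i (by omega)]; simp [mul_assoc]
          _ = _ := by rw [this]; simp [mul_assoc]
    · rw [desc, mul_assoc, hc j (i + 1) (by omega) (by omega), ← mul_assoc,
        ih (by omega) (by omega) (by omega), mul_assoc]

theorem exists_desc {k : ℕ} (h2 : ∀ i < k, S i * S i = 1)
    (hb : ∀ i, i + 1 < k → S i * S (i + 1) * S i = S (i + 1) * S i * S (i + 1))
    (hc : ∀ i j, i + 2 ≤ j → j < k → S i * S j = S j * S i) {g : Q} (hg : g ∈ Hs S k) :
    ∃ v ∈ Hs S (k - 1), ∃ m j, j + m = k ∧ g = v * desc S m j := by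
  have step : ∀ g, (∃ v ∈ Hs S (k - 1), ∃ m j, j + m = k ∧ g = v * desc S m j) → ∀ i < k,
      ∃ v ∈ Hs S (k - 1), ∃ m j, j + m = k ∧ g * S i = v * desc S m j := by
    rintro _ ⟨v, hv, m, j, hjm, rfl⟩ i hi
    by_cases c1 : i + 2 ≤ j
    · exact ⟨v * S i, mul_mem hv (mem_Hs (by omega)), m, j, hjm, by
        rw [mul_assoc, desc_comm_lt hc c1 hjm.le, mul_assoc]⟩
    by_cases c2 : i + 1 = j
    · subst c2
      exact ⟨v, hv, m + 1, i, by omega, by rw [desc, mul_assoc]⟩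
    by_cases c3 : i = j
    · subst c3
      obtain _ | m := m
      · omega
      · exact ⟨v, hv, m, i + 1, by omega, by
          rw [desc, mul_assoc, mul_assoc, h2 i hi, mul_one]⟩
    · obtain ⟨i, rfl⟩ : ∃ i', i = i' + 1 := ⟨i - 1, by omega⟩
      exact ⟨v * S i, mul_mem hv (mem_Hs (by omega)), m, j, hjm, by
        rw [mul_assoc, desc_shift hb hc (by omega) (by omega) hjm.le, mul_assoc]⟩
  refine Subgroup.closure_induction_right (p := fun g _ =>
    ∃ v ∈ Hs S (k - 1), ∃ m j, j + m = k ∧ g = v * desc S m j) ?_ ?_ ?_ hg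
  · exact ⟨1, one_mem _, 0, k, by omega, by simp [desc]⟩
  · rintro g _ _ ⟨i, hi, rfl⟩ h
    exact step g h i hi
  · rintro g _ _ ⟨i, hi, rfl⟩ h
    rw [inv_eq_of_mul_eq_one_right (h2 i hi)]
    exact step g h i hi

theorem eq_one_of_perm {n : ℕ} (θ : Q →* Equiv.Perm (Fin n))
    (hθ : ∀ i (h : i + 1 < n), θ (S i) = Equiv.swap ⟨i, by omega⟩ ⟨i + 1, h⟩) (k : ℕ)
      (hk : k + 1 ≤ n)
    (h2 : ∀ i < k, S i * S i = 1)
    (hb : ∀ i, i + 1 < k → S i * S (i + 1) * S i = S (i + 1) * S i * S (i + 1))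
    (hc : ∀ i j, i + 2 ≤ j → j < k → S i * S j = S j * S i) {g : Q} (hg : g ∈ Hs S k)
    (h1 : θ g = 1) : g = 1 := by
  induction k generalizing g with
  | zero =>
    have : Hs S 0 = ⊥ := by simp [Hs]
    rwa [this, Subgroup.mem_bot] at hg
  | succ k ih =>
    obtain ⟨v, hv, m, j, hjm, rfl⟩ := exists_desc h2 hb hc hg
    rw [Nat.add_sub_cancel] at hv
    have hvk : θ v ⟨k + 1, by omega⟩ = ⟨k + 1, by omega⟩ := by
      have : Hs S k ≤ (MulAction.stabilizer (Equiv.Perm (Fin n))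
        (⟨k + 1, by omega⟩ : Fin n)).comap θ := by
        refine (Subgroup.closure_le _).2 ?_
        rintro _ ⟨i, hi, rfl⟩
        have hi : i < k := hi
        show θ (S i) ⟨k + 1, _⟩ = _
        rw [hθ i (by omega)]
        apply Equiv.swap_apply_of_ne_of_ne <;> simp [Fin.ext_iff] <;> omega
      exact this hv
    have hd : ∀ m j (h : j + m < n), θ (desc S m j) ⟨j, by omega⟩ = ⟨j + m, h⟩ := by
      intro m
      induction m with
      | zero => intro j h; simp [desc]
      | succ m ih =>
        intro j h
        rw [desc, map_mul, Equiv.Perm.mul_apply, hθ j (by omega), Equiv.swap_apply_left,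
          ih _ (by omega)]
        simp [Fin.ext_iff]; omega
    have h3 : θ (v * desc S m j) ⟨j, by omega⟩ = ⟨j, by omega⟩ := by rw [h1]; rfl
    rw [map_mul, Equiv.Perm.mul_apply, hd m j (by omega)] at h3
    simp only [hjm] at h3
    rw [hvk] at h3
    obtain rfl : k + 1 = j := by simpa using h3
    obtain rfl : m = 0 := by omega
    simp only [desc, mul_one] at h1 ⊢
    exact ih (by omega) (fun i hi => h2 i (by omega)) (fun i hi => hb i (by omega))
      (fun i j h hj => hc i j h (by omega)) hv h1

end Coset

theorem s_sq_mem_P {i : ℕ} (h : i + 1 < n) : s n i * s n i ∈ P n := by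
  rw [mem_P, map_mul, σ_s h, Equiv.swap_mul_self]

theorem s_last_mem_P {i : ℕ} (h : i + 1 = n) : s n i ∈ P n := by
  rw [mem_P, σ_last h]

theorem P_le_of_normal {N : Subgroup (ArtinB n)} [N.Normal]
    (h2 : ∀ i, i + 1 < n → s n i * s n i ∈ N) (hl : ∀ i, i + 1 = n → s n i ∈ N) : P n ≤ N := by
  obtain _ | m := n
  · intro g hg
    refine induction_s (p := fun g => g ∈ N) (one_mem _) (fun i hi => by omega)
      (fun _ _ => mul_mem) (fun _ => inv_mem) g
  set N' := N ⊓ P (m + 1)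
  let q := QuotientGroup.mk' N'
  let θ : ArtinB (m + 1) ⧸ N' →* Equiv.Perm (Fin (m + 1)) :=
    QuotientGroup.lift N' (σ (m + 1)) (fun g hg => mem_P.1 hg.2)
  have hq : ∀ g, g ∈ N' → q g = 1 := fun g hg => (QuotientGroup.eq_one_iff g).2 hg
  intro g hg
  have h1 : q g = 1 := by
    refine eq_one_of_perm (S := fun i => q (s (m + 1) i)) θ (fun i h => σ_s h)
      m le_rfl ?_ ?_ ?_ ?_ ?_
    · intro i hi
      rw [← map_mul]; exact hq _ ⟨h2 i (by omega), s_sq_mem_P (by omega)⟩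
    · intro i hi; simp only [← map_mul]; rw [braid (by omega)]
    · intro i j h hj; simp only [← map_mul]; rw [s_comm h]
    · refine induction_s (p := fun g => q g ∈ _) ?_ ?_ ?_ ?_ g
      · rw [map_one]; exact one_mem _
      · intro i hi
        by_cases h : i < m
        · exact mem_Hs (S := fun i => q (s (m + 1) i)) h
        · rw [hq _ ⟨hl i (by omega), s_last_mem_P (by omega)⟩]; exact one_mem _
      · intro a b ha hb; rw [map_mul]; exact mul_mem ha hb
      · intro a ha; rw [map_inv]; exact inv_mem ha
    · exact mem_P.1 hg
  exact ((QuotientGroup.eq_one_iff g).1 h1).1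

theorem P_eq_PA : P n = PA n n := by
  apply le_antisymm
  · refine P_le_of_normal (fun i h => ?_) (fun i h => s_last_mem_PA h)
    rw [← pow_two]; exact s_sq_mem_PA h
  · refine (Subgroup.closure_le _).2 ?_
    rintro _ ⟨p, q, h1, h2, rfl⟩
    obtain rfl | h2 := h2.eq_or_lt
    · rw [A_pole]; exact U_le_P (ι_mem_U _)
    obtain ⟨m, rfl⟩ : ∃ m, q = p + m + 1 := ⟨q - p - 1, by omega⟩
    clear h1
    induction m generalizing p with
    | zero => rw [add_zero] at *; rw [A_last h2, pow_two]; exact s_sq_mem_P h2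
    | succ m ih =>
      have h3 := ih (p := p + 1)
      rw [show p + 1 + m + 1 = p + (m + 1) + 1 by omega] at h3
      have := P_normal.conj_mem _ (h3 (by omega) (by omega)) (s n p)⁻¹
      rw [SetLike.mem_coe, A_succ (by omega) (by omega)]
      simpa using this

theorem A_mem_P {p q : ℕ} (h : p < q) (hq : q ≤ n) : A n p q ∈ P n := by
  rw [P_eq_PA]; exact A_mem_PA h hq

/-! ### The action of pure elements, faithfulness and the center -/

theorem A_mem_Hs {p q : ℕ} (h : p < q) (hq : q < n) : A n p q ∈ Hs (s n) q := by
  obtain ⟨m, rfl⟩ : ∃ m, q = p + m + 1 := ⟨q - p - 1, by omega⟩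
  clear h
  induction m generalizing p with
  | zero => rw [add_zero] at *; rw [A_last hq]; exact pow_mem (mem_Hs (by omega)) 2
  | succ m ih =>
    have h3 := ih (p := p + 1) (by omega)
    rw [show p + 1 + m + 1 = p + (m + 1) + 1 by omega] at h3
    have h4 : s n p ∈ Hs (s n) (p + (m + 1) + 1) := mem_Hs (by omega)
    rw [A_succ (by omega) (by omega)]
    exact mul_mem (mul_mem (inv_mem h4) h3) h4

theorem Hs_mono {k m : ℕ} (h : k ≤ m) : Hs (s n) k ≤ Hs (s n) m :=
  Subgroup.closure_mono (Set.image_mono (Set.Iio_subset_Iio h))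

theorem PA_le_Hs {m : ℕ} (h : m < n) : PA n m ≤ Hs (s n) m := by
  refine (Subgroup.closure_le _).2 ?_
  rintro _ ⟨p, q, h1, h2, rfl⟩
  exact Hs_mono h2 (A_mem_Hs h1 (by omega))

theorem pr_of_mem_Hs {m : ℕ} (hm : m < n) {g : ArtinB n} (hg : g ∈ Hs (s n) m) : pr n g = g :=
  MonoidHom.eqOn_closure (f := pr n) (g := MonoidHom.id _) (s := s n '' Set.Iio m)
    (by rintro _ ⟨i, hi, rfl⟩; exact pr_s (by have : i < m := hi; omega)) hg

theorem Θ_Hs_gt {m : ℕ} (hm : m < n) {g : ArtinB n} (hg : g ∈ Hs (s n) m) {j : ℕ} (hj : m < j) :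
    Θ n g (x j) = x j := by
  have : Hs (s n) m ≤ (MulAction.stabilizer (MulAut F) (x j)).comap (Θ n) := by
    refine (Subgroup.closure_le _).2 ?_
    rintro _ ⟨i, hi, rfl⟩
    have hi : i < m := hi
    show Θ n (s n i) (x j) = x j
    rw [Θ_s (by omega), hur_ne (by omega) (by omega)]
  exact this hg

theorem Θ_Hs_mem {m k : ℕ} (hm : m < k) (hk : k ≤ n) {g : ArtinB n} (hg : g ∈ Hs (s n) m) {w : F}
    (hw : w ∈ Fs k) : Θ n g w ∈ Fs k := by
  suffices (∀ w ∈ Fs k, Θ n g w ∈ Fs k) ∧ (∀ w ∈ Fs k, Θ n g⁻¹ w ∈ Fs k) from this.1 w hw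
  clear hw w
  induction hg using Subgroup.closure_induction with
  | mem g h =>
    obtain ⟨i, hi, rfl⟩ := h
    have hi : i < m := hi
    rw [map_inv, Θ_s (by omega)]
    exact ⟨fun w hw => map_mem_Fs (f := (hur i).toMonoidHom) (fun j hj => hur_mem_Fs (by omega) hj)
      hw,
      fun w hw => map_mem_Fs (f := (hur i)⁻¹.toMonoidHom)
        (fun j hj => hur_symm_mem_Fs (by omega) hj) hw⟩
  | one => simp
  | mul a b _ _ ha hb =>
    exact ⟨fun w hw => by rw [map_mul]; exact ha.1 _ (hb.1 _ hw),
      fun w hw => by rw [mul_inv_rev, map_mul]; exact hb.2 _ (ha.2 _ hw)⟩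
  | inv a _ ha => rw [inv_inv]; exact ⟨ha.2, ha.1⟩

theorem κ_hur {q i : ℕ} (h : i + 1 < q) (w : F) : κ q (hur i w) = hur i (κ q w) := by
  have : (κ q).comp (hur i).toMonoidHom = (hur i).toMonoidHom.comp (κ q) := by
    apply fhom_ext; intro j
    show κ q (hur i (x j)) = hur i (κ q (x j))
    by_cases hj : j < q
    · rw [κ_lt hj, κ_of_mem (hur_mem_Fs h hj)]
    · rw [hur_ne (by omega) (by omega), κ_ge (by omega), map_one]
  exact DFunLike.congr_fun this w

/-- The effect of pushing the strand `q` along `w`. -/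
def IsPush (n q : ℕ) (g : ArtinB n) (w : F) : Prop :=
  (∀ u, κ q (Θ n g u) = κ q u) ∧ ∃ v, Θ n g (x q) = v * x q * v⁻¹ ∧ κ q v = (κ q w)⁻¹

theorem IsPush.mul {q : ℕ} {g g' : ArtinB n} {w w' : F} (h : IsPush n q g w)
    (h' : IsPush n q g' w') :
    IsPush n q (g * g') (w * w') := by
  obtain ⟨h1, v, h2, h3⟩ := h
  obtain ⟨h1', v', h2', h3'⟩ := h'
  refine ⟨fun u => by rw [map_mul, MulAut.mul_apply, h1, h1'], Θ n g v' * v, ?_, ?_⟩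
  · rw [map_mul, MulAut.mul_apply, h2', map_mul, map_mul, h2, map_inv]; group
  · rw [map_mul, h1, h3, h3', map_mul, mul_inv_rev]

theorem IsPush.inv {q : ℕ} {g : ArtinB n} {w : F} (h : IsPush n q g w) : IsPush n q g⁻¹ w⁻¹ := by
  obtain ⟨h1, v, h2, h3⟩ := h
  have h1' : ∀ u, κ q (Θ n g⁻¹ u) = κ q u := fun u => by
    rw [← h1, ← MulAut.mul_apply, ← map_mul, mul_inv_cancel, map_one, MulAut.one_apply]
  refine ⟨h1', Θ n g⁻¹ v⁻¹, ?_, ?_⟩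
  · rw [map_inv, autInv_eq_iff, ← map_inv (Θ n)]
    simp only [map_mul, map_inv, MulAut.apply_inv_self, h2]
    group
  · rw [h1', map_inv, h3, map_inv]

theorem isPush_A {p q : ℕ} (h : p < q) (hq : q < n) : IsPush n q (A n p q) (x p) := by
  obtain ⟨m, rfl⟩ : ∃ m, q = p + m + 1 := ⟨q - p - 1, by omega⟩
  clear h
  induction m generalizing p with
  | zero =>
    rw [add_zero] at *
    rw [A_last hq]
    refine ⟨fun u => ?_, (x (p + 1))⁻¹ * (x p)⁻¹, ?_, ?_⟩
    · have : (κ (p + 1)).comp (Θ n (s n p ^ 2)).toMonoidHom = κ (p + 1) := by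
        apply fhom_ext; intro j
        show κ (p + 1) (Θ n (s n p ^ 2) (x j)) = κ (p + 1) (x j)
        rw [map_pow, Θ_s hq, pow_two, MulAut.mul_apply]
        by_cases e1 : j = p
        · subst e1
          rw [hur_self, hur_succ]; simp [κ_ge]
        by_cases e2 : j = p + 1
        · subst e2
          rw [hur_succ]; simp [hur_self, hur_succ, κ_ge]
        · rw [hur_ne e1 e2, hur_ne e1 e2]
      exact DFunLike.congr_fun this u
    · rw [map_pow, Θ_s hq, pow_two, MulAut.mul_apply, hur_succ]
      simp only [map_mul, map_inv, hur_self, hur_succ]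
      group
    · simp [κ_ge]
  | succ m ih =>
    have h3 := ih (p := p + 1) (by omega)
    rw [show p + 1 + m + 1 = p + (m + 1) + 1 by omega] at h3
    rw [A_succ (by omega) (by omega)]
    set q := p + (m + 1) + 1 with hqdef
    obtain ⟨h1, v, h2, h3⟩ := h3
    have hs : Θ n (s n p) = hur p := Θ_s (by omega)
    have hκ : ∀ w, κ q ((hur p)⁻¹ w) = (hur p)⁻¹ (κ q w) := fun w => by
      rw [eq_comm, autInv_eq_iff, ← κ_hur (by omega), MulAut.apply_inv_self]
    refine ⟨fun u => ?_, (hur p)⁻¹ v, ?_, ?_⟩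
    · simp only [map_mul, map_inv, MulAut.mul_apply, hs, hκ, h1]
      rw [κ_hur (by omega), MulAut.inv_apply_self]
    · simp only [map_mul, map_inv, MulAut.mul_apply, hs]
      rw [hur_ne (by omega) (by omega), h2]
      simp only [map_mul, map_inv]
      rw [show (hur p)⁻¹ (x q) = x q by rw [autInv_eq_iff, hur_ne] <;> omega]
    · rw [hκ, h3, map_inv, κ_lt (by omega), κ_lt (by omega), inv_inj, autInv_eq_iff, hur_self]

theorem isPush_jh {q : ℕ} (hq : q < n) {w : F} (hw : w ∈ Fs q) :
    IsPush n q (jh n q (ι q w)) w := by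
  induction hw using Subgroup.closure_induction with
  | mem g h => obtain ⟨i, hi, rfl⟩ := h; exact isPush_A hi hq
  | one => rw [map_one, map_one]; exact ⟨by simp, 1, by simp, by simp⟩
  | mul a b _ _ ha hb => rw [map_mul, map_mul]; exact ha.mul hb
  | inv a _ ha => rw [map_inv, map_inv]; exact ha.inv

theorem PA_zero : PA n 0 = ⊥ := by
  rw [eq_bot_iff]
  refine (Subgroup.closure_le _).2 ?_
  rintro _ ⟨p, q, h1, h2, rfl⟩
  omega

theorem κ_eq_one_of_conj {q : ℕ} {v : F} (h : v * x q * v⁻¹ = x q) : κ q v = 1 := by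
  rw [eq_zpow_of_commute (expo q) (by rw [expo_of]; simp) (mul_inv_eq_iff_eq_mul.1 h).symm,
    map_zpow,
    κ_ge le_rfl, one_zpow]

theorem PA_faithful {m : ℕ} (hm : m < n) {g : ArtinB n} (hg : g ∈ PA n m)
    (h : ∀ i ≤ m, Θ n g (x i) = x i) : g = 1 := by
  induction m generalizing g with
  | zero => rwa [PA_zero, Subgroup.mem_bot] at hg
  | succ m ih =>
    obtain ⟨w, hw, u, hu, rfl⟩ := PA_comb hm.le hg
    have hu' := PA_le_Hs (show m < n by omega) hu
    obtain ⟨h1, v, h2, h3⟩ := isPush_jh hm hw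
    have hu1 : u = 1 := by
      refine ih (by omega) hu fun i hi => ?_
      have h4 : Θ n u (x i) ∈ Fs (m + 1) := Θ_Hs_mem (by omega) (by omega) hu' (x_mem_Fs (by omega))
      have h5 := congrArg (κ (m + 1)) (h i (by omega))
      rwa [map_mul, MulAut.mul_apply, h1, κ_of_mem h4, κ_lt (by omega)] at h5
    have h4 := h (m + 1) le_rfl
    rw [hu1, mul_one, h2] at h4
    have h5 := κ_eq_one_of_conj h4
    rw [h3, inv_eq_one, κ_of_mem hw] at h5
    rw [hu1, h5, map_one, map_one, mul_one]

theorem mem_P_of_fix {g : ArtinB n} (h : ∀ i < n, Θ n g (x i) = x i) : g ∈ P n := by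
  rw [mem_P]
  ext ⟨i, hi⟩
  obtain ⟨v, -, h1⟩ := Θ_x g i hi
  rw [h i hi] at h1
  by_contra hne
  rw [Equiv.Perm.one_apply] at hne
  have h2 := congrArg (expo i) h1
  rw [map_mul, map_mul, map_inv, mul_inv_cancel_comm, x, expo_of, x, expo_of, if_pos rfl,
    if_neg hne] at h2
  exact absurd (congrArg Multiplicative.toAdd h2) (by simp)

theorem P_comb (hn : 0 < n) {g : ArtinB n} (hg : g ∈ P n) :
    ∃ w ∈ Fs n, ∃ u ∈ PA n (n - 1), g = ι n w * u := by
  rw [P_eq_PA] at hg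
  obtain _ | m := n
  · omega
  obtain ⟨w, hw, u, hu, rfl⟩ := PA_comb le_rfl hg
  exact ⟨w, hw, u, hu, by rw [jh_self]⟩

theorem pr_of_mem_PA (hn : 0 < n) {u : ArtinB n} (hu : u ∈ PA n (n - 1)) : pr n u = u :=
  pr_of_mem_Hs (m := n - 1) (by omega) (PA_le_Hs (by omega) hu)

theorem mem_PA_of_pr (hn : 0 < n) {g : ArtinB n} (hg : g ∈ P n) (h : pr n g = g) :
    g ∈ PA n (n - 1) := by
  obtain ⟨w, hw, u, hu, rfl⟩ := P_comb hn hg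
  rw [map_mul, pr_ι, one_mul, pr_of_mem_PA hn hu] at h
  rwa [← h]

theorem braid_faithful (hn : 0 < n) {g : ArtinB n} (hp : pr n g = g)
    (h : ∀ i < n, Θ n g (x i) = x i) : g = 1 :=
  PA_faithful (m := n - 1) (by omega) (mem_PA_of_pr hn (mem_P_of_fix h) hp)
    fun i hi => h i (by omega)

theorem Θ_fix {g : ArtinB n} (h : ∀ i < n, Θ n g (x i) = x i) {w : F} (hw : w ∈ Fs n) :
    Θ n g w = w :=
  Fs_eqOn (f := (Θ n g).toMonoidHom) (g := MonoidHom.id F) h hw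

theorem exists_zpow_of_fix (hn : 0 < n) {g : ArtinB n} (h : ∀ i < n, Θ n g (x i) = x i) :
    ∃ k : ℤ, g = ΔB n ^ k := by
  obtain ⟨w, hw, u, hu, rfl⟩ := P_comb hn (mem_P_of_fix h)
  obtain ⟨m, rfl⟩ : ∃ m, n = m + 1 := ⟨n - 1, by omega⟩
  set c := cp 0 (m + 1) with hc
  have hcm : c ∈ Fs (m + 1) := by simpa using cp_mem 0 (m + 1)
  have hc1 := Θ_fix h hcm
  have hpu := pr_of_mem_PA hn hu
  rw [map_mul, MulAut.mul_apply, ← hpu, Θ_pr_cp, Θ_ι hw, MulAut.conj_apply, ← hc] at hc1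
  have hexp : expo 0 c = Multiplicative.ofAdd 1 := by
    have : ∀ k, expo 0 (cp 1 k) = 1 := by
      intro k
      induction k with
      | zero => simp [cp_zero]
      | succ k ih => rw [cp_succ, map_mul, ih, x, expo_of, if_neg (by omega)]; rfl
    rw [hc, cp_succ', map_mul, this, x, expo_of]; rfl
  have hwc := eq_zpow_of_commute (expo 0) hexp (mul_inv_eq_iff_eq_mul.1 hc1).symm
  generalize (Multiplicative.toAdd (expo 0 w)) = e at hwc
  refine ⟨e, ?_⟩
  have hcomm : Commute (ι (m + 1) c) (tw (m + 1) 0 m) := by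
    have h1 := ι_Θ (tw (m + 1) 0 m) c
    rw [← pr_tw (n := m + 1) (a := 0) (m := m) (by omega), Θ_pr_cp,
      pr_tw (n := m + 1) (a := 0) (m := m) (by omega)] at h1
    exact eq_mul_inv_iff_mul_eq.1 h1
  have hΔ : ΔB (m + 1) ^ e = ι (m + 1) w * tw (m + 1) 0 m ^ e := by
    rw [ΔB_eq, ← hc, hcomm.mul_zpow, hwc, map_zpow]
  have hone : u⁻¹ * tw (m + 1) 0 m ^ e = 1 := by
    apply braid_faithful hn
    · rw [map_mul, map_inv, map_zpow, hpu, pr_tw (by omega)]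
    · intro i hi
      have e1 : u⁻¹ * tw (m + 1) 0 m ^ e = (ι (m + 1) w * u)⁻¹ * ΔB (m + 1) ^ e := by rw [hΔ]; group
      have e2 : Θ (m + 1) (ΔB (m + 1) ^ e) (x i) = x i := by
        have : ΔB (m + 1) ∈ (MulAction.stabilizer (MulAut F) (x i)).comap (Θ (m + 1)) := Θ_ΔB hi
        exact zpow_mem this e
      rw [e1, map_mul, MulAut.mul_apply, e2, map_inv, autInv_eq_iff, h i hi]
  rw [hΔ, eq_of_inv_mul_eq_one hone]

theorem isBSeq_wt (n : ℕ) : IsBSeq n fun i => if i + 1 = n then Multiplicative.ofAdd (1 : ℤ)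
    else 1 where
  braid i h := by simp [show ¬ i + 1 = n by omega, show ¬ i + 1 + 1 = n by omega]
  braid4 i h := by split_ifs <;> simp [mul_comm]
  comm i j _ _ := mul_comm _ _

/-- The exponent sum of the last generator. -/
noncomputable def wt (n : ℕ) : ArtinB n →* Multiplicative ℤ := liftB _ (isBSeq_wt n)

theorem wt_lt {i : ℕ} (h : i + 1 < n) : wt n (s n i) = 1 := by
  rw [wt, liftB_s _ _ (by omega)]; simp [show ¬ i + 1 = n by omega]

theorem wt_last {i : ℕ} (h : i + 1 = n) : wt n (s n i) = Multiplicative.ofAdd 1 := by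
  rw [wt, liftB_s _ _ (by omega)]; simp [h]

theorem wt_ρB (hn : 0 < n) : wt n (ρB n) = Multiplicative.ofAdd 1 := by
  obtain ⟨m, rfl⟩ : ∃ m, n = m + 1 := ⟨n - 1, by omega⟩
  rw [ρB_eq_blk, blk_succ, map_mul, wt_last (by omega)]
  have : ∀ k ≤ m, wt (m + 1) (blk (m + 1) 0 k) = 1 := by
    intro k
    induction k with
    | zero => simp [blk]
    | succ k ih => intro hk; rw [blk_succ, map_mul, ih (by omega), wt_lt (by omega), one_mul]
  rw [this m le_rfl, one_mul]

theorem wt_ΔB (hn : 0 < n) (k : ℤ) : (wt n (ΔB n ^ k)).toAdd = n * k := by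
  rw [map_zpow, ΔB, map_pow, wt_ρB hn]; simp [mul_comm]

theorem ΔB_central (g : ArtinB n) : ΔB n * g = g * ΔB n := by
  obtain rfl | hn := Nat.eq_zero_or_pos n
  · simp [ΔB]
  have h : ∀ i < n, Θ n (ΔB n * g * (ΔB n)⁻¹ * g⁻¹) (x i) = x i := by
    intro i hi
    have h1 : ∀ w ∈ Fs n, Θ n (ΔB n) w = w := fun w hw => Θ_fix (fun i hi => Θ_ΔB hi) hw
    have h2 : ∀ w ∈ Fs n, (Θ n (ΔB n))⁻¹ w = w := fun w hw => by rw [autInv_eq_iff, h1 w hw]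
    have h3 : (Θ n g)⁻¹ (x i) ∈ Fs n := by rw [← map_inv]; exact Θ_mem_Fs _ (x_mem_Fs hi)
    simp only [map_mul, map_inv, MulAut.mul_apply]
    rw [h2 _ h3, MulAut.apply_inv_self, h1 _ (x_mem_Fs hi)]
  obtain ⟨k, hk⟩ := exists_zpow_of_fix hn h
  have h4 := congrArg (fun g => (wt n g).toAdd) hk
  simp only [wt_ΔB hn] at h4
  simp only [map_mul, map_inv, toAdd_mul, toAdd_inv] at h4
  have h5 : k = 0 := by
    have : (n : ℤ) * k = 0 := by rw [← h4]; ring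
    rcases mul_eq_zero.1 this with h | h
    · omega
    · exact h
  rw [h5, zpow_zero] at hk
  exact mul_inv_eq_iff_eq_mul.1 (mul_inv_eq_one.1 hk)

theorem exists_zpow_of_central (hn : 0 < n) {z : ArtinB n} (h : ∀ g, z * g = g * z) :
    ∃ k : ℤ, z = ΔB n ^ k := by
  refine exists_zpow_of_fix hn fun i hi => ?_
  have h1 := ι_Θ z (x i)
  rw [h, mul_inv_cancel_right, ← mul_inv_eq_one, ← map_inv, ← map_mul] at h1
  exact mul_inv_eq_one.1 (ι_injOn (mul_mem (Θ_mem_Fs _ (x_mem_Fs hi)) (inv_mem (x_mem_Fs hi))) h1)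

theorem zpow_ΔB_injective (hn : 0 < n) {k l : ℤ} (h : ΔB n ^ k = ΔB n ^ l) : k = l := by
  have := congrArg (fun g => (wt n g).toAdd) h
  simp only [wt_ΔB hn] at this
  exact mul_left_cancel₀ (by exact_mod_cast hn.ne') this

end BnAux

namespace BnAux

/-! ### Braid sequences in finite groups -/

section Count

variable {H : Type*} [Group H]

/-- A sequence satisfying the braid relations. -/
structure IsBraid (S : ℕ → H) (m : ℕ) : Prop where
  braid : ∀ i, i + 1 < m → S i * S (i + 1) * S i = S (i + 1) * S i * S (i + 1)
  comm : ∀ i j, i + 2 ≤ j → j < m → S i * S j = S j * S i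

/-- The half twists. -/
def ht (S : ℕ → H) : ℕ → ℕ → H
  | p, 0 => S p
  | p, k + 1 => (S p)⁻¹ * ht S (p + 1) k * S p

variable {S : ℕ → H} {m : ℕ}

theorem ht_succ (p k : ℕ) : ht S p (k + 1) = (S p)⁻¹ * ht S (p + 1) k * S p := rfl

namespace IsBraid

theorem conj_eq (hS : IsBraid S m) {i : ℕ} (h : i + 1 < m) :
    S (i + 1) * S i * (S (i + 1))⁻¹ = (S i)⁻¹ * S (i + 1) * S i := by
  rw [mul_inv_eq_iff_eq_mul, mul_assoc, mul_assoc, eq_inv_mul_iff_mul_eq, ← mul_assoc,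
    hS.braid i h, mul_assoc]

theorem eq_of_comm (hS : IsBraid S m) {i : ℕ} (h : i + 1 < m)
    (hc : S i * S (i + 1) = S (i + 1) * S i) : S i = S (i + 1) := by
  have := hS.braid i h
  rw [hc, mul_assoc, mul_assoc] at this
  have := mul_left_cancel this
  rw [hc] at this
  exact mul_right_cancel this

theorem triv (hS : IsBraid S m) {i : ℕ} (h : i + 1 < m) (he : S i = S (i + 1)) : S 0 = S 1 := by
  induction i with
  | zero => exact he
  | succ i ih =>
    refine ih (by omega) (hS.eq_of_comm (by omega) ?_)
    rw [he]; exact hS.comm i (i + 2) le_rfl (by omega)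

theorem all_eq (hS : IsBraid S m) (h : S 0 = S 1) {i : ℕ} (hi : i < m) : S i = S 0 := by
  suffices ∀ i, i + 1 < m → S i = S 0 ∧ S (i + 1) = S 0 by
    obtain _ | i := i
    · rfl
    · exact (this i hi).2
  intro i
  induction i with
  | zero => intro _; exact ⟨rfl, h.symm⟩
  | succ i ih =>
    intro hi
    obtain ⟨h1, h2⟩ := ih (by omega)
    refine ⟨h2, ?_⟩
    rw [← h2, eq_comm]
    refine hS.eq_of_comm hi ?_
    rw [h2, ← h1]; exact hS.comm i (i + 2) le_rfl hi

theorem ht_comm_lt (hS : IsBraid S m) {p k i : ℕ} (hpk : p + k < m) (h : i + 1 < p) :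
    Commute (S i) (ht S p k) := by
  induction k generalizing p with
  | zero => exact hS.comm i p (by omega) (by omega)
  | succ k ih =>
    have : Commute (S i) (S p) := hS.comm i p (by omega) (by omega)
    exact (this.inv_right.mul_right (ih (by omega) (by omega))).mul_right this

theorem ht_comm_gt (hS : IsBraid S m) {p k i : ℕ} (hi : i < m) (h : p + k + 1 < i) :
    Commute (S i) (ht S p k) := by
  induction k generalizing p with
  | zero => exact (hS.comm p i (by omega) (by omega)).symm
  | succ k ih =>
    have : Commute (S i) (S p) := (hS.comm p i (by omega) (by omega)).symm
    exact (this.inv_right.mul_right (ih (by omega))).mul_right this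

theorem ht_comm_mid (hS : IsBraid S m) {p k i : ℕ} (hpk : p + k < m) (h : p < i) (hi : i < p + k) :
    Commute (S i) (ht S p k) := by
  induction k generalizing p with
  | zero => omega
  | succ k ih =>
    by_cases e : i = p + 1
    · subst e
      obtain _ | k := k
      · omega
      have h1 := hS.ht_comm_lt (p := p + 2) (k := k) (i := p) (by omega) (by omega)
      rw [ht_succ, ht_succ]
      have hb := hS.braid p (by omega)
      generalize ht S (p + 1 + 1) k = t at *
      have h1 : S p * t = t * S p := h1
      show _ * _ = _ * _
      generalize S p = a at *
      generalize S (p + 1) = b at *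
      have e1 : b * a⁻¹ * b⁻¹ = a⁻¹ * b⁻¹ * a := by
        rw [mul_inv_eq_iff_eq_mul, mul_assoc, mul_assoc, eq_inv_mul_iff_mul_eq,
          eq_inv_mul_iff_mul_eq,
          ← mul_assoc, ← mul_assoc, mul_inv_eq_iff_eq_mul, hb]
      calc b * (a⁻¹ * (b⁻¹ * t * b) * a) = (b * a⁻¹ * b⁻¹) * t * b * a := by group
        _ = a⁻¹ * b⁻¹ * (a * t) * b * a := by rw [e1]; group
        _ = a⁻¹ * b⁻¹ * t * (a * b * a) := by rw [h1]; group
        _ = _ := by rw [hb]; group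
    · have : Commute (S i) (S p) := (hS.comm p i (by omega) (by omega)).symm
      exact (this.inv_right.mul_right (ih (by omega) (by omega) (by omega))).mul_right this

theorem ht_up (hS : IsBraid S m) {p k : ℕ} (h : p + k + 1 < m) :
    S (p + k + 1) * ht S p k * (S (p + k + 1))⁻¹ = ht S p (k + 1) := by
  induction k generalizing p with
  | zero => exact hS.conj_eq h
  | succ k ih =>
    have h1 : S (p + (k + 1) + 1) * S p = S p * S (p + (k + 1) + 1) :=
      (hS.comm p _ (by omega) h).symm
    have h2 := ih (p := p + 1) (by omega)
    rw [show p + 1 + k + 1 = p + (k + 1) + 1 by omega] at h2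
    rw [ht_succ, ht_succ p (k + 1), ← h2]
    generalize S (p + (k + 1) + 1) = b at *
    generalize S p = a at *
    have h3 : b * a⁻¹ = a⁻¹ * b := (Commute.inv_right h1).eq
    have h4 : b⁻¹ * a = a * b⁻¹ := (Commute.inv_left h1).eq
    calc _ = (b * a⁻¹) * ht S (p + 1) k * (a * b⁻¹) := by group
      _ = _ := by rw [h3, ← h4]; group

theorem triv_right (hS : IsBraid S m) {p k : ℕ} (h : p + k + 1 < m)
    (he : ht S p k = ht S p (k + 1)) : S 0 = S 1 := by
  induction k generalizing p with
  | zero =>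
    refine hS.triv h ?_
    have : S p = (S p)⁻¹ * S (p + 1) * S p := he
    rw [mul_assoc, eq_inv_mul_iff_mul_eq] at this
    exact mul_right_cancel this
  | succ k ih =>
    rw [ht_succ, ht_succ p (k + 1)] at he
    exact ih (p := p + 1) (by omega) (mul_left_cancel (mul_right_cancel he))

theorem triv_left (hS : IsBraid S m) {p k : ℕ} (h : p + k + 1 < m)
    (he : ht S (p + 1) k = ht S p (k + 1)) : S 0 = S 1 := by
  induction k generalizing p with
  | zero =>
    refine hS.triv h (hS.eq_of_comm h ?_)
    have : S (p + 1) = (S p)⁻¹ * S (p + 1) * S p := he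
    rwa [mul_assoc, eq_inv_mul_iff_mul_eq] at this
  | succ k ih =>
    have h1 := hS.ht_up (p := p + 1) (k := k) (by omega)
    have h2 := hS.ht_up (p := p) (k := k + 1) (by omega)
    rw [← h1, ← h2, show p + 1 + k + 1 = p + (k + 1) + 1 by omega] at he
    exact ih (by omega) (mul_left_cancel (mul_right_cancel he))

theorem triv_of_comm (hS : IsBraid S m) {p k i : ℕ} (hpk : p + k < m) (hi : i < m)
    (h : (i = p ∧ k ≠ 0) ∨ i + 1 = p ∨ i = p + k + 1 ∨ (i = p + k ∧ k ≠ 0))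
    (hc : Commute (S i) (ht S p k)) : S 0 = S 1 := by
  have hc' := hc.eq
  rcases h with ⟨rfl, hk⟩ | rfl | rfl | ⟨rfl, hk⟩
  · obtain ⟨k, rfl⟩ := Nat.exists_eq_succ_of_ne_zero hk
    refine hS.triv_left (p := i) (k := k) hpk ?_
    rw [Nat.succ_eq_add_one] at hc'
    have h1 := ht_succ (S := S) i k
    have : ht S (i + 1) k = S i * ht S i (k + 1) * (S i)⁻¹ := by rw [h1]; group
    rw [this, hc', mul_inv_cancel_right]
  · refine hS.triv_left (p := i) (k := k) (by omega) ?_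
    rw [ht_succ, mul_assoc, eq_inv_mul_iff_mul_eq, hc']
  · refine hS.triv_right (p := p) (k := k) hi ?_
    rw [← hS.ht_up hi, hc', mul_inv_cancel_right]
  · obtain ⟨k, rfl⟩ := Nat.exists_eq_succ_of_ne_zero hk
    refine hS.triv_right (p := p) (k := k) hpk ?_
    rw [Nat.succ_eq_add_one] at hc'
    have h1 := hS.ht_up (p := p) (k := k) hpk
    rw [show p + (k + 1) = p + k + 1 by omega] at hc'
    have : ht S p k = (S (p + k + 1))⁻¹ * ht S p (k + 1) * S (p + k + 1) := by rw [← h1]; group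
    rw [this, mul_assoc, ← hc', inv_mul_cancel_left]

theorem ht_inj (hS : IsBraid S m) (hm : m = 2 ∨ 4 ≤ m) (h01 : S 0 ≠ S 1) {p k p' k' : ℕ}
    (h : p + k < m) (h' : p' + k' < m) (he : ht S p k = ht S p' k') : p = p' ∧ k = k' := by
  have key : ∀ {p k p' k' : ℕ}, p + k < m → p' + k' < m → ht S p k = ht S p' k' → ∀ i < m,
      ((i = p ∧ k ≠ 0) ∨ i + 1 = p ∨ i = p + k + 1 ∨ (i = p + k ∧ k ≠ 0)) →
      ((i = p' ∧ k' ≠ 0) ∨ i + 1 = p' ∨ i = p' + k' + 1 ∨ (i = p' + k' ∧ k' ≠ 0)) := by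
    intro p k p' k' h h' he i hi h1
    by_contra h2
    refine h01 (hS.triv_of_comm h hi h1 ?_)
    rw [he]
    by_cases c1 : i + 1 < p'
    · exact hS.ht_comm_lt h' c1
    by_cases c2 : p' + k' + 1 < i
    · exact hS.ht_comm_gt hi c2
    by_cases c3 : p' < i ∧ i < p' + k'
    · exact hS.ht_comm_mid h' c3.1 c3.2
    · obtain ⟨rfl, rfl⟩ : i = p' ∧ k' = 0 := by omega
      exact Commute.refl _
  have hodd : ∀ i < m, ((i = p ∨ i = p + k + 1) ↔ (i = p' ∨ i = p' + k' + 1)) ↔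
      ((i + 1 = p ∨ i + 1 = p + k + 1) ↔ (i + 1 = p' ∨ i + 1 = p' + k' + 1)) := by
    intro i hi
    have h1 := key h h' he i hi
    have h2 := key h' h he.symm i hi
    clear key he hS h01
    by_cases a1 : i = p <;> by_cases a2 : i = p + k + 1 <;> by_cases a3 : i = p' <;>
      by_cases a4 : i = p' + k' + 1 <;> by_cases a5 : i + 1 = p <;>
      by_cases a6 : i + 1 = p + k + 1 <;> by_cases a7 : i + 1 = p' <;>
      by_cases a8 : i + 1 = p' + k' + 1 <;> first | (exfalso; omega) |
        simp only [a1, a2, a3, a4, a5, a6, a7, a8, or_true, true_or, or_self, iff_self, iff_true,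
          true_iff] <;> omega
  have hall : ∀ i ≤ m, ((i = p ∨ i = p + k + 1) ↔ (i = p' ∨ i = p' + k' + 1)) ↔
      ((0 = p ∨ 0 = p + k + 1) ↔ (0 = p' ∨ 0 = p' + k' + 1)) := by
    intro i
    induction i with
    | zero => intro _; rfl
    | succ i ih => intro hi; exact (hodd i hi).symm.trans (ih (by omega))
  clear hodd key he hS h01
  by_cases c : ((0 = p ∨ 0 = p + k + 1) ↔ (0 = p' ∨ 0 = p' + k' + 1))
  · have h1 := (hall p (by omega)).2 c
    have h2 := (hall (p + k + 1) (by omega)).2 c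
    have h3 := (hall p' (by omega)).2 c
    have h4 := (hall (p' + k' + 1) (by omega)).2 c
    omega
  · have h1 := mt (hall 1 (by omega)).1 c
    have h2 := mt (hall 2 (by omega)).1 c
    rcases hm with rfl | hm
    · omega
    · have h3 := mt (hall 3 (by omega)).1 c
      have h4 := mt (hall 4 (by omega)).1 c
      omega

end IsBraid

end Count

section Count

variable {H : Type*} [Group H] {S : ℕ → H} {m : ℕ}

theorem IsBraid.conj_succ (hS : IsBraid S m) {i : ℕ} (h : i + 1 < m) :
    S (i + 1) = S i * S (i + 1) * S i * (S i * S (i + 1))⁻¹ := by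
  rw [eq_mul_inv_iff_mul_eq, ← mul_assoc, hS.braid i h]

theorem IsBraid.exists_conj (hS : IsBraid S m) {K : Subgroup H} {a : ℕ}
    (hK : ∀ i, a ≤ i → i < m → S i ∈ K) {p : ℕ} (hp : a ≤ p) (hpm : p < m) :
    ∃ g ∈ K, S p = g * S a * g⁻¹ := by
  induction p, hp using Nat.le_induction with
  | base => exact ⟨1, one_mem _, by simp⟩
  | succ p hp ih =>
    obtain ⟨g, hg, e⟩ := ih (by omega)
    refine ⟨S p * S (p + 1) * g, mul_mem (mul_mem (hK _ hp (by omega)) (hK _ (by omega) hpm)) hg,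
      ?_⟩
    calc S (p + 1) = S p * S (p + 1) * S p * (S p * S (p + 1))⁻¹ := hS.conj_succ hpm
      _ = S p * S (p + 1) * (g * S a * g⁻¹) * (S p * S (p + 1))⁻¹ := by rw [← e]
      _ = _ := by group

theorem IsBraid.exists_conj_ht (hS : IsBraid S m) {K : Subgroup H} {a : ℕ}
    (hK : ∀ i, a ≤ i → i < m → S i ∈ K) {p k : ℕ} (hp : a ≤ p) (hpm : p + k < m) :
    ∃ g ∈ K, ht S p k = g * S a * g⁻¹ := by
  induction k generalizing p with
  | zero => exact hS.exists_conj hK hp hpm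
  | succ k ih =>
    obtain ⟨g, hg, e⟩ := ih (p := p + 1) (by omega) (by omega)
    refine ⟨(S p)⁻¹ * g, mul_mem (inv_mem (hK _ hp (by omega))) hg, ?_⟩
    rw [ht_succ, e]; group

theorem IsBraid.count [Finite H] (hS : IsBraid S m) (hm : m = 2 ∨ 4 ≤ m) (h01 : S 0 ≠ S 1)
    {K D : Subgroup H} {a : ℕ} (hK : ∀ i, a ≤ i → i < m → S i ∈ K) (hDK : D ≤ K)
    (hD : ∀ d ∈ D, d * S a = S a * d) :
    (m - a) * (m - a + 1) * Nat.card D ≤ 2 * Nat.card K := by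
  have hex : ∀ j : Fin (m - a), ∀ k : Fin (j + 1), ∃ g ∈ K,
      ht S (m - 1 - j) k = g * S a * g⁻¹ := fun j k =>
    hS.exists_conj_ht hK (by omega) (by omega)
  choose g hgK hg using hex
  let f : (Σ j : Fin (m - a), Fin (j + 1)) × D → K := fun q =>
    ⟨g q.1.1 q.1.2 * q.2, mul_mem (hgK _ _) (hDK q.2.2)⟩
  have hf : Function.Injective f := by
    rintro ⟨⟨j, k⟩, d, hd⟩ ⟨⟨j', k'⟩, d', hd'⟩ h
    have h : g j k * d = g j' k' * d' := congrArg Subtype.val h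
    have e : ∀ (j : Fin (m - a)) (k : Fin (j + 1)) (d : H), d ∈ D →
        ht S (m - 1 - j) k = (g j k * d) * S a * (g j k * d)⁻¹ := by
      intro j k d hd
      rw [hg, mul_inv_rev, mul_assoc _ d, hD d hd]; group
    have := e j k d hd
    rw [h, ← e j' k' d' hd'] at this
    obtain ⟨h1, h2⟩ := hS.ht_inj hm h01 (by omega) (by omega) this
    obtain rfl : j = j' := Fin.ext (by omega)
    obtain rfl : k = k' := Fin.ext h2
    obtain rfl := mul_left_cancel h
    rfl
  have h1 := Nat.card_le_card_of_injective f hf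
  rw [Nat.card_prod, Nat.card_eq_fintype_card, Fintype.card_sigma] at h1
  simp only [Fintype.card_fin] at h1
  rw [Fin.sum_univ_eq_sum_range (fun i => i + 1)] at h1
  have h2 : ∀ r : ℕ, (∑ i ∈ Finset.range r, (i + 1)) * 2 = r * (r + 1) := by
    intro r
    induction r with
    | zero => rfl
    | succ r ih => rw [Finset.sum_range_succ, add_mul, ih]; ring
  rw [← h2]
  nlinarith

theorem IsBraid.swap (hS : IsBraid S m) {i : ℕ} (h : i + 2 < m) :
    SemiconjBy (S (i + 1) * S i * S (i + 2) * S (i + 1)) (S i) (S (i + 2)) ∧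
    SemiconjBy (S (i + 1) * S i * S (i + 2) * S (i + 1)) (S (i + 2)) (S i) := by
  have h1 := hS.braid i (by omega)
  have h2 := hS.braid (i + 1) h
  have h3 := hS.comm i (i + 2) le_rfl h
  rw [show i + 1 + 1 = i + 2 from rfl] at h2
  unfold SemiconjBy
  generalize S i = a at *
  generalize S (i + 1) = b at *
  generalize S (i + 2) = c at *
  constructor
  · calc b * a * c * b * a = b * (a * c) * b * a := by group
      _ = b * c * (a * b * a) := by rw [h3]; group
      _ = (b * c * b) * a * b := by rw [h1]; group
      _ = c * b * (c * a) * b := by rw [h2]; group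
      _ = _ := by rw [← h3]; group
  · calc b * a * c * b * c = b * a * (c * b * c) := by group
      _ = (b * a * b) * c * b := by rw [← h2]; group
      _ = _ := by rw [← h1]; group

theorem IsBraid.not_mem_of_five (hS : IsBraid S 5) (h01 : S 0 ≠ S 1) (j k : ℤ) :
    S 4 ≠ S 0 ^ j * S 2 ^ k := by
  intro h4
  have c : ∀ i j, i + 2 ≤ j → j < 5 → Commute (S i) (S j) := hS.comm
  obtain ⟨w1, w2⟩ := hS.swap (i := 0) (by omega)
  obtain ⟨v1, v2⟩ := hS.swap (i := 2) (by omega)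
  simp only [zero_add, Nat.reduceAdd] at w1 w2 v1 v2
  have w4 : Commute (S 1 * S 0 * S 2 * S 1) (S 4) :=
    (((c 1 4 (by omega) (by omega)).mul_left (c 0 4 (by omega) (by omega))).mul_left
      (c 2 4 (by omega) (by omega))).mul_left (c 1 4 (by omega) (by omega))
  have v0 : Commute (S 3 * S 2 * S 4 * S 3) (S 0) :=
    ((((c 0 3 (by omega) (by omega)).mul_right (c 0 2 (by omega) (by omega))).mul_right
      (c 0 4 (by omega) (by omega))).mul_right (c 0 3 (by omega) (by omega))).symm
  set w := S 1 * S 0 * S 2 * S 1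
  set v := S 3 * S 2 * S 4 * S 3
  have cc {x g y : H} (h : SemiconjBy g x y) : y = g * x * g⁻¹ := (mul_inv_eq_of_eq_mul h).symm
  let Z := Subgroup.centralizer (S '' Set.Iio 5)
  have hZ {z : H} : z ∈ Z ↔ ∀ i < 5, Commute (S i) z := by
    simp [Z, Subgroup.mem_centralizer_iff, Commute, SemiconjBy]
  have hZc {z : H} (hz : z ∈ Z) : Commute w z := by
    have := hZ.1 hz
    exact (((this 1 (by omega)).mul_left (this 0 (by omega))).mul_left
      (this 2 (by omega))).mul_left (this 1 (by omega))
  have hZ02 {e : ℤ} (h : S 0 ^ e ∈ Z) : S 2 ^ e ∈ Z := by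
    rw [cc (w1.zpow_right e), (hZc h).eq, mul_inv_cancel_right]; exact h
  have hZ20 {e : ℤ} (h : S 2 ^ e ∈ Z) : S 0 ^ e ∈ Z := by
    rw [cc (w2.zpow_right e), (hZc h).eq, mul_inv_cancel_right]; exact h
  have key : ∀ e : ℤ, Commute (S 0) (S 2 ^ e) → Commute (S 3) (S 2 ^ e) → S 2 ^ e ∈ Z := by
    intro e h0 h3
    have h2 : Commute (S 2) (S 2 ^ e) := Commute.self_zpow _ _
    rw [hZ]
    intro i hi
    interval_cases i
    · exact h0
    · have : SemiconjBy (S 2 * S 3) (S 2) (S 3) := by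
        have := hS.braid 2 (by omega)
        unfold SemiconjBy
        rw [this, mul_assoc]
      have : S 2 ^ e = S 3 ^ e := by
        rw [cc (this.zpow_right e), (h2.mul_left h3).eq, mul_inv_cancel_right]
      rw [this]
      exact (c 1 3 (by omega) (by omega)).zpow_right e
    · exact h2
    · exact h3
    · exact (c 2 4 (by omega) (by omega)).symm.zpow_right e
  have z1 : S 0 ^ (j - k) ∈ Z := by
    have h5 : S 4 = S 2 ^ j * S 0 ^ k := by
      have : S 4 = w * S 4 * w⁻¹ := cc w4
      rw [this, h4, cc (w1.zpow_right j), cc (w2.zpow_right k)]; group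
    have h6 : S 0 ^ (j - k) = S 2 ^ (j - k) := by
      have h02 := ((c 0 2 (by omega) (by omega)).zpow_zpow k k).eq
      rw [zpow_sub, zpow_sub]
      rw [h4] at h5
      have h7 : S 2 ^ j = S 0 ^ j * S 2 ^ k * (S 0 ^ k)⁻¹ := by rw [h5]; group
      have h8 : (S 2 ^ k) * (S 0 ^ k)⁻¹ = (S 0 ^ k)⁻¹ * (S 2 ^ k) := by
        exact ((c 0 2 (by omega) (by omega)).zpow_zpow k k).symm.inv_right.eq
      rw [h7, mul_assoc (S 0 ^ j), h8]; group
    refine hZ20 (key _ ?_ ?_)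
    · rw [← h6]; exact Commute.self_zpow _ _
    · rw [← h6]; exact (c 0 3 (by omega) (by omega)).symm.zpow_right _
  have h4' : S 4 = S 0 ^ (j - k) * (S 0 ^ k * S 2 ^ k) := by
    rw [h4, ← mul_assoc, ← zpow_add, sub_add_cancel]
  have z2' : S 2 ^ (1 - k * k) = (S 0 ^ (j - k)) ^ (k + 1) * S 0 ^ (k + k * k) := by
    have e1 : S 2 = S 0 ^ (j - k) * (S 0 ^ k * S 4 ^ k) := by
      have : S 4 = S 0 ^ (j - k) * (S 0 ^ k * S 2 ^ k) := h4'
      have e0 (e : ℤ) : v * S 0 ^ e * v⁻¹ = S 0 ^ e := (cc (v0.zpow_right e)).symm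
      calc S 2 = v * S 4 * v⁻¹ := cc v2
        _ = v * (S 0 ^ (j - k) * (S 0 ^ k * S 2 ^ k)) * v⁻¹ := by rw [← this]
        _ = (v * S 0 ^ (j - k) * v⁻¹) * (v * S 0 ^ k * v⁻¹) * (v * S 2 ^ k * v⁻¹) := by group
        _ = _ := by rw [e0, e0, ← cc (v1.zpow_right k), mul_assoc]
    have c02 := c 0 2 (by omega) (by omega)
    have e2 : S 4 ^ k = (S 0 ^ j) ^ k * (S 2 ^ k) ^ k := by
      rw [h4]; exact (c02.zpow_zpow j k).mul_zpow k
    have e3 : S 2 = S 0 ^ (j - k) * S 0 ^ k * (S 0 ^ j) ^ k * (S 2 ^ k) ^ k := by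
      conv_lhs => rw [e1, e2]
      simp only [mul_assoc]
    rw [sub_eq_add_neg, zpow_add, zpow_one, zpow_neg, zpow_mul, mul_inv_eq_iff_eq_mul]
    conv_lhs => rw [e3]
    congr 1
    simp only [← zpow_mul, ← zpow_add]
    congr 1; ring
  have z2 : S 2 ^ (1 - k * k) ∈ Z := by
    have := hZ.1 (zpow_mem z1 (k + 1))
    refine key _ ?_ ?_
    · rw [z2']; exact (this 0 (by omega)).mul_right (Commute.self_zpow _ _)
    · rw [z2']
      exact (this 3 (by omega)).mul_right ((c 0 3 (by omega) (by omega)).symm.zpow_right _)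
  have z3 : S 0 ^ (k + k * k) ∈ Z := by
    have : S 0 ^ (k + k * k) = ((S 0 ^ (j - k)) ^ (k + 1))⁻¹ * S 2 ^ (1 - k * k) := by
      rw [z2', inv_mul_cancel_left]
    rw [this]; exact mul_mem (inv_mem (zpow_mem z1 _)) z2
  have z4 : S 0 ^ (k + 1) ∈ Z := by
    have : S 0 ^ (k + 1) = S 0 ^ (k + k * k) * S 0 ^ (1 - k * k) := by
      rw [← zpow_add]; congr 1; ring
    rw [this]; exact mul_mem z3 (hZ20 z2)
  have h5 : S 4 * (S 0 * S 2) ∈ Z := by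
    have : S 4 * (S 0 * S 2) = S 0 ^ (j - k) * (S 0 ^ (k + 1) * S 2 ^ (k + 1)) := by
      have c02 := ((c 0 2 (by omega) (by omega)).zpow_right k).symm
      rw [h4', zpow_add_one, zpow_add_one]
      calc _ = S 0 ^ (j - k) * (S 0 ^ k * (S 2 ^ k * S 0) * S 2) := by group
        _ = _ := by rw [c02.eq]; group
    rw [this]; exact mul_mem z1 (mul_mem z4 (hZ02 z4))
  have h6 : Commute (S 1) (S 0 * S 2) := by
    have h7 := (hZ.1 h5) 1 (by omega)
    have h8 := (c 1 4 (by omega) (by omega)).inv_right.mul_right h7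
    rwa [inv_mul_cancel_left] at h8
  have h7 : ht S 0 1 = ht S 1 1 := by
    have h8 := hS.ht_up (p := 1) (k := 0) (by omega)
    rw [← h8]
    show (S 0)⁻¹ * S 1 * S 0 = S 2 * S 1 * (S 2)⁻¹
    rw [eq_mul_inv_iff_mul_eq]
    calc (S 0)⁻¹ * S 1 * S 0 * S 2 = (S 0)⁻¹ * (S 1 * (S 0 * S 2)) := by group
      _ = _ := by rw [h6.eq]; group
  have := (hS.ht_inj (by omega) h01 (by omega) (by omega) h7).1
  omega

theorem two_mul_card_le [Finite H] {A B : Subgroup H} (h : A ≤ B) {b : H} (hb : b ∈ B)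
    (hA : b ∉ A) : 2 * Nat.card A ≤ Nat.card B := by
  obtain ⟨c, hc⟩ := Subgroup.card_dvd_of_le h
  have hB : 0 < Nat.card B := Nat.card_pos
  have : c ≠ 1 := by
    rintro rfl
    have := Subgroup.eq_of_le_of_card_ge h (by omega)
    exact hA (this ▸ hb)
  have : c ≠ 0 := by rintro rfl; omega
  have : 2 ≤ c := by omega
  rw [hc, mul_comm]
  exact Nat.mul_le_mul_left _ this

theorem IsBraid.card_five [Finite H] (hS : IsBraid S 5) (h01 : S 0 ≠ S 1) :
    24 * orderOf (S 0) ≤ Nat.card (Subgroup.centralizer {S 0}) := by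
  have c : ∀ i j, i + 2 ≤ j → j < 5 → S i * S j = S j * S i := hS.comm
  let D2 := Subgroup.closure {S 0, S 2}
  let D := Subgroup.closure {S 0, S 2, S 4}
  have m1 : S 2 ∉ Subgroup.zpowers (S 0) := by
    rintro ⟨j, hj⟩
    refine h01 (hS.triv (i := 2) (by omega) (hS.eq_of_comm (by omega) ?_))
    rw [← hj]
    have h03 : Commute (S 0) (S 3) := c 0 3 (by omega) (by omega)
    exact (h03.zpow_left j).eq
  have m2 : S 4 ∉ D2 := by
    intro h
    have : ∃ j k : ℤ, S 4 = S 0 ^ j * S 2 ^ k := by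
      generalize S 4 = y at h
      induction h using Subgroup.closure_induction with
      | mem x hx =>
        rcases hx with rfl | rfl
        · exact ⟨1, 0, by simp⟩
        · exact ⟨0, 1, by simp⟩
      | one => exact ⟨0, 0, by simp⟩
      | mul x y _ _ hx hy =>
        obtain ⟨j, k, rfl⟩ := hx
        obtain ⟨j', k', rfl⟩ := hy
        refine ⟨j + j', k + k', ?_⟩
        have h02 : Commute (S 0) (S 2) := c 0 2 (by omega) (by omega)
        have := (h02.zpow_zpow j' k).eq
        calc _ = S 0 ^ j * (S 2 ^ k * S 0 ^ j') * S 2 ^ k' := by group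
          _ = _ := by rw [← this]; group
      | inv x _ hx =>
        obtain ⟨j, k, rfl⟩ := hx
        refine ⟨-j, -k, ?_⟩
        have h02 : Commute (S 0) (S 2) := c 0 2 (by omega) (by omega)
        have := (h02.zpow_zpow (-j) (-k)).eq
        rw [this]; group
    obtain ⟨j, k, e⟩ := this
    exact hS.not_mem_of_five h01 j k e
  have l1 : 2 * Nat.card (Subgroup.zpowers (S 0)) ≤ Nat.card D2 :=
    two_mul_card_le (by rw [Subgroup.zpowers_le]; exact Subgroup.subset_closure (by simp))
      (Subgroup.subset_closure (by simp)) m1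
  have l2 : 2 * Nat.card D2 ≤ Nat.card D :=
    two_mul_card_le (Subgroup.closure_mono (by intro x; simp; tauto))
      (Subgroup.subset_closure (by simp)) m2
  have l3 := hS.count (by omega) h01 (a := 2) (K := Subgroup.centralizer {S 0}) (D := D)
    (fun i hi h => by
      rw [Subgroup.mem_centralizer_singleton_iff]; exact (c 0 i hi h).symm)
    ((Subgroup.closure_le _).2 (by
      rintro x (rfl | rfl | rfl) <;>
        simp only [SetLike.mem_coe, Subgroup.mem_centralizer_singleton_iff]
      · exact (c 0 2 (by omega) (by omega)).symm
      · exact (c 0 4 (by omega) (by omega)).symm))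
    (fun d hd => by
      have : D ≤ Subgroup.centralizer {S 2} := (Subgroup.closure_le _).2 (by
        rintro x (rfl | rfl | rfl) <;>
          simp only [SetLike.mem_coe, Subgroup.mem_centralizer_singleton_iff]
        · exact c 0 2 (by omega) (by omega)
        · exact (c 2 4 (by omega) (by omega)).symm)
      exact Subgroup.mem_centralizer_singleton_iff.1 (this hd))
  rw [Nat.card_zpowers] at l1
  omega

end Count

open Nat in
theorem IsBraid.bound {m : ℕ} : ∀ {H : Type*} [Group H] [Finite H] {S : ℕ → H},
    IsBraid S m → (m = 2 ∨ 4 ≤ m) → S 0 ≠ S 1 → (m + 1)! * orderOf (S 0) ≤ 2 * Nat.card H := by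
  induction m using Nat.strong_induction_on with
  | _ m ih =>
  intro H _ _ S hS hm h01
  have c : ∀ i j, i + 2 ≤ j → j < m → S i * S j = S j * S i := hS.comm
  by_cases h2 : m = 2
  · subst h2
    have := hS.count hm h01 (a := 0) (K := ⊤) (D := Subgroup.zpowers (S 0))
      (fun _ _ _ => trivial) le_top (fun d hd => by
        obtain ⟨j, rfl⟩ := hd
        exact (Commute.self_zpow (S 0) j).symm)
    rw [Nat.card_zpowers, Subgroup.card_top] at this
    simpa [Nat.factorial] using this
  obtain ⟨q, rfl⟩ : ∃ q, m = q + 2 := ⟨m - 2, by omega⟩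
  have hC := hS.count hm h01 (a := 0) (K := ⊤) (D := Subgroup.centralizer {S 0})
      (fun _ _ _ => trivial) le_top (fun d hd => Subgroup.mem_centralizer_singleton_iff.1 hd)
  rw [Subgroup.card_top] at hC
  suffices (q + 1)! * orderOf (S 0) ≤ Nat.card (Subgroup.centralizer {S 0}) by
    rw [Nat.factorial_succ, Nat.factorial_succ]
    simp only [Nat.sub_zero] at hC
    have h3 := Nat.mul_le_mul_left ((q + 2) * (q + 2 + 1)) this
    calc _ = (q + 2) * (q + 2 + 1) * ((q + 1)! * orderOf (S 0)) := by ring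
      _ ≤ _ := h3.trans hC
  by_cases h5 : q = 3
  · subst h5
    exact hS.card_five h01
  let C := Subgroup.centralizer {S 0}
  have hSC : ∀ i, i < q → S (i + 2) ∈ C := fun i hi =>
    Subgroup.mem_centralizer_singleton_iff.2 (c 0 (i + 2) (by omega) (by omega)).symm
  let N : Subgroup C := (Subgroup.zpowers (S 0)).subgroupOf C
  have hN : N.Normal := by
    refine ⟨fun a ha g => ?_⟩
    obtain ⟨j, hj⟩ := ha
    refine ⟨j, ?_⟩
    have h1 : Commute (S 0) (g : H) :=
      (Subgroup.mem_centralizer_singleton_iff.1 g.2).symm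
    show _ = (g : H) * a * (g : H)⁻¹
    have hj : S 0 ^ j = (a : H) := hj
    rw [← hj, eq_mul_inv_iff_mul_eq]
    exact (h1.zpow_left j).eq
  let S' : ℕ → C ⧸ N := fun i => if h : i < q then QuotientGroup.mk' N ⟨S (i + 2), hSC i h⟩ else 1
  have hS'e : ∀ i (h : i < q), S' i = QuotientGroup.mk' N ⟨S (i + 2), hSC i h⟩ :=
    fun i h => dif_pos h
  have hS' : IsBraid S' q := by
    constructor
    · intro i hi
      rw [hS'e i (by omega), hS'e (i + 1) hi]
      simp only [← map_mul]
      congr 1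
      exact Subtype.ext (hS.braid (i + 2) (by omega))
    · intro i j hij hj
      rw [hS'e i (by omega), hS'e j hj]
      simp only [← map_mul]
      congr 1
      exact Subtype.ext (c _ _ (by omega) (by omega))
  have hne : S' 0 ≠ S' 1 := by
    rw [hS'e 0 (by omega), hS'e 1 (by omega), Ne, QuotientGroup.mk'_apply, QuotientGroup.mk'_apply,
      QuotientGroup.eq]
    rintro ⟨j, hj⟩
    have hj : S 0 ^ j = (S 2)⁻¹ * S 3 := hj
    refine h01 (hS.triv (i := 2) (by omega) (hS.eq_of_comm (by omega) ?_))
    have h3 : S 3 = S 2 * S 0 ^ j := by rw [hj, mul_inv_cancel_left]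
    have h02 : Commute (S 0) (S 2) := c 0 2 (by omega) (by omega)
    have h4 : Commute (S 2) (S 0 ^ j) := h02.symm.zpow_right j
    show Commute (S 2) (S 3)
    rw [h3]
    exact (Commute.refl _).mul_right h4
  have hb := ih q (by omega) hS' (by omega) hne
  have ho : 2 ≤ orderOf (S' 0) := by
    have h0 : 0 < orderOf (S' 0) := orderOf_pos _
    have : orderOf (S' 0) ≠ 1 := by
      rw [Ne, orderOf_eq_one_iff]
      intro h
      have h1 := hS'.conj_succ (i := 0) (by omega)
      rw [zero_add, h, mul_one, mul_inv_cancel] at h1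
      exact hne (h.trans h1.symm)
    omega
  have hcard : Nat.card C = Nat.card (C ⧸ N) * orderOf (S 0) := by
    rw [Subgroup.card_eq_card_quotient_mul_card_subgroup N]
    congr 1
    rw [← Nat.card_zpowers]
    refine Nat.card_congr (Subgroup.subgroupOfEquivOfLe ?_).toEquiv
    rw [Subgroup.zpowers_le]
    exact Subgroup.mem_centralizer_singleton_iff.2 rfl
  show _ ≤ Nat.card C
  rw [hcard]
  have : (q + 1)! ≤ Nat.card (C ⧸ N) := by
    have := Nat.mul_le_mul_left (q + 1)! ho
    omega
  exact Nat.mul_le_mul_right _ this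

end BnAux

namespace BnAux

open FreeGroup (of)
open FreeGroupAux

variable {n : ℕ}

theorem perm_eq_one (hn : 4 ≤ n) (p : Equiv.Perm (Fin n))
    (h : ∀ i (hi : i + 2 < n), p * Equiv.swap ⟨i, by omega⟩ ⟨i + 1, by omega⟩ =
      Equiv.swap ⟨i, by omega⟩ ⟨i + 1, by omega⟩ * p) : p = 1 := by
  have key : ∀ i (hi : i + 2 < n),
      ((p ⟨i, by omega⟩ : ℕ) = i ∨ (p ⟨i, by omega⟩ : ℕ) = i + 1) ∧
      ((p ⟨i + 1, by omega⟩ : ℕ) = i ∨ (p ⟨i + 1, by omega⟩ : ℕ) = i + 1) := by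
    intro i hi
    have h0 := h i hi
    set a : Fin n := ⟨i, by omega⟩ with ha
    set b : Fin n := ⟨i + 1, by omega⟩ with hb
    have hab : a ≠ b := by simp [ha, hb]
    have h1 : p b = Equiv.swap a b (p a) := by
      have := congrArg (fun q : Equiv.Perm (Fin n) => q a) h0
      simpa using this
    have h2 : p a = a ∨ p a = b := by
      by_contra hc
      rw [not_or] at hc
      rw [Equiv.swap_apply_of_ne_of_ne hc.1 hc.2] at h1
      exact hab (p.injective h1.symm)
    rcases h2 with h2 | h2
    · rw [h2, Equiv.swap_apply_left] at h1
      rw [h1, h2]; simp [ha, hb]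
    · rw [h2, Equiv.swap_apply_right] at h1
      rw [h1, h2]; simp [ha, hb]
  have inj : ∀ i j (hi : i < n) (hj : j < n), (p ⟨i, hi⟩ : ℕ) = p ⟨j, hj⟩ → i = j := by
    intro i j hi hj e
    simpa using p.injective (Fin.ext e)
  have hmid : ∀ i (hi : i + 2 < n), 1 ≤ i → (p ⟨i, by omega⟩ : ℕ) = i := by
    intro i hi h1
    obtain ⟨i, rfl⟩ : ∃ j, i = j + 1 := ⟨i - 1, by omega⟩
    have h1 := key i (by omega)
    have h2 := key (i + 1) hi
    omega
  have h0 : (p ⟨0, by omega⟩ : ℕ) = 0 := by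
    have h1 := key 0 (by omega)
    have h2 := hmid 1 (by omega) le_rfl
    have h3 := inj 0 1 (by omega) (by omega)
    omega
  have hlow : ∀ i (hi : i + 1 < n), (p ⟨i, by omega⟩ : ℕ) = i := by
    intro i hi
    by_cases h1 : i = 0
    · subst h1; exact h0
    by_cases h2 : i + 2 < n
    · exact hmid i h2 (by omega)
    · obtain ⟨i, rfl⟩ : ∃ j, i = j + 1 := ⟨i - 1, by omega⟩
      have h3 := key i (by omega)
      have h4 := hmid i (by omega) (by omega)
      have h5 := inj i (i + 1) (by omega) (by omega)
      omega
  refine Equiv.ext fun i => Fin.ext ?_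
  show (p i : ℕ) = i
  by_cases hi : i.1 + 1 < n
  · exact hlow i.1 hi
  · by_contra hne
    have h1 := (p i).2
    have h2 := hlow (p i) (by omega)
    have h3 := inj (p i) i (p i).2 i.2 h2
    exact hne h3

theorem σ_surjective (hn : 0 < n) : Function.Surjective (σ n) := by
  obtain ⟨m, rfl⟩ : ∃ m, n = m + 1 := ⟨n - 1, by omega⟩
  intro p
  have hp : p ∈ Submonoid.closure (Set.range fun i : Fin m => Equiv.swap i.castSucc i.succ) := by
    rw [Equiv.Perm.mclosure_swap_castSucc_succ]; trivial
  suffices Submonoid.closure (Set.range fun i : Fin m => Equiv.swap i.castSucc i.succ) ≤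
      MonoidHom.mrange (σ (m + 1)) from this hp
  rw [Submonoid.closure_le]
  rintro _ ⟨i, rfl⟩
  exact ⟨s (m + 1) i, σ_s (by omega)⟩

theorem le_ker_of_surjective (hn : 5 ≤ n) (f : ArtinB n →* Equiv.Perm (Fin n))
    (hf : Function.Surjective f) : P n ≤ f.ker := by
  let S : ℕ → Equiv.Perm (Fin n) := fun i => f (s n i)
  have hS : IsBraid S (n - 1) := by
    constructor
    · intro i hi
      simp only [S, ← map_mul]
      rw [braid (by omega)]
    · intro i j hij hj
      simp only [S, ← map_mul]
      rw [s_comm hij]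
  have h01 : S 0 ≠ S 1 := by
    intro h
    have hall : ∀ i, i + 1 < n → f (s n i) = f (s n 0) := fun i hi => hS.all_eq h (by omega)
    have h0 : ∀ g, Commute (f (s n 0)) (f g) := by
      intro g
      refine induction_s (p := fun g => Commute (f (s n 0)) (f g)) ?_ ?_ ?_ ?_ g
      · rw [map_one]; exact Commute.one_right _
      · intro i hi
        by_cases h1 : i + 1 < n
        · rw [hall i h1]
        · show _ * _ = _ * _
          rw [← map_mul, ← map_mul, s_comm (by omega)]
      · intro a b ha hb; rw [map_mul]; exact ha.mul_right hb
      · intro a ha; rw [map_inv]; exact ha.inv_right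
    have h1 : ∀ g, Commute (f (s n (n - 1))) (f g) := by
      intro g
      refine induction_s (p := fun g => Commute (f (s n (n - 1))) (f g)) ?_ ?_ ?_ ?_ g
      · rw [map_one]; exact Commute.one_right _
      · intro i hi
        by_cases h1 : i + 1 < n
        · rw [hall i h1]; exact (h0 _).symm
        · rw [show i = n - 1 by omega]
      · intro a b ha hb; rw [map_mul]; exact ha.mul_right hb
      · intro a ha; rw [map_inv]; exact ha.inv_right
    have h2 : ∀ g h, Commute (f h) (f g) := by
      intro g h
      refine induction_s (p := fun h => Commute (f h) (f g)) ?_ ?_ ?_ ?_ h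
      · rw [map_one]; exact Commute.one_left _
      · intro i hi
        by_cases h3 : i + 1 < n
        · rw [hall i h3]; exact h0 g
        · rw [show i = n - 1 by omega]; exact h1 g
      · intro a b ha hb; rw [map_mul]; exact ha.mul_left hb
      · intro a ha; rw [map_inv]; exact ha.inv_left
    obtain ⟨a, ha⟩ := hf (Equiv.swap ⟨0, by omega⟩ ⟨1, by omega⟩)
    obtain ⟨b, hb⟩ := hf (Equiv.swap ⟨1, by omega⟩ ⟨2, by omega⟩)
    have h3 := (h2 a b).eq
    rw [ha, hb] at h3
    have h4 := congrArg (fun q : Equiv.Perm (Fin n) => q ⟨0, by omega⟩) h3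
    simp [Equiv.swap_apply_def] at h4
  have hcard : Nat.card (Equiv.Perm (Fin n)) = n.factorial := by
    rw [Nat.card_eq_fintype_card, Fintype.card_perm, Fintype.card_fin]
  have hn1 : n - 1 + 1 = n := by omega
  have hb := hS.bound (by omega) h01
  rw [hcard, hn1, mul_comm 2] at hb
  have hord : orderOf (S 0) ≤ 2 := Nat.le_of_mul_le_mul_left hb (Nat.factorial_pos n)
  have hord2 : ∀ {H : Type} [Group H] [Finite H] {S : ℕ → H}, IsBraid S (n - 1) → S 0 ≠ S 1 →
      2 ≤ orderOf (S 0) := by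
    intro H _ _ S hS h01
    have h0 : 0 < orderOf (S 0) := orderOf_pos _
    have : orderOf (S 0) ≠ 1 := by
      rw [Ne, orderOf_eq_one_iff]
      intro h
      have h1 := hS.conj_succ (i := 0) (by omega)
      rw [zero_add, h, mul_one, mul_inv_cancel] at h1
      exact h01 (h.trans h1.symm)
    omega
  have hsq0 : S 0 * S 0 = 1 := by
    rw [← pow_two, ← le_antisymm hord (hord2 hS h01), pow_orderOf_eq_one]
  have hsq : ∀ i, i + 1 < n → S i * S i = 1 := by
    intro i hi
    obtain ⟨g, -, e⟩ := hS.exists_conj (K := ⊤) (a := 0) (fun _ _ _ => trivial) (Nat.zero_le i)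
      (by omega)
    rw [e]
    calc _ = g * (S 0 * S 0) * g⁻¹ := by group
      _ = 1 := by rw [hsq0]; group
  let K := (f.comp (pr n)).range
  have hSK : ∀ i, i + 1 < n → S i ∈ K := fun i hi => ⟨s n i, by simp [pr_s hi, S]⟩
  have hK : K = ⊤ := by
    let S' : ℕ → K := fun i => if h : i + 1 < n then ⟨S i, hSK i h⟩ else 1
    have hS'e : ∀ i (h : i + 1 < n), S' i = ⟨S i, hSK i h⟩ := fun i h => dif_pos h
    have hS' : IsBraid S' (n - 1) := by
      constructor
      · intro i hi
        rw [hS'e i (by omega), hS'e (i + 1) (by omega)]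
        exact Subtype.ext (hS.braid i hi)
      · intro i j hij hj
        rw [hS'e i (by omega), hS'e j (by omega)]
        exact Subtype.ext (hS.comm i j hij hj)
    have h01' : S' 0 ≠ S' 1 := by
      rw [hS'e 0 (by omega), hS'e 1 (by omega)]
      exact fun h => h01 (congrArg Subtype.val h)
    have hb := hS'.bound (by omega) h01'
    rw [hn1] at hb
    have h2 := Nat.mul_le_mul_left n.factorial (hord2 hS' h01')
    refine Subgroup.eq_top_of_le_card _ ?_
    rw [hcard]
    omega
  have hPle : P n ≤ (f.comp (pr n)).ker := by
    refine P_le_of_normal (fun i hi => ?_) (fun i hi => ?_)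
    · rw [MonoidHom.mem_ker, MonoidHom.comp_apply, map_mul, pr_s hi, map_mul]
      exact hsq i hi
    · rw [MonoidHom.mem_ker, MonoidHom.comp_apply, pr_last hi, map_one]
  have hPeq : (f.comp (pr n)).ker ≤ P n := by
    have h1 : (f.comp (pr n)).ker.index = n.factorial := by
      rw [Subgroup.index_ker, show (f.comp (pr n)).range = ⊤ from hK, ← hcard]
      exact Nat.card_congr Subgroup.topEquiv.toEquiv
    have h2 : (P n).index = n.factorial := by
      rw [P, Subgroup.index_ker, MonoidHom.range_eq_top.2 (σ_surjective (by omega)), ← hcard]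
      exact Nat.card_congr Subgroup.topEquiv.toEquiv
    have h3 := Subgroup.relIndex_mul_index hPle
    rw [h1, h2] at h3
    have : (P n).relIndex (f.comp (pr n)).ker = 1 := by
      have := Nat.factorial_pos n
      exact Nat.eq_of_mul_eq_mul_right this (by rw [h3, one_mul])
    exact Subgroup.relIndex_eq_one.1 this
  have ht : f (s n (n - 1)) = 1 := by
    obtain ⟨g, hg⟩ : f (s n (n - 1)) ∈ K := hK ▸ trivial
    rw [MonoidHom.comp_apply] at hg
    have hσ : σ n g = 1 := by
      refine perm_eq_one (by omega) _ fun i hi => ?_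
      have h1 : g * s n i * (s n i * g)⁻¹ ∈ (f.comp (pr n)).ker := by
        have h0 : f (pr n (g * s n i)) = f (pr n (s n i * g)) := by
          rw [map_mul, map_mul, map_mul, map_mul, hg, pr_s (i := i) (by omega), ← map_mul,
            ← map_mul, s_comm (show i + 2 ≤ n - 1 by omega)]
        rw [MonoidHom.mem_ker, MonoidHom.comp_apply, map_mul, map_inv, map_mul, map_inv, h0,
          mul_inv_cancel]
      have h2 := mem_P.1 (hPeq h1)
      rw [map_mul, map_inv, mul_inv_eq_one, map_mul, map_mul, σ_s (i := i) (by omega)] at h2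
      exact h2
    rw [← hg]
    exact hPle (mem_P.2 hσ)
  refine P_le_of_normal (fun i hi => ?_) (fun i hi => ?_)
  · rw [MonoidHom.mem_ker, map_mul]; exact hsq i hi
  · rw [MonoidHom.mem_ker, show i = n - 1 by omega]; exact ht

theorem aut_mem_P (hn : 5 ≤ n) (φ : MulAut (ArtinB n)) {g : ArtinB n} (hg : g ∈ P n) :
    φ g ∈ P n :=
  le_ker_of_surjective hn ((σ n).comp φ.toMonoidHom)
    ((σ_surjective (by omega)).comp φ.surjective) hg

/-! ### Relations between the pure generators -/

theorem hur_symm_succ (i : ℕ) : (hur i)⁻¹ (x (i + 1)) = x i := by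
  rw [autInv_eq_iff, hur_self]

theorem hur_symm_self (i : ℕ) : (hur i)⁻¹ (x i) = x i * x (i + 1) * (x i)⁻¹ := by
  rw [autInv_eq_iff, map_mul, map_mul, map_inv, hur_self, hur_succ]; group

theorem hur_symm_ne {i j : ℕ} (h1 : j ≠ i) (h2 : j ≠ i + 1) : (hur i)⁻¹ (x j) = x j := by
  rw [autInv_eq_iff, hur_ne h1 h2]

theorem Θ_A {p k : ℕ} (h : p < k) (hk : k < n) :
    Θ n (A n p k) (x p) = (x p * x k)⁻¹ * x p * (x p * x k) ∧
    Θ n (A n p k) (x k) = (x p * x k)⁻¹ * x k * (x p * x k) ∧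
    (∀ q, p < q → q < k → Θ n (A n p k) (x q) =
      ((x k)⁻¹ * (x p)⁻¹ * x k * x p) * x q * ((x k)⁻¹ * (x p)⁻¹ * x k * x p)⁻¹) ∧
    ∀ i, i < p ∨ k < i → Θ n (A n p k) (x i) = x i := by
  obtain ⟨m, rfl⟩ : ∃ m, k = p + 1 + m := ⟨k - p - 1, by omega⟩
  clear h
  induction m generalizing p with
  | zero =>
    rw [add_zero] at *
    have e : ∀ w, Θ n (A n p (p + 1)) w = hur p (hur p w) := by
      intro w; rw [A_last hk, map_pow, Θ_s hk, pow_two]; rfl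
    refine ⟨?_, ?_, fun q h1 h2 => by omega, fun i hi => ?_⟩
    · rw [e, hur_self, hur_succ]; group
    · rw [e, hur_succ, map_mul, map_mul, map_inv, hur_self, hur_succ]; group
    · rw [e, hur_ne, hur_ne] <;> omega
  | succ m ih =>
    obtain ⟨h1, h2, h3, h4⟩ := ih (p := p + 1) (by omega)
    rw [show p + 1 + 1 + m = p + 1 + (m + 1) by omega] at h1 h2 h3 h4
    generalize hkk : p + 1 + (m + 1) = k at *
    have e : ∀ w, Θ n (A n p k) w = (hur p)⁻¹ (Θ n (A n (p + 1) k) (hur p w)) := by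
      intro w
      rw [A_succ (by omega) (by omega), map_mul, map_mul, map_inv, Θ_s (by omega)]; rfl
    have hk' : (hur p)⁻¹ (x k) = x k := hur_symm_ne (by omega) (by omega)
    refine ⟨?_, ?_, fun q hq1 hq2 => ?_, fun i hi => ?_⟩
    · rw [e, hur_self, h1]
      simp only [map_mul, map_inv, hk', hur_symm_succ]
    · rw [e, hur_ne (by omega) (by omega), h2]
      simp only [map_mul, map_inv, hk', hur_symm_succ]
    · by_cases hq : q = p + 1
      · subst hq
        rw [e, hur_succ]
        simp only [map_mul, map_inv, h4 p (Or.inl (by omega)), hur_symm_self, h1, hk',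
          hur_symm_succ]
        group
      · rw [e, hur_ne (by omega) hq, h3 q (by omega) hq2]
        simp only [map_mul, map_inv, hur_symm_ne (show q ≠ p by omega) hq, hk', hur_symm_succ]
    · rw [e, hur_ne (by omega) (by omega), h4 i (by omega), hur_symm_ne (by omega) (by omega)]

theorem A_conj_jh {p q k : ℕ} (hp : p < q) (hq : q < k) (hk : k ≤ n) (w : F) :
    A n p q * jh n k (ι k w) * (A n p q)⁻¹ = jh n k (ι k (Θ k (A k p q) w)) := by
  have := jh_ι_conj (n := n) k (A k p q) w
  rwa [jh_A hp hq hk] at this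

/-- The pure generators, indexed symmetrically. -/
noncomputable def AA (n i j : ℕ) : ArtinB n := A n (min i j) (max i j)

theorem AA_symm (i j : ℕ) : AA n i j = AA n j i := by rw [AA, AA, min_comm, max_comm]

theorem AA_of_lt {i j : ℕ} (h : i < j) : AA n i j = A n i j := by
  rw [AA, min_eq_left h.le, max_eq_right h.le]

theorem A_tri {p q k : ℕ} (hp : p < q) (hq : q < k) (hk : k ≤ n) :
    Commute (A n p k * A n q k * A n p q) (A n p k) ∧
    Commute (A n p k * A n q k * A n p q) (A n q k) := by
  obtain ⟨h1, h2, -, -⟩ := Θ_A (n := k) hp hq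
  have e1 := A_conj_jh hp hq hk (x p)
  have e2 := A_conj_jh hp hq hk (x q)
  rw [h1] at e1
  rw [h2] at e2
  simp only [map_mul, map_inv] at e1 e2
  change A n p q * A n p k * _ = (A n p k * A n q k)⁻¹ * A n p k * (A n p k * A n q k) at e1
  change A n p q * A n q k * _ = (A n p k * A n q k)⁻¹ * A n q k * (A n p k * A n q k) at e2
  constructor
  · calc A n p k * A n q k * A n p q * A n p k
        = A n p k * A n q k * (A n p q * A n p k * (A n p q)⁻¹) * A n p q := by group
      _ = _ := by rw [e1]; group
  · calc A n p k * A n q k * A n p q * A n q k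
        = A n p k * A n q k * (A n p q * A n q k * (A n p q)⁻¹) * A n p q := by group
      _ = _ := by rw [e2]; group

theorem A_comm_of_fix {p q i k : ℕ} (hp : p < q) (hq : q < k) (hk : k ≤ n) (hi : i < p ∨ q < i) :
    Commute (A n p q) (A n i k) := by
  obtain ⟨-, -, -, h⟩ := Θ_A (n := k) hp hq
  have e := A_conj_jh hp hq hk (x i)
  rw [h i hi] at e
  exact mul_inv_eq_iff_eq_mul.1 e

theorem A_cross {p q k l : ℕ} (hp : p < q) (hq : q < k) (hk : k < l) (hl : l ≤ n) :
    ∃ w ∈ Subgroup.closure {A n p l, A n k l},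
      A n p k * A n q l * (A n p k)⁻¹ = w * A n q l * w⁻¹ := by
  obtain ⟨-, -, h, -⟩ := Θ_A (n := l) (hp.trans hq) hk
  have e := h q hp hq
  have e1 := A_conj_jh (hp.trans hq) hk hl (x q)
  rw [e] at e1
  simp only [map_mul, map_inv] at e1
  have a1 : A n p l ∈ Subgroup.closure {A n p l, A n k l} := Subgroup.subset_closure (by simp)
  have a2 : A n k l ∈ Subgroup.closure {A n p l, A n k l} := Subgroup.subset_closure (by simp)
  exact ⟨(A n k l)⁻¹ * (A n p l)⁻¹ * A n k l * A n p l,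
    mul_mem (mul_mem (mul_mem (inv_mem a2) (inv_mem a1)) a2) a1, e1⟩

/-- The cyclic order on the natural numbers. -/
def Cyc (i j k : ℕ) : Prop := (i < j ∧ j < k) ∨ (j < k ∧ k < i) ∨ (k < i ∧ i < j)

/-- Families satisfying the relations between the pure generators. -/
structure IsPureSys {G : Type*} [Group G] (n : ℕ) (a : ℕ → ℕ → G) : Prop where
  symm : ∀ i j, a i j = a j i
  tri : ∀ i j k, i ≤ n → j ≤ n → k ≤ n → Cyc i j k → Commute (a i k * a j k * a i j) (a i k) ∧
    Commute (a i k * a j k * a i j) (a j k)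
  comm : ∀ i j k l, i ≤ n → j ≤ n → k ≤ n → l ≤ n → Cyc i j k → Cyc i k l →
    Commute (a i j) (a k l)
  cross : ∀ i j k l, i ≤ n → j ≤ n → k ≤ n → l ≤ n → Cyc i j k → Cyc i k l →
    ∃ w ∈ Subgroup.closure {a i j, a j k, a k l, a l i},
      Commute (w * a i k) (a j l) ∨ Commute (w * a j l) (a i k)

theorem Cyc.four {i j k l : ℕ} (h1 : Cyc i j k) (h2 : Cyc i k l) :
    (i < j ∧ j < k ∧ k < l) ∨ (j < k ∧ k < l ∧ l < i) ∨ (k < l ∧ l < i ∧ i < j) ∨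
      (l < i ∧ i < j ∧ j < k) := by
  unfold Cyc at h1 h2; omega

theorem isPureSys_AA : IsPureSys n (AA n) where
  symm := AA_symm
  tri := by
    have key : ∀ p q k, p < q → q < k → k ≤ n →
        Commute (AA n p k * AA n q k * AA n p q) (AA n p k) ∧
        Commute (AA n p k * AA n q k * AA n p q) (AA n q k) ∧
        Commute (AA n p k * AA n q k * AA n p q) (AA n p q) := by
      intro p q k h1 h2 h3
      rw [AA_of_lt (h1.trans h2), AA_of_lt h1, AA_of_lt h2]
      obtain ⟨e1, e2⟩ := A_tri h1 h2 h3
      refine ⟨e1, e2, ?_⟩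
      have := ((e1.mul_right e2).inv_right).mul_right (Commute.refl _)
      rwa [inv_mul_cancel_left] at this
    intro i j k hi hj hk h
    rcases h with ⟨h1, h2⟩ | ⟨h1, h2⟩ | ⟨h1, h2⟩
    · obtain ⟨e1, e2, -⟩ := key i j k h1 h2 hk
      exact ⟨e1, e2⟩
    · obtain ⟨e1, e2, e3⟩ := key j k i h1 h2 hi
      have e : AA n i k * AA n j k * AA n i j = AA n j i * AA n k i * AA n j k := by
        have : AA n j i * AA n k i * AA n j k =
            AA n j i * (AA n k i * AA n j k * AA n j i) * (AA n j i)⁻¹ := by group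
        have e4 := e1
        rw [show AA n j i * AA n k i * AA n j k = AA n j i * (AA n k i * AA n j k) by group] at e4
        have e5 : AA n j i * (AA n k i * AA n j k) * AA n j i =
          AA n j i * (AA n j i * (AA n k i * AA n j k)) := e4
        rw [mul_assoc] at e5
        have e6 := mul_left_cancel e5
        rw [AA_symm i k, AA_symm i j, e6, mul_assoc]
      rw [e, AA_symm i k]
      exact ⟨e2, e3⟩
    · obtain ⟨e1, e2, e3⟩ := key k i j h1 h2 hj
      have e : AA n i k * AA n j k * AA n i j = AA n k j * AA n i j * AA n k i := by
        have e5 : AA n k j * AA n i j * AA n k i * AA n k i =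
          AA n k i * (AA n k j * AA n i j * AA n k i) := e3
        have e6 : AA n k j * AA n i j * AA n k i = AA n k i * AA n k j * AA n i j := by
          apply mul_right_cancel (b := AA n k i)
          rw [e5]; group
        rw [e6, AA_symm i k, AA_symm j k]
      rw [e, AA_symm i k, AA_symm j k]
      exact ⟨e3, e1⟩
  comm := by
    have key : ∀ p q k l, p < q → q < k → k < l → l ≤ n →
        Commute (AA n p q) (AA n k l) ∧ Commute (AA n q k) (AA n p l) := by
      intro p q k l h1 h2 h3 h4
      rw [AA_of_lt h1, AA_of_lt h2, AA_of_lt h3, AA_of_lt (by omega)]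
      exact ⟨A_comm_of_fix h1 (by omega) h4 (by omega), A_comm_of_fix h2 h3 h4 (by omega)⟩
    intro i j k l hi hj hk hl h1 h2
    rcases h1.four h2 with ⟨h1, h2, h3⟩ | ⟨h1, h2, h3⟩ | ⟨h1, h2, h3⟩ | ⟨h1, h2, h3⟩
    · exact (key _ _ _ _ h1 h2 h3 hl).1
    · rw [AA_symm i]; exact (key _ _ _ _ h1 h2 h3 hi).2.symm
    · exact (key _ _ _ _ h1 h2 h3 hj).1.symm
    · rw [AA_symm k]; exact (key _ _ _ _ h1 h2 h3 hk).2
  cross := by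
    have key : ∀ p q k l, p < q → q < k → k < l → l ≤ n →
        ∃ w ∈ Subgroup.closure {AA n p q, AA n q k, AA n k l, AA n l p},
          Commute (w * AA n p k) (AA n q l) := by
      intro p q k l h1 h2 h3 h4
      rw [AA_symm l, AA_of_lt (show p < l by omega), AA_of_lt h3, AA_of_lt (show p < k by omega),
        AA_of_lt (show q < l by omega)]
      obtain ⟨w, hw, e⟩ := A_cross h1 h2 h3 h4
      refine ⟨w⁻¹, inv_mem (Subgroup.closure_mono ?_ hw), ?_⟩
      · rintro _ (rfl | rfl) <;> simp
      show _ * _ = _ * _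
      rw [mul_inv_eq_iff_eq_mul, mul_assoc w] at e
      rw [mul_assoc, e]; group
    intro i j k l hi hj hk hl h1 h2
    rcases h1.four h2 with ⟨h1, h2, h3⟩ | ⟨h1, h2, h3⟩ | ⟨h1, h2, h3⟩ | ⟨h1, h2, h3⟩
    · obtain ⟨w, hw, e⟩ := key _ _ _ _ h1 h2 h3 hl
      exact ⟨w, hw, Or.inl e⟩
    · obtain ⟨w, hw, e⟩ := key _ _ _ _ h1 h2 h3 hi
      refine ⟨w, ?_, Or.inr ?_⟩
      · convert hw using 2; ext; simp; tauto
      · rwa [AA_symm i]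
    · obtain ⟨w, hw, e⟩ := key _ _ _ _ h1 h2 h3 hj
      refine ⟨w, ?_, Or.inl ?_⟩
      · convert hw using 2; ext; simp; tauto
      · rwa [AA_symm i, AA_symm j]
    · obtain ⟨w, hw, e⟩ := key _ _ _ _ h1 h2 h3 hk
      refine ⟨w, ?_, Or.inr ?_⟩
      · convert hw using 2; ext; simp; tauto
      · rwa [AA_symm j]

/-- The pure generators as elements of the pure subgroup. -/
noncomputable def aP (n i j : ℕ) : P n :=
  if h : i ≠ j ∧ i ≤ n ∧ j ≤ n then ⟨AA n i j, A_mem_P (by omega) (by omega)⟩ else 1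

theorem coe_aP {i j : ℕ} (h : i ≠ j) (hi : i ≤ n) (hj : j ≤ n) : (aP n i j : ArtinB n) =
    AA n i j := by
  rw [aP, dif_pos ⟨h, hi, hj⟩]

theorem isPureSys_aP : IsPureSys n (aP n) where
  symm i j := by
    by_cases h : i ≠ j ∧ i ≤ n ∧ j ≤ n
    · exact Subtype.ext (by
        rw [coe_aP h.1 h.2.1 h.2.2, coe_aP h.1.symm h.2.2 h.2.1, AA_symm])
    · rw [aP, dif_neg h, aP, dif_neg (by tauto)]
  tri i j k hi hj hk h := by
    have := isPureSys_AA.tri i j k hi hj hk h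
    have h' := h
    unfold Cyc at h'
    rw [← coe_aP (n := n) (i := i) (j := j), ← coe_aP (n := n) (i := i) (j := k),
      ← coe_aP (n := n) (i := j) (j := k)] at this <;> try omega
    exact ⟨Subtype.ext this.1, Subtype.ext this.2⟩
  comm i j k l hi hj hk hl h1 h2 := by
    have := isPureSys_AA.comm i j k l hi hj hk hl h1 h2
    have h := h1.four h2
    rw [← coe_aP (n := n) (i := i) (j := j), ← coe_aP (n := n) (i := k) (j := l)] at this <;>
      try omega
    exact Subtype.ext this
  cross i j k l hi hj hk hl h1 h2 := by
    have := isPureSys_AA.cross i j k l hi hj hk hl h1 h2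
    have h := h1.four h2
    rw [← coe_aP (n := n) (i := i) (j := j), ← coe_aP (n := n) (i := k) (j := l),
      ← coe_aP (n := n) (i := j) (j := k), ← coe_aP (n := n) (i := l) (j := i),
      ← coe_aP (n := n) (i := i) (j := k), ← coe_aP (n := n) (i := j) (j := l)] at this <;>
      try omega
    obtain ⟨w, hw, e⟩ := this
    have hw' : w ∈ (Subgroup.closure {aP n i j, aP n j k, aP n k l, aP n l i}).map
        (P n).subtype := by
      rw [MonoidHom.map_closure]
      convert hw using 2
      simp [Set.image_insert_eq]
    obtain ⟨w', hw1, rfl⟩ := hw'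
    exact ⟨w', hw1, e.imp (fun h => Subtype.ext h) (fun h => Subtype.ext h)⟩

theorem IsPureSys.map {G H : Type*} [Group G] [Group H] {a : ℕ → ℕ → G} (ha : IsPureSys n a)
    (f : G →* H) : IsPureSys n fun i j => f (a i j) where
  symm i j := by rw [ha.symm]
  tri i j k hi hj hk h := by
    have := ha.tri i j k hi hj hk h
    simp only [← map_mul]
    exact ⟨this.1.map f, this.2.map f⟩
  comm i j k l hi hj hk hl h1 h2 := (ha.comm i j k l hi hj hk hl h1 h2).map f
  cross i j k l hi hj hk hl h1 h2 := by
    obtain ⟨w, hw, e⟩ := ha.cross i j k l hi hj hk hl h1 h2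
    refine ⟨f w, ?_, ?_⟩
    · have := Subgroup.mem_map_of_mem f hw
      rw [MonoidHom.map_closure] at this
      convert this using 2
      simp [Set.image_insert_eq]
    · simp only [← map_mul]
      exact e.imp (fun h => h.map f) (fun h => h.map f)

theorem closure_aP : Subgroup.closure {g | ∃ i j, i < j ∧ j ≤ n ∧ g = aP n i j} = ⊤ := by
  rw [eq_top_iff]
  rintro ⟨g, hg⟩ -
  have hg' := hg
  rw [P_eq_PA, PA] at hg'
  have : g ∈ (Subgroup.closure {g | ∃ i j, i < j ∧ j ≤ n ∧ g = aP n i j}).map (P n).subtype := by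
    rw [MonoidHom.map_closure]
    convert hg' using 2
    ext y
    constructor
    · rintro ⟨_, ⟨i, j, h1, h2, rfl⟩, rfl⟩
      refine ⟨i, j, h1, h2, ?_⟩
      rw [Subgroup.coe_subtype, coe_aP h1.ne (by omega) h2, AA_of_lt h1]
    · rintro ⟨i, j, h1, h2, rfl⟩
      refine ⟨_, ⟨i, j, h1, h2, rfl⟩, ?_⟩
      rw [Subgroup.coe_subtype, coe_aP h1.ne (by omega) h2, AA_of_lt h1]
  obtain ⟨g', h1, rfl⟩ := this
  exact h1

theorem hom_ext_aP {H : Type*} [Group H] {f g : P n →* H}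
    (h : ∀ i j, i < j → j ≤ n → f (aP n i j) = g (aP n i j)) : f = g := by
  refine MonoidHom.eq_of_eqOn_dense closure_aP ?_
  rintro _ ⟨i, j, h1, h2, rfl⟩
  exact h i j h1 h2

/-! ### Pure systems in free groups -/

/-- A noncommuting triangle of a pure system. -/
structure Tri {α : Type*} (n : ℕ) (a : ℕ → ℕ → FreeGroup α) (i j k : ℕ) : Prop where
  cyc : Cyc i j k
  hi : i ≤ n
  hj : j ≤ n
  hk : k ≤ n
  prod : a i k * a j k * a i j = 1
  ne : ¬ Commute (a i j) (a j k)

namespace IsPureSys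

variable {α : Type*} {a : ℕ → ℕ → FreeGroup α}

theorem eq_one_of_commute {u v w : FreeGroup α} (h : ¬ Commute u v) (h1 : Commute w u)
    (h2 : Commute w v) : w = 1 := by
  by_contra hw
  exact h (commute_trans hw h1.symm h2)

theorem rot (ha : IsPureSys n a) {i j k : ℕ} (h : Tri n a i j k) : Tri n a j k i where
  cyc := by have := h.cyc; unfold Cyc at *; omega
  hi := h.hj
  hj := h.hk
  hk := h.hi
  prod := by
    have := h.prod
    rw [ha.symm j i, ha.symm k i, ← h.prod, mul_assoc, mul_eq_one_iff_eq_inv.1 h.prod]; simp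
  ne := fun hc => h.ne (by
    have := mul_eq_one_iff_eq_inv'.1 h.prod
    rw [this]
    rw [ha.symm k i] at hc
    exact (hc.symm.mul_left (Commute.refl _)).inv_left)

theorem tri_or (ha : IsPureSys n a) {i j k : ℕ} (hc : Cyc i j k) (hi : i ≤ n) (hj : j ≤ n)
    (hk : k ≤ n) : Tri n a i j k ∨ Commute (a i j) (a j k) := by
  refine or_iff_not_imp_right.2 fun h => ⟨hc, hi, hj, hk, ?_, h⟩
  obtain ⟨h1, h2⟩ := ha.tri i j k hi hj hk hc
  by_contra h0
  have h3 : Commute (a i k) (a j k) := commute_trans h0 h1.symm h2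
  have h4 : Commute (a i k * a j k) (a j k) := h3.mul_left (Commute.refl _)
  have h5 := h4.inv_left.mul_left h2
  rw [inv_mul_cancel_left] at h5
  exact h h5

theorem tri_or' (ha : IsPureSys n a) {i j k : ℕ} (hc : Cyc i j k) (hi : i ≤ n) (hj : j ≤ n)
    (hk : k ≤ n) : Tri n a i j k ∨ (Commute (a i j) (a j k) ∧ Commute (a j k) (a i k) ∧
      Commute (a i k) (a i j)) := by
  refine or_iff_not_imp_left.2 fun h => ⟨(ha.tri_or hc hi hj hk).resolve_left h, ?_, ?_⟩
  · have := (ha.tri_or (i := j) (j := k) (k := i) (by unfold Cyc at *; omega) hj hk hi).resolve_left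
      fun h' => h (ha.rot (ha.rot h'))
    rwa [ha.symm k i] at this
  · have := (ha.tri_or (i := k) (j := i) (k := j) (by unfold Cyc at *; omega) hk hi hj).resolve_left
      fun h' => h (ha.rot h')
    rwa [ha.symm k i] at this

theorem ne' (ha : IsPureSys n a) {i j k : ℕ} (h : Tri n a i j k) : ¬ Commute (a i j) (a i k) :=
  fun hc => (ha.rot (ha.rot h)).ne (by rw [ha.symm k i]; exact hc.symm)

theorem ne'' (ha : IsPureSys n a) {i j k : ℕ} (h : Tri n a i j k) : ¬ Commute (a j k) (a i k) :=
  fun hc => (ha.rot h).ne (by rw [ha.symm k i]; exact hc)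

theorem tri_ne_one (ha : IsPureSys n a) {i j k : ℕ} (h : Tri n a i j k) :
    a i j ≠ 1 ∧ a j k ≠ 1 ∧ a i k ≠ 1 :=
  ⟨fun e => h.ne (e ▸ Commute.one_left _), fun e => h.ne (e ▸ Commute.one_right _),
    fun e => ha.ne' h (e ▸ Commute.one_right _)⟩

/-- The fourth point over a noncommuting triangle. -/
theorem four_point (ha : IsPureSys n a) {i j k l : ℕ} (h : Tri n a i j k) (hl : l ≤ n)
    (hc : Cyc i k l) : (a i l = 1 ∧ a j l = 1 ∧ a k l = 1) ∨
      (a k l = a i j ∧ a i l = a j k ∧ Tri n a i j l ∧ Tri n a j k l ∧ Tri n a i k l) := by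
  have hq := h.cyc
  obtain ⟨-, hi, hj, hk, -, -⟩ := id h
  have c1 : Cyc i j l := by unfold Cyc at *; omega
  have c2 : Cyc j k l := by unfold Cyc at *; omega
  have c3 : Cyc j l i := by unfold Cyc at *; omega
  have h1 : Commute (a i j) (a k l) := ha.comm i j k l hi hj hk hl h.cyc hc
  have h2 : Commute (a j k) (a i l) := by
    have := ha.comm j k l i hj hk hl hi c2 c3
    rwa [ha.symm l i] at this
  rcases ha.tri_or' hc hi hk hl with t | ⟨t1, t2, t3⟩
  · right
    have e1 := h.prod
    have e2 := t.prod
    have e3 : a i l * a k l = a j k * a i j := by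
      apply mul_right_cancel (b := a i k)
      rw [e2, mul_eq_one_iff_eq_inv.1 ((mul_assoc _ _ _).symm.trans e1), mul_inv_cancel]
    have hw : (a j k)⁻¹ * a i l = a i j * (a k l)⁻¹ := by
      rw [inv_mul_eq_iff_eq_mul, ← mul_assoc, ← e3]; group
    have w1 : Commute ((a j k)⁻¹ * a i l) (a j k) :=
      (Commute.refl (a j k)).inv_left.mul_left h2.symm
    have w2 : Commute ((a j k)⁻¹ * a i l) (a i j) := by
      rw [hw]; exact (Commute.refl (a i j)).mul_left h1.symm.inv_left
    have w3 := eq_one_of_commute h.ne w2 w1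
    have e4 : a i l = a j k := (inv_mul_eq_one.1 w3).symm
    have e5 : a k l = a i j := by
      rw [hw] at w3; exact (mul_inv_eq_one.1 w3).symm
    refine ⟨e5, e4, ?_, ?_, t⟩
    · refine (ha.tri_or' c1 hi hj hl).resolve_right ?_
      rintro ⟨-, -, h5⟩
      rw [e4] at h5; exact h.ne h5.symm
    · refine (ha.tri_or' c2 hj hk hl).resolve_right ?_
      rintro ⟨h5, -, -⟩
      rw [e5] at h5; exact h.ne h5.symm
  · left
    rcases ha.tri_or' c1 hi hj hl with u | ⟨u1, u2, u3⟩
    · have hkl : a k l = 1 := eq_one_of_commute (ha.ne' u) h1.symm t2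
      rcases ha.tri_or' c2 hj hk hl with v | ⟨v1, v2, v3⟩
      · exact absurd hkl (ha.tri_ne_one v).2.1
      · exact absurd (eq_one_of_commute (ha.ne'' u) v3.symm h2) (ha.tri_ne_one h).2.1
    rcases ha.tri_or' c2 hj hk hl with v | ⟨v1, v2, v3⟩
    · exact absurd (eq_one_of_commute (ha.ne'' v) h1 u1) (ha.tri_ne_one h).1
    exact ⟨eq_one_of_commute h.ne u3 h2.symm, eq_one_of_commute h.ne u1.symm v3,
      eq_one_of_commute h.ne h1.symm v1.symm⟩

theorem disjoint_same (ha : IsPureSys n a) {i j k l m : ℕ} (h : Tri n a i j k) (hl : l ≤ n)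
    (hm : m ≤ n) (h1 : Cyc i k l) (h2 : Cyc i l m) : a l m = 1 := by
  have hq := h.cyc
  obtain ⟨-, hi, hj, hk, -, -⟩ := id h
  refine eq_one_of_commute h.ne ?_ ?_
  · exact (ha.comm i j l m hi hj hl hm (by unfold Cyc at *; omega) h2).symm
  · exact (ha.comm j k l m hj hk hl hm (by unfold Cyc at *; omega) (by unfold Cyc at *; omega)).symm

theorem disjoint_cross (ha : IsPureSys n a) {i l j m k : ℕ} (h : Tri n a i j k) (hl : l ≤ n)
    (hm : m ≤ n) (h1 : Cyc i l j) (h2 : Cyc j m k) : a l m = 1 := by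
  have hq := h.cyc
  obtain ⟨-, hi, hj, hk, -, -⟩ := id h
  rcases ha.four_point (ha.rot h) hl (by unfold Cyc at *; omega) with ⟨l1, l2, l3⟩ | ⟨-, -, u, -, t⟩
  · rcases ha.four_point (ha.rot (ha.rot h)) hm (by unfold Cyc at *; omega) with
      ⟨m1, m2, m3⟩ | ⟨-, -, -, t, h'⟩
    · have hx : ∃ w : FreeGroup α, w = 1 ∧ (Commute (w * a l m) (a j k) ∨
          Commute (w * a j k) (a l m)) := by
        obtain ⟨w, hw, e⟩ := ha.cross l j m k hl hj hm hk (by unfold Cyc at *; omega)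
          (by unfold Cyc at *; omega)
        refine ⟨w, ?_, e⟩
        rw [ha.symm l j, ha.symm m k, l1, m3, m1, l2] at hw
        simpa [Subgroup.closure_singleton_one] using hw
      obtain ⟨w, rfl, hx⟩ := hx
      have hx' : Commute (a l m) (a j k) := by
        simp only [one_mul] at hx
        exact hx.elim id Commute.symm
      refine eq_one_of_commute (ha.ne'' h) hx' ?_
      rw [ha.symm i k]
      exact ha.comm l m k i hl hm hk hi (by unfold Cyc at *; omega) (by unfold Cyc at *; omega)
    · have e1 : a i l = 1 := ha.disjoint_same (ha.rot h') hi hl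
        (by unfold Cyc at *; omega) (by unfold Cyc at *; omega)
      rcases ha.four_point (ha.rot t) hl (by unfold Cyc at *; omega)
        with ⟨-, h5, -⟩ | ⟨-, -, -, -, h5⟩
      · rw [ha.symm l m]; exact h5
      · exact absurd e1 (ha.tri_ne_one h5).2.1
  · have e1 : a m k = 1 := ha.disjoint_same (ha.rot t) hm hk
      (by unfold Cyc at *; omega) (by unfold Cyc at *; omega)
    rcases ha.four_point (ha.rot u) hm (by unfold Cyc at *; omega)
      with ⟨-, h5, -⟩ | ⟨-, -, -, -, h5⟩
    · exact h5
    · exact absurd (ha.symm k m ▸ e1) (ha.tri_ne_one h5).2.2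

theorem disjoint (ha : IsPureSys n a) {i j k l m : ℕ} (h : Tri n a i j k) (hl : l ≤ n)
    (hm : m ≤ n) (hlm : l ≠ m) (l1 : l ≠ i) (l2 : l ≠ j) (l3 : l ≠ k) (m1 : m ≠ i) (m2 : m ≠ j)
    (m3 : m ≠ k) : a l m = 1 := by
  wlog hc : Cyc i l j generalizing i j k
  · by_cases h2 : Cyc j l k
    · exact this (ha.rot h) l2 l3 l1 m2 m3 m1 h2
    · have hq := h.cyc
      exact this (ha.rot (ha.rot h)) l3 l1 l2 m3 m1 m2 (by unfold Cyc at *; omega)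
  have hq := h.cyc
  by_cases h2 : Cyc j m k
  · exact ha.disjoint_cross h hl hm hc h2
  by_cases h3 : Cyc k m i
  · rw [ha.symm]
    exact ha.disjoint_cross (ha.rot (ha.rot h)) hm hl h3 hc
  have h' := ha.rot h
  have h5 : Cyc j i m := by clear hc; unfold Cyc at *; omega
  have h6 : Cyc j i l := by clear h2 h3 h5; unfold Cyc at *; omega
  clear hc h2 h3 hq
  by_cases h4 : Cyc j l m
  · exact ha.disjoint_same h' hl hm h6 h4
  · rw [ha.symm]
    exact ha.disjoint_same h' hm hl h5 (by clear h6; unfold Cyc at *; omega)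

/-- A pure system with noncommuting values is supported on a triangle or on four points. -/
theorem support (ha : IsPureSys n a) {i j k : ℕ} (h : Tri n a i j k) :
    (∀ p q, p ≤ n → q ≤ n → p ≠ q → a p q ≠ 1 →
      (p = i ∨ p = j ∨ p = k) ∧ (q = i ∨ q = j ∨ q = k)) ∨
    ∃ i j k l, l ≤ n ∧ Tri n a i j k ∧ Tri n a i j l ∧ Tri n a j k l ∧ Tri n a i k l ∧
      a k l = a i j ∧ a i l = a j k ∧ ∀ p q, p ≤ n → q ≤ n → p ≠ q → a p q ≠ 1 →
      (p = i ∨ p = j ∨ p = k ∨ p = l) ∧ (q = i ∨ q = j ∨ q = k ∨ q = l) := by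
  by_cases H : ∀ i' j' k', ((i' = i ∧ j' = j ∧ k' = k) ∨ (i' = j ∧ j' = k ∧ k' = i) ∨
      (i' = k ∧ j' = i ∧ k' = j)) → ∀ l ≤ n, Cyc i' k' l → a i l = 1 ∧ a j l = 1 ∧ a k l = 1
  · left
    have key : ∀ p q, p ≤ n → q ≤ n → p ≠ q → a p q ≠ 1 → (q = i ∨ q = j ∨ q = k) := by
      intro p q hp hq hpq h0
      by_contra! hc
      obtain ⟨c1, c2, c3⟩ := hc
      have h5 : a i q = 1 ∧ a j q = 1 ∧ a k q = 1 := by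
        have := h.cyc
        by_cases d1 : Cyc i k q
        · exact H _ _ _ (.inl ⟨rfl, rfl, rfl⟩) q hq d1
        by_cases d2 : Cyc j i q
        · exact H _ _ _ (.inr (.inl ⟨rfl, rfl, rfl⟩)) q hq d2
        · exact H _ _ _ (.inr (.inr ⟨rfl, rfl, rfl⟩)) q hq (by unfold Cyc at *; omega)
      by_cases p1 : p = i
      · exact h0 (p1 ▸ h5.1)
      by_cases p2 : p = j
      · exact h0 (p2 ▸ h5.2.1)
      by_cases p3 : p = k
      · exact h0 (p3 ▸ h5.2.2)
      exact h0 (ha.disjoint h hp hq hpq p1 p2 p3 c1 c2 c3)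
    intro p q hp hq hpq h0
    exact ⟨key q p hq hp hpq.symm (by rwa [ha.symm]), key p q hp hq hpq h0⟩
  · right
    push Not at H
    obtain ⟨i', j', k', hr, l, hl, hc, hne⟩ := H
    have h' : Tri n a i' j' k' := by
      rcases hr with ⟨rfl, rfl, rfl⟩ | ⟨rfl, rfl, rfl⟩ | ⟨rfl, rfl, rfl⟩
      exacts [h, ha.rot h, ha.rot (ha.rot h)]
    rcases ha.four_point h' hl hc with ⟨e1, e2, e3⟩ | ⟨e1, e2, t1, t2, t3⟩
    · exfalso
      rcases hr with ⟨rfl, rfl, rfl⟩ | ⟨rfl, rfl, rfl⟩ | ⟨rfl, rfl, rfl⟩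
      exacts [hne e1 e2 e3, hne e3 e1 e2, hne e2 e3 e1]
    refine ⟨i', j', k', l, hl, h', t1, t2, t3, e1, e2, ?_⟩
    have q1 := h'.cyc
    have key : ∀ p q, p ≤ n → q ≤ n → p ≠ q → a p q ≠ 1 →
        (q = i' ∨ q = j' ∨ q = k' ∨ q = l) := by
      intro p q hp hq hpq h0
      by_contra! hc
      obtain ⟨c1, c2, c3, c4⟩ := hc
      by_cases p1 : p = i'
      · exact h0 (ha.disjoint t2 hp hq hpq (by unfold Cyc at *; omega) (by unfold Cyc at *; omega)
          (by unfold Cyc at *; omega) c2 c3 c4)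
      by_cases p2 : p = j'
      · exact h0 (ha.disjoint t3 hp hq hpq (by unfold Cyc at *; omega) (by unfold Cyc at *; omega)
          (by unfold Cyc at *; omega) c1 c3 c4)
      by_cases p3 : p = k'
      · exact h0 (ha.disjoint t1 hp hq hpq (by unfold Cyc at *; omega) (by unfold Cyc at *; omega)
          (by unfold Cyc at *; omega) c1 c2 c4)
      exact h0 (ha.disjoint h' hp hq hpq p1 p2 p3 c1 c2 c3)
    intro p q hp hq hpq h0
    exact ⟨key q p hq hp hpq.symm (by rwa [ha.symm]), key p q hp hq hpq h0⟩

theorem exists_tri (ha : IsPureSys n a) {i j k l : ℕ} (hij : i < j) (hkl : k < l) (hj : j ≤ n)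
    (hl : l ≤ n) (h : ¬ Commute (a i j) (a k l)) : ∃ i j k, Tri n a i j k := by
  by_contra! H
  have key : ∀ i j k, i ≤ n → j ≤ n → k ≤ n → i ≠ j → j ≠ k → Commute (a i j) (a j k) := by
    intro i j k hi hj hk h1 h2
    rcases eq_or_ne i k with rfl | h3
    · rw [ha.symm]
    by_cases hc : Cyc i j k
    · exact (ha.tri_or hc hi hj hk).resolve_left (H _ _ _)
    · have := ((ha.tri_or (i := k) (j := j) (k := i) (by unfold Cyc at *; omega) hk hj
        hi).resolve_left (H _ _ _)).symm
      rwa [ha.symm j i, ha.symm k j] at this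
  have cr : ∀ i j k l, i < j → j < k → k < l → l ≤ n → Commute (a i k) (a j l) := by
    intro i j k l h1 h2 h3 h4
    obtain ⟨w, hw, e⟩ := ha.cross i j k l (by omega) (by omega) (by omega) h4
      (by unfold Cyc at *; omega) (by unfold Cyc at *; omega)
    have hh : ∀ u, (∀ y ∈ ({a i j, a j k, a k l, a l i} : Set (FreeGroup α)), Commute u y) →
        Commute w u := by
      intro u hu
      have : Subgroup.closure {a i j, a j k, a k l, a l i} ≤ Subgroup.centralizer {u} := by
        rw [Subgroup.closure_le]
        intro y hy
        exact Subgroup.mem_centralizer_singleton_iff.2 (hu y hy).symm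
      exact Subgroup.mem_centralizer_singleton_iff.1 (this hw)
    rcases e with e | e
    · have : Commute w (a j l) := hh _ (by
        rintro y (rfl | rfl | rfl | rfl)
        · rw [ha.symm i, ha.symm j l]; exact key _ _ _ h4 (by omega) (by omega) (by omega)
            (by omega)
        · rw [ha.symm j l]; exact key _ _ _ h4 (by omega) (by omega) (by omega) (by omega)
        · rw [ha.symm k l]; exact key _ _ _ (by omega) (by omega) (by omega) (by omega) (by omega)
        · exact key _ _ _ (by omega) (by omega) (by omega) (by omega) (by omega))
      have := this.inv_left.mul_left e
      rwa [inv_mul_cancel_left] at this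
    · have : Commute w (a i k) := hh _ (by
        rintro y (rfl | rfl | rfl | rfl)
        · rw [ha.symm i k]; exact key _ _ _ (by omega) (by omega) (by omega) (by omega) (by omega)
        · rw [ha.symm j k]; exact key _ _ _ (by omega) (by omega) (by omega) (by omega) (by omega)
        · exact key _ _ _ (by omega) (by omega) (by omega) (by omega) (by omega)
        · rw [ha.symm i k, ha.symm l i]
          exact key _ _ _ (by omega) (by omega) (by omega) (by omega) (by omega))
      have := this.inv_left.mul_left e
      rw [inv_mul_cancel_left] at this
      exact this.symm
  clear H
  wlog hik : i ≤ k generalizing i j k l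
  · exact this hkl hij hl hj (fun h' => h h'.symm) (by omega)
  apply h
  rcases hik.eq_or_lt with rfl | hik
  · rw [ha.symm i j]; exact key _ _ _ hj (by omega) hl (by omega) (by omega)
  rcases eq_or_ne j k with rfl | h1
  · exact key _ _ _ (by omega) hj hl (by omega) (by omega)
  rcases eq_or_ne j l with rfl | h2
  · rw [ha.symm k j]; exact key _ _ _ (by omega) hj (by omega) (by omega) (by omega)
  rcases lt_or_gt_of_ne h1 with h1 | h1
  · exact ha.comm _ _ _ _ (by omega) hj (by omega) hl (by unfold Cyc; omega) (by unfold Cyc; omega)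
  rcases lt_or_gt_of_ne h2 with h2 | h2
  · exact cr _ _ _ _ hik h1 h2 hl
  · rw [ha.symm i j]
    exact (ha.comm k l j i (by omega) hl hj (by omega) (by unfold Cyc; omega)
      (by unfold Cyc; omega)).symm

end IsPureSys

/-! ### The projection to three strands -/

theorem exists_hom_of_rel {G H : Type*} [Group G] [Group H] (R : G → H → Prop)
    (ht : ∀ g, ∃ h, R g h) (hf : ∀ g h h', R g h → R g h' → h = h')
    (hm : ∀ g g' h h', R g h → R g' h' → R (g * g') (h * h')) : ∃ f : G →* H, ∀ g, R g (f g) := by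
  choose f h using ht
  exact ⟨MonoidHom.mk' f fun a b => hf _ _ _ (h _) (hm _ _ _ _ (h a) (h b)), h⟩

theorem IsPush.one (q : ℕ) : IsPush n q 1 1 := ⟨by simp, 1, by simp, by simp⟩

theorem IsPush.unique {q : ℕ} {g : ArtinB n} {w w' : F} (h : IsPush n q g w)
    (h' : IsPush n q g w') :
    κ q w = κ q w' := by
  obtain ⟨-, v, h1, h2⟩ := h
  obtain ⟨-, v', h1', h2'⟩ := h'
  have : κ q (v'⁻¹ * v) = 1 := by
    apply κ_eq_one_of_conj
    calc v'⁻¹ * v * x q * (v'⁻¹ * v)⁻¹ = v'⁻¹ * (v * x q * v⁻¹) * v' := by group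
      _ = v'⁻¹ * (v' * x q * v'⁻¹) * v' := by rw [← h1, h1']
      _ = x q := by group
  rw [map_mul, map_inv, h2, h2', inv_inv, mul_inv_eq_one] at this
  exact this.symm

theorem exists_comb {j : ℕ} (d : ℕ) (h : j + d < n) {m : ArtinB n} (hm : m ∈ PA n (j + d)) :
    ∃ m' ∈ PA n j, ∀ u, κ (j + 1) (Θ n m u) = κ (j + 1) (Θ n m' u) := by
  induction d generalizing m with
  | zero => exact ⟨m, hm, fun u => rfl⟩
  | succ d ih =>
    obtain ⟨w, hw, m', hm', rfl⟩ := PA_comb (m := j + d) (by omega) hm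
    obtain ⟨m'', h1, h2⟩ := ih (by omega) hm'
    refine ⟨m'', h1, fun u => ?_⟩
    rw [map_mul, MulAut.mul_apply, ← κ_κ (show j + 1 ≤ j + d + 1 by omega),
      (isPush_jh (by omega) hw).1, κ_κ (by omega), h2]

theorem tower_step {k : ℕ} (hk0 : 0 < k) (hk : k < n) {m : ArtinB n} (hm : m ∈ PA n (n - 1)) {w : F}
    (h : IsPush n k m w) (hw : κ k w = 1) (u : F) : κ (k + 1) (Θ n m u) = κ (k + 1) u := by
  obtain ⟨k, rfl⟩ : ∃ k', k = k' + 1 := ⟨k - 1, by omega⟩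
  obtain ⟨m', hm', e⟩ := exists_comb (j := k + 1) (n - 1 - (k + 1)) (by omega)
    (m := m) (by rwa [show k + 1 + (n - 1 - (k + 1)) = n - 1 by omega])
  obtain ⟨w', hw', u', hu', rfl⟩ := PA_comb (m := k) (by omega) hm'
  have hp := isPush_jh hk hw'
  have hu1 : u' = 1 := by
    refine PA_faithful (m := k) (by omega) hu' fun i hi => ?_
    have h1 : Θ n u' (x i) ∈ Fs (k + 1) :=
      Θ_Hs_mem (m := k) (by omega) hk.le (PA_le_Hs (by omega) hu') (x_mem_Fs (by omega))
    rw [← κ_of_mem h1, ← hp.1, ← MulAut.mul_apply, ← map_mul,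
      ← κ_κ (show k + 1 ≤ k + 1 + 1 by omega), ← e, κ_κ (by omega), h.1, κ_lt (by omega)]
  subst hu1
  rw [mul_one] at e
  obtain ⟨-, v, h1, h2⟩ := h
  obtain ⟨-, v', h1', h2'⟩ := hp
  have : κ (k + 1) (κ (k + 2) (v'⁻¹ * v)) = 1 := by
    apply κ_eq_one_of_conj
    have e1 := e (x (k + 1))
    rw [h1, h1'] at e1
    simp only [map_mul, map_inv] at e1 ⊢
    rw [κ_lt (show k + 1 < k + 1 + 1 by omega)] at e1
    calc _ = (κ (k + 2) v')⁻¹ * (κ (k + 2) v * x (k + 1) * (κ (k + 2) v)⁻¹) * κ (k + 2) v' := by group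
      _ = _ := by rw [e1]; group
  rw [κ_κ (by omega), map_mul, map_inv, h2, h2', hw, inv_one, mul_one, inv_inv, κ_of_mem hw']
    at this
  rw [e, this]; simp

/-- The full twist of the braid subgroup. -/
noncomputable def TT (n : ℕ) : ArtinB n := pr n (ΔB n)

theorem TT_comm (g : ArtinB n) : Commute (TT n) (pr n g) := by
  rw [TT, Commute, SemiconjBy, ← map_mul, ← map_mul, ΔB_central]

theorem ΔB_eq_TT (hn : 0 < n) : ΔB n = ι n (cp 0 n) * TT n := by
  obtain ⟨n, rfl⟩ : ∃ m, n = m + 1 := ⟨n - 1, by omega⟩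
  rw [TT, ΔB_eq, map_mul, pr_ι, one_mul, pr_tw (by omega)]

theorem Θ_TT {i : ℕ} (hi : i < n) (j : ℤ) :
    Θ n (TT n ^ j) (x i) = (cp 0 n ^ j)⁻¹ * x i * cp 0 n ^ j := by
  have h1 : TT n ^ j = ι n (cp 0 n ^ j)⁻¹ * ΔB n ^ j := by
    have h : Commute (ι n (cp 0 n)) (TT n) := by
      have := ι_Θ (pr n (ΔB n)) (cp 0 n)
      rw [Θ_pr_cp] at this
      exact mul_inv_eq_iff_eq_mul.1 this.symm |>.symm
    rw [ΔB_eq_TT (by omega), h.mul_zpow, map_inv, map_zpow, inv_mul_cancel_left]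
  have h2 : Θ n (ΔB n ^ j) (x i) = x i := by
    have : Θ n (ΔB n) ∈ MulAction.stabilizer (MulAut F) (x i) := Θ_ΔB hi
    rw [map_zpow]; exact zpow_mem this j
  rw [h1, map_mul, MulAut.mul_apply, h2, Θ_ι, MulAut.conj_apply, inv_inv]
  have := cp_mem 0 n
  rw [zero_add] at this
  exact inv_mem (zpow_mem this j)

theorem κ_cp {k : ℕ} (h : k ≤ n) : κ k (cp 0 n) = cp 0 k := by
  induction n, h using Nat.le_induction with
  | base => exact κ_of_mem (by simpa using cp_mem 0 k)
  | succ m hm ih => rw [cp_succ, map_mul, ih, zero_add, κ_ge hm, mul_one]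

theorem ΔB_mem_P : ΔB n ∈ P n := mem_P_of_fix fun _ hi => Θ_ΔB hi

theorem TT_mem_P : TT n ∈ P n := by rw [mem_P, TT, σ_pr, ← mem_P]; exact ΔB_mem_P

theorem κ_Θ_eq {g : ArtinB n} (hn : 0 < n) (hg : g ∈ PA n (n - 1)) {q : ℕ}
    (h : ∀ i < q, κ q (Θ n g (x i)) = x i) (u : F) : κ q (Θ n g u) = κ q u := by
  have : (κ q).comp (Θ n g).toMonoidHom = κ q := by
    apply fhom_ext
    intro i
    show κ q (Θ n g (x i)) = κ q (x i)
    by_cases hi : i < q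
    · rw [h i hi, κ_lt hi]
    rw [κ_ge (not_lt.1 hi)]
    by_cases hin : i < n
    · obtain ⟨v, -, e⟩ := Θ_x g i hin
      have hP : σ n g = 1 := by
        rw [← mem_P, P_eq_PA]; exact PA_mono (by omega) hg
      rw [e, hP]
      simp [κ_ge (not_lt.1 hi)]
    · rw [Θ_Hs_gt (m := n - 1) (by omega) (PA_le_Hs (by omega) hg) (by omega), κ_ge (not_lt.1 hi)]
  exact DFunLike.congr_fun this u

/-- The relation defining the projection to three strands. -/
def ThreeRel (n : ℕ) (p : P n) (q : ArtinB n × F) : Prop :=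
  q.2 ∈ Fs 2 ∧ IsPush n 2 q.1 q.2 ∧ ∃ j : ℤ, q.1 = pr n p * TT n ^ j

theorem ThreeRel.mul {p p' : P n} {q q' : ArtinB n × F} (h : ThreeRel n p q)
    (h' : ThreeRel n p' q') : ThreeRel n (p * p') (q * q') := by
  obtain ⟨h1, h2, j, h3⟩ := h
  obtain ⟨h1', h2', j', h3'⟩ := h'
  refine ⟨mul_mem h1 h1', h2.mul h2', j + j', ?_⟩
  rw [Prod.fst_mul, h3, h3', Subgroup.coe_mul, map_mul, zpow_add, mul_assoc, mul_assoc,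
    ((TT_comm (p' : ArtinB n)).zpow_left j).left_comm]

theorem ThreeRel.inv {p : P n} {q : ArtinB n × F} (h : ThreeRel n p q) : ThreeRel n p⁻¹ q⁻¹ := by
  obtain ⟨h1, h2, j, h3⟩ := h
  refine ⟨inv_mem h1, h2.inv, -j, ?_⟩
  rw [Prod.fst_inv, h3, Subgroup.coe_inv, map_inv, mul_inv_rev, zpow_neg]
  have h4 := (TT_comm (p : ArtinB n)).zpow_left j
  exact h4.inv_inv

theorem ThreeRel.unique (hn : 2 ≤ n) {p : P n} {q q' : ArtinB n × F} (h : ThreeRel n p q)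
    (h' : ThreeRel n p q') : q = q' := by
  obtain ⟨h1, h2, j, h3⟩ := h
  obtain ⟨h1', h2', j', h3'⟩ := h'
  have e : q'.1 = q.1 * TT n ^ (j' - j) := by
    rw [h3, h3', mul_assoc, ← zpow_add]; congr 2; omega
  have h4 : κ 2 (Θ n (TT n ^ (j' - j)) (x 0)) = x 0 := by
    have := h2'.1 (x 0)
    rw [e, map_mul, MulAut.mul_apply, h2.1, κ_lt (show 0 < 2 by omega)] at this
    exact this
  rw [Θ_TT (by omega)] at h4
  simp only [map_mul, map_inv, map_zpow, κ_lt (show 0 < 2 by omega), κ_cp hn] at h4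
  have h5 : x 0 * cp 0 2 ^ (j' - j) = cp 0 2 ^ (j' - j) * x 0 := by
    rw [mul_assoc, inv_mul_eq_iff_eq_mul] at h4; exact h4
  have h6 := eq_zpow_of_commute (expo 0) (by rw [expo_of]; simp) h5
  have h7 := congrArg (fun w => (expo 1 w).toAdd) h6
  simp [cp_succ, cp_zero, x, expo_of] at h7
  have h8 : j' = j := by omega
  subst h8
  have h9 : q.1 = q'.1 := by rw [h3, h3']
  refine Prod.ext h9 ?_
  rw [← κ_of_mem h1, ← κ_of_mem h1']
  rw [← h9] at h2'
  exact h2.unique h2'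

theorem threeRel_of_ge {p q : ℕ} (hp : p < q) (hq : q < n) (h3 : 3 ≤ q) :
    IsPush n 2 (A n p q) 1 := by
  obtain ⟨h1, h2, h3', h4⟩ := Θ_A hp hq
  have hA : A n p q ∈ PA n (n - 1) := A_mem_PA hp (by omega)
  have k3 : ∀ i < 3, κ 3 (Θ n (A n p q) (x i)) = x i := by
    intro i hi
    rcases lt_trichotomy i p with h | h | h
    · rw [h4 i (.inl h), κ_lt hi]
    · subst h
      rw [h1]; simp [κ_lt hi, κ_ge h3]
    · rw [h3' i h (by omega)]; simp [κ_lt hi, κ_ge h3]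
  refine ⟨fun u => ?_, ?_⟩
  · rw [← κ_κ (show 2 ≤ 3 by omega), κ_Θ_eq (by omega) hA k3, κ_κ (by omega)]
  · rcases lt_trichotomy 2 p with h | h | h
    · exact ⟨1, by rw [h4 2 (.inl h)]; simp, by simp⟩
    · subst h
      exact ⟨(x 2 * x q)⁻¹, by rw [h1]; group, by simp [κ_ge (show 2 ≤ q by omega),
        κ_ge (le_refl 2)]⟩
    · exact ⟨_, h3' 2 h (by omega), by simp [κ_ge (show 2 ≤ q by omega)]⟩

theorem threeRel_zero_one (hn : 3 ≤ n) : IsPush n 2 (A n 0 1 * TT n ^ (-1 : ℤ)) (cp 0 2)⁻¹ := by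
  obtain ⟨h1, h2, -, h4⟩ := Θ_A (n := n) (show 0 < 1 by omega) (by omega)
  have hA : A n 0 1 ∈ PA n (n - 1) := A_mem_PA (by omega) (by omega)
  have hT : TT n ∈ PA n (n - 1) := mem_PA_of_pr (by omega) TT_mem_P (by rw [TT, pr_pr])
  have hc : Θ n (A n 0 1) (cp 0 n) = cp 0 n := by
    have := Θ_pr_cp (A n 0 1)
    rwa [pr_of_mem_PA (by omega) hA] at this
  have hc2 : cp 0 2 = x 0 * x 1 := by simp [cp_succ, cp_zero]
  refine ⟨κ_Θ_eq (by omega) (mul_mem hA (zpow_mem hT _)) ?_, cp 0 n, ?_, ?_⟩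
  · intro i hi
    rw [map_mul, MulAut.mul_apply, Θ_TT (by omega)]
    simp only [map_mul, map_inv, hc, κ_cp (show 2 ≤ n by omega), zpow_neg_one, inv_inv]
    rw [hc2]
    obtain rfl | rfl : i = 0 ∨ i = 1 := by omega
    · rw [h1]; simp [κ_lt]; group
    · rw [h2]; simp [κ_lt]; group
  · rw [map_mul, MulAut.mul_apply, Θ_TT (by omega)]
    simp only [map_mul, map_inv, hc, zpow_neg_one, inv_inv, h4 2 (.inr (by omega))]
  · rw [κ_cp (by omega), map_inv, inv_inv, κ_of_mem (by simpa using cp_mem 0 2)]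

theorem exists_three (hn : 3 ≤ n) : ∃ f : P n →* ArtinB n × F, ∀ p, ThreeRel n p (f p) := by
  refine exists_hom_of_rel (ThreeRel n) (fun p => ?_) (fun p q q' => ThreeRel.unique (by omega))
    fun p p' q q' => ThreeRel.mul
  have hp : p ∈ Subgroup.closure {g | ∃ i j, i < j ∧ j ≤ n ∧ g = aP n i j} := by
    rw [closure_aP]; trivial
  induction hp using Subgroup.closure_induction with
  | one => exact ⟨1, one_mem _, IsPush.one _, 0, by simp⟩
  | mul p p' _ _ h h' =>
    obtain ⟨q, h⟩ := h
    obtain ⟨q', h'⟩ := h'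
    exact ⟨_, h.mul h'⟩
  | inv p _ h =>
    obtain ⟨q, h⟩ := h
    exact ⟨_, h.inv⟩
  | mem p h =>
    obtain ⟨i, j, hij, hj, rfl⟩ := h
    have hA : (aP n i j : ArtinB n) = A n i j := by
      rw [coe_aP hij.ne (by omega) hj, AA_of_lt hij]
    rcases Nat.lt_or_ge j n with h | h
    · have hpr : pr n (aP n i j : ArtinB n) = A n i j := by
        rw [hA]; exact pr_of_mem_PA (by omega) (A_mem_PA hij (by omega))
      rcases Nat.lt_or_ge 2 j with h3 | h3
      · exact ⟨(A n i j, 1), one_mem _, threeRel_of_ge hij h h3, 0, by simp [hpr]⟩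
      · obtain rfl | rfl : j = 2 ∨ j = 1 := by omega
        · exact ⟨(A n i 2, x i), x_mem_Fs hij, isPush_A hij h, 0, by simp [hpr]⟩
        · obtain rfl : i = 0 := by omega
          exact ⟨(A n 0 1 * TT n ^ (-1 : ℤ), (cp 0 2)⁻¹),
            inv_mem (by simpa using cp_mem 0 2), threeRel_zero_one hn, -1, by simp [hpr]⟩
    · obtain rfl : j = n := by omega
      refine ⟨1, one_mem _, IsPush.one _, 0, ?_⟩
      rw [hA, A_pole, pr_ι]; simp

theorem ThreeRel.of_mem_U {p : P n} (hp : (p : ArtinB n) ∈ U n) : ThreeRel n p 1 :=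
  ⟨one_mem _, IsPush.one _, 0, by rw [mem_U_iff.1 hp]; simp⟩

theorem ThreeRel.of_A {i : ℕ} (hi : i < 2) (hn : 3 ≤ n) : ThreeRel n (aP n i 2) (A n i 2, x i) := by
  refine ⟨x_mem_Fs hi, isPush_A hi (by omega), 0, ?_⟩
  rw [coe_aP hi.ne (by omega) (by omega), AA_of_lt hi,
    pr_of_mem_PA (by omega) (A_mem_PA hi (by omega))]
  simp

open Classical in
/-- The projection of the pure group to three strands of the pure braid quotient. -/
noncomputable def three (n : ℕ) : P n →* ArtinB n × F :=
  if h : 3 ≤ n then (exists_three h).choose else 1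

theorem three_rel (hn : 3 ≤ n) (p : P n) : ThreeRel n p (three n p) := by
  rw [three, dif_pos hn]; exact (exists_three hn).choose_spec p

theorem three_eq (hn : 3 ≤ n) {p : P n} {q : ArtinB n × F} (h : ThreeRel n p q) :
    three n p = q := (three_rel hn p).unique (by omega) h

/-- The restriction of an automorphism to the pure subgroup. -/
noncomputable def resP (hn : 5 ≤ n) (ψ : MulAut (ArtinB n)) : P n →* P n :=
  (ψ.toMonoidHom.comp (P n).subtype).codRestrict (P n) fun p => aut_mem_P hn ψ p.2

theorem coe_resP (hn : 5 ≤ n) (ψ : MulAut (ArtinB n)) (p : P n) :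
    (resP hn ψ p : ArtinB n) = ψ p := rfl

/-- The free quotient of the pure subgroup twisted by an automorphism. -/
noncomputable def quo (hn : 5 ≤ n) (ψ : MulAut (ArtinB n)) : P n →* F :=
  ((MonoidHom.snd _ _).comp (three n)).comp (resP hn ψ)

theorem quo_apply (hn : 5 ≤ n) (ψ : MulAut (ArtinB n)) (p : P n) :
    quo hn ψ p = (three n (resP hn ψ p)).2 := rfl

theorem quo_congr (hn : 5 ≤ n) {ψ ψ' : MulAut (ArtinB n)} {p p' : P n}
    (h : ψ p = ψ' p') : quo hn ψ p = quo hn ψ' p' := by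
  rw [quo_apply, quo_apply, show resP hn ψ p = resP hn ψ' p' from Subtype.ext h]

theorem quo_surj (hn : 5 ≤ n) (ψ : MulAut (ArtinB n)) {i : ℕ} (hi : i < 2) :
    ∃ p, quo hn ψ p = x i := by
  refine ⟨⟨ψ⁻¹ (aP n i 2 : P n), aut_mem_P hn _ (aP n i 2).2⟩, ?_⟩
  rw [quo_apply, show resP hn ψ _ = aP n i 2 from Subtype.ext (by rw [coe_resP]; simp),
    three_eq (by omega) (ThreeRel.of_A hi (by omega))]

theorem quo_eq_one_of_mem_U (hn : 5 ≤ n) (ψ : MulAut (ArtinB n)) {p : P n} (h : ψ p ∈ U n) :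
    quo hn ψ p = 1 := by
  rw [quo_apply, three_eq (by omega) (ThreeRel.of_mem_U (p := resP hn ψ p) h)]; rfl

/-- The values of the free quotient on the pure generators. -/
noncomputable def qa (hn : 5 ≤ n) (ψ : MulAut (ArtinB n)) (i j : ℕ) : F := quo hn ψ (aP n i j)

theorem isPureSys_qa (hn : 5 ≤ n) (ψ : MulAut (ArtinB n)) : IsPureSys n (qa hn ψ) :=
  isPureSys_aP.map (quo hn ψ)

theorem exists_tri_qa (hn : 5 ≤ n) (ψ : MulAut (ArtinB n)) :
    ∃ i j k, Tri n (qa hn ψ) i j k := by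
  by_contra! H
  have h1 : ∀ p q : P n, Commute (quo hn ψ p) (quo hn ψ q) := by
    intro p q
    have hp : p ∈ Subgroup.closure {g | ∃ i j, i < j ∧ j ≤ n ∧ g = aP n i j} := by
      rw [closure_aP]; trivial
    have hq : q ∈ Subgroup.closure {g | ∃ i j, i < j ∧ j ≤ n ∧ g = aP n i j} := by
      rw [closure_aP]; trivial
    induction hp using Subgroup.closure_induction with
    | one => simp
    | mul _ _ _ _ h h' => rw [map_mul]; exact h.mul_left h'
    | inv _ _ h => rw [map_inv]; exact h.inv_left
    | mem p h =>
      obtain ⟨i, j, hij, hj, rfl⟩ := h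
      induction hq using Subgroup.closure_induction with
      | one => simp
      | mul _ _ _ _ h h' => rw [map_mul]; exact h.mul_right h'
      | inv _ _ h => rw [map_inv]; exact h.inv_right
      | mem q h =>
        obtain ⟨k, l, hkl, hl, rfl⟩ := h
        by_contra h
        obtain ⟨i, j, k, h⟩ := (isPureSys_qa hn ψ).exists_tri hij hkl hj hl h
        exact H i j k h
  obtain ⟨p, hp⟩ := quo_surj hn ψ (show 0 < 2 by omega)
  obtain ⟨q, hq⟩ := quo_surj hn ψ (show 1 < 2 by omega)
  have := (h1 p q).eq
  rw [hp, hq] at this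
  have h2 := eq_zpow_of_commute (expo 0) (by rw [x, expo_of]; simp) this
  have h3 := congrArg (fun w => (expo 1 w).toAdd) h2
  simp [x, expo_of] at h3

open Classical in
/-- The strands whose pole generator is detected by the free quotient. -/
noncomputable def polar (hn : 5 ≤ n) (ψ : MulAut (ArtinB n)) : Finset (Fin n) :=
  Finset.univ.filter fun i => qa hn ψ i n ≠ 1

theorem mem_polar (hn : 5 ≤ n) (ψ : MulAut (ArtinB n)) (i : Fin n) :
    i ∈ polar hn ψ ↔ qa hn ψ i n ≠ 1 := by simp [polar]

theorem ι_mem_P (w : F) : ι n w ∈ P n := U_le_P (ι_mem_U w)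

theorem coe_aP_pole {i : ℕ} (hi : i < n) : (aP n i n : ArtinB n) = ι n (x i) := by
  rw [coe_aP hi.ne hi.le le_rfl, AA_of_lt hi, A_pole]

theorem qa_conj_pole (hn : 5 ≤ n) (ψ : MulAut (ArtinB n)) (g : ArtinB n) (i : Fin n) :
    qa hn (ψ * MulAut.conj g) i n ≠ 1 ↔ qa hn ψ (σ n g i) n ≠ 1 := by
  obtain ⟨v, hv, e⟩ := Θ_x g i i.2
  have h : qa hn (ψ * MulAut.conj g) i n =
      quo hn ψ ⟨ι n v, ι_mem_P v⟩ * qa hn ψ (σ n g i) n * (quo hn ψ ⟨ι n v, ι_mem_P v⟩)⁻¹ := by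
    rw [qa, qa, ← map_inv, ← map_mul, ← map_mul]
    apply quo_congr
    rw [MulAut.mul_apply, MulAut.conj_apply, coe_aP_pole i.2, ← ι_Θ, e,
      Subgroup.coe_mul, Subgroup.coe_mul, Subgroup.coe_inv, coe_aP_pole (Fin.is_lt _),
      map_mul (ι n), map_mul (ι n), map_inv (ι n)]
  rw [h, Ne, conj_eq_one_iff]

theorem mem_polar_conj (hn : 5 ≤ n) (ψ : MulAut (ArtinB n)) (g : ArtinB n) (i : Fin n) :
    i ∈ polar hn (ψ * MulAut.conj g) ↔ σ n g i ∈ polar hn ψ := by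
  rw [mem_polar, mem_polar, qa_conj_pole]

theorem card_polar_conj (hn : 5 ≤ n) (ψ : MulAut (ArtinB n)) (g : ArtinB n) :
    (polar hn (ψ * MulAut.conj g)).card = (polar hn ψ).card := by
  refine Finset.card_bijective (σ n g) (Equiv.bijective _) fun i => mem_polar_conj hn ψ g i

theorem polar_empty (hn : 5 ≤ n) {ψ : MulAut (ArtinB n)} (h : polar hn ψ = ∅) {p : P n}
    (hp : (p : ArtinB n) ∈ U n) : quo hn ψ p = 1 := by
  obtain ⟨w, hw, e⟩ := exists_ι_of_mem_U hp
  obtain rfl : p = ⟨ι n w, ι_mem_P w⟩ := Subtype.ext e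
  let L : F →* F := (quo hn ψ).comp ((ι n).codRestrict (P n) ι_mem_P)
  have : L = 1 := by
    apply fhom_ext
    intro i
    rcases Nat.lt_or_ge i n with hi | hi
    · have h1 : (⟨i, hi⟩ : Fin n) ∉ polar hn ψ := by simp [h]
      rw [mem_polar, not_not, qa] at h1
      rw [MonoidHom.one_apply, ← h1]
      exact quo_congr hn (by rw [coe_aP_pole hi]; rfl)
    · exact (congrArg (quo hn ψ) (show _ = 1 from Subtype.ext (ι_ge hi))).trans (map_one _)
  exact DFunLike.congr_fun this w

/-- The possible supports. -/
theorem polar_cases (hn : 5 ≤ n) (ψ : MulAut (ArtinB n)) :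
    polar hn ψ = ∅ ∨
    (∃ i j : Fin n, i < j ∧ polar hn ψ = {i, j} ∧ Tri n (qa hn ψ) i j n ∧
      ∀ p q, p ≤ n → q ≤ n → p ≠ q → qa hn ψ p q ≠ 1 →
        (p = i ∨ p = j ∨ p = n) ∧ (q = i ∨ q = j ∨ q = n)) ∨
    ∃ i j k : Fin n, i < j ∧ j < k ∧ polar hn ψ = {i, j, k} ∧ Tri n (qa hn ψ) i j k ∧
      qa hn ψ k n = qa hn ψ i j ∧
      ∀ p q, p ≤ n → q ≤ n → p ≠ q → qa hn ψ p q ≠ 1 →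
        (p = i ∨ p = j ∨ p = k ∨ p = n) ∧ (q = i ∨ q = j ∨ q = k ∨ q = n) := by
  have ha := isPureSys_qa hn ψ
  obtain ⟨i, j, k, h⟩ := exists_tri_qa hn ψ
  rcases ha.support h with hs | ⟨i, j, k, l, hl, h1, h2, h3, h4, h5, h6, hs⟩
  · by_cases hi : n = i ∨ n = j ∨ n = k
    swap
    · refine .inl (Finset.eq_empty_of_forall_notMem fun p hp => ?_)
      rw [mem_polar] at hp
      exact hi (hs p n p.2.le le_rfl p.2.ne hp).2
    right; left
    have key : ∀ i j, Tri n (qa hn ψ) i j n → (∀ p q, p ≤ n → q ≤ n → p ≠ q → qa hn ψ p q ≠ 1 →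
        (p = i ∨ p = j ∨ p = n) ∧ (q = i ∨ q = j ∨ q = n)) →
        ∃ i j : Fin n, i < j ∧ polar hn ψ = {i, j} ∧ Tri n (qa hn ψ) i j n ∧
      ∀ p q, p ≤ n → q ≤ n → p ≠ q → qa hn ψ p q ≠ 1 →
        (p = i ∨ p = j ∨ p = n) ∧ (q = i ∨ q = j ∨ q = n) := by
      intro i j h hs
      have hc : i < j ∧ j < n := by
        have := h.cyc; have := h.hi; have := h.hj; unfold Cyc at *; omega
      refine ⟨⟨i, by omega⟩, ⟨j, hc.2⟩, hc.1, ?_, h, hs⟩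
      ext p
      rw [mem_polar]
      obtain ⟨e1, e2, e3⟩ := ha.tri_ne_one h
      constructor
      · intro hp
        have := (hs p n p.2.le le_rfl p.2.ne hp).1
        have := p.2
        simp [Fin.ext_iff]; omega
      · intro hp
        simp [Fin.ext_iff] at hp
        rcases hp with hp | hp <;> rw [hp] <;> assumption
    rcases hi with rfl | rfl | rfl
    · exact key j k (ha.rot h) fun p q a b c d => by have := hs p q a b c d; omega
    · exact key k i (ha.rot (ha.rot h)) fun p q a b c d => by have := hs p q a b c d; omega
    · exact key i j h hs
  · by_cases hi : n = i ∨ n = j ∨ n = k ∨ n = l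
    swap
    · refine .inl (Finset.eq_empty_of_forall_notMem fun p hp => ?_)
      rw [mem_polar] at hp
      exact hi (hs p n p.2.le le_rfl p.2.ne hp).2
    right; right
    have key : ∀ i j k, Tri n (qa hn ψ) i j k → Tri n (qa hn ψ) i j n → Tri n (qa hn ψ) j k n →
        Tri n (qa hn ψ) i k n →
        qa hn ψ k n = qa hn ψ i j → (∀ p q, p ≤ n → q ≤ n → p ≠ q → qa hn ψ p q ≠ 1 →
        (p = i ∨ p = j ∨ p = k ∨ p = n) ∧ (q = i ∨ q = j ∨ q = k ∨ q = n)) →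
        ∃ i j k : Fin n, i < j ∧ j < k ∧ polar hn ψ = {i, j, k} ∧ Tri n (qa hn ψ) i j k ∧
      qa hn ψ k n = qa hn ψ i j ∧
      ∀ p q, p ≤ n → q ≤ n → p ≠ q → qa hn ψ p q ≠ 1 →
        (p = i ∨ p = j ∨ p = k ∨ p = n) ∧ (q = i ∨ q = j ∨ q = k ∨ q = n) := by
      intro i j k h h2 h3 h4 e hs
      have hc : i < j ∧ j < k ∧ k < n := by
        have := h2.cyc; have := h3.cyc; have := h2.hi; have := h3.hi; have := h3.hj
        unfold Cyc at *; omega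
      refine ⟨⟨i, by omega⟩, ⟨j, by omega⟩, ⟨k, hc.2.2⟩, hc.1, hc.2.1, ?_, h, e, hs⟩
      ext p
      rw [mem_polar]
      obtain ⟨e1, e2, e3⟩ := ha.tri_ne_one h2
      obtain ⟨e1', e2', e3'⟩ := ha.tri_ne_one h3
      constructor
      · intro hp
        have := (hs p n p.2.le le_rfl p.2.ne hp).1
        have := p.2
        simp [Fin.ext_iff]; omega
      · intro hp
        simp [Fin.ext_iff] at hp
        rcases hp with hp | hp | hp <;> rw [hp] <;> assumption
    rcases hi with rfl | rfl | rfl | rfl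
    · exact key j k l h3 (ha.rot h1) (ha.rot h4) (ha.rot h2) (by rw [ha.symm l, h6])
        fun p q a b c d => by have := hs p q a b c d; omega
    · exact key k l i (ha.rot h4) (ha.rot h3) (ha.rot (ha.rot h2)) (ha.rot (ha.rot h1))
        (by rw [h5]) fun p q a b c d => by have := hs p q a b c d; omega
    · exact key l i j (ha.rot (ha.rot h2)) (ha.rot (ha.rot h4)) (h1) (ha.rot (ha.rot h3))
        (by rw [ha.symm l, h6]) fun p q a b c d => by have := hs p q a b c d; omega
    · exact key i j k h1 h2 h3 h4 h5 hs

/-- The full turn of the strand `q` around the previous ones. -/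
noncomputable def dl (n q : ℕ) : ArtinB n := jh n q (ι q (cp 0 q))

theorem dl_zero : dl n 0 = 1 := by simp [dl, cp_zero]

theorem dl_succ {q : ℕ} (hq : q + 1 < n) : dl n (q + 1) = s n q * dl n q * s n q := by
  have h : ∀ w ∈ Fs q, s n q * jh n q (ι q w) * (s n q)⁻¹ = jh n (q + 1) (ι (q + 1) w) := by
    intro w hw
    exact Fs_eqOn (f := ((MulAut.conj (s n q)).toMonoidHom.comp (jh n q)).comp (ι q))
      (g := (jh n (q + 1)).comp (ι (q + 1))) (fun i hi => s_conj_A hi hq) hw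
  have h2 : jh n (q + 1) (ι (q + 1) (x q)) = s n q ^ 2 := A_last hq
  rw [dl, cp_succ, map_mul, map_mul, ← h _ (by simpa using cp_mem 0 q), zero_add, h2, dl]
  group

theorem s_comm_dl_gt {q i : ℕ} (h : q < i) (hi : i < n) : Commute (s n i) (dl n q) := by
  have : ∀ w ∈ Fs q, s n i * jh n q (ι q w) * (s n i)⁻¹ = jh n q (ι q w) := by
    intro w hw
    exact Fs_eqOn (f := ((MulAut.conj (s n i)).toMonoidHom.comp (jh n q)).comp (ι q))
      (g := (jh n q).comp (ι q)) (fun j hj => by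
        change s n i * A n j q * (s n i)⁻¹ = A n j q
        rw [s_comm_A hj h hi]; group) hw
  exact mul_inv_eq_iff_eq_mul.1 (this _ (by simpa using cp_mem 0 q))

theorem s_comm_dl_lt {q i : ℕ} (hq : q ≤ n) (h : i + 1 < q) : Commute (s n i) (dl n q) := by
  have := s_conj_jh hq h (cp 0 q)
  rw [hur_cp (by omega) (by omega)] at this
  exact mul_inv_eq_iff_eq_mul.1 this

theorem dl_mem_PA {q : ℕ} : dl n q ∈ PA n q := V_le_PA le_rfl (jh_mem_V q _)

theorem dl_comm {q : ℕ} (hq : q + 1 < n) : Commute (dl n q) (dl n (q + 1)) := by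
  obtain ⟨g, hg, e⟩ := exists_jh_of_mem_PA (show q < q + 1 by omega)
    hq.le (dl_mem_PA (n := n) (q := q))
  have := jh_ι_conj (n := n) (q + 1) g (cp 0 (q + 1))
  rw [← pr_of_mem_PA (by omega) (u := g) (by simpa using hg), Θ_pr_cp,
    pr_of_mem_PA (by omega) (u := g) (by simpa using hg), e] at this
  exact mul_inv_eq_iff_eq_mul.1 this

theorem pr_dl {q : ℕ} (hq : q < n) : pr n (dl n q) = dl n q :=
  pr_of_mem_PA (by omega) (PA_mono (by omega) dl_mem_PA)

theorem isBSeq_mu (n : ℕ) :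
    IsBSeq n fun i => if i + 1 < n then (s n i)⁻¹ else dl n (n - 1) * s n (n - 1) where
  braid i hi := by
    have := congrArg (·⁻¹) (braid hi)
    simp only [show i + 1 < n by omega, show i + 1 + 1 < n by omega, if_true]
    simpa [mul_assoc] using this
  braid4 i hi := by
    obtain rfl : n = i + 2 := hi.symm
    have h1 := dl_succ (n := i + 2) (q := i) (by omega)
    have h2 := (dl_comm (n := i + 2) (q := i) (by omega)).eq
    have h3 := (s_comm_dl_gt (n := i + 2) (q := i) (i := i + 1) (by omega) (by omega)).eq
    have h4 := braid4 (n := i + 2) (i := i) rfl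
    simp only [show i + 1 < i + 2 by omega, show ¬ i + 1 + 1 < i + 2 by omega, if_true, if_false,
      show i + 2 - 1 = i + 1 by omega]
    rw [h1] at h2 ⊢
    generalize s (i + 2) i = a at *
    generalize s (i + 2) (i + 1) = r at *
    generalize dl (i + 2) i = d at *
    have e1 : a⁻¹ * (a * d * a * r) * a⁻¹ * (a * d * a * r) = d * a * d * (r * a * r) := by
      calc _ = d * a * (r * d) * a * r := by group
        _ = _ := by rw [h3]; group
    have e2 : a * d * a * r * a⁻¹ * (a * d * a * r) * a⁻¹ = a * d * a * d * (r * a * r * a⁻¹) := by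
      calc _ = a * d * a * (r * d) * a * r * a⁻¹ := by group
        _ = _ := by rw [h3]; group
    rw [e1, e2, ← h2]
    have e3 : r * a * r * a⁻¹ = a⁻¹ * (r * a * r) := by
      rw [mul_inv_eq_iff_eq_mul, mul_assoc a⁻¹, eq_inv_mul_iff_mul_eq, ← h4]; group
    rw [e3]; group
  comm i j hij hj := by
    rw [if_pos (by omega)]
    rcases Nat.lt_or_ge (j + 1) n with h | h
    · rw [if_pos h]
      have : Commute (s n i) (s n j) := s_comm hij
      exact this.inv_inv
    · rw [if_neg (by omega)]
      have h1 : Commute (s n i) (s n (n - 1)) := s_comm (by omega)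
      have h2 : Commute (s n i) (dl n (n - 1)) := s_comm_dl_lt (by omega) (by omega)
      exact (h2.mul_right h1).inv_left

/-- The twisted inversion endomorphism. -/
noncomputable def muHom (n : ℕ) : ArtinB n →* ArtinB n := liftB _ (isBSeq_mu n)

theorem muHom_s {i : ℕ} (h : i + 1 < n) : muHom n (s n i) = (s n i)⁻¹ := by
  rw [muHom, liftB_s _ _ (by omega), if_pos h]

theorem muHom_last (h : 0 < n) : muHom n (s n (n - 1)) = dl n (n - 1) * s n (n - 1) := by
  rw [muHom, liftB_s _ _ (by omega), if_neg (by omega)]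

theorem muHom_dl {q : ℕ} (hq : q < n) : muHom n (dl n q) = (dl n q)⁻¹ := by
  induction q with
  | zero => simp [dl_zero]
  | succ q ih => rw [dl_succ hq, map_mul, map_mul, ih (by omega), muHom_s hq]; group

theorem muHom_muHom (g : ArtinB n) : muHom n (muHom n g) = g := by
  have : (muHom n).comp (muHom n) = MonoidHom.id _ := by
    apply hom_ext
    intro i hi
    rcases Nat.lt_or_ge (i + 1) n with h | h
    · simp [muHom_s h]
    · obtain rfl : i = n - 1 := by omega
      rw [MonoidHom.comp_apply, muHom_last (by omega), map_mul, muHom_dl (by omega),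
        muHom_last (by omega)]
      simp
  exact DFunLike.congr_fun this g

/-- The automorphism `μ`. -/
noncomputable def mu (n : ℕ) : MulAut (ArtinB n) where
  toFun := muHom n
  invFun := muHom n
  left_inv := muHom_muHom
  right_inv := muHom_muHom
  map_mul' := map_mul _

theorem mu_s {i : ℕ} (h : i + 1 < n) : mu n (s n i) = (s n i)⁻¹ := muHom_s h

theorem mu_last (h : 0 < n) : mu n (s n (n - 1)) = dl n (n - 1) * s n (n - 1) := muHom_last h

theorem mu_mu (g : ArtinB n) : mu n (mu n g) = g := muHom_muHom g

theorem cp_add (a m k : ℕ) : cp a (m + k) = cp a m * cp (a + m) k := by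
  induction k with
  | zero => simp [cp_zero]
  | succ k ih => rw [← add_assoc, cp_succ, ih, cp_succ, mul_assoc, add_assoc]

theorem map_cp_eq_one {H : Type*} [Group H] (L : F →* H) {a m : ℕ}
    (h : ∀ p, a ≤ p → p < a + m → L (x p) = 1) : L (cp a m) = 1 := by
  induction m with
  | zero => simp [cp_zero]
  | succ m ih =>
    rw [cp_succ, map_mul, ih fun p h1 h2 => h p h1 (by omega), h _ (by omega) (by omega), one_mul]

theorem map_cp_two {H : Type*} [Group H] (L : F →* H) {i j m : ℕ} (hij : i < j) (hj : j < m)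
    (h : ∀ p, p < m → p ≠ i → p ≠ j → L (x p) = 1) : L (cp 0 m) = L (x i) * L (x j) := by
  obtain ⟨k, rfl⟩ := Nat.exists_eq_add_of_lt hij
  obtain ⟨l, rfl⟩ := Nat.exists_eq_add_of_lt hj
  have e : cp 0 (i + k + 1 + l + 1) =
      cp 0 i * (x i * cp (i + 1) k) * (x (i + k + 1) * cp (i + k + 1 + 1) l) := by
    rw [← cp_succ', ← cp_succ', add_assoc (i + k + 1), add_assoc i k 1, cp_add, cp_add]
    simp
  rw [e]
  simp only [map_mul]
  rw [map_cp_eq_one L fun p _ _ => h p (by omega) (by omega) (by omega),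
    map_cp_eq_one L (a := i + 1) fun p _ _ => h p (by omega) (by omega) (by omega),
    map_cp_eq_one L (a := i + k + 1 + 1) fun p _ _ => h p (by omega) (by omega) (by omega)]
  simp

theorem jh_ι_mem_P {q : ℕ} (hq : q ≤ n) (w : F) : ((jh n q).comp (ι q)) w ∈ P n := by
  rw [P_eq_PA]; exact PA_mono hq (V_le_PA le_rfl (jh_mem_V q w))

theorem coe_aP_lt {i j : ℕ} (hij : i < j) (hj : j ≤ n) : (aP n i j : ArtinB n) = A n i j := by
  rw [coe_aP hij.ne (by omega) hj, AA_of_lt hij]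

theorem dl_mul_s_mem_P (hn : 0 < n) : dl n (n - 1) * s n (n - 1) ∈ P n :=
  mul_mem (jh_ι_mem_P (by omega) _) (s_last_mem_P (by omega))

theorem quo_dl_last (hn : 5 ≤ n) {ψ : MulAut (ArtinB n)} (hc : (polar hn ψ).card = 3)
    {p : P n} (hp : (p : ArtinB n) = dl n (n - 1) * s n (n - 1)) : quo hn ψ p = 1 := by
  obtain h | ⟨i, j, hij, h, -⟩ | ⟨i, j, k, hij, hjk, hpol, htri, he, hs⟩ := polar_cases hn ψ
  · rw [h] at hc; simp at hc
  · rw [h, Finset.card_pair hij.ne] at hc; omega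
  let L : F →* F := (quo hn ψ).comp (((jh n (n - 1)).comp (ι (n - 1))).codRestrict (P n)
    (jh_ι_mem_P (by omega)))
  have hL : ∀ p < n - 1, L (x p) = qa hn ψ p (n - 1) := fun p hp =>
    quo_congr hn (by rw [coe_aP_lt hp (by omega)]; rfl)
  have h1 : quo hn ψ p = L (cp 0 (n - 1)) * qa hn ψ (n - 1 : ℕ) n := by
    change _ = quo hn ψ _ * quo hn ψ _
    rw [← map_mul]
    refine quo_congr hn ?_
    rw [hp, Subgroup.coe_mul, coe_aP_pole (by omega), ι_last (by omega)]; rfl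
  have hk := k.2
  rcases Nat.lt_or_ge k (n - 1) with hk1 | hk1
  · have h2 : ∀ q, q ≤ n → q ≠ n - 1 → qa hn ψ q (n - 1) = 1 := by
      intro q hq h3
      by_contra h4
      have := (hs q (n - 1) hq (by omega) h3 h4).2
      have : (i : ℕ) < j := hij
      have : (j : ℕ) < k := hjk
      omega
    rw [h1, map_cp_eq_one L fun q _ hq => by rw [hL q (by omega), h2 q (by omega) (by omega)],
      (isPureSys_qa hn ψ).symm, h2 n le_rfl (by omega), one_mul]
  · have hkn : (k : ℕ) = n - 1 := by omega
    have hij' : (i : ℕ) < j := hij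
    have hjk' : (j : ℕ) < k := hjk
    rw [h1, map_cp_two L hij' (by omega) ?_, hL _ (by omega), hL _ (by omega), ← hkn, he]
    · exact htri.prod
    · intro q hq h3 h4
      rw [hL q hq]
      by_contra h5
      have := (hs q (n - 1) (by omega) (by omega) (by omega) h5).1
      omega

theorem exists_conj_last {i : ℕ} (hi : i < n) :
    ∃ g, ι n (x i) = g * s n (n - 1) * g⁻¹ := by
  obtain ⟨m, hm⟩ := Nat.exists_eq_add_of_lt hi
  clear hi
  induction m generalizing i with
  | zero => exact ⟨1, by rw [ι_last (by omega), show n - 1 = i by omega]; simp⟩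
  | succ m ih =>
    obtain ⟨g, hg⟩ := @ih (i + 1) (by omega)
    exact ⟨(s _ i)⁻¹ * g, by rw [ι_succ (by omega), hg]; group⟩

theorem quo_mu (hn : 5 ≤ n) {φ : MulAut (ArtinB n)} (hc : (polar hn φ).card = 3) {p : P n}
    (hp : (p : ArtinB n) ∈ U n) : quo hn (φ * mu n) p = 1 := by
  refine polar_empty hn (Finset.eq_empty_of_forall_notMem fun i hi => ?_) hp
  rw [mem_polar] at hi
  obtain ⟨g, hg⟩ := exists_conj_last i.2
  refine hi ?_
  rw [← quo_dl_last hn (ψ := φ * MulAut.conj (mu n g)) (by rw [card_polar_conj, hc])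
    (p := ⟨_, dl_mul_s_mem_P (by omega)⟩) rfl]
  refine quo_congr hn ?_
  rw [coe_aP_pole i.2, hg, MulAut.mul_apply, MulAut.mul_apply, MulAut.conj_apply, map_mul (mu n),
    map_mul (mu n), mu_last (by omega), map_inv]

theorem expo_x (p i : ℕ) : expo p (x i) = Multiplicative.ofAdd (if i = p then (1 : ℤ) else 0) :=
  expo_of _ _

theorem exists_fix_P {g : ArtinB n} (hg : g ∈ P n) {q : ℕ} (hq : q < n) :
    ∃ v ∈ Fs n, Θ n g (x q) = v * x q * v⁻¹ := by
  obtain ⟨v, hv, e⟩ := Θ_x g q hq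
  rw [mem_P.1 hg] at e
  exact ⟨v, hv, e⟩

theorem expo_Θ_P {g : ArtinB n} (hg : g ∈ P n) (p : ℕ) {w : F} (hw : w ∈ Fs n) :
    expo p (Θ n g w) = expo p w := by
  refine Fs_eqOn (f := (expo p).comp (Θ n g).toMonoidHom) (fun i hi => ?_) hw
  obtain ⟨v, hv, e⟩ := exists_fix_P hg hi
  change expo p (Θ n g (x i)) = _
  rw [e]; simp

/-- The exponents of the conjugators. -/
theorem exists_link (n : ℕ) {p q : ℕ} (hpq : p ≠ q) (hq : q < n) :
    ∃ f : P n →* Multiplicative ℤ, ∀ g : P n, ∃ v ∈ Fs n, Θ n g (x q) = v * x q * v⁻¹ ∧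
      f g = expo p v := by
  refine exists_hom_of_rel (fun (g : P n) m => ∃ v ∈ Fs n, Θ n g (x q) = v * x q * v⁻¹ ∧
      m = expo p v) ?_ ?_ ?_
  · rintro ⟨g, hg⟩
    obtain ⟨v, hv, e⟩ := exists_fix_P hg hq
    exact ⟨_, v, hv, e, rfl⟩
  · rintro g _ _ ⟨v, hv, e, rfl⟩ ⟨v', hv', e', rfl⟩
    have h : x q * (v⁻¹ * v') = (v⁻¹ * v') * x q := by
      rw [e] at e'
      calc x q * (v⁻¹ * v') = v⁻¹ * (v * x q * v⁻¹) * v' := by group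
        _ = _ := by rw [e']; group
    have h2 := eq_zpow_of_commute (expo q) (by rw [expo_x]; simp) h
    have h3 := congrArg (expo p) h2
    rw [map_mul, map_zpow, expo_x, if_neg (Ne.symm hpq), ofAdd_zero, one_zpow, map_inv,
      inv_mul_eq_one] at h3
    exact h3
  · rintro ⟨g, hg⟩ ⟨g', hg'⟩ _ _ ⟨v, hv, e, rfl⟩ ⟨v', hv', e', rfl⟩
    refine ⟨Θ n g v' * v, mul_mem (Θ_mem_Fs g hv') hv, ?_, ?_⟩
    · change Θ n (g * g') (x q) = _
      change Θ n g (x q) = _ at e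
      change Θ n g' (x q) = _ at e'
      rw [map_mul, MulAut.mul_apply, e', map_mul, map_mul, e, map_inv]; group
    · rw [map_mul, expo_Θ_P hg p hv', mul_comm]

/-- The linking exponent of the strand `p` in the conjugator of the strand `q`. -/
noncomputable def lk (n p q : ℕ) : Additive (P n) →+ ℤ :=
  if h : p ≠ q ∧ q < n then MonoidHom.toAdditiveLeft (exists_link n h.1 h.2).choose else 0

theorem lk_self (p : ℕ) : lk n p p = 0 := by simp [lk]

theorem lk_eq {p q : ℕ} (hpq : p ≠ q) (hq : q < n) {g : P n} {v : F}
    (hv : Θ n g (x q) = v * x q * v⁻¹) : lk n p q (Additive.ofMul g) = (expo p v).toAdd := by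
  rw [lk, dif_pos ⟨hpq, hq⟩]
  obtain ⟨v', hv', e, h⟩ := (exists_link n hpq hq).choose_spec g
  change Multiplicative.toAdd ((exists_link n hpq hq).choose g) = _
  rw [h]
  rw [hv] at e
  have h1 : x q * (v⁻¹ * v') = (v⁻¹ * v') * x q := by
    calc x q * (v⁻¹ * v') = v⁻¹ * (v * x q * v⁻¹) * v' := by group
      _ = _ := by rw [e]; group
  have h2 := eq_zpow_of_commute (expo q) (by rw [expo_x]; simp) h1
  have h3 := congrArg (expo p) h2
  rw [map_mul, map_zpow, expo_x, if_neg (Ne.symm hpq), ofAdd_zero, one_zpow, map_inv,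
    inv_mul_eq_one] at h3
  rw [h3]

theorem lk_pole {p q i : ℕ} (hi : i < n) (hq : q < n) :
    lk n p q (Additive.ofMul (aP n i n)) = if p = i ∧ p ≠ q then 1 else 0 := by
  rcases eq_or_ne p q with rfl | h
  · simp [lk_self]
  · rw [lk_eq h hq (v := x i) (by rw [coe_aP_pole hi, Θ_ι_x hi]; rfl), expo_x]
    simp [h, eq_comm]

theorem lk_lt {p q i j : ℕ} (hij : i < j) (hj : j < n) (hq : q < n) :
    lk n p q (Additive.ofMul (aP n i j)) =
      if (p = i ∧ q = j) ∨ (p = j ∧ q = i) then -1 else 0 := by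
  rcases eq_or_ne p q with rfl | h
  · simp only [lk_self, AddMonoidHom.zero_apply]; rw [if_neg (by omega)]
  obtain ⟨h1, h2, h3, h4⟩ := Θ_A hij hj
  rw [← coe_aP_lt hij hj.le] at h1 h2 h3 h4
  rcases eq_or_ne q i with rfl | hi
  · rw [lk_eq h hq (v := (x q * x j)⁻¹) (by rw [h1]; group)]
    simp only [map_inv, map_mul, expo_x, toAdd_inv, toAdd_mul, toAdd_ofAdd]
    rcases eq_or_ne j p with rfl | h'
    · simp [hij.ne]
    · rw [if_neg h', if_neg (Ne.symm h), if_neg (by omega)]; simp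
  rcases eq_or_ne q j with rfl | hj'
  · rw [lk_eq h hq (v := (x i * x q)⁻¹) (by rw [h2]; group)]
    simp only [map_inv, map_mul, expo_x, toAdd_inv, toAdd_mul, toAdd_ofAdd]
    rcases eq_or_ne i p with rfl | h'
    · simp [hij.ne']
    · rw [if_neg h', if_neg (Ne.symm h), if_neg (by omega)]; simp
  rw [if_neg (by omega)]
  by_cases hc : i < q ∧ q < j
  · rw [lk_eq h hq (h3 q hc.1 hc.2)]
    simp only [map_inv, map_mul, toAdd_inv, toAdd_mul]; omega
  · rw [lk_eq h hq (v := 1) (by rw [h4 q (by omega)]; simp)]; simp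

/-- The exponent sum of the last generator on the pure subgroup. -/
noncomputable def wtP (n : ℕ) : Additive (P n) →+ ℤ :=
  MonoidHom.toAdditiveLeft ((wt n).comp (P n).subtype)

theorem wtP_apply (g : P n) : wtP n (Additive.ofMul g) = (wt n g).toAdd := rfl

theorem wt_A {i j : ℕ} (hij : i < j) (hj : j < n) : wt n (A n i j) = 1 := by
  obtain ⟨m, rfl⟩ := Nat.exists_eq_add_of_lt hij
  clear hij
  induction m generalizing i with
  | zero => rw [A_last (by omega), map_pow, wt_lt (by omega), one_pow]
  | succ m ih =>
    have := @ih (i + 1) (by omega)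
    rw [show i + 1 + m + 1 = i + (m + 1) + 1 by omega] at this
    rw [A_succ (by omega) (by omega), map_mul, map_mul, this, map_inv, wt_lt (by omega)]
    simp

theorem wtP_lt {i j : ℕ} (hij : i < j) (hj : j < n) : wtP n (Additive.ofMul (aP n i j)) = 0 := by
  rw [wtP_apply, coe_aP_lt hij hj.le, wt_A hij hj]; rfl

theorem wtP_pole {i : ℕ} (hi : i < n) : wtP n (Additive.ofMul (aP n i n)) = 1 := by
  obtain ⟨g, hg⟩ := exists_conj_last hi
  rw [wtP_apply, coe_aP_pole hi, hg, map_mul (wt n), map_mul (wt n), map_inv (wt n),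
    wt_last (by omega)]
  simp

theorem addHom_ext_aP {f g : Additive (P n) →+ ℤ}
    (h1 : ∀ i < n, f (Additive.ofMul (aP n i n)) = g (Additive.ofMul (aP n i n)))
    (h2 : ∀ i j, i < j → j < n → f (Additive.ofMul (aP n i j)) = g (Additive.ofMul (aP n i j))) :
    f = g := by
  apply MonoidHom.toAdditiveLeft.symm.injective
  apply hom_ext_aP
  intro i j hij hj
  rcases hj.lt_or_eq with h | rfl
  · exact congrArg Multiplicative.ofAdd (h2 i j hij h)
  · exact congrArg Multiplicative.ofAdd (h1 i hij)

/-- `n` times the exponent sum of the pole generator of the strand `p`. -/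
noncomputable def poleSum (n p : ℕ) : Additive (P n) →+ ℤ :=
  wtP n + ∑ q ∈ Finset.range n, (lk n p q - lk n q p)

theorem poleSum_pole {p i : ℕ} (hi : i < n) (hp : p < n) :
    poleSum n p (Additive.ofMul (aP n i n)) = if p = i then (n : ℤ) else 0 := by
  simp only [poleSum, AddMonoidHom.add_apply, AddMonoidHom.finsetSum_apply, AddMonoidHom.sub_apply,
    wtP_pole hi, lk_pole hi hp]
  rw [Finset.sum_congr rfl (g := fun q => (if p = i then (1 : ℤ) else 0) - if q = i then 1 else 0)]
  · rw [Finset.sum_sub_distrib, Finset.sum_ite_eq']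
    simp [hi]
  · intro q hq
    rw [lk_pole hi (Finset.mem_range.1 hq)]
    by_cases h1 : p = i <;> by_cases h2 : q = i <;> by_cases h3 : p = q <;> simp [h1, h2, h3]
      <;> omega

theorem poleSum_lt {p i j : ℕ} (hij : i < j) (hj : j < n) (hp : p < n) :
    poleSum n p (Additive.ofMul (aP n i j)) = 0 := by
  simp only [poleSum, AddMonoidHom.add_apply, AddMonoidHom.finsetSum_apply, AddMonoidHom.sub_apply,
    wtP_lt hij hj]
  rw [zero_add, Finset.sum_eq_zero]
  intro q hq
  rw [lk_lt hij hj (Finset.mem_range.1 hq), lk_lt hij hj hp]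
  split_ifs <;> omega

theorem smul_eq_sum (χ : Additive (P n) →+ ℤ) : (n : ℤ) • χ =
    (∑ p ∈ Finset.range n, χ (Additive.ofMul (aP n p n)) • poleSum n p) +
    ∑ p ∈ Finset.range n, ∑ q ∈ Finset.range n,
      (if p < q then χ (Additive.ofMul (aP n p q)) else 0) •
      (poleSum n p - (n : ℤ) • lk n p q) := by
  apply addHom_ext_aP
  · intro i hi
    simp only [AddMonoidHom.add_apply, AddMonoidHom.finsetSum_apply, AddMonoidHom.smul_apply,
      AddMonoidHom.sub_apply]
    rw [Finset.sum_eq_single i, Finset.sum_eq_zero, poleSum_pole hi hi]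
    · simp [mul_comm]
    · intro p hp
      refine Finset.sum_eq_zero fun q hq => ?_
      rw [poleSum_pole hi (Finset.mem_range.1 hp), lk_pole hi (Finset.mem_range.1 hq)]
      by_cases h : p < q
      · by_cases h2 : p = i <;> simp [h2, h.ne]
        intro; omega
      · simp [h]
    · intro p hp h
      rw [poleSum_pole hi (Finset.mem_range.1 hp)]; simp [h]
    · intro h; exact absurd (Finset.mem_range.2 hi) h
  · intro i j hij hj
    simp only [AddMonoidHom.add_apply, AddMonoidHom.finsetSum_apply, AddMonoidHom.smul_apply,
      AddMonoidHom.sub_apply]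
    rw [Finset.sum_eq_zero, Finset.sum_eq_single i, Finset.sum_eq_single j,
      poleSum_lt hij hj (by omega),
      lk_lt hij hj hj]
    · simp [hij, mul_comm]
    · intro q hq h
      rw [poleSum_lt hij hj (by omega), lk_lt hij hj (Finset.mem_range.1 hq),
        if_neg (by omega : ¬ (i = i ∧ q = j ∨ i = j ∧ q = i))]; simp
    · intro h; exact absurd (Finset.mem_range.2 hj) h
    · intro p hp h
      refine Finset.sum_eq_zero fun q hq => ?_
      rw [poleSum_lt hij hj (Finset.mem_range.1 hp), lk_lt hij hj (Finset.mem_range.1 hq)]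
      by_cases h' : p < q
      · rw [if_neg (by omega : ¬ (p = i ∧ q = j ∨ p = j ∧ q = i))]; simp
      · simp [h']
    · intro h; exact absurd (Finset.mem_range.2 (hij.trans hj)) h
    · intro p hp
      rw [poleSum_lt hij hj (Finset.mem_range.1 hp)]; simp

/-- A homomorphism vanishing on a central element with unlinked strands. -/
theorem apply_mul_wtP (χ : Additive (P n) →+ ℤ) (hn : 0 < n) {z d : Additive (P n)}
    (hz : ∀ p q, p ≠ q → p < n → q < n → lk n p q z = 0)
    (hd : ∀ p q, p ≠ q → p < n → q < n → lk n p q d = 0) :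
    wtP n z * χ d = wtP n d * χ z := by
  have h0 : ∀ z : Additive (P n), (∀ p q, p ≠ q → p < n → q < n → lk n p q z = 0) →
      ∀ p q, p < n → q < n → lk n p q z = 0 := by
    intro z h p q hp hq
    rcases eq_or_ne p q with rfl | h'
    · rw [lk_self]; rfl
    · exact h p q h' hp hq
  have h1 : ∀ z : Additive (P n), (∀ p q, p ≠ q → p < n → q < n → lk n p q z = 0) →
      ∀ p < n, poleSum n p z = wtP n z := by
    intro z h p hp
    simp only [poleSum, AddMonoidHom.add_apply, AddMonoidHom.finsetSum_apply,
      AddMonoidHom.sub_apply]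
    rw [Finset.sum_eq_zero, add_zero]
    intro q hq
    rw [h0 z h p q hp (Finset.mem_range.1 hq), h0 z h q p (Finset.mem_range.1 hq) hp, sub_zero]
  have h2 : ∃ S : ℤ, ∀ z : Additive (P n),
      (∀ p q, p ≠ q → p < n → q < n → lk n p q z = 0) → (n : ℤ) * χ z = S * wtP n z := by
    refine ⟨(∑ p ∈ Finset.range n, χ (Additive.ofMul (aP n p n))) +
      ∑ p ∈ Finset.range n, ∑ q ∈ Finset.range n,
        (if p < q then χ (Additive.ofMul (aP n p q)) else 0), fun z h => ?_⟩
    have := DFunLike.congr_fun (smul_eq_sum χ) z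
    simp only [AddMonoidHom.add_apply, AddMonoidHom.finsetSum_apply, AddMonoidHom.smul_apply,
      AddMonoidHom.sub_apply, smul_eq_mul] at this
    rw [this, add_mul, Finset.sum_mul, Finset.sum_mul]
    congr 1
    · exact Finset.sum_congr rfl fun p hp => by rw [h1 z h p (Finset.mem_range.1 hp)]
    · refine Finset.sum_congr rfl fun p hp => ?_
      rw [Finset.sum_mul]
      refine Finset.sum_congr rfl fun q hq => ?_
      rw [h1 z h p (Finset.mem_range.1 hp),
        h0 z h p q (Finset.mem_range.1 hp) (Finset.mem_range.1 hq), mul_zero, sub_zero]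
  obtain ⟨S, hS⟩ := h2
  have e1 := hS z hz
  have e2 := hS d hd
  have hn' : (n : ℤ) ≠ 0 := by exact_mod_cast hn.ne'
  apply mul_left_cancel₀ hn'
  linear_combination (wtP n z) * e2 - (wtP n d) * e1

/-- A homomorphism supported on a triangle with a vertex at the pole. -/
theorem eq_lk_of_triangle {i j : ℕ} (hij : i < j) (hj : j < n) (χ : Additive (P n) →+ ℤ)
    (h : χ (Additive.ofMul (aP n i n)) + χ (Additive.ofMul (aP n j n)) +
      χ (Additive.ofMul (aP n i j)) = 0)
    (hs : ∀ p q, p < q → q ≤ n → χ (Additive.ofMul (aP n p q)) ≠ 0 →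
      (p = i ∨ p = j ∨ p = n) ∧ (q = i ∨ q = j ∨ q = n)) :
    χ = χ (Additive.ofMul (aP n i n)) • lk n i j + χ (Additive.ofMul (aP n j n)) • lk n j i := by
  apply addHom_ext_aP
  · intro k hk
    simp only [AddMonoidHom.add_apply, AddMonoidHom.smul_apply, smul_eq_mul,
      lk_pole hk hj, lk_pole hk (hij.trans hj)]
    rcases eq_or_ne k i with rfl | h1
    · simp [hij.ne, hij.ne']
    rcases eq_or_ne k j with rfl | h2
    · simp [hij.ne, hij.ne']
    have : χ (Additive.ofMul (aP n k n)) = 0 := by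
      by_contra h3
      have := hs k n hk le_rfl h3
      omega
    simp [this, Ne.symm h1, Ne.symm h2]
  · intro k l hkl hl
    simp only [AddMonoidHom.add_apply, AddMonoidHom.smul_apply, smul_eq_mul,
      lk_lt hkl hl hj, lk_lt hkl hl (hij.trans hj)]
    by_cases h1 : k = i ∧ l = j
    · obtain ⟨rfl, rfl⟩ := h1
      simp; linarith
    have : χ (Additive.ofMul (aP n k l)) = 0 := by
      by_contra h3
      have := hs k l hkl hl.le h3
      omega
    rw [this, if_neg (by omega), if_neg (by omega)]; simp

theorem lk_eq_zero_of_triangle (hn : 5 ≤ n) {ψ : MulAut (ArtinB n)} {i j : Fin n} (hij : i < j)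
    (ht : Tri n (qa hn ψ) i j n)
    (hs : ∀ p q, p ≤ n → q ≤ n → p ≠ q → qa hn ψ p q ≠ 1 →
        (p = i ∨ p = j ∨ p = n) ∧ (q = i ∨ q = j ∨ q = n)) {z : P n} (hz : quo hn ψ z = 1) :
    lk n i j (Additive.ofMul z) = 0 ∧ lk n j i (Additive.ofMul z) = 0 := by
  obtain ⟨d₁, d₂, hd⟩ := exists_det_ne_zero (u := qa hn ψ i j) (v := qa hn ψ j n) ht.ne
  let K := Subgroup.closure ({qa hn ψ i j, qa hn ψ j n} : Set F)
  have hu : qa hn ψ i j ∈ K := Subgroup.subset_closure (by simp)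
  have hv : qa hn ψ j n ∈ K := Subgroup.subset_closure (by simp)
  have hw : qa hn ψ i n = (qa hn ψ i j)⁻¹ * (qa hn ψ j n)⁻¹ := by
    have := ht.prod
    rw [mul_assoc, mul_eq_one_iff_eq_inv] at this
    rw [this]; group
  have hw' : qa hn ψ i n ∈ K := by rw [hw]; exact mul_mem (inv_mem hu) (inv_mem hv)
  have hij' : (i : ℕ) < j := hij
  have hr : ∀ p, quo hn ψ p ∈ K := by
    intro p
    have hp : p ∈ Subgroup.closure {g | ∃ i j, i < j ∧ j ≤ n ∧ g = aP n i j} := by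
      rw [closure_aP]; trivial
    refine (Subgroup.closure_le (K.comap (quo hn ψ))).2 ?_ hp
    rintro _ ⟨k, l, hkl, hl, rfl⟩
    change qa hn ψ k l ∈ K
    by_cases h1 : qa hn ψ k l = 1
    · rw [h1]; exact one_mem _
    have h2 := hs k l (by omega) hl hkl.ne h1
    have : (k = i ∧ l = j) ∨ (k = i ∧ l = n) ∨ (k = j ∧ l = n) := by omega
    rcases this with ⟨rfl, rfl⟩ | ⟨rfl, rfl⟩ | ⟨rfl, rfl⟩ <;> assumption
  let f : P n →* K := (quo hn ψ).codRestrict K hr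
  have key : ∀ d : K →* Multiplicative ℤ,
      (d ⟨_, hu⟩).toAdd * lk n i j (Additive.ofMul z) +
      (d ⟨_, hv⟩).toAdd * (lk n i j (Additive.ofMul z) - lk n j i (Additive.ofMul z)) = 0 := by
    intro d
    let χ : Additive (P n) →+ ℤ := MonoidHom.toAdditiveLeft (d.comp f)
    have h1 : χ (Additive.ofMul (aP n i j)) = (d ⟨_, hu⟩).toAdd := rfl
    have h2 : χ (Additive.ofMul (aP n j n)) = (d ⟨_, hv⟩).toAdd := rfl
    have h3 : χ (Additive.ofMul (aP n i n)) = -(d ⟨_, hu⟩).toAdd - (d ⟨_, hv⟩).toAdd := by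
      change (d ⟨_, hw'⟩).toAdd = _
      have : (⟨_, hw'⟩ : K) = ⟨_, hu⟩⁻¹ * ⟨_, hv⟩⁻¹ := Subtype.ext hw
      rw [this, map_mul, map_inv, map_inv, toAdd_mul, toAdd_inv, toAdd_inv]; ring
    have h4 := eq_lk_of_triangle hij' j.2 χ (by rw [h1, h2, h3]; ring) fun p q hpq hq h =>
      hs p q (by omega) hq hpq.ne fun h' => h (by
        change (d ⟨quo hn ψ (aP n p q), hr _⟩).toAdd = 0
        rw [show (⟨quo hn ψ (aP n p q), hr _⟩ : K) = 1 from Subtype.ext h', map_one]; rfl)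
    have h5 := DFunLike.congr_fun h4 (Additive.ofMul z)
    have h6 : χ (Additive.ofMul z) = 0 := by
      change (d ⟨quo hn ψ z, hr z⟩).toAdd = 0
      rw [show (⟨quo hn ψ z, hr z⟩ : K) = 1 from Subtype.ext hz, map_one]; rfl
    rw [h6, h2, h3] at h5
    simp only [AddMonoidHom.add_apply, AddMonoidHom.smul_apply, smul_eq_mul] at h5
    linarith
  have k1 := key d₁
  have k2 := key d₂
  set a := lk n i j (Additive.ofMul z)
  set b := lk n j i (Additive.ofMul z)
  have ha : a = 0 := by
    apply (mul_eq_zero.1 _).resolve_left hd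
    linear_combination (d₂ ⟨_, hv⟩).toAdd * k1 - (d₁ ⟨_, hv⟩).toAdd * k2
  have hb : a - b = 0 := by
    apply (mul_eq_zero.1 _).resolve_left hd
    linear_combination (d₁ ⟨_, hu⟩).toAdd * k2 - (d₂ ⟨_, hu⟩).toAdd * k1
  exact ⟨ha, by omega⟩

theorem exists_perm_pair {α : Type*} [DecidableEq α] {a b i j : α} (hab : a ≠ b) (hij : i ≠ j) :
    ∃ π : Equiv.Perm α, π a = i ∧ π b = j := by
  refine ⟨Equiv.swap (Equiv.swap a i b) j * Equiv.swap a i, ?_, ?_⟩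
  · rw [Equiv.Perm.mul_apply, Equiv.swap_apply_left, Equiv.swap_apply_of_ne_of_ne]
    · intro h
      have := congrArg (Equiv.swap a i) h
      simp at this
      exact hab this
    · exact hij
  · rw [Equiv.Perm.mul_apply, Equiv.swap_apply_left]

theorem lk_ΔB {p q : ℕ} (hpq : p ≠ q) (hq : q < n) :
    lk n p q (Additive.ofMul ⟨ΔB n, ΔB_mem_P⟩) = 0 := by
  rw [lk_eq hpq hq (v := 1) (by simpa using Θ_ΔB hq)]; simp

theorem card_polar_ne_two (hn : 5 ≤ n) (φ : MulAut (ArtinB n)) : (polar hn φ).card ≠ 2 := by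
  intro hc
  obtain ⟨i, j, hij, hpol⟩ := Finset.card_eq_two.1 hc
  have hA : φ⁻¹ (aP n 0 n : P n) ∈ P n := aut_mem_P hn _ (aP n 0 n).2
  set z : P n := ⟨_, hA⟩ with hz
  have hz1 : ∀ g, quo hn (φ * MulAut.conj g) z = 1 := by
    intro g
    refine quo_eq_one_of_mem_U hn _ ?_
    rw [MulAut.mul_apply, MulAut.conj_apply, map_mul, map_mul, hz, map_inv]
    change φ g * φ (φ⁻¹ _) * _ ∈ _
    rw [MulAut.apply_inv_self, coe_aP_pole (by omega), ← ι_Θ]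
    exact ι_mem_U _
  have hlk' : ∀ a b : Fin n, a < b → lk n a b (Additive.ofMul z) = 0 ∧
      lk n b a (Additive.ofMul z) = 0 := by
    intro a b hab
    obtain ⟨π, ha, hb⟩ := exists_perm_pair hab.ne hij
    obtain ⟨g, rfl⟩ := σ_surjective (by omega) π
    have hp : polar hn (φ * MulAut.conj g) = {a, b} := by
      ext k
      rw [mem_polar_conj, hpol, ← ha, ← hb]; simp
    obtain h | ⟨i', j', hij', h, ht, hs⟩ | ⟨i', j', k', h1, h2, h, -⟩ :=
      polar_cases hn (φ * MulAut.conj g)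
    · rw [h] at hp; simpa using hp.symm
    · rw [hp] at h
      have e : i' = a ∧ j' = b := by
        have h1 : i' ∈ ({a, b} : Finset (Fin n)) := by rw [h]; simp
        have h2 : j' ∈ ({a, b} : Finset (Fin n)) := by rw [h]; simp
        simp only [Finset.mem_insert, Finset.mem_singleton] at h1 h2
        have := hab.le
        rcases h1 with rfl | rfl <;> rcases h2 with rfl | rfl
        · exact absurd hij' (lt_irrefl _)
        · exact ⟨rfl, rfl⟩
        · exact absurd hij' hab.le.not_gt
        · exact absurd hij' (lt_irrefl _)
      obtain ⟨rfl, rfl⟩ := e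
      exact lk_eq_zero_of_triangle hn hab ht hs (hz1 g)
    · rw [h] at hp
      have := congrArg Finset.card hp
      rw [Finset.card_pair hab.ne, Finset.card_eq_three.2
        ⟨i', j', k', h1.ne, (h1.trans h2).ne, h2.ne, rfl⟩] at this
      omega
  have hlk : ∀ p q, p ≠ q → p < n → q < n → lk n p q (Additive.ofMul z) = 0 := by
    intro p q hpq hp hq
    rcases hpq.lt_or_gt with h | h
    · exact (hlk' ⟨p, hp⟩ ⟨q, hq⟩ h).1
    · exact (hlk' ⟨q, hq⟩ ⟨p, hp⟩ h).2
  let χ : Additive (P n) →+ ℤ := (lk n 0 1).comp (MonoidHom.toAdditive (resP hn φ))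
  obtain ⟨k, hk⟩ := exists_zpow_of_central (n := n) (by omega) (z := φ (ΔB n)) (fun g => by
    have := congrArg φ (ΔB_central (φ⁻¹ g))
    rwa [map_mul, map_mul, MulAut.apply_inv_self] at this)
  have h1 := apply_mul_wtP χ (by omega) hlk fun p q hpq _ hq => lk_ΔB hpq hq
  have h2 : χ (Additive.ofMul ⟨ΔB n, ΔB_mem_P⟩) = 0 := by
    change lk n 0 1 (Additive.ofMul (resP hn φ ⟨ΔB n, ΔB_mem_P⟩)) = 0
    rw [show resP hn φ ⟨ΔB n, ΔB_mem_P⟩ = ⟨ΔB n, ΔB_mem_P⟩ ^ k from Subtype.ext (by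
      rw [coe_resP, hk]; rfl), ofMul_zpow, map_zsmul, lk_ΔB (by omega) (by omega), smul_zero]
  have h3 : χ (Additive.ofMul z) = 1 := by
    change lk n 0 1 (Additive.ofMul (resP hn φ z)) = 1
    rw [show resP hn φ z = aP n 0 n from Subtype.ext (by
      rw [coe_resP, hz]; exact MulAut.apply_inv_self _ _ _), lk_pole (by omega) (by omega)]
    simp
  have h4 : wtP n (Additive.ofMul ⟨ΔB n, ΔB_mem_P⟩) = n := by
    rw [wtP_apply]
    simpa using wt_ΔB (n := n) (by omega) 1
  rw [h2, h3, h4] at h1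
  omega

/-- After twisting, the projection to three strands kills the image of the fibre. -/
theorem quo_dichotomy (hn : 5 ≤ n) (φ : MulAut (ArtinB n)) :
    (∀ p : P n, (p : ArtinB n) ∈ U n → quo hn φ p = 1) ∨
    (∀ p : P n, (p : ArtinB n) ∈ U n → quo hn (φ * mu n) p = 1) := by
  obtain h | ⟨i, j, hij, h, -⟩ | ⟨i, j, k, h1, h2, h, -⟩ := polar_cases hn φ
  · exact .inl fun p hp => polar_empty hn h hp
  · exact absurd (by rw [h, Finset.card_pair hij.ne]) (card_polar_ne_two hn φ)
  · exact .inr fun p hp => quo_mu hn (by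
      rw [h]; exact Finset.card_eq_three.2 ⟨i, j, k, h1.ne, (h1.trans h2).ne, h2.ne, rfl⟩) hp

theorem fg_map {G H : Type*} [Group G] [Group H] {N : Subgroup G} (h : N.FG) (f : G →* H) :
    (N.map f).FG := by
  classical
  obtain ⟨S, rfl⟩ := h
  exact ⟨S.image f, by rw [Finset.coe_image, MonoidHom.map_closure]⟩

theorem κ_hur_ge {q i : ℕ} (h : q ≤ i) (w : F) : κ q (hur i w) = κ q w := by
  have : (κ q).comp (hur i).toMonoidHom = κ q := by
    apply fhom_ext; intro j
    show κ q (hur i (x j)) = κ q (x j)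
    rcases eq_or_ne j i with rfl | h1
    · rw [hur_self, κ_ge (by omega), κ_ge h]
    rcases eq_or_ne j (i + 1) with rfl | h2
    · rw [hur_succ]; simp only [map_mul, map_inv]
      rw [κ_ge (show q ≤ i + 1 by omega), κ_ge h]; simp
    rw [hur_ne h1 h2]
  exact DFunLike.congr_fun this w

theorem exists_shift {d : ℕ} (h : 2 + d < n) : ∃ g, pr n g = g ∧ Θ n g (x 2) = x (2 + d) ∧
    ∀ u, κ 2 (Θ n g u) = κ 2 u := by
  induction d with
  | zero => exact ⟨1, by simp, by simp, by simp⟩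
  | succ d ih =>
    obtain ⟨g, h1, h2, h3⟩ := ih (by omega)
    refine ⟨s n (2 + d) * g, by rw [map_mul, h1, pr_s (by omega)], ?_, fun u => ?_⟩
    · rw [map_mul, MulAut.mul_apply, h2, Θ_s (by omega), hur_self]; rfl
    · rw [map_mul, MulAut.mul_apply, Θ_s (by omega), κ_hur_ge (by omega), h3]

theorem eq_bot_of_push {N : Subgroup (ArtinB n)} (hn : 3 ≤ n) (hfg : N.FG) (hP : N ≤ PA n (n - 1))
    (hpush : ∀ m ∈ N, IsPush n 2 m 1) (hc : ∀ g, ∀ m ∈ N, pr n g * m * (pr n g)⁻¹ ∈ N) :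
    N = ⊥ := by
  have claim : ∀ k, 3 ≤ k → k ≤ n → ∀ m ∈ N, ∀ u, κ k (Θ n m u) = κ k u := by
    intro k hk
    induction k, hk using Nat.le_induction with
    | base =>
      intro hk m hm
      exact tower_step (k := 2) (by omega) hk (hP hm) (hpush m hm) (map_one _)
    | succ k hk ih =>
      intro hkn m hm
      have hrel : ∀ m : N, ∃ w, IsPush n k (m : ArtinB n) w ∧ w ∈ Fs k := by
        intro m
        obtain ⟨v, -, hv⟩ := exists_fix_P (P_eq_PA (n := n) ▸ PA_mono (by omega) (hP m.2))
          (show k < n by omega)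
        refine ⟨κ k v⁻¹, ⟨ih (by omega) m m.2, v, hv, ?_⟩, κ_mem _ _⟩
        rw [κ_κ le_rfl, map_inv, inv_inv]
      obtain ⟨f, hf⟩ := exists_hom_of_rel (fun (m : N) w => IsPush n k (m : ArtinB n) w ∧ w ∈ Fs k)
        hrel (fun g h h' h1 h2 => by
          rw [← κ_of_mem h1.2, ← κ_of_mem h2.2]; exact h1.1.unique h2.1)
        fun g g' h h' h1 h2 => ⟨h1.1.mul h2.1, mul_mem h1.2 h2.2⟩
      have huniq : ∀ (m : N) w, IsPush n k (m : ArtinB n) w → w ∈ Fs k → f m = w :=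
        fun m w h h' => by
        rw [← κ_of_mem h', ← κ_of_mem (hf m).2]; exact (hf m).1.unique h
      have hone : ∀ m, f m = 1 := by
        intro m
        by_contra hm1
        have : Group.FG N := (Group.fg_iff_subgroup_fg N).2 hfg
        have hfg' : f.range.FG := (Group.fg_iff_subgroup_fg _).1 (Group.fg_range f)
        have hconj : ∀ y ∈ Fs k, ∀ w ∈ f.range, y * w * y⁻¹ ∈ f.range := by
          rintro y hy _ ⟨m, rfl⟩
          have h1 := hc (jh n k (ι k y)) m m.2
          rw [pr_of_mem_PA (by omega) (V_le_PA (show k ≤ n - 1 by omega) (jh_mem_V k y))] at h1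
          refine ⟨⟨_, h1⟩, huniq _ _ ?_ (mul_mem (mul_mem hy (hf m).2) (inv_mem hy))⟩
          exact ((isPush_jh (by omega) hy).mul (hf m).1).mul (isPush_jh (by omega) hy).inv
        obtain ⟨j, hj, m, hjm⟩ := exists_pow_mem_of_fg hfg' (p := 0) (q := 1) (by omega)
          (hconj _ (x_mem_Fs (by omega))) (hconj _ (x_mem_Fs (by omega)))
          (fun w hw => by simpa using hconj _ (inv_mem (x_mem_Fs (show 1 < k by omega))) w hw)
          ⟨m, rfl⟩ hm1
        obtain ⟨d, rfl⟩ : ∃ d, k = 2 + d := ⟨k - 2, by omega⟩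
        obtain ⟨g, hg1, hg2, hg3⟩ := exists_shift (show 2 + d < n by omega)
        have hm' := hc g⁻¹ m m.2
        rw [map_inv, hg1, inv_inv] at hm'
        obtain ⟨-, v, hv, hv'⟩ := (hf m).1
        have h2 := hpush _ hm'
        have h3 : IsPush n 2 (g⁻¹ * m * g) (x 0 ^ j) := by
          refine ⟨h2.1, Θ n g⁻¹ v, ?_, ?_⟩
          · rw [map_mul, map_mul, MulAut.mul_apply, MulAut.mul_apply, hg2, hv, map_mul, map_mul]
            rw [map_inv, map_inv, autInv_eq_iff.2 hg2.symm]
          · rw [← hg3, ← MulAut.mul_apply, ← map_mul, mul_inv_cancel, map_one, MulAut.one_apply,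
              ← κ_κ (show 2 ≤ 2 + d by omega), hv', hjm, map_inv, κ_κ (by omega)]
        have h4 := h3.unique h2
        rw [map_one, map_pow, κ_lt (by omega)] at h4
        have h5 := congrArg (fun w => (expo 0 w).toAdd) h4
        simp [x, expo_of] at h5
        omega
      exact tower_step (by omega) (by omega) (hP hm) (hf ⟨m, hm⟩).1 (by rw [hone, map_one])
  rw [eq_bot_iff]
  intro m hm
  rw [Subgroup.mem_bot]
  refine braid_faithful (by omega) (pr_of_mem_PA (by omega) (hP hm)) fun i hi => ?_
  have := claim n hn le_rfl m hm (x i)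
  rwa [κ_of_mem (Θ_mem_Fs m (x_mem_Fs hi)), κ_lt hi] at this

theorem TT_zpow_eq_one (hn : 2 ≤ n) {j : ℤ} (h : κ 2 (Θ n (TT n ^ j) (x 0)) = x 0) : j = 0 := by
  rw [Θ_TT (by omega)] at h
  simp only [map_mul, map_inv, map_zpow, κ_lt (show 0 < 2 by omega), κ_cp hn] at h
  have h5 : x 0 * cp 0 2 ^ j = cp 0 2 ^ j * x 0 := by
    rw [mul_assoc, inv_mul_eq_iff_eq_mul] at h; exact h
  have h6 := eq_zpow_of_commute (expo 0) (by rw [expo_of]; simp) h5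
  have h7 := congrArg (fun w => (expo 1 w).toAdd) h6
  simpa [cp_succ, cp_zero, x, expo_of] using h7

theorem three_conj (hn : 3 ≤ n) {M : Subgroup (P n)} (hM : ∀ p ∈ M, (three n p).2 = 1)
    {p : P n} (hp : p ∈ M) {g : ArtinB n} (hpr : pr n g = g) (hκ : (∀ u, κ 2 (Θ n g u) = κ 2 u) ∨
      ∃ a : MulAut F, ∀ u, κ 3 (Θ n g u) = a (κ 3 u)) :
    (three n (MulAut.conjNormal g p)).1 = g * (three n p).1 * g⁻¹ := by
  obtain ⟨-, h1, j, h2⟩ := three_rel hn p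
  obtain ⟨-, h1', j', h2'⟩ := three_rel hn (MulAut.conjNormal g p)
  rw [hM _ hp] at h1
  have h3 : (three n p).1 ∈ PA n (n - 1) := by
    refine mem_PA_of_pr (by omega) ?_ ?_
    · rw [h2, mem_P, map_mul, σ_pr, ← map_mul, ← mem_P]
      exact mul_mem p.2 (zpow_mem TT_mem_P _)
    · rw [h2, map_mul, pr_pr, map_zpow, TT, pr_pr]
  have e : g * (three n p).1 * g⁻¹ = (three n (MulAut.conjNormal g p)).1 * TT n ^ (j - j') := by
    rw [h2, h2', MulAut.conjNormal_apply]
    simp only [map_mul, map_inv, hpr]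
    have := (TT_comm g).zpow_left j
    rw [hpr] at this
    rw [mul_assoc, mul_assoc, (this.inv_right).eq, zpow_sub]
    group
  have h4 : κ 2 (Θ n (g * (three n p).1 * g⁻¹) (x 0)) = x 0 := by
    have e1 : ∀ u, Θ n g (Θ n g⁻¹ u) = u := fun u => by
      rw [← MulAut.mul_apply, ← map_mul, mul_inv_cancel, map_one, MulAut.one_apply]
    rw [map_mul, map_mul, MulAut.mul_apply, MulAut.mul_apply]
    rcases hκ with h | ⟨a, h⟩
    · rw [h, h1.1, ← h, e1, κ_lt (by omega)]
    · rw [← κ_κ (show 2 ≤ 3 by omega), h, tower_step (by omega) (by omega) h3 h1 (map_one _), ← h,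
        e1, κ_κ (by omega), κ_lt (by omega)]
  have h5 : j - j' = 0 := by
    apply TT_zpow_eq_one (show 2 ≤ n by omega)
    rw [e, map_mul, MulAut.mul_apply, h1'.1] at h4
    exact h4
  rw [e, h5, zpow_zero, mul_one]

theorem three_eq_one (hn : 3 ≤ n) {M : Subgroup (P n)} (hfg : M.FG)
    (hM : ∀ p ∈ M, (three n p).2 = 1) (hc : ∀ g : ArtinB n, ∀ p ∈ M, MulAut.conjNormal g p ∈ M)
    {p : P n} (hp : p ∈ M) : (three n p).1 = 1 := by
  have key : M.map ((MonoidHom.fst _ _).comp (three n)) = ⊥ := by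
    refine eq_bot_of_push hn (fg_map hfg _) ?_ ?_ ?_
    · rintro _ ⟨p, hp, rfl⟩
      obtain ⟨-, -, j, h2⟩ := three_rel hn p
      change (three n p).1 ∈ _
      refine mem_PA_of_pr (by omega) ?_ ?_
      · rw [h2, mem_P, map_mul, σ_pr, ← map_mul, ← mem_P]
        exact mul_mem p.2 (zpow_mem TT_mem_P _)
      · rw [h2, map_mul, pr_pr, map_zpow, TT, pr_pr]
    · rintro _ ⟨p, hp, rfl⟩
      have := (three_rel hn p).2.1
      rwa [hM p hp] at this
    · have e1 : ∀ {g : ArtinB n} u, Θ n g (Θ n g⁻¹ u) = u := fun {g} u => by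
        rw [← MulAut.mul_apply, ← map_mul, mul_inv_cancel, map_one, MulAut.one_apply]
      suffices h : ∀ g, (∀ m ∈ M.map ((MonoidHom.fst _ _).comp (three n)),
          pr n g * m * (pr n g)⁻¹ ∈ M.map ((MonoidHom.fst _ _).comp (three n))) ∧
          ∀ m ∈ M.map ((MonoidHom.fst _ _).comp (three n)),
          pr n g⁻¹ * m * (pr n g⁻¹)⁻¹ ∈ M.map ((MonoidHom.fst _ _).comp (three n)) from
        fun g => (h g).1
      intro g
      refine induction_s (p := fun g => (∀ m ∈ M.map ((MonoidHom.fst _ _).comp (three n)),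
          pr n g * m * (pr n g)⁻¹ ∈ M.map ((MonoidHom.fst _ _).comp (three n))) ∧
          ∀ m ∈ M.map ((MonoidHom.fst _ _).comp (three n)),
          pr n g⁻¹ * m * (pr n g⁻¹)⁻¹ ∈ M.map ((MonoidHom.fst _ _).comp (three n))) (by simp)
            (fun i hi => ?_) ?_ ?_ g
      · by_cases hi' : i + 1 < n
        · have hκ : (∀ u, κ 2 (Θ n (s n i) u) = κ 2 u) ∨
              ∃ a : MulAut F, ∀ u, κ 3 (Θ n (s n i) u) = a (κ 3 u) := by
            rw [Θ_s hi']
            by_cases h : i + 1 < 3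
            · exact .inr ⟨hur i, κ_hur h⟩
            · exact .inl (κ_hur_ge (by omega))
          have hκ' : (∀ u, κ 2 (Θ n (s n i)⁻¹ u) = κ 2 u) ∨
              ∃ a : MulAut F, ∀ u, κ 3 (Θ n (s n i)⁻¹ u) = a (κ 3 u) := by
            rcases hκ with h | ⟨a, h⟩
            · exact .inl fun u => by rw [← h, e1]
            · refine .inr ⟨a⁻¹, fun u => ?_⟩
              rw [eq_comm, autInv_eq_iff, ← h, e1]
          constructor
          · rintro _ ⟨p, hp, rfl⟩
            refine ⟨_, hc (s n i) p hp, ?_⟩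
            rw [pr_s hi']
            exact three_conj hn hM hp (pr_s hi') hκ
          · rintro _ ⟨p, hp, rfl⟩
            refine ⟨_, hc (s n i)⁻¹ p hp, ?_⟩
            rw [map_inv (pr n), pr_s hi']
            exact three_conj hn hM hp (by rw [map_inv, pr_s hi']) hκ'
        · simp [pr_last (show i + 1 = n by omega)]
      · rintro g h ⟨hg, hg'⟩ ⟨hh, hh'⟩
        constructor
        · intro m hm
          have := hg _ (hh m hm)
          rw [map_mul]; convert this using 1; group
        · intro m hm
          have := hh' _ (hg' m hm)
          rw [mul_inv_rev, map_mul]; convert this using 1; group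
      · rintro g ⟨hg, hg'⟩
        exact ⟨hg', by simpa using hg⟩
  have : (three n p).1 ∈ M.map ((MonoidHom.fst _ _).comp (three n)) := ⟨p, hp, rfl⟩
  rwa [key, Subgroup.mem_bot] at this

/-- The automorphism preserves the free normal subgroup modulo the centre. -/
def Good (n : ℕ) (φ : MulAut (ArtinB n)) : Prop :=
  ∀ w, ∃ w' ∈ Fs n, ∃ k : ℤ, φ (ι n w) = ι n w' * ΔB n ^ k

theorem Fs_fg (k : ℕ) : (Fs k).FG := by
  classical
  refine ⟨(Finset.range k).image x, ?_⟩
  rw [Fs]; congr 1; ext w; simp [eq_comm]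

theorem good_of_quo (hn : 5 ≤ n) {φ : MulAut (ArtinB n)}
    (h : ∀ p : P n, (p : ArtinB n) ∈ U n → quo hn φ p = 1) : Good n φ := by
  intro w
  let i' : F →* P n := (ι n).codRestrict (P n) ι_mem_P
  have hi' : ∀ w, ((i' w : P n) : ArtinB n) = ι n w := fun _ => rfl
  have h1 : (three n (resP hn φ (i' (κ n w)))).1 = 1 := by
    refine three_eq_one (M := (Fs n).map ((resP hn φ).comp i')) (by omega) (fg_map (Fs_fg n) _)
      ?_ ?_ ⟨κ n w, κ_mem n w, rfl⟩
    · rintro _ ⟨v, -, rfl⟩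
      exact h (i' v) (by rw [hi']; exact ι_mem_U v)
    · rintro g _ ⟨v, hv, rfl⟩
      refine ⟨Θ n (φ⁻¹ g) v, Θ_mem_Fs _ hv, Subtype.ext ?_⟩
      simp only [MonoidHom.comp_apply, coe_resP, MulAut.conjNormal_apply, hi', ι_Θ, map_mul,
        map_inv]
      simp only [← MulAut.mul_apply, mul_inv_cancel, MulAut.one_apply]
  obtain ⟨-, -, j, h2⟩ := three_rel (by omega) (resP hn φ (i' (κ n w)))
  rw [h1, coe_resP, hi', ι_κ] at h2
  have h3 : φ (ι n w) * ΔB n ^ j ∈ U n := by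
    rw [mem_U_iff, map_mul, map_zpow]; exact h2.symm
  obtain ⟨w', hw', e⟩ := exists_ι_of_mem_U h3
  exact ⟨w', hw', -j, by rw [← e]; group⟩

theorem aut_ΔB (hn : 0 < n) (φ : MulAut (ArtinB n)) : ∃ k : ℤ, φ (ΔB n) = ΔB n ^ k := by
  refine exists_zpow_of_central hn fun g => ?_
  obtain ⟨g, rfl⟩ := φ.surjective g
  rw [← map_mul, ΔB_central, map_mul]

theorem aut_ΔB_cases (hn : 0 < n) (φ : MulAut (ArtinB n)) :
    φ (ΔB n) = ΔB n ∨ φ (ΔB n) = (ΔB n)⁻¹ := by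
  obtain ⟨k, hk⟩ := aut_ΔB hn φ
  obtain ⟨l, hl⟩ := aut_ΔB hn φ⁻¹
  have h1 : φ (φ⁻¹ (ΔB n)) = ΔB n := by rw [← MulAut.mul_apply, mul_inv_cancel, MulAut.one_apply]
  rw [hl, map_zpow, hk, ← zpow_mul] at h1
  have h2 : k * l = 1 := zpow_ΔB_injective hn (by rw [h1, zpow_one])
  rcases Int.eq_one_or_neg_one_of_mul_eq_one h2 with rfl | rfl
  · left; rw [hk, zpow_one]
  · right; rw [hk, zpow_neg_one]

theorem ΔB_zpow_comm (k : ℤ) (g : ArtinB n) : Commute (ΔB n ^ k) g :=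
  Commute.zpow_left (ΔB_central g) k

theorem Good.mul (hn : 0 < n) {φ ψ : MulAut (ArtinB n)} (h : Good n φ) (h' : Good n ψ) :
    Good n (φ * ψ) := by
  intro w
  obtain ⟨w', -, k, e⟩ := h' w
  obtain ⟨w'', hw, l, e'⟩ := h w'
  obtain ⟨m, hm⟩ := aut_ΔB hn φ
  refine ⟨w'', hw, l + m * k, ?_⟩
  rw [MulAut.mul_apply, e, map_mul, e', map_zpow, hm, ← zpow_mul, zpow_add, mul_assoc]

theorem not_good_mu (hn : 3 ≤ n) : ¬ Good n (mu n) := by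
  intro h
  obtain ⟨w', -, k, e⟩ := h (x (n - 1))
  rw [ι_last (by omega), mu_last (by omega)] at e
  have e2 := congrArg (pr n) e
  rw [map_mul, map_mul, pr_last (by omega), pr_ι, pr_dl (by omega), mul_one, one_mul,
    map_zpow] at e2
  change _ = TT n ^ k at e2
  have h1 : IsPush n (n - 1) (dl n (n - 1)) (cp 0 (n - 1)) :=
    isPush_jh (by omega) (by simpa using cp_mem 0 (n - 1))
  rw [e2] at h1
  have h2 : k = 0 := TT_zpow_eq_one (n := n) (by omega) (by
    rw [← κ_κ (show 2 ≤ n - 1 by omega), h1.1, κ_κ (by omega), κ_lt (by omega)])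
  rw [h2, zpow_zero] at h1
  have h3 := h1.unique (IsPush.one _)
  have h5 := congrArg (fun w => (expo 0 w).toAdd) (congrArg (κ 1) h3)
  simp only [map_one] at h5
  rw [κ_κ (by omega)] at h5
  obtain ⟨m, hm⟩ : ∃ m, n - 1 = m + 1 := ⟨n - 2, by omega⟩
  rw [hm, κ_cp (by omega)] at h5
  simp [cp_succ, cp_zero, x, expo_of] at h5

theorem exists_good (hn : 5 ≤ n) (φ : MulAut (ArtinB n)) :
    ∃ ψ, (ψ = φ ∨ ψ = φ * mu n) ∧ Good n ψ ∧ Good n ψ⁻¹ := by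
  obtain ⟨ψ, h1, h2⟩ : ∃ ψ, (ψ = φ ∨ ψ = φ * mu n) ∧ Good n ψ := by
    rcases quo_dichotomy hn φ with h | h
    · exact ⟨φ, .inl rfl, good_of_quo hn h⟩
    · exact ⟨_, .inr rfl, good_of_quo hn h⟩
  refine ⟨ψ, h1, h2, ?_⟩
  rcases quo_dichotomy hn ψ⁻¹ with h | h
  · exact good_of_quo hn h
  · have := h2.mul (by omega) (good_of_quo hn h)
    rw [mul_inv_cancel_left] at this
    exact absurd this (not_good_mu (by omega))

theorem ι_mul_ΔB_inj (hn : 2 ≤ n) {w w' : F} {k k' : ℤ} (hw : w ∈ Fs n) (hw' : w' ∈ Fs n)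
    (h : ι n w * ΔB n ^ k = ι n w' * ΔB n ^ k') : w = w' ∧ k = k' := by
  have h1 := congrArg (pr n) h
  simp only [map_mul, pr_ι, one_mul, map_zpow] at h1
  change TT n ^ k = TT n ^ k' at h1
  have h2 : k - k' = 0 := TT_zpow_eq_one hn (by
    rw [zpow_sub, h1, mul_inv_cancel, map_one, MulAut.one_apply, κ_lt (by omega)])
  have h3 : k = k' := by omega
  subst h3
  refine ⟨?_, rfl⟩
  have h4 : ι n (w * w'⁻¹) = 1 := by
    rw [map_mul, map_inv (ι n), mul_inv_eq_one]; exact mul_right_cancel h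
  exact mul_inv_eq_one.1 (ι_injOn (mul_mem hw (inv_mem hw')) h4)

/-- `α` is the map induced on the free group by the automorphism `φ`. -/
def Induces (n : ℕ) (φ : MulAut (ArtinB n)) (α : F →* F) : Prop :=
  ∀ w, α w ∈ Fs n ∧ ∃ k : ℤ, φ (ι n w) = ι n (α w) * ΔB n ^ k

theorem Good.exists_induces (hn : 2 ≤ n) {φ : MulAut (ArtinB n)} (h : Good n φ) :
    ∃ α : F →* F, Induces n φ α := by
  refine exists_hom_of_rel (fun w w' => w' ∈ Fs n ∧ ∃ k : ℤ, φ (ι n w) = ι n w' * ΔB n ^ k) ?_ ?_ ?_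
  · intro w; obtain ⟨w', h1, k, h2⟩ := h w; exact ⟨w', h1, k, h2⟩
  · rintro w v v' ⟨h1, k, h2⟩ ⟨h1', k', h2'⟩
    exact (ι_mul_ΔB_inj hn h1 h1' (h2.symm.trans h2')).1
  · rintro w w' v v' ⟨h1, k, h2⟩ ⟨h1', k', h2'⟩
    refine ⟨mul_mem h1 h1', k + k', ?_⟩
    rw [map_mul, map_mul, map_mul, h2, h2', zpow_add, mul_assoc, mul_assoc, ← mul_assoc (ΔB n ^ k),
      (ΔB_zpow_comm k _).eq, mul_assoc]

theorem Induces.eq (hn : 2 ≤ n) {φ : MulAut (ArtinB n)} {α : F →* F} (h : Induces n φ α) {w w' : F}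
    {k : ℤ} (hw' : w' ∈ Fs n) (e : φ (ι n w) = ι n w' * ΔB n ^ k) : α w = w' := by
  obtain ⟨h1, k', h2⟩ := h w
  exact (ι_mul_ΔB_inj hn h1 hw' (h2.symm.trans e)).1

theorem Induces.Θ (hn : 2 ≤ n) {φ : MulAut (ArtinB n)} {α : F →* F} (h : Induces n φ α)
    (g : ArtinB n) (w : F) : α (Θ n g w) = Θ n (φ g) (α w) := by
  obtain ⟨h1, k, h2⟩ := h w
  refine h.eq hn (Θ_mem_Fs _ h1) (k := k) ?_
  rw [ι_Θ, ι_Θ, map_mul, map_mul, h2, map_inv φ]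
  simp only [mul_assoc]
  rw [(ΔB_zpow_comm k (φ g)⁻¹).eq]

theorem Induces.comp (hn : 2 ≤ n) {φ ψ : MulAut (ArtinB n)} {α β : F →* F} (h : Induces n φ α)
    (h' : Induces n ψ β) : Induces n (φ * ψ) (α.comp β) := by
  intro w
  obtain ⟨h1, k, h2⟩ := h' w
  obtain ⟨h3, l, h4⟩ := h (β w)
  obtain ⟨m, hm⟩ := aut_ΔB (by omega) φ
  refine ⟨h3, l + m * k, ?_⟩
  rw [MulAut.mul_apply, h2, map_mul, h4, map_zpow, hm, ← zpow_mul, zpow_add, mul_assoc]; rfl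

theorem induces_one : Induces n 1 (κ n) := fun w =>
  ⟨κ_mem n w, 0, by rw [ι_κ]; simp⟩

theorem Induces.inv_apply (hn : 2 ≤ n) {φ : MulAut (ArtinB n)} {α β : F →* F} (h : Induces n φ α)
    (h' : Induces n φ⁻¹ β) (w : F) : α (β w) = BnAux.κ n w := by
  have h1 := h.comp hn h'
  rw [mul_inv_cancel] at h1
  obtain ⟨h2, k, h3⟩ := induces_one (n := n) w
  exact h1.eq hn h2 h3

theorem lt_of_mem_toWord {z : ℕ} {b : F} (hb : b ∈ Fs z) : ∀ p ∈ b.toWord, p.1 < z := by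
  induction hb using Subgroup.closure_induction with
  | mem g h => obtain ⟨i, hi, rfl⟩ := h; simpa [x] using hi
  | one => simp
  | mul u v _ _ h1 h2 =>
    intro p hp
    rcases List.mem_append.1 ((FreeGroup.toWord_mul_sublist u v).subset hp) with h | h
    exacts [h1 p h, h2 p h]
  | inv u _ h =>
    intro p hp
    simp only [FreeGroup.toWord_inv, FreeGroup.invRev, List.mem_reverse, List.mem_map] at hp
    obtain ⟨q, hq, rfl⟩ := hp
    exact h q hq

theorem norm_pow_of_cyc {L : List (ℕ × Bool)} (h : FreeGroup.IsCyclicallyReduced L) (m : ℕ) :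
    (FreeGroup.mk L ^ m).norm = m * L.length := by
  rw [FreeGroup.pow_mk, FreeGroup.norm, FreeGroup.toWord_mk,
    (h.flatten_replicate m).isReduced.reduce_eq]
  simp

theorem length_le_of_cyc {L : List (ℕ × Bool)} (h : FreeGroup.IsCyclicallyReduced L) {y : F}
    (hy : IsConj y (FreeGroup.mk L)) : L.length ≤ y.norm := by
  obtain ⟨v, hv⟩ := isConj_iff.1 hy
  have h1 : ∀ m : ℕ, m * L.length ≤ 2 * v.norm + m * y.norm := by
    intro m
    have hy : (y ^ m).norm ≤ m * y.norm := by
      induction m with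
      | zero => simp
      | succ m ih =>
        rw [pow_succ, add_mul, one_mul]; exact (FreeGroup.norm_mul_le _ _).trans (by omega)
    rw [← norm_pow_of_cyc h, ← hv, conj_pow]
    have h1 := FreeGroup.norm_mul_le (v * y ^ m) v⁻¹
    have h2 := FreeGroup.norm_mul_le v (y ^ m)
    rw [FreeGroup.norm_inv_eq] at h1
    omega
  by_contra hlt
  push Not at hlt
  have h2 := h1 (2 * v.norm + 1)
  nlinarith

/-- The word of a syllable `a z^{±1}`. -/
def syl (z : ℕ) (p : F × Bool) : List (ℕ × Bool) := p.1.toWord ++ [(z, p.2)]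

/-- The product of a list of syllables. -/
def ev (z : ℕ) (ps : List (F × Bool)) : F := FreeGroup.mk (ps.flatMap (syl z))

theorem ev_nil (z : ℕ) : ev z [] = 1 := rfl

theorem ev_append (z : ℕ) (l l' : List (F × Bool)) : ev z (l ++ l') = ev z l * ev z l' := by
  simp [ev, FreeGroup.mul_mk]

theorem ev_cons (z : ℕ) (p : F × Bool) (l : List (F × Bool)) :
    ev z (p :: l) = p.1 * FreeGroup.mk [(z, p.2)] * ev z l := by
  rw [ev, List.flatMap_cons, ← FreeGroup.mul_mk, syl, ← FreeGroup.mul_mk, FreeGroup.mk_toWord, ev]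

theorem isConj_ev_rotate (z : ℕ) (l l' : List (F × Bool)) :
    IsConj (ev z (l ++ l')) (ev z (l' ++ l)) := by
  rw [ev_append, ev_append]; exact isConj_iff.2 ⟨(ev z l)⁻¹, by group⟩

/-- Consecutive syllables do not cancel. -/
def Adj (p q : F × Bool) : Prop := q.1 = 1 → p.2 = q.2

theorem isCyclicallyReduced_syl {z : ℕ} {ps : List (F × Bool)} (hps : ∀ p ∈ ps, p.1 ∈ Fs z)
    (h1 : ps.IsChain Adj) (h2 : ∀ p ∈ ps.getLast?, ∀ q ∈ ps.head?, Adj p q) :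
    FreeGroup.IsCyclicallyReduced (ps.flatMap (syl z)) := by
  have hne : ∀ p, syl z p ≠ [] := by simp [syl]
  have hadj : ∀ p q : F × Bool, q.1 ∈ Fs z → Adj p q → ∀ a ∈ (syl z p).getLast?,
      ∀ b ∈ (syl z q).head?, a.1 = b.1 → a.2 = b.2 := by
    rintro p ⟨q, e⟩ hq h a ha b hb hab
    simp only [syl, List.getLast?_append, List.getLast?_singleton, Option.some_or, Option.mem_def,
      Option.some.injEq] at ha
    subst ha
    by_cases hq1 : q = 1
    · have : (z, e) = b := by simpa [syl, hq1] using hb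
      subst this
      exact h hq1
    · have hw : q.toWord ≠ [] := by simpa using hq1
      rw [syl, List.head?_append_of_ne_nil _ hw] at hb
      have := lt_of_mem_toWord hq b (List.mem_of_mem_head? hb)
      simp only at hab; omega
  have hred : FreeGroup.IsReduced (ps.flatMap (syl z)) := by
    rw [FreeGroup.IsReduced, List.flatMap_def, List.isChain_flatten (by
      intro h; obtain ⟨p, -, hp⟩ := List.mem_map.1 h; exact hne p hp)]
    constructor
    · intro l hl
      obtain ⟨p, hp, rfl⟩ := List.mem_map.1 hl
      rw [syl, List.isChain_append]
      refine ⟨FreeGroup.isReduced_toWord, by simp, ?_⟩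
      intro a ha b hb hab
      have : (z, p.2) = b := by simpa using hb
      subst this
      have := lt_of_mem_toWord (hps p hp) a (List.mem_of_mem_getLast? ha)
      simp only at hab; omega
    · rw [List.isChain_map]
      refine List.IsChain.imp_of_mem_imp ?_ h1
      intro p q hp hq h
      exact hadj p q (hps q hq) h
  refine ⟨hred, ?_⟩
  rcases ps with _ | ⟨p, t⟩
  · simp
  obtain ⟨l, q, hl⟩ : ∃ l q, p :: t = l ++ [q] := by
    rcases List.eq_nil_or_concat (p :: t) with h | ⟨l, q, h⟩
    · simp at h
    · exact ⟨l, q, by simpa using h⟩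
  intro a ha b hb
  have hb' : b ∈ (syl z p).head? := by
    rwa [List.flatMap_cons, List.head?_append_of_ne_nil _ (hne p)] at hb
  have ha' : a ∈ (syl z q).getLast? := by
    rwa [hl, List.flatMap_append, List.flatMap_singleton, List.getLast?_append_of_ne_nil _ (hne q)]
      at ha
  exact hadj q p (hps p (by simp)) (h2 q (by rw [hl]; simp) p (by simp)) a ha' b hb'

theorem exists_ev {z : ℕ} {y : F} (hy : y ∈ Fs (z + 1)) :
    ∃ ps : List (F × Bool), (∀ p ∈ ps, p.1 ∈ Fs z) ∧ ∃ b ∈ Fs z, y = ev z ps * b := by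
  have key : ∀ (g : F), g ∈ Fs z → ∀ y, (∃ ps : List (F × Bool), (∀ p ∈ ps, p.1 ∈ Fs z) ∧
      ∃ b ∈ Fs z, y = ev z ps * b) → ∃ ps : List (F × Bool), (∀ p ∈ ps, p.1 ∈ Fs z) ∧
      ∃ b ∈ Fs z, g * y = ev z ps * b := by
    rintro g hg y ⟨ps, hps, b, hb, rfl⟩
    rcases ps with _ | ⟨p, ps⟩
    · exact ⟨[], by simp, g * b, mul_mem hg hb, by simp [ev_nil]⟩
    · refine ⟨(g * p.1, p.2) :: ps, ?_, b, hb, by rw [ev_cons, ev_cons]; simp only [mul_assoc]⟩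
      intro q hq
      rcases List.mem_cons.1 hq with rfl | hq
      · exact mul_mem hg (hps p (by simp))
      · exact hps q (by simp [hq])
  have key2 : ∀ (e : Bool), ∀ y, (∃ ps : List (F × Bool), (∀ p ∈ ps, p.1 ∈ Fs z) ∧
      ∃ b ∈ Fs z, y = ev z ps * b) → ∃ ps : List (F × Bool), (∀ p ∈ ps, p.1 ∈ Fs z) ∧
      ∃ b ∈ Fs z, FreeGroup.mk [(z, e)] * y = ev z ps * b := by
    rintro e y ⟨ps, hps, b, hb, rfl⟩
    refine ⟨(1, e) :: ps, ?_, b, hb, by rw [ev_cons]; simp only [one_mul, mul_assoc]⟩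
    intro q hq
    rcases List.mem_cons.1 hq with rfl | hq
    · exact one_mem _
    · exact hps q hq
  refine Subgroup.closure_induction_left (p := fun y _ => ∃ ps : List (F × Bool),
    (∀ p ∈ ps, p.1 ∈ Fs z) ∧ ∃ b ∈ Fs z, y = ev z ps * b) ?_ ?_ ?_ hy
  · exact ⟨[], by simp, 1, one_mem _, by simp [ev_nil]⟩
  · rintro _ ⟨i, hi, rfl⟩ y - h
    rcases (Nat.lt_succ_iff_lt_or_eq.1 hi) with h1 | rfl
    · exact key _ (x_mem_Fs h1) y h
    · exact key2 true y h
  · rintro _ ⟨i, hi, rfl⟩ y - h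
    rcases (Nat.lt_succ_iff_lt_or_eq.1 hi) with h1 | rfl
    · exact key _ (inv_mem (x_mem_Fs h1)) y h
    · exact key2 false y h

theorem exists_cyc {z : ℕ} {y : F} (hy : y ∈ Fs (z + 1)) (hno : ∀ b ∈ Fs z, ¬ IsConj y b) :
    ∃ ps : List (F × Bool), (∀ p ∈ ps, p.1 ∈ Fs z) ∧ IsConj y (ev z ps) ∧ ps.IsChain Adj ∧
      ∀ p ∈ ps.getLast?, ∀ q ∈ ps.head?, Adj p q := by
  let Q : ℕ → Prop := fun k => ∃ ps : List (F × Bool), ps.length = k ∧ (∀ p ∈ ps, p.1 ∈ Fs z) ∧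
    IsConj y (ev z ps)
  have hQ : ∃ k, Q k := by
    obtain ⟨ps, hps, b, hb, rfl⟩ := exists_ev hy
    rcases ps with _ | ⟨p, ps⟩
    · exact absurd (by rw [ev_nil, one_mul]) (hno b hb)
    · refine ⟨_, (b * p.1, p.2) :: ps, rfl, ?_, ?_⟩
      · intro q hq
        rcases List.mem_cons.1 hq with rfl | hq
        · exact mul_mem hb (hps p (by simp))
        · exact hps q (by simp [hq])
      · rw [ev_cons, ev_cons]; exact isConj_iff.2 ⟨b, by group⟩
  classical
  obtain ⟨ps, hlen, hps, hc⟩ := Nat.find_spec hQ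
  have hmin : ∀ l, Q l → ps.length ≤ l := fun l hl => hlen ▸ Nat.find_min' hQ hl
  have key : ∀ p q l, (∀ p' ∈ p :: q :: l, p'.1 ∈ Fs z) → (p :: q :: l).length = ps.length →
      IsConj y (ev z (p :: q :: l)) → Adj p q := by
    intro p q l hmem hl hcj hq1
    by_contra hne
    have e : ev z (p :: q :: l) = p.1 * ev z l := by
      rw [ev_cons, ev_cons, hq1, one_mul, ← mul_assoc, mul_assoc p.1]
      congr 1
      have : p.2 = !q.2 := by revert hne; cases p.2 <;> cases q.2 <;> simp
      rw [FreeGroup.mul_mk, this]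
      have h1 : (FreeGroup.mk [(z, !q.2), (z, q.2)] : F) = 1 := by
        have := FreeGroup.Red.Step.not (L₁ := []) (L₂ := []) (x := z) (b := !q.2)
        simp only [Bool.not_not, List.nil_append] at this
        exact Quot.sound this
      simp only [List.cons_append, List.nil_append]
      rw [h1, mul_one]
    rcases l with _ | ⟨r, l⟩
    · rw [e, ev_nil, mul_one] at hcj
      exact hno _ (hmem p (by simp)) hcj
    · have := hmin _ ⟨(p.1 * r.1, r.2) :: l, rfl, by
        intro p' hp'
        rcases List.mem_cons.1 hp' with rfl | h
        · exact mul_mem (hmem p (by simp)) (hmem r (by simp))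
        · exact hmem _ (by simp [h]), by
        rw [e] at hcj
        rw [ev_cons] at hcj ⊢
        simpa only [mul_assoc] using hcj⟩
      simp only [List.length_cons] at this hl
      omega
  have krot : ∀ l₁ l₂ p q l, ps = l₁ ++ l₂ → l₂ ++ l₁ = p :: q :: l → Adj p q := by
    intro l₁ l₂ p q l h1 h2
    refine key p q l (fun p' hp' => hps p' ?_) ?_ ?_
    · rw [← h2] at hp'; rw [h1]; simp only [List.mem_append] at hp' ⊢; tauto
    · rw [← h2, h1]; simp [add_comm]
    · rw [← h2]; rw [h1] at hc; exact hc.trans (isConj_ev_rotate _ _ _)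
  refine ⟨ps, hps, hc, ?_, ?_⟩
  · rw [List.isChain_iff_forall_rel_of_append_cons_cons]
    intro a b l₁ l₂ h
    exact krot l₁ (a :: b :: l₂) a b (l₂ ++ l₁) h rfl
  · intro p hp q hq
    rcases ps with _ | ⟨h, t⟩
    · simp at hq
    obtain rfl : h = q := by simpa using hq
    rcases List.eq_nil_or_concat t with rfl | ⟨t', l, rfl⟩
    · obtain rfl : h = p := by simpa using hp
      intro _; rfl
    · obtain rfl : l = p := by
        rw [List.concat_eq_append, ← List.cons_append, List.getLast?_append] at hp
        simpa using hp
      exact krot (h :: t') [l] l h t' (by simp) rfl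

theorem finite_Fs_norm_le (z K : ℕ) : {b : F | b ∈ Fs z ∧ b.norm ≤ K}.Finite := by
  refine Set.Finite.subset ((List.finite_length_le (Fin z × Bool) K).image fun l =>
    FreeGroup.mk (l.map fun p => (p.1.1, p.2))) ?_
  rintro b ⟨h1, h2⟩
  have h3 := lt_of_mem_toWord h1
  refine ⟨b.toWord.pmap (fun p hp => (⟨p.1, hp⟩, p.2)) h3, ?_, ?_⟩
  · simpa [FreeGroup.norm] using h2
  · simp [List.map_pmap, FreeGroup.mk_toWord]

/-- Evaluation of a word in two elements. -/
noncomputable def sub2 {G : Type*} [Group G] (a b : G) : F →* G :=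
  FreeGroup.lift fun i => if i = 0 then a else if i = 1 then b else 1

theorem sub2_zero {G : Type*} [Group G] (a b : G) : sub2 a b (x 0) = a := by simp [sub2, x]

theorem sub2_one {G : Type*} [Group G] (a b : G) : sub2 a b (x 1) = b := by simp [sub2, x]

theorem map_sub2 {G H : Type*} [Group G] [Group H] (f : G →* H) (a b : G) (W : F) :
    f (sub2 a b W) = sub2 (f a) (f b) W := by
  have : f.comp (sub2 a b) = sub2 (f a) (f b) := by
    apply fhom_ext; intro i
    rcases i with _ | _ | i <;> simp [sub2, x]
  exact DFunLike.congr_fun this W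

theorem conj_or_sub2 {z : ℕ} {y C : F} (hy : y ∈ Fs (z + 1)) (hC : C ∈ Fs z)
    (χ : F →* Multiplicative ℤ) (hχ : χ C = Multiplicative.ofAdd 1) (f : ℕ → F →* F)
    (hf : ∀ N, f N (x z) = x z) (hfC : ∀ N, ∀ b ∈ Fs z, f N b = C⁻¹ ^ N * b * C ^ N)
    (hfy : ∀ N, IsConj (f N y) y) :
    (∃ b ∈ Fs z, IsConj y b) ∨ ∃ W, IsConj y (sub2 C (x z) W) := by
  by_cases hno : ∀ b ∈ Fs z, ¬ IsConj y b
  swap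
  · push Not at hno; exact .inl hno
  right
  obtain ⟨ps, hps, hc, h1, h2⟩ := exists_cyc hy hno
  have hz : ∀ N e, f N (FreeGroup.mk [(z, e)]) = FreeGroup.mk [(z, e)] := by
    intro N e
    have h : (FreeGroup.mk [(z, true)] : F) = x z := rfl
    have h' : (FreeGroup.mk [(z, false)] : F) = (x z)⁻¹ := rfl
    cases e
    · rw [h', map_inv, hf]
    · rw [h, hf]
  have hev : ∀ N (l : List (F × Bool)), (∀ p ∈ l, p.1 ∈ Fs z) → f N (ev z l) =
      ev z (l.map fun p => (C⁻¹ ^ N * p.1 * C ^ N, p.2)) := by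
    intro N l hl
    induction l with
    | nil => simp [ev_nil]
    | cons p l ih =>
      rw [ev_cons, List.map_cons, ev_cons, map_mul, map_mul, hz, hfC N _ (hl p (by simp)),
        ih fun q hq => hl q (by simp [hq])]
  have hC1 : C ≠ 1 := by
    rintro rfl; rw [map_one] at hχ; exact absurd (congrArg Multiplicative.toAdd hχ) (by simp)
  have hbd : ∀ N, ∀ p ∈ ps, (C⁻¹ ^ N * p.1 * C ^ N).norm ≤ y.norm := by
    intro N p hp
    have h3 : FreeGroup.IsCyclicallyReduced
        ((ps.map fun p => (C⁻¹ ^ N * p.1 * C ^ N, p.2)).flatMap (syl z)) := by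
      refine isCyclicallyReduced_syl ?_ ?_ ?_
      · intro q hq
        obtain ⟨r, hr, rfl⟩ := List.mem_map.1 hq
        exact mul_mem (mul_mem (pow_mem (inv_mem hC) _) (hps r hr)) (pow_mem hC _)
      · rw [List.isChain_map]
        refine h1.imp fun a b h h' => h ?_
        simp only [inv_pow] at h'
        simpa [mul_assoc, inv_mul_eq_one] using h'
      · intro a ha b hb h'
        rw [List.getLast?_map, Option.mem_map] at ha
        rw [List.head?_map, Option.mem_map] at hb
        obtain ⟨a, ha, rfl⟩ := ha
        obtain ⟨b, hb, rfl⟩ := hb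
        refine h2 a ha b hb ?_
        simp only [inv_pow] at h'
        simpa [mul_assoc, inv_mul_eq_one] using h'
    have h4 : IsConj y (FreeGroup.mk
        ((ps.map fun p => (C⁻¹ ^ N * p.1 * C ^ N, p.2)).flatMap (syl z))) := by
      change IsConj y (ev z _)
      rw [← hev N ps hps]
      exact (hfy N).symm.trans ((f N).map_isConj hc)
    refine le_trans ?_ (length_le_of_cyc h3 h4)
    rw [List.length_flatMap, List.map_map]
    have : (C⁻¹ ^ N * p.1 * C ^ N).norm + 1 ∈ ps.map (List.length ∘ syl z ∘
        fun p => (C⁻¹ ^ N * p.1 * C ^ N, p.2)) :=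
      List.mem_map.2 ⟨p, hp, by simp [syl, FreeGroup.norm]⟩
    exact (Nat.le_succ _).trans (List.le_sum_of_mem this)
  have hpow : ∀ p ∈ ps, p.1 = C ^ (χ p.1).toAdd := by
    intro p hp
    have hfin := finite_Fs_norm_le z y.norm
    obtain ⟨N, -, M, -, hNM, he⟩ := Set.infinite_univ.exists_ne_map_eq_of_mapsTo
      (f := fun N : ℕ => C⁻¹ ^ N * p.1 * C ^ N)
      (fun N _ => (⟨mul_mem (mul_mem (pow_mem (inv_mem hC) _) (hps p hp)) (pow_mem hC _),
        hbd N p hp⟩ : _ ∈ {b : F | b ∈ Fs z ∧ b.norm ≤ y.norm})) hfin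
    have h3 : p.1 * C ^ ((N : ℤ) - M) = C ^ ((N : ℤ) - M) * p.1 := by
      rw [zpow_sub, zpow_natCast, zpow_natCast]
      simp only [inv_pow] at he
      have h5 : p.1 * C ^ N = C ^ N * ((C ^ M)⁻¹ * p.1 * C ^ M) := by rw [← he]; group
      have h6 : (C ^ M)⁻¹ * C ^ N = C ^ N * (C ^ M)⁻¹ := by
        rw [← zpow_natCast, ← zpow_natCast, ← zpow_neg, ← zpow_add, ← zpow_add, add_comm]
      rw [← mul_assoc, h5]; group
    have h4 : C ^ ((N : ℤ) - M) ≠ 1 := fun h => hC1 (zpow_eq_one h (by omega))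
    refine eq_zpow_of_commute χ hχ (commute_trans (y := C ^ ((N : ℤ) - M)) h4 ?_ h3.symm)
    rw [← zpow_one_add, ← zpow_add_one, add_comm]
  obtain ⟨W, hW⟩ : ∃ W, ev z ps = sub2 C (x z) W := by
    clear hc h1 h2 hev hbd
    induction ps with
    | nil => exact ⟨1, by rw [ev_nil, map_one]⟩
    | cons p l ih =>
      obtain ⟨W, hW⟩ := ih (fun q hq => hps q (by simp [hq])) (fun q hq => hpow q (by simp [hq]))
      obtain ⟨j, hj⟩ : ∃ j : ℤ, p.1 = C ^ j := ⟨_, hpow p (by simp)⟩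
      refine ⟨x 0 ^ j * FreeGroup.mk [(1, p.2)] * W, ?_⟩
      rw [ev_cons, map_mul, map_mul, map_zpow, sub2_zero, ← hW, hj]
      congr 2
      have h : ∀ i, (FreeGroup.mk [(i, true)] : F) = x i := fun _ => rfl
      have h' : ∀ i, (FreeGroup.mk [(i, false)] : F) = (x i)⁻¹ := fun _ => rfl
      cases p.2
      · rw [h', h', map_inv, sub2_one]
      · rw [h, h, sub2_one]
  exact ⟨W, hW ▸ hc⟩

theorem Θ_inv_apply (g : ArtinB n) (w : F) : Θ n g (Θ n g⁻¹ w) = w := by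
  rw [← MulAut.mul_apply, ← map_mul, mul_inv_cancel, map_one, MulAut.one_apply]

theorem Θ_inv_apply' (g : ArtinB n) (w : F) : Θ n g⁻¹ (Θ n g w) = w := by
  rw [← MulAut.mul_apply, ← map_mul, inv_mul_cancel, map_one, MulAut.one_apply]

theorem isConj_Θ_iff (g : ArtinB n) {u v : F} : IsConj (Θ n g u) (Θ n g v) ↔ IsConj u v := by
  refine ⟨fun h => ?_, fun h => (Θ n g).toMonoidHom.map_isConj h⟩
  have := (Θ n g⁻¹).toMonoidHom.map_isConj h
  simpa only [MulEquiv.toMonoidHom_eq_coe, MonoidHom.coe_coe, Θ_inv_apply'] using this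

theorem isConj_Θ_cp (g : ArtinB n) : IsConj (Θ n g (cp 0 n)) (cp 0 n) := by
  obtain ⟨u, hu, e⟩ := exists_ι_of_mem_U (mul_pr_inv_mem g)
  rw [mul_inv_eq_iff_eq_mul] at e
  rw [e, map_mul, MulAut.mul_apply, Θ_pr_cp, Θ_ι hu]
  exact (isConj_iff.2 ⟨u, rfl⟩ : IsConj (cp 0 n) _).symm

theorem isConj_Θ_x (g : ArtinB n) {i : ℕ} (hi : i < n) :
    IsConj (Θ n g (x i)) (x (σ n g ⟨i, hi⟩)) := by
  obtain ⟨v, -, h⟩ := Θ_x g i hi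
  rw [h]; exact (isConj_iff.2 ⟨v, rfl⟩ : IsConj (x _) _).symm

theorem exists_Θ_shift {a d : ℕ} (h : a + d < n) :
    ∃ g, (∀ j < a, Θ n g (x j) = x j) ∧ Θ n g (x a) = x (a + d) := by
  refine ⟨blk n a d ^ d, fun j hj => ?_, ?_⟩
  · rw [map_pow]
    generalize d = k at h ⊢
    have : ∀ k', (Θ n (blk n a k) ^ k') (x j) = x j := by
      intro k'
      induction k' with
      | zero => simp
      | succ k' ih => rw [pow_succ, MulAut.mul_apply, Θ_blk_out h (.inl hj), ih]
    exact this k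
  · rw [map_pow, Θ_blk_pow_lt h le_rfl le_rfl]

theorem sub2_zpow {G : Type*} [Group G] (a : G) (i j : ℤ) (W : F) :
    ∃ m : ℤ, sub2 (a ^ i) (a ^ j) W = a ^ m := by
  have := map_sub2 (zpowersHom G a) (Multiplicative.ofAdd i) (Multiplicative.ofAdd j) W
  simp only [zpowersHom_apply, toAdd_ofAdd] at this
  exact ⟨_, this.symm⟩

/-- The conjugacy class of `y` is invariant under the pure subgroup. -/
def PInv (n : ℕ) (y : F) : Prop := y ∈ Fs n ∧ ∀ g ∈ P n, IsConj (Θ n g y) y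

theorem PInv.Θ {y : F} (h : PInv n y) (g : ArtinB n) : PInv n (Θ n g y) := by
  refine ⟨Θ_mem_Fs g h.1, fun p hp => ?_⟩
  have e : p * g = g * (g⁻¹ * p * g) := by group
  rw [← MulAut.mul_apply, ← map_mul, e, map_mul, MulAut.mul_apply, isConj_Θ_iff]
  refine h.2 _ ?_
  have := P_normal.conj_mem p hp g⁻¹
  rwa [inv_inv] at this

theorem expo_cp (m : ℕ) : expo 0 (cp 0 (m + 1)) = Multiplicative.ofAdd 1 := by
  induction m with
  | zero => simp [cp_succ, cp_zero, x, expo_of]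
  | succ m ih => rw [cp_succ, map_mul, ih]; simp [x, expo_of]

theorem PInv.dich (hn : 2 ≤ n) {y : F} (h : PInv n y) :
    (∃ b ∈ Fs (n - 1), IsConj y b) ∨ ∃ W, IsConj y (sub2 (cp 0 n) (x (n - 1)) W) := by
  obtain ⟨k, rfl⟩ : ∃ k, n = k + 2 := ⟨n - 2, by omega⟩
  have hC : cp 0 (k + 1) ∈ Fs (k + 1) := by simpa using cp_mem 0 (k + 1)
  have hlt : 0 + k < k + 2 := by omega
  have htw : ∀ b ∈ Fs (k + 1), BnAux.Θ (k + 2) (tw (k + 2) 0 k) b =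
      (cp 0 (k + 1))⁻¹ * b * cp 0 (k + 1) := by
    intro b hb
    have := Fs_eqOn (f := (BnAux.Θ (k + 2) (tw (k + 2) 0 k)).toMonoidHom)
      (g := (MulAut.conj (cp 0 (k + 1))⁻¹).toMonoidHom) (k := k + 1) (fun i hi => by
        show BnAux.Θ (k + 2) (tw (k + 2) 0 k) (x i) = MulAut.conj (cp 0 (k + 1))⁻¹ (x i)
        rw [Θ_tw hlt (by omega) (by omega), MulAut.conj_apply, inv_inv]) hb
    change _ = MulAut.conj _ _ at this
    rwa [MulAut.conj_apply, inv_inv] at this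
  have hP : tw (k + 2) 0 k ∈ P (k + 2) := by
    rw [mem_P]
    ext i
    have h1 := isConj_Θ_x (tw (k + 2) 0 k) i.2
    have h2 : IsConj (BnAux.Θ (k + 2) (tw (k + 2) 0 k) (x i)) (x i) := by
      by_cases hi : (i : ℕ) < k + 1
      · rw [htw _ (x_mem_Fs hi)]
        exact (isConj_iff.2 ⟨(cp 0 (k + 1))⁻¹, by rw [inv_inv]⟩ : IsConj (x i) _).symm
      · rw [Θ_tw_out hlt (by omega)]
    obtain ⟨v, hv⟩ := isConj_iff.1 (h2.symm.trans h1)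
    have h3 := congrArg (fun w => (expo (i : ℕ) w).toAdd) hv
    by_contra hne
    rw [Equiv.Perm.one_apply] at hne
    simp [x, expo_of] at h3
    exact hne h3
  have hfix : ∀ N : ℕ, BnAux.Θ (k + 2) (tw (k + 2) 0 k ^ N) (x (k + 1)) = x (k + 1) := by
    intro N
    induction N with
    | zero => simp
    | succ N ih => rw [pow_succ, map_mul, MulAut.mul_apply, Θ_tw_out hlt (by omega), ih]
  have hconj : ∀ N : ℕ, ∀ b ∈ Fs (k + 1), BnAux.Θ (k + 2) (tw (k + 2) 0 k ^ N) b =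
      (cp 0 (k + 1))⁻¹ ^ N * b * cp 0 (k + 1) ^ N := by
    intro N
    induction N with
    | zero => simp
    | succ N ih =>
      intro b hb
      rw [pow_succ, map_mul, MulAut.mul_apply, htw _ hb,
        ih _ (mul_mem (mul_mem (inv_mem hC) hb) hC)]
      rw [pow_succ, pow_succ']; simp only [mul_assoc]
  rcases conj_or_sub2 (z := k + 1) h.1 hC (expo 0) (expo_cp k)
    (fun N => (BnAux.Θ (k + 2) (tw (k + 2) 0 k ^ N)).toMonoidHom) hfix hconj
    (fun N => h.2 _ (pow_mem hP N)) with h1 | ⟨W, hW⟩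
  · exact .inl h1
  · right
    refine ⟨sub2 (x 0 * (x 1)⁻¹) (x 1) W, ?_⟩
    rw [map_sub2, map_mul, map_inv, sub2_zero, sub2_one, cp_succ]
    simpa using hW

theorem eq_one_of_forall_conj (hn : 0 < n) {y : F} (hy : y ∈ Fs n)
    (h : ∀ g, ∃ b ∈ Fs (n - 1), IsConj (Θ n g y) b) : y = 1 := by
  have key : ∀ d ≤ n, ∃ b ∈ Fs (n - d), IsConj y b := by
    intro d
    induction d with
    | zero => exact fun _ => ⟨y, hy, IsConj.refl y⟩
    | succ d ih =>
      intro hd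
      obtain ⟨b, hb, hc⟩ := ih (by omega)
      obtain ⟨k, hk⟩ : ∃ k, n - d = k + 1 := ⟨n - d - 1, by omega⟩
      rw [hk] at hb
      have hkn : k + (n - 1 - k) = n - 1 := by omega
      obtain ⟨g, hg1, hg2⟩ := exists_Θ_shift (n := n) (a := k) (d := n - 1 - k) (by omega)
      rw [hkn] at hg2
      obtain ⟨b', hb', hc'⟩ := h g
      have h1 : IsConj (Θ n g b) b' := ((isConj_Θ_iff g).2 hc).symm.trans hc'
      have h2 := (κ (n - 1)).map_isConj h1
      rw [κ_of_mem hb'] at h2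
      have h3 : κ (n - 1) (Θ n g b) = Θ n g (κ k b) := by
        refine Fs_eqOn (f := (κ (n - 1)).comp (Θ n g).toMonoidHom)
          (g := (Θ n g).toMonoidHom.comp (κ k)) (fun i hi => ?_) hb
        show κ (n - 1) (Θ n g (x i)) = Θ n g (κ k (x i))
        rcases Nat.lt_succ_iff_lt_or_eq.1 hi with hi | rfl
        · rw [hg1 i hi, κ_lt (by omega), κ_lt hi, hg1 i hi]
        · rw [hg2, κ_ge le_rfl, κ_ge le_rfl, map_one]
      rw [h3] at h2
      refine ⟨κ k b, ?_, hc.trans ((isConj_Θ_iff g).1 (h1.trans h2.symm))⟩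
      rw [show n - (d + 1) = k by omega]; exact κ_mem k b
  obtain ⟨b, hb, hc⟩ := key n le_rfl
  rw [Nat.sub_self] at hb
  have : Fs 0 = ⊥ := by simp [Fs]
  rw [this, Subgroup.mem_bot] at hb
  rw [hb] at hc
  exact isConj_one_left.1 hc

theorem PInv.classify (hn : 3 ≤ n) {y : F} (h : PInv n y) :
    y = 1 ∨ (∃ m : ℤ, IsConj y (cp 0 n ^ m)) ∨ ∃ m : ℤ, ∃ j < n, IsConj y (x j ^ m) := by
  by_cases hall : ∀ g, ∃ b ∈ Fs (n - 1), IsConj (BnAux.Θ n g y) b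
  · exact .inl (eq_one_of_forall_conj (by omega) h.1 hall)
  right
  push Not at hall
  obtain ⟨g, hg⟩ := hall
  have hback : ∀ u, IsConj (BnAux.Θ n g y) u → IsConj y (BnAux.Θ n g⁻¹ u) := fun u hu => by
    rw [← isConj_Θ_iff g, Θ_inv_apply]; exact hu
  have h1 := h.Θ g
  generalize hy1 : BnAux.Θ n g y = y1 at *
  obtain ⟨k, rfl⟩ : ∃ k, n = k + 2 := ⟨n - 2, by omega⟩
  obtain ⟨W, hW⟩ : ∃ W, IsConj y1 (sub2 (cp 0 (k + 2)) (x (k + 1)) W) := by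
    rcases h1.dich (by omega) with ⟨b, hb, hc⟩ | h2
    · exact absurd hc (hg b hb)
    · exact h2
  obtain ⟨B, hB1, hB2⟩ : ∃ B, BnAux.Θ (k + 2) B (x (k + 1)) = x k ∧
      BnAux.Θ (k + 2) B (cp 0 (k + 2)) = cp 0 (k + 2) := by
    refine ⟨(blk (k + 2) 0 (k + 1))⁻¹, ?_, ?_⟩
    · rw [map_inv, autInv_eq_iff, Θ_blk_lt (by omega) (by omega) (by omega)]
    · rw [map_inv, autInv_eq_iff, Θ_blk_cp (by omega)]
  have h2 : IsConj (BnAux.Θ (k + 2) B y1) (sub2 (cp 0 (k + 2)) (x k) W) := by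
    have := (isConj_Θ_iff B).2 hW
    have e := map_sub2 (BnAux.Θ (k + 2) B).toMonoidHom (cp 0 (k + 2)) (x (k + 1)) W
    change BnAux.Θ (k + 2) B _ = sub2 (BnAux.Θ (k + 2) B _) (BnAux.Θ (k + 2) B _) W at e
    rwa [e, hB1, hB2] at this
  rcases (h1.Θ B).dich (by omega) with ⟨b, hb, hc⟩ | ⟨W', hc⟩
  · right
    have h3 := h2.symm.trans hc
    have h4 := (κ (k + 1)).map_isConj h3
    rw [map_sub2, κ_of_mem (w := b) (by simpa using hb), κ_cp (by omega), κ_lt (by omega)] at h4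
    have h5 := h3.trans h4.symm
    let L : F →* F := FreeGroup.lift fun i => if i = k then x (k + 1) else
      if i = k + 1 then (x (k + 1))⁻¹ * cp 0 (k + 2) else 1
    have hL1 : L (x k) = x (k + 1) := by simp [L, x]
    have hL2 : L (x (k + 1)) = (x (k + 1))⁻¹ * cp 0 (k + 2) := by simp [L, x]
    have hL3 : ∀ i < k, L (x i) = 1 := fun i hi => by
      simp [L, x, show i ≠ k by omega, show i ≠ k + 1 by omega]
    have h6 := L.map_isConj h5
    rw [map_sub2, map_sub2, hL1] at h6
    have h7 : L (cp 0 (k + 1)) = x (k + 1) := by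
      rw [cp_succ, map_mul, map_cp_eq_one L (fun p _ hp => hL3 p (by omega)), one_mul, zero_add,
        hL1]
    rw [cp_succ 0 (k + 1), map_mul, h7, zero_add, hL2, mul_inv_cancel_left] at h6
    obtain ⟨m, hm⟩ := sub2_zpow (x (k + 1)) 1 1 W
    rw [zpow_one] at hm
    rw [hm] at h6
    refine ⟨m, _, (σ (k + 2) g⁻¹ ⟨k + 1, by omega⟩).2, (hback _ (hW.trans h6)).trans ?_⟩
    rw [map_zpow]
    obtain ⟨v, hv⟩ := isConj_iff.1 (isConj_Θ_x g⁻¹ (show k + 1 < k + 2 by omega))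
    exact isConj_iff.2 ⟨v, by rw [← conj_zpow, hv]⟩
  · left
    have h3 := h2.symm.trans hc
    let L : F →* F := FreeGroup.lift fun i => if i = k then x (k + 1) else
      if i = 0 then cp 0 (k + 2) * (x (k + 1))⁻¹ else 1
    have hL1 : L (x k) = x (k + 1) := by simp [L, x]
    have hL2 : L (x 0) = cp 0 (k + 2) * (x (k + 1))⁻¹ := by
      simp [L, x, show 0 ≠ k by omega]
    have hL3 : ∀ i, i ≠ 0 → i ≠ k → L (x i) = 1 := fun i hi hi' => by
      simp [L, x, hi, hi']
    have h6 := L.map_isConj h3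
    have e : L (cp 0 (k + 2)) = cp 0 (k + 2) := by
      rw [map_cp_two L (i := 0) (j := k) (by omega) (by omega) (fun p _ h h' => hL3 p h h'), hL1,
        hL2]
      group
    simp only [show k + 2 - 1 = k + 1 from rfl] at h6
    rw [map_sub2, map_sub2, hL1, hL3 (k + 1) (by omega) (by omega), e] at h6
    obtain ⟨m, hm⟩ := sub2_zpow (cp 0 (k + 2)) 1 0 W'
    rw [zpow_one, zpow_zero] at hm
    rw [hm] at h6
    refine ⟨m, (hback _ (hW.trans h6)).trans ?_⟩
    rw [map_zpow]
    obtain ⟨v, hv⟩ := isConj_iff.1 (isConj_Θ_cp (n := k + 2) g⁻¹)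
    exact isConj_iff.2 ⟨v, by rw [← conj_zpow, hv]⟩

/-- The total exponent on the first `n` letters. -/
noncomputable def tot (n : ℕ) : F →* Multiplicative ℤ := (wt n).comp (ι n)

theorem tot_x {i : ℕ} (hi : i < n) : tot n (x i) = Multiplicative.ofAdd 1 := by
  obtain ⟨g, hg⟩ := exists_conj_last hi
  simp only [tot, MonoidHom.comp_apply]
  rw [hg, map_mul, map_mul, map_inv, mul_right_comm, mul_inv_cancel, one_mul, wt_last (by omega)]

theorem map_eq_of_isConj {G : Type*} [Group G] (f : G →* Multiplicative ℤ) {u v : G}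
    (h : IsConj u v) : f u = f v := isConj_iff_eq.1 (f.map_isConj h)

theorem tot_cp {m : ℕ} (hm : m ≤ n) : tot n (cp 0 m) = Multiplicative.ofAdd (m : ℤ) := by
  induction m with
  | zero => simp [cp_zero]
  | succ m ih =>
    rw [cp_succ, map_mul, ih (by omega), zero_add, tot_x (by omega), ← ofAdd_add]; simp

theorem expo_cp_of_lt {i m : ℕ} (h : i < m) : expo i (cp 0 m) = Multiplicative.ofAdd 1 := by
  induction m with
  | zero => omega
  | succ m ih =>
    rw [cp_succ, map_mul, zero_add, x, expo_of]
    rcases Nat.lt_succ_iff_lt_or_eq.1 h with h | rfl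
    · rw [ih h, if_neg (by omega)]; simp
    · rw [if_pos rfl, map_cp_eq_one _ (fun p _ hp => ?_), one_mul]
      rw [x, expo_of, if_neg (by omega)]; rfl

theorem exists_Θ_x {i j : ℕ} (hi : i < n) (hj : j < n) : ∃ g, IsConj (Θ n g (x i)) (x j) := by
  obtain ⟨g, hg⟩ := σ_surjective (by omega) (Equiv.swap (⟨i, hi⟩ : Fin n) ⟨j, hj⟩)
  refine ⟨g, ?_⟩
  have := isConj_Θ_x g hi
  rwa [hg, Equiv.swap_apply_left] at this

theorem isConj_Θ_x_of_mem {g : ArtinB n} (hg : g ∈ P n) {i : ℕ} (hi : i < n) :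
    IsConj (Θ n g (x i)) (x i) := by
  have := isConj_Θ_x g hi
  rwa [mem_P.1 hg] at this

theorem Induces.map_Θ_isConj (hn : 2 ≤ n) {φ : MulAut (ArtinB n)} {α : F →* F} (h : Induces n φ α)
    {g : ArtinB n} {u v : F} (huv : IsConj (BnAux.Θ n g u) v) :
    IsConj (BnAux.Θ n (φ g) (α u)) (α v) := by
  rw [← h.Θ hn]; exact α.map_isConj huv

theorem Induces.pInv (hn : 5 ≤ n) {φ : MulAut (ArtinB n)} {α : F →* F} (h : Induces n φ α) {i : ℕ}
    (hi : i < n) : PInv n (α (x i)) := by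
  refine ⟨(h _).1, fun g hg => ?_⟩
  have h1 : φ⁻¹ g ∈ P n := aut_mem_P hn _ hg
  have := h.map_Θ_isConj (by omega) (isConj_Θ_x_of_mem h1 hi)
  rwa [← MulAut.mul_apply, mul_inv_cancel, MulAut.one_apply] at this

theorem Induces.isConj_cp (hn : 2 ≤ n) {φ : MulAut (ArtinB n)} {α : F →* F} (h : Induces n φ α)
    (g : ArtinB n) : IsConj (BnAux.Θ n g (α (cp 0 n))) (α (cp 0 n)) := by
  have := h.map_Θ_isConj (by omega) (isConj_Θ_cp (φ⁻¹ g))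
  rwa [← MulAut.mul_apply, mul_inv_cancel, MulAut.one_apply] at this

theorem Induces.exists_isConj_x (hn : 5 ≤ n) {φ : MulAut (ArtinB n)} {α β : F →* F}
    (h : Induces n φ α) (h' : Induces n φ⁻¹ β) :
    ∃ m : ℤ, ∀ i < n, ∃ j < n, IsConj (α (x i)) (x j ^ m) := by
  have hinv : φ⁻¹⁻¹ = φ := inv_inv φ
  have h'' : Induces n φ⁻¹⁻¹ α := by rwa [hinv]
  have hx0 : x 0 ∈ Fs n := x_mem_Fs (by omega)
  have hshift : ∀ i < n, ∃ g, IsConj (BnAux.Θ n g (α (x 0))) (α (x i)) := by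
    intro i hi
    obtain ⟨g, hg⟩ := exists_Θ_x (show 0 < n by omega) hi
    exact ⟨φ g, h.map_Θ_isConj (by omega) hg⟩
  rcases (h.pInv hn (show 0 < n by omega)).classify (by omega) with h1 | ⟨m, hm⟩ | ⟨m, j, hj, hm⟩
  · have := h'.inv_apply (by omega) h'' (x 0)
    rw [h1, map_one, κ_of_mem hx0] at this
    have := congrArg (fun w => (expo 0 w).toAdd) this
    simp [x, expo_of] at this
  · have hc : ∀ i < n, IsConj (α (x i)) (cp 0 n ^ m) := by
      intro i hi
      obtain ⟨g, hg⟩ := hshift i hi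
      refine hg.symm.trans (((isConj_Θ_iff g).2 hm).trans ?_)
      rw [map_zpow]
      obtain ⟨v, hv⟩ := isConj_iff.1 (isConj_Θ_cp g)
      exact isConj_iff.2 ⟨v, by rw [← conj_zpow, hv]⟩
    have he : (expo 0).comp α (β (x 0)) = (expo 1).comp α (β (x 0)) := by
      refine Fs_eqOn (fun i hi => ?_) (h' (x 0)).1
      rw [MonoidHom.comp_apply, MonoidHom.comp_apply, map_eq_of_isConj _ (hc i hi),
        map_eq_of_isConj _ (hc i hi), map_zpow, map_zpow, expo_cp_of_lt (by omega),
        expo_cp_of_lt (by omega)]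
    rw [MonoidHom.comp_apply, MonoidHom.comp_apply, h.inv_apply (by omega) h', κ_of_mem hx0] at he
    simp [x, expo_of] at he
  · refine ⟨m, fun i hi => ?_⟩
    obtain ⟨g, hg⟩ := hshift i hi
    refine ⟨_, (σ n g ⟨j, hj⟩).2, hg.symm.trans (((isConj_Θ_iff g).2 hm).trans ?_)⟩
    rw [map_zpow]
    obtain ⟨v, hv⟩ := isConj_iff.1 (isConj_Θ_x g hj)
    exact isConj_iff.2 ⟨v, by rw [← conj_zpow, hv]⟩

theorem tot_apply_of_isConj {α : F →* F} {m : ℤ}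
    (hm : ∀ i < n, ∃ j < n, IsConj (α (x i)) (x j ^ m)) {w : F} (hw : w ∈ Fs n) :
    tot n (α w) = tot n w ^ m := by
  refine Fs_eqOn (f := (tot n).comp α) (g := (zpowGroupHom m).comp (tot n)) (fun i hi => ?_) hw
  obtain ⟨j, hj, hc⟩ := hm i hi
  rw [MonoidHom.comp_apply, map_eq_of_isConj _ hc, map_zpow, tot_x hj, MonoidHom.comp_apply,
    tot_x hi]
  rfl

theorem Induces.exists_sign (hn : 5 ≤ n) {φ : MulAut (ArtinB n)} {α β : F →* F}
    (h : Induces n φ α) (h' : Induces n φ⁻¹ β) :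
    ∃ m : ℤ, (m = 1 ∨ m = -1) ∧ (∀ i < n, ∃ j < n, IsConj (α (x i)) (x j ^ m)) ∧
      IsConj (α (cp 0 n)) (cp 0 n ^ m) := by
  obtain ⟨m, hm⟩ := h.exists_isConj_x hn h'
  have h1 : m = 1 ∨ m = -1 := by
    have := tot_apply_of_isConj hm (h' (x 0)).1
    rw [h.inv_apply (by omega) h', κ_of_mem (x_mem_Fs (by omega)), tot_x (by omega)] at this
    have := congrArg Multiplicative.toAdd this
    rw [toAdd_zpow, toAdd_ofAdd, smul_eq_mul] at this
    exact Int.isUnit_iff.1 (.of_mul_eq_one _ this.symm)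
  refine ⟨m, h1, hm, ?_⟩
  have hc0 : cp 0 n ∈ Fs n := by simpa using cp_mem 0 n
  have h2 := tot_apply_of_isConj hm hc0
  rw [tot_cp le_rfl] at h2
  have h2 := congrArg Multiplicative.toAdd h2
  rw [toAdd_zpow, toAdd_ofAdd, smul_eq_mul] at h2
  have hn0 : (n : ℤ) ≠ 0 := by omega
  have hmn : m * n ≠ 0 := mul_ne_zero (by omega) hn0
  rcases PInv.classify (by omega) ⟨(h (cp 0 n)).1, fun g _ => h.isConj_cp (by omega) g⟩ with
    h3 | ⟨k, hk⟩ | ⟨k, j, hj, hk⟩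
  · rw [h3, map_one] at h2; exact absurd h2.symm hmn
  · rw [map_eq_of_isConj _ hk, map_zpow, tot_cp le_rfl, toAdd_zpow, toAdd_ofAdd, smul_eq_mul] at h2
    rwa [mul_right_cancel₀ hn0 h2] at hk
  · exfalso
    rw [map_eq_of_isConj _ hk, map_zpow, tot_x hj, toAdd_zpow, toAdd_ofAdd, smul_eq_mul, mul_one]
      at h2
    obtain ⟨i, hi, hij⟩ : ∃ i < n, i ≠ j := by
      rcases Nat.eq_zero_or_pos j with rfl | hj
      · exact ⟨1, by omega, by omega⟩
      · exact ⟨0, by omega, by omega⟩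
    obtain ⟨g, hg⟩ := exists_Θ_x hj hi
    obtain ⟨v, hv⟩ := isConj_iff.1 hg
    have h4 : IsConj (BnAux.Θ n g (x j ^ k)) (x i ^ k) :=
      isConj_iff.2 ⟨v, by rw [map_zpow, ← conj_zpow, hv]⟩
    have h5 := (hk.symm.trans (h.isConj_cp (by omega) g).symm).trans
      (((isConj_Θ_iff g).2 hk).trans h4)
    have h6 := map_eq_of_isConj (expo i) h5
    simp [x, expo_of, Ne.symm hij] at h6
    have := congrArg Multiplicative.toAdd h6
    simp [toAdd_zpow] at this
    omega

theorem isBSeq_neg (n : ℕ) : IsBSeq n fun i => (s n i)⁻¹ where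
  braid i hi := by
    have := congrArg Inv.inv (braid hi)
    simpa only [mul_inv_rev, mul_assoc] using this
  braid4 i hi := by
    have := congrArg Inv.inv (braid4 hi)
    simpa only [mul_inv_rev, mul_assoc] using this.symm
  comm i j hij hj := (show Commute (s n i) (s n j) from s_comm hij).inv_inv

/-- The endomorphism inverting the standard generators. -/
noncomputable def negHom (n : ℕ) : ArtinB n →* ArtinB n := liftB _ (isBSeq_neg n)

theorem negHom_s {i : ℕ} (h : i < n) : negHom n (s n i) = (s n i)⁻¹ := by
  rw [negHom, liftB_s _ _ h]

theorem negHom_negHom (g : ArtinB n) : negHom n (negHom n g) = g := by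
  have : (negHom n).comp (negHom n) = MonoidHom.id _ := by
    apply hom_ext
    intro i hi
    simp [negHom_s hi]
  exact DFunLike.congr_fun this g

/-- The automorphism inverting the standard generators. -/
noncomputable def neg (n : ℕ) : MulAut (ArtinB n) where
  toFun := negHom n
  invFun := negHom n
  left_inv := negHom_negHom
  right_inv := negHom_negHom
  map_mul' := map_mul _

theorem neg_s {i : ℕ} (h : i < n) : neg n (s n i) = (s n i)⁻¹ := negHom_s h

theorem neg_neg_mul : neg n * neg n = 1 := MulEquiv.ext negHom_negHom

theorem neg_inv : (neg n)⁻¹ = neg n := inv_eq_of_mul_eq_one_right neg_neg_mul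

theorem pr_neg (g : ArtinB n) : pr n (neg n g) = neg n (pr n g) := by
  have : (pr n).comp (negHom n) = (negHom n).comp (pr n) := by
    apply hom_ext
    intro i hi
    rw [MonoidHom.comp_apply, MonoidHom.comp_apply, negHom_s hi, map_inv]
    rcases Nat.lt_or_ge (i + 1) n with h | h
    · rw [pr_s h, negHom_s hi]
    · rw [pr_last (by omega), inv_one, map_one]
  exact DFunLike.congr_fun this g

theorem good_neg (n : ℕ) : Good n (neg n) := by
  intro w
  have : neg n (ι n w) ∈ U n := by
    rw [mem_U_iff, pr_neg, mem_U_iff.1 (ι_mem_U w), map_one]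
  obtain ⟨w', hw', h⟩ := exists_ι_of_mem_U this
  exact ⟨w', hw', 0, by rw [h, zpow_zero, mul_one]⟩

theorem wt_neg (g : ArtinB n) : wt n (neg n g) = (wt n g)⁻¹ := by
  have : (wt n).comp (negHom n) = invMonoidHom.comp (wt n) := by
    apply hom_ext
    intro i hi
    rw [MonoidHom.comp_apply, negHom_s hi, map_inv]; rfl
  exact DFunLike.congr_fun this g

/-- A positive automorphism maps the free letters to conjugates of free letters. -/
def Pos (n : ℕ) (α : F →* F) : Prop :=
  (∀ i < n, ∃ j < n, IsConj (α (x i)) (x j)) ∧ IsConj (α (cp 0 n)) (cp 0 n)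

theorem Good.exists_pos (hn : 5 ≤ n) {φ : MulAut (ArtinB n)} (h : Good n φ) (h' : Good n φ⁻¹) :
    ∃ ψ α, (ψ = φ ∨ ψ = φ * neg n) ∧ Induces n ψ α ∧ Pos n α := by
  obtain ⟨α, hα⟩ := h.exists_induces (by omega)
  obtain ⟨β, hβ⟩ := h'.exists_induces (by omega)
  obtain ⟨m, hm, hx, hc⟩ := hα.exists_sign hn hβ
  rcases hm with rfl | rfl
  · exact ⟨φ, α, .inl rfl, hα, by simpa using hx, by simpa using hc⟩
  have g1 : Good n (φ * neg n) := h.mul (by omega) (good_neg n)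
  have g2 : Good n (φ * neg n)⁻¹ := by
    rw [mul_inv_rev, neg_inv]; exact (good_neg n).mul (by omega) h'
  obtain ⟨γ, hγ⟩ := g1.exists_induces (by omega)
  obtain ⟨γ', hγ'⟩ := g2.exists_induces (by omega)
  obtain ⟨k, hk, hkx, hkc⟩ := hγ.exists_sign hn hγ'
  rcases hk with rfl | rfl
  · exact ⟨_, γ, .inr rfl, hγ, by simpa using hkx, by simpa using hkc⟩
  exfalso
  obtain ⟨J, hJ⟩ := (good_neg n).exists_induces (by omega)
  obtain ⟨J', hJ'⟩ : ∃ J', Induces n (neg n)⁻¹ J' := by rw [neg_inv]; exact ⟨J, hJ⟩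
  obtain ⟨w', hw', e⟩ : ∃ w' ∈ Fs n, neg n (ι n (x 0)) = ι n w' := by
    have : neg n (ι n (x 0)) ∈ U n := by
      rw [mem_U_iff, pr_neg, mem_U_iff.1 (ι_mem_U _), map_one]
    exact exists_ι_of_mem_U this
  have hJ0 : J (x 0) = w' := hJ.eq (by omega) hw' (k := 0) (by rw [e, zpow_zero, mul_one])
  have e1 : tot n w' = (tot n (x 0))⁻¹ := by
    simp only [tot, MonoidHom.comp_apply]; rw [← e, wt_neg]
  have e2 : γ (x 0) = α w' := by
    obtain ⟨l, hl⟩ := (hα w').2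
    refine hγ.eq (by omega) (hα _).1 (k := l) ?_
    rw [MulAut.mul_apply, e, hl]
  have e3 := tot_apply_of_isConj hkx (x_mem_Fs (show 0 < n by omega))
  rw [e2, tot_apply_of_isConj hx hw', e1, tot_x (by omega)] at e3
  have := congrArg Multiplicative.toAdd e3
  simp at this

theorem toWord_mul_of_junction {u v : F}
    (h : ∀ p ∈ u.toWord.getLast?, ∀ q ∈ v.toWord.head?, p.1 = q.1 → p.2 = q.2) :
    (u * v).toWord = u.toWord ++ v.toWord := by
  have hr : FreeGroup.IsReduced (u.toWord ++ v.toWord) :=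
    List.isChain_append.2 ⟨FreeGroup.isReduced_toWord, FreeGroup.isReduced_toWord, h⟩
  conv_lhs => rw [← FreeGroup.mk_toWord (x := u), ← FreeGroup.mk_toWord (x := v)]
  rw [FreeGroup.mul_mk, FreeGroup.toWord_mk, hr.reduce_eq]

theorem norm_mul_lt_of_getLast {w : F} {k : ℕ} {e : Bool} (h : (k, e) ∈ w.toWord.getLast?) :
    (w * FreeGroup.mk [(k, !e)]).norm < w.norm := by
  obtain ⟨l, hl⟩ := List.mem_getLast?_eq_getLast h |>.elim fun h0 h1 =>
    (⟨w.toWord.dropLast, by rw [h1, List.dropLast_append_getLast]⟩ : ∃ l, w.toWord = l ++ [(k, e)])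
  have hw : w = FreeGroup.mk l * FreeGroup.mk [(k, e)] := by
    rw [FreeGroup.mul_mk, ← hl, FreeGroup.mk_toWord]
  have h1 : FreeGroup.mk [(k, e)] * FreeGroup.mk [(k, !e)] = (1 : F) := by
    rw [show FreeGroup.mk [(k, !e)] = (FreeGroup.mk [(k, e)] : F)⁻¹ by
      rw [FreeGroup.inv_mk]; simp [FreeGroup.invRev], mul_inv_cancel]
  have h2 : w * FreeGroup.mk [(k, !e)] = FreeGroup.mk l := by rw [hw, mul_assoc, h1, mul_one]
  rw [h2]
  have h3 : w.norm = l.length + 1 := by rw [FreeGroup.norm, hl]; simp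
  have h4 : (FreeGroup.mk l : F).norm ≤ l.length := FreeGroup.norm_mk_le
  omega

theorem getLast_of_head_inv {w : F} {k : ℕ} {e : Bool} (h : (k, e) ∈ (w⁻¹).toWord.head?) :
    (k, !e) ∈ w.toWord.getLast? := by
  rw [FreeGroup.toWord_inv, FreeGroup.invRev, List.head?_reverse, List.getLast?_map] at h
  obtain ⟨⟨a, b⟩, hab, he⟩ := Option.map_eq_some_iff.1 h
  rw [Option.mem_def, hab]
  simp only [Prod.mk.injEq] at he
  obtain ⟨rfl, rfl⟩ := he
  simp

theorem head_inv_of_getLast {w : F} {k : ℕ} {e : Bool} (h : (k, e) ∈ w.toWord.getLast?) :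
    (k, !e) ∈ (w⁻¹).toWord.head? := by
  rw [FreeGroup.toWord_inv, FreeGroup.invRev, List.head?_reverse, List.getLast?_map]
  rw [Option.mem_def] at h ⊢
  rw [h]; rfl

theorem norm_mul_lt_of_head {w : F} {k : ℕ} {e : Bool} (h : (k, e) ∈ w.toWord.head?) :
    (FreeGroup.mk [(k, !e)] * w).norm < w.norm := by
  have h1 : (k, !e) ∈ (w⁻¹).toWord.getLast? := getLast_of_head_inv (by rwa [inv_inv])
  have h2 := norm_mul_lt_of_getLast h1
  rw [Bool.not_not, FreeGroup.norm_inv_eq] at h2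
  have h3 : w⁻¹ * FreeGroup.mk [(k, e)] = (FreeGroup.mk [(k, !e)] * w)⁻¹ := by
    rw [mul_inv_rev, FreeGroup.inv_mk]; simp [FreeGroup.invRev]
  rwa [h3, FreeGroup.norm_inv_eq] at h2

/-- If the path from `g` to `g'` starts along a letter along which `g` does not backtrack,
inserting the inverse letter shortens the word. -/
theorem norm_insert_lt {g g' : F} {k : ℕ} {e : Bool} (h : (k, e) ∈ (g⁻¹ * g').toWord.head?)
    (hg : (k, !e) ∉ g.toWord.getLast?) :
    (g * FreeGroup.mk [(k, !e)] * (g⁻¹ * g')).norm < g'.norm := by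
  have h1 : (g * (g⁻¹ * g')).toWord = g.toWord ++ (g⁻¹ * g').toWord := by
    apply toWord_mul_of_junction
    rintro ⟨a, b⟩ hp q hq hab
    obtain rfl : (k, e) = q := Option.mem_unique h hq
    obtain rfl : a = k := hab
    by_contra hne
    refine hg ?_
    have : b = !e := by cases b <;> cases e <;> simp_all
    rwa [← this]
  rw [mul_inv_cancel_left] at h1
  have h2 : g'.norm = g.norm + (g⁻¹ * g').norm := by
    rw [FreeGroup.norm, h1, List.length_append]; rfl
  have h3 := norm_mul_lt_of_head h
  have h4 := FreeGroup.norm_mul_le g (FreeGroup.mk [(k, !e)] * (g⁻¹ * g'))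
  rw [mul_assoc]
  omega

theorem toWord_x (i : ℕ) : (x i).toWord = [(i, true)] := FreeGroup.toWord_of i

theorem toWord_cp (m : ℕ) : (cp 0 m).toWord = (List.range m).map fun i => (i, true) := by
  induction m with
  | zero => simp [cp_zero]
  | succ m ih =>
    rw [cp_succ, toWord_mul_of_junction, ih, zero_add, toWord_x, List.range_succ, List.map_append]
    · rfl
    · intro p hp q hq _
      rw [zero_add, toWord_x] at hq
      rw [ih] at hp
      have hp := List.mem_of_getLast? hp
      obtain ⟨i, -, rfl⟩ := List.mem_map.1 hp
      obtain rfl : (m, true) = q := by simpa using hq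
      rfl

theorem eq_id_of_reduced {f : F →* F} {g : ℕ → F} {θ : ℕ → ℕ} {m : ℕ}
    (hf : ∀ i ≤ m, f (x i) = g i * x (θ i) * (g i)⁻¹)
    (ha : ∀ i ≤ m, ∀ e, (θ i, e) ∉ (g i).toWord.getLast?)
    (hb : ∀ i < m, (θ i, false) ∉ ((g i)⁻¹ * g (i + 1)).toWord.head?)
    (hb' : ∀ i < m, (θ (i + 1), false) ∉ ((g i)⁻¹ * g (i + 1)).toWord.getLast?)
    (hc : f (cp 0 (m + 1)) = cp 0 (m + 1)) : ∀ i ≤ m, f (x i) = x i := by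
  have key : ∀ k ≤ m, ∃ L, (f (cp 0 k) * g k * x (θ k)).toWord = L ∧ (θ k, true) ∈ L.getLast? ∧
      k + 1 ≤ L.length ∧ (L.length = k + 1 → (∀ i ≤ k, g i = 1) ∧
        L = (List.range (k + 1)).map fun i => (θ i, true)) := by
    intro k
    induction k with
    | zero =>
      intro _
      refine ⟨(g 0).toWord ++ [(θ 0, true)], ?_, by simp, by simp, fun h => ?_⟩
      · rw [cp_zero, map_one, one_mul, toWord_mul_of_junction, toWord_x]
        rintro ⟨a, b⟩ hp q hq hpq
        rw [toWord_x] at hq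
        obtain rfl : (θ 0, true) = q := by simpa using hq
        obtain rfl : a = θ 0 := hpq
        exact absurd hp (ha 0 (by omega) b)
      · have h1 : (g 0).toWord = [] := by simpa using h
        refine ⟨fun i hi => ?_, by rw [h1]; simp⟩
        obtain rfl : i = 0 := by omega
        exact FreeGroup.toWord_eq_nil_iff.1 h1
    | succ k ih =>
      intro hk
      obtain ⟨L, hL, hlast, hlen, heq⟩ := ih (by omega)
      have h1 : ((g k)⁻¹ * g (k + 1) * x (θ (k + 1))).toWord =
          ((g k)⁻¹ * g (k + 1)).toWord ++ [(θ (k + 1), true)] := by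
        rw [toWord_mul_of_junction, toWord_x]
        rintro ⟨a, b⟩ hp q hq hpq
        rw [toWord_x] at hq
        obtain rfl : (θ (k + 1), true) = q := by simpa using hq
        obtain rfl : a = θ (k + 1) := hpq
        cases b
        · exact absurd hp (hb' k (by omega))
        · rfl
      have h2 : f (cp 0 (k + 1)) * g (k + 1) * x (θ (k + 1)) =
          f (cp 0 k) * g k * x (θ k) * ((g k)⁻¹ * g (k + 1) * x (θ (k + 1))) := by
        rw [cp_succ, map_mul, zero_add, hf k (by omega)]; simp only [mul_assoc]
      refine ⟨L ++ (((g k)⁻¹ * g (k + 1)).toWord ++ [(θ (k + 1), true)]), ?_, by simp, by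
        simp; omega, fun h => ?_⟩
      · rw [h2, toWord_mul_of_junction, hL, h1]
        rw [hL, h1]
        intro p hp q hq hpq
        obtain rfl : (θ k, true) = p := Option.mem_unique hlast hp
        obtain ⟨a, b⟩ := q
        obtain rfl : θ k = a := hpq
        cases b
        · exfalso
          cases hw : ((g k)⁻¹ * g (k + 1)).toWord with
          | nil => rw [hw] at hq; simp at hq
          | cons c l =>
            refine hb k (by omega) ?_
            rw [hw] at hq ⊢
            simpa using hq
        · rfl
      · simp only [List.length_append, List.length_singleton] at h
        have h3 : ((g k)⁻¹ * g (k + 1)).toWord = [] := List.length_eq_zero_iff.1 (by omega)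
        obtain ⟨h4, h5⟩ := heq (by omega)
        have h6 := FreeGroup.toWord_eq_nil_iff.1 h3
        refine ⟨fun i hi => ?_, ?_⟩
        · rcases Nat.lt_or_eq_of_le hi with hi | rfl
          · exact h4 i (by omega)
          · rwa [h4 k le_rfl, inv_one, one_mul] at h6
        · rw [h3, h5, List.range_succ (n := k + 1), List.map_append]; rfl
  obtain ⟨L, hL, hlast, hlen, heq⟩ := key m le_rfl
  have h1 : cp 0 (m + 1) = f (cp 0 m) * g m * x (θ m) * (g m)⁻¹ := by
    rw [← hc, cp_succ, map_mul, zero_add, hf m le_rfl]; simp only [mul_assoc]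
  have h2 : (cp 0 (m + 1)).toWord = L ++ ((g m)⁻¹).toWord := by
    rw [h1, toWord_mul_of_junction, hL]
    rw [hL]
    intro p hp q hq hpq
    obtain rfl : (θ m, true) = p := Option.mem_unique hlast hp
    obtain ⟨a, b⟩ := q
    obtain rfl : θ m = a := hpq
    exact absurd (getLast_of_head_inv hq) (ha m le_rfl _)
  rw [toWord_cp] at h2
  have h3 := congrArg List.length h2
  simp only [List.length_map, List.length_range, List.length_append] at h3
  obtain ⟨h4, h5⟩ := heq (by omega)
  have h6 : ((g m)⁻¹).toWord = [] := List.length_eq_zero_iff.1 (by omega)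
  rw [h6, List.append_nil, h5] at h2
  intro i hi
  have h7 := List.map_inj_left.1 h2 i (List.mem_range.2 (by omega))
  rw [hf i hi, h4 i hi]
  simp only [Prod.mk.injEq, and_true] at h7
  rw [← h7]; simp

theorem sum_range_lt_of_two {f f' : ℕ → ℕ} {i j : ℕ} (hi : i < n) (hj : j < n) (hij : i ≠ j)
    (h : f' i + f' j < f i + f j) (he : ∀ k, k ≠ i → k ≠ j → f' k = f k) :
    ∑ k ∈ Finset.range n, f' k < ∑ k ∈ Finset.range n, f k := by
  have hjm : j ∈ (Finset.range n).erase i := Finset.mem_erase.2 ⟨hij.symm, Finset.mem_range.2 hj⟩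
  have hr : ∑ k ∈ ((Finset.range n).erase i).erase j, f' k =
      ∑ k ∈ ((Finset.range n).erase i).erase j, f k :=
    Finset.sum_congr rfl fun k hk => he k (Finset.mem_erase.1 (Finset.mem_erase.1 hk).2).1
      (Finset.mem_erase.1 hk).1
  have e1 := Finset.add_sum_erase _ f' (Finset.mem_range.2 hi)
  have e2 := Finset.add_sum_erase _ f (Finset.mem_range.2 hi)
  have e3 := Finset.add_sum_erase _ f' hjm
  have e4 := Finset.add_sum_erase _ f hjm
  omega

/-- `g` and `θ` describe the images of the letters under `γ` twisted by the braid `b`. -/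
def Desc (n : ℕ) (γ : F →* F) (b : ArtinB n) (g : ℕ → F) (θ : ℕ → ℕ) : Prop :=
  pr n b = b ∧ ∀ i < n, γ (Θ n b (x i)) = g i * x (θ i) * (g i)⁻¹

theorem hur_inv_self (i : ℕ) : (hur i)⁻¹ (x i) = x i * x (i + 1) * (x i)⁻¹ := by
  rw [autInv_eq_iff, map_mul, map_mul, map_inv, hur_self, hur_succ]; group

theorem hur_inv_succ (i : ℕ) : (hur i)⁻¹ (x (i + 1)) = x i := by
  rw [autInv_eq_iff, hur_self]

theorem hur_inv_ne {i j : ℕ} (h : j ≠ i) (h' : j ≠ i + 1) : (hur i)⁻¹ (x j) = x j := by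
  rw [autInv_eq_iff, hur_ne h h']

theorem Desc.move {γ : F →* F} {b : ArtinB n} {g : ℕ → F} {θ : ℕ → ℕ} (h : Desc n γ b g θ) {i : ℕ}
    (hi : i + 1 < n) :
    Desc n γ (b * s n i)
      (fun j => if j = i then g (i + 1) else if j = i + 1 then
        g (i + 1) * (x (θ (i + 1)))⁻¹ * ((g (i + 1))⁻¹ * g i) else g j)
      (fun j => if j = i then θ (i + 1) else if j = i + 1 then θ i else θ j) := by
  refine ⟨by rw [map_mul, h.1, pr_s hi], fun j hj => ?_⟩
  rw [map_mul, MulAut.mul_apply, Θ_s hi]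
  by_cases h1 : j = i
  · subst h1
    simp only [↓reduceIte]
    rw [hur_self, h.2 _ hi]
  by_cases h2 : j = i + 1
  · subst h2
    simp only [h1, if_false, if_true]
    simp only [hur_succ, map_mul, map_inv]
    rw [h.2 _ hi, h.2 i (by omega)]
    group
  · simp only [h1, h2, if_false]
    rw [hur_ne h1 h2, h.2 j hj]

theorem Desc.move_inv {γ : F →* F} {b : ArtinB n} {g : ℕ → F} {θ : ℕ → ℕ} (h : Desc n γ b g θ)
    {i : ℕ} (hi : i + 1 < n) :
    Desc n γ (b * (s n i)⁻¹)
      (fun j => if j = i then g i * x (θ i) * ((g i)⁻¹ * g (i + 1)) else if j = i + 1 then g i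
        else g j)
      (fun j => if j = i then θ (i + 1) else if j = i + 1 then θ i else θ j) := by
  refine ⟨by rw [map_mul, map_inv (pr n), h.1, pr_s hi], fun j hj => ?_⟩
  rw [map_mul, MulAut.mul_apply, map_inv (Θ n), Θ_s hi]
  by_cases h1 : j = i
  · subst h1
    simp only [↓reduceIte, hur_inv_self, map_mul, map_inv]
    rw [h.2 _ hi, h.2 j (by omega)]
    group
  by_cases h2 : j = i + 1
  · subst h2
    simp only [h1, if_false, if_true]
    rw [hur_inv_succ, h.2 i (by omega)]
  · simp only [h1, h2, if_false]
    rw [hur_inv_ne h1 h2, h.2 j hj]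

theorem mk_commute (k : ℕ) (e : Bool) :
    (FreeGroup.mk [(k, e)] : F) * x k * (FreeGroup.mk [(k, e)])⁻¹ = x k := by
  cases e
  · rw [show FreeGroup.mk [(k, false)] = (x k)⁻¹ from rfl]; group
  · rw [show FreeGroup.mk [(k, true)] = x k from rfl]; group

/-- Artin's theorem: an endomorphism fixing the product of the letters and permuting the
conjugacy classes of the letters is a braid. -/
theorem exists_Θ_of_fix_cp (hn : 0 < n) {γ : F →* F} (hc : γ (cp 0 n) = cp 0 n)
    (hx : ∀ i < n, ∃ j, IsConj (γ (x i)) (x j)) :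
    ∃ b, ∀ i < n, γ (Θ n b (x i)) = x i := by
  have hex : ∃ N b g θ, Desc n γ b g θ ∧ ∑ i ∈ Finset.range n, (g i).norm = N := by
    have : ∀ i, ∃ p : F × ℕ, i < n → γ (x i) = p.1 * x p.2 * p.1⁻¹ := by
      intro i
      by_cases hi : i < n
      · obtain ⟨j, hj⟩ := hx i hi
        obtain ⟨v, hv⟩ := isConj_iff.1 hj.symm
        exact ⟨(v, j), fun _ => hv.symm⟩
      · exact ⟨(1, 0), fun h => absurd h hi⟩
    choose p hp using this
    refine ⟨_, 1, fun i => (p i).1, fun i => (p i).2, ⟨map_one _, fun i hi => ?_⟩, rfl⟩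
    rw [map_one, MulAut.one_apply, hp i hi]
  classical
  obtain ⟨b, g, θ, hd, hN⟩ := Nat.find_spec hex
  have hmin : ∀ b' g' θ', Desc n γ b' g' θ' →
      ¬ ∑ i ∈ Finset.range n, (g' i).norm < ∑ i ∈ Finset.range n, (g i).norm := by
    intro b' g' θ' h' hlt
    rw [hN] at hlt
    exact Nat.find_min hex hlt ⟨b', g', θ', h', rfl⟩
  obtain ⟨m, rfl⟩ : ∃ m, n = m + 1 := ⟨n - 1, by omega⟩
  have ha : ∀ i ≤ m, ∀ e, (θ i, e) ∉ (g i).toWord.getLast? := by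
    intro i hi e he
    refine hmin b (Function.update g i (g i * FreeGroup.mk [(θ i, !e)])) θ
      ⟨hd.1, fun j hj => ?_⟩ ?_
    · by_cases hij : j = i
      · subst hij
        rw [Function.update_self, hd.2 j hj, mul_inv_rev]
        conv_lhs => rw [← mk_commute (θ j) (!e)]
        simp only [mul_assoc]
      · rw [Function.update_of_ne hij, hd.2 j hj]
    · refine Finset.sum_lt_sum (fun j _ => ?_) ⟨i, Finset.mem_range.2 (by omega), ?_⟩
      · by_cases hij : j = i
        · subst hij
          rw [Function.update_self]; exact (norm_mul_lt_of_getLast he).le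
        · rw [Function.update_of_ne hij]
      · rw [Function.update_self]; exact norm_mul_lt_of_getLast he
  refine ⟨b, fun i hi => eq_id_of_reduced (f := γ.comp (Θ (m + 1) b).toMonoidHom) (m := m)
    (fun i hi => hd.2 i (by omega)) ha (fun i hi he => ?_) (fun i hi he => ?_) ?_ i (by omega)⟩
  · have h1 := norm_insert_lt he (ha i hi.le true)
    refine hmin _ _ _ (hd.move_inv (i := i) (by omega)) (sum_range_lt_of_two (i := i) (j := i + 1)
      (by omega) (by omega) (by omega) ?_ fun k hk hk' => by simp [hk, hk'])
    simp only [if_true, Nat.succ_ne_self, if_false]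
    have h2 : (FreeGroup.mk [(θ i, !false)] : F) = x (θ i) := rfl
    rw [h2] at h1
    omega
  · have he' := head_inv_of_getLast he
    rw [mul_inv_rev, inv_inv] at he'
    have h1 := norm_insert_lt he' (ha (i + 1) hi _)
    refine hmin _ _ _ (hd.move (i := i) (by omega)) (sum_range_lt_of_two (i := i) (j := i + 1)
      (by omega) (by omega) (by omega) ?_ fun k hk hk' => by simp [hk, hk'])
    simp only [if_true, Nat.succ_ne_self, if_false]
    have h2 : (FreeGroup.mk [(θ (i + 1), !!false)] : F) = (x (θ (i + 1)))⁻¹ := rfl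
    rw [h2] at h1
    omega
  · show γ (Θ (m + 1) b (cp 0 (m + 1))) = _
    have := Θ_pr_cp b
    rw [hd.1] at this
    rw [this, hc]

/-- A positive automorphism is, up to inner automorphisms, a transvection. -/
theorem Induces.exists_conj (hn : 2 ≤ n) {φ : MulAut (ArtinB n)} {α : F →* F} (h : Induces n φ α)
    (hp : Pos n α) :
    ∃ y : ArtinB n, ∀ g, ∃ k : ℤ, y * φ g * y⁻¹ = g * ΔB n ^ k := by
  obtain ⟨v₀, hv₀⟩ := isConj_iff.1 hp.2
  have hc0 : cp 0 n ∈ Fs n := by simpa using cp_mem 0 n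
  obtain ⟨v, hvF, hv⟩ : ∃ v ∈ Fs n, v * α (cp 0 n) * v⁻¹ = cp 0 n := by
    refine ⟨BnAux.κ n v₀, κ_mem _ _, ?_⟩
    have := congrArg (BnAux.κ n) hv₀
    rwa [map_mul, map_mul, map_inv, κ_of_mem hc0, κ_of_mem (h _).1] at this
  obtain ⟨b, hb⟩ := exists_Θ_of_fix_cp (n := n) (by omega)
    (γ := (MulAut.conj v).toMonoidHom.comp α) (by simpa using hv) (fun i hi => by
      obtain ⟨j, -, hj⟩ := hp.1 i hi
      refine ⟨j, IsConj.trans (IsConj.symm ?_) hj⟩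
      exact isConj_iff.2 ⟨v, rfl⟩)
  have hb' : ∀ w ∈ Fs n, v * α (BnAux.Θ n b w) * v⁻¹ = w := fun w hw =>
    Fs_eqOn (f := ((MulAut.conj v).toMonoidHom.comp α).comp (BnAux.Θ n b).toMonoidHom)
      (g := MonoidHom.id F) hb hw
  have hι : ∀ w ∈ Fs n, BnAux.Θ n (ι n v) w = v * w * v⁻¹ := fun w hw => by
    rw [Θ_ι hvF, MulAut.conj_apply]
  have hφ : ∀ g w, w ∈ Fs n → BnAux.Θ n (ι n v * φ b * φ g * (ι n v * φ b)⁻¹) w =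
      BnAux.Θ n g w := by
    intro g w hw
    have h1 : BnAux.Θ n (ι n v * φ b) (α w) = w := by
      rw [map_mul, MulAut.mul_apply, ← h.Θ hn, hι _ (h _).1, hb' w hw]
    have h2 : BnAux.Θ n (ι n v * φ b)⁻¹ w = α w := by
      rw [map_inv, autInv_eq_iff, h1]
    rw [map_mul, MulAut.mul_apply, h2, mul_assoc, map_mul, MulAut.mul_apply, ← map_mul φ,
      ← h.Θ hn, hι _ (h _).1, map_mul, MulAut.mul_apply, hb' _ (Θ_mem_Fs _ hw)]
  refine ⟨ι n v * φ b, fun g => ?_⟩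
  obtain ⟨k, hk⟩ := exists_zpow_of_fix (n := n) (by omega)
    (g := g⁻¹ * (ι n v * φ b * φ g * (ι n v * φ b)⁻¹)) (fun i hi => by
      rw [map_mul, MulAut.mul_apply, hφ g _ (x_mem_Fs hi), Θ_inv_apply'])
  exact ⟨k, by rw [← hk, mul_inv_cancel_left]⟩

theorem mul_ΔB_mul (g h : ArtinB n) (k l : ℤ) :
    g * ΔB n ^ k * (h * ΔB n ^ l) = g * h * ΔB n ^ (k + l) := by
  rw [zpow_add, mul_assoc, ← mul_assoc _ h, (ΔB_zpow_comm k h).eq]; simp only [mul_assoc]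

theorem mul_ΔB_inv (g : ArtinB n) (k : ℤ) : (g * ΔB n ^ k)⁻¹ = g⁻¹ * ΔB n ^ (-k) := by
  rw [mul_inv_rev, ← zpow_neg, (ΔB_zpow_comm _ _).eq]

theorem mul_ΔB_pow (g : ArtinB n) (k : ℤ) (m : ℕ) :
    (g * ΔB n ^ k) ^ m = g ^ m * ΔB n ^ (m * k) := by
  rw [((ΔB_zpow_comm k g).symm).mul_pow, ← zpow_natCast (ΔB n ^ k), ← zpow_mul, mul_comm k]

theorem ρB_eq (hn : 0 < n) : ρB n = blk n 0 (n - 1) * s n (n - 1) := by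
  obtain ⟨m, rfl⟩ : ∃ m, n = m + 1 := ⟨n - 1, by omega⟩
  rw [ρB_eq_blk, blk_succ, zero_add]; rfl

theorem map_blk {φ : ArtinB n →* ArtinB n} {p : ℤ} {N : ℕ}
    (h : ∀ i < N, φ (s n i) = s n i * ΔB n ^ p) {m : ℕ} (hm : m ≤ N) :
    φ (blk n 0 m) = blk n 0 m * ΔB n ^ (m * p) := by
  induction m with
  | zero => simp [blk]
  | succ m ih =>
    rw [blk_succ, map_mul, ih (by omega), zero_add, h m (by omega), mul_ΔB_mul]
    congr 2; push_cast; ring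

theorem map_dl {φ : ArtinB n →* ArtinB n} {p : ℤ}
    (h : ∀ i, i + 1 < n → φ (s n i) = s n i * ΔB n ^ p) {q : ℕ} (hq : q < n) :
    φ (dl n q) = dl n q * ΔB n ^ (2 * q * p) := by
  induction q with
  | zero => simp [dl_zero]
  | succ q ih =>
    rw [dl_succ hq, map_mul, map_mul, ih (by omega), h q hq, mul_ΔB_mul, mul_ΔB_mul]
    congr 2; push_cast; ring

theorem neg_dl {q : ℕ} (hq : q < n) : neg n (dl n q) = (dl n q)⁻¹ := by
  induction q with
  | zero => simp [dl_zero]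
  | succ q ih => rw [dl_succ hq, map_mul, map_mul, ih (by omega), neg_s (by omega)]; group

/-- `φ` is a transvection: it multiplies the generators by central elements. -/
def IsTransv (n : ℕ) (p : ℤ) (φ : MulAut (ArtinB n)) : Prop :=
  (∀ i, i + 1 < n → φ (s n i) = s n i * ΔB n ^ p) ∧
    φ (s n (n - 1)) = s n (n - 1) * ΔB n ^ (-(p * ((n : ℤ) - 1)))

theorem exists_isTransv (hn : 3 ≤ n) {φ : MulAut (ArtinB n)}
    (h : ∀ g, ∃ k : ℤ, φ g = g * ΔB n ^ k) : ∃ p, IsTransv n p φ := by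
  choose k hk using h
  have hk0 : ∀ i, i + 1 < n → k (s n i) = k (s n 0) := by
    intro i
    induction i with
    | zero => exact fun _ => rfl
    | succ i ih =>
      intro hi
      rw [← ih (by omega)]
      have h1 := congrArg φ (braid (n := n) (i := i) (by omega))
      simp only [map_mul, hk (s n i), hk (s n (i + 1)), mul_ΔB_mul] at h1
      rw [braid (by omega)] at h1
      have h2 := zpow_ΔB_injective (by omega) (mul_left_cancel h1)
      omega
  have hs : ∀ i < n - 1, φ (s n i) = s n i * ΔB n ^ k (s n 0) := fun i hi => by
    rw [hk (s n i), hk0 i (by omega)]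
  refine ⟨k (s n 0), fun i hi => hs i (by omega), ?_⟩
  have hρ : φ (ρB n) = ρB n * ΔB n ^ (((n - 1 : ℕ) : ℤ) * k (s n 0) + k (s n (n - 1))) := by
    rw [ρB_eq (by omega), map_mul, hk (s n (n - 1))]
    have := map_blk (φ := φ.toMonoidHom) hs le_rfl
    change φ _ = _ at this
    rw [this, mul_ΔB_mul]
  have hΔ : φ (ΔB n) =
      ΔB n ^ (1 + n * (((n - 1 : ℕ) : ℤ) * k (s n 0) + k (s n (n - 1)))) := by
    rw [zpow_add, zpow_one]
    conv_lhs => rw [ΔB, map_pow, hρ, mul_ΔB_pow]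
    rfl
  rw [hk (s n (n - 1))]
  congr 2
  generalize hK : ((n - 1 : ℕ) : ℤ) * k (s n 0) + k (s n (n - 1)) = K at hΔ
  have hK0 : K = 0 := by
    have h1 : 1 + n * K = 1 ∨ 1 + n * K = -1 := by
      rcases aut_ΔB_cases (by omega) φ with h | h
      · exact .inl (zpow_ΔB_injective (n := n) (by omega) (by rw [← hΔ, h, zpow_one]))
      · exact .inr (zpow_ΔB_injective (n := n) (by omega) (by rw [← hΔ, h, zpow_neg_one]))
    rcases h1 with h1 | h1
    · have : (n : ℤ) * K = 0 := by omega
      exact (mul_eq_zero.1 this).resolve_left (by omega)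
    · have h2 : (n : ℤ) ∣ 2 := ⟨-K, by linarith⟩
      have := Int.le_of_dvd (by norm_num) h2
      omega
  rw [hK0, Nat.cast_sub (by omega)] at hK
  push_cast at hK
  linarith

theorem exists_conj_isTransv (hn : 5 ≤ n) (φ : MulAut (ArtinB n)) :
    ∃ (y : ArtinB n) (p : ℤ) (χ : MulAut (ArtinB n)), IsTransv n p χ ∧
      ((MulAut.conj y * φ = χ ∨ MulAut.conj y * φ = χ * neg n) ∨
        MulAut.conj y * φ = χ * mu n ∨ MulAut.conj y * φ = χ * neg n * mu n) := by
  obtain ⟨ψ, hψ, g1, g2⟩ := exists_good hn φ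
  obtain ⟨ξ, α, hξ, hα, hpos⟩ := g1.exists_pos hn g2
  obtain ⟨y, hy⟩ := hα.exists_conj (by omega) hpos
  obtain ⟨p, hp⟩ := exists_isTransv (φ := MulAut.conj y * ξ) (by omega) (fun g => by
    obtain ⟨k, hk⟩ := hy g
    exact ⟨k, by rw [MulAut.mul_apply, MulAut.conj_apply, hk]⟩)
  have hmu : mu n * mu n = 1 := MulEquiv.ext mu_mu
  refine ⟨y, p, _, hp, ?_⟩
  rcases hψ with rfl | rfl <;> rcases hξ with rfl | rfl
  · exact .inl (.inl rfl)
  · exact .inl (.inr (by rw [mul_assoc, mul_assoc, neg_neg_mul, mul_one]))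
  · exact .inr (.inl (by rw [mul_assoc, mul_assoc, hmu, mul_one]))
  · refine .inr (.inr ?_)
    rw [mul_assoc, mul_assoc, mul_assoc _ (neg n), ← mul_assoc (neg n), neg_neg_mul, one_mul,
      mul_assoc, hmu, mul_one]

theorem δB_eq (hn : 2 ≤ n) : δB n = dl n (n - 1) := by
  have key : ∀ q, q + 1 < n → dl n (q + 1) = ((List.range q).map fun i => s n (q - i)).prod *
      s n 0 ^ 2 * ((List.range q).map fun i => s n (i + 1)).prod := by
    intro q
    induction q with
    | zero => intro hq; rw [dl_succ hq, dl_zero]; simp [pow_two]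
    | succ q ih =>
      intro hq
      rw [dl_succ hq, ih (by omega), List.range_succ_eq_map, List.map_cons, List.prod_cons,
        ← List.range_succ_eq_map, List.range_succ, List.map_append, List.prod_append, List.map_map]
      simp only [Function.comp_def, Nat.succ_eq_add_one, Nat.add_sub_add_right, Nat.sub_zero,
        List.map_cons, List.map_nil, List.prod_cons, List.prod_nil, mul_one, mul_assoc]
  obtain ⟨m, rfl⟩ : ∃ m, n = m + 2 := ⟨n - 2, by omega⟩
  rw [show m + 2 - 1 = m + 1 from rfl, key m (by omega), δB]
  congr 2
  congr 1
  refine List.map_congr_left fun i hi => ?_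
  have := List.mem_range.1 hi
  rw [s]; congr 1; omega

theorem ρ₀B_eq : ρ₀B n = blk n 0 (n - 1) := by
  have : ∀ m, ((List.range m).map fun i => rB n (i + 1)).prod = blk n 0 m := by
    intro m
    induction m with
    | zero => rfl
    | succ m ih => rw [List.range_succ, List.map_append, List.prod_append, ih, blk_succ]; simp [s]
  exact this _

theorem s_last_eq (hn : 0 < n) : s n (n - 1) = (blk n 0 (n - 1))⁻¹ * ρB n := by
  rw [ρB_eq hn, inv_mul_cancel_left]

theorem blk_succ' (a m : ℕ) : blk n a (m + 1) = s n a * blk n (a + 1) m := by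
  induction m with
  | zero => simp [blk]
  | succ m ih => rw [blk_succ, ih, blk_succ, mul_assoc, add_right_comm, add_assoc]

theorem transv_last (hn : 0 < n) {T : MulAut (ArtinB n)}
    (hs : ∀ i < n - 1, T (s n i) = s n i * ΔB n) (hρ : T (ρB n) = ρB n) :
    T (s n (n - 1)) = s n (n - 1) * ΔB n ^ (-((n : ℤ) - 1)) := by
  have h := map_blk (φ := T.toMonoidHom) (p := 1) (fun i hi => (hs i hi).trans (by rw [zpow_one]))
    le_rfl
  change T _ = _ at h
  rw [s_last_eq hn, map_mul, map_inv T, h, hρ, mul_ΔB_inv, mul_assoc, (ΔB_zpow_comm _ _).eq,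
    ← mul_assoc]
  congr 2
  rw [Nat.cast_sub hn]; push_cast; ring

theorem tau_last (hn : 2 ≤ n) {τ : MulAut (ArtinB n)}
    (hs : ∀ i < n - 1, τ (s n i) = (s n (n - 2 - i))⁻¹) (hρ : τ (ρB n) = (ρB n)⁻¹) :
    τ (s n (n - 1)) = ρ₀B n * (s n (n - 1))⁻¹ * (ρ₀B n)⁻¹ := by
  have h : ∀ m ≤ n - 1, τ (blk n 0 m) = (blk n (n - 1 - m) m)⁻¹ := by
    intro m
    induction m with
    | zero => intro _; simp [blk]
    | succ m ih =>
      intro hm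
      rw [blk_succ, map_mul, ih (by omega), zero_add, hs m (by omega), blk_succ', mul_inv_rev,
        show n - 1 - (m + 1) = n - 2 - m by omega, show n - 2 - m + 1 = n - 1 - m by omega]
  have h1 := h _ le_rfl
  rw [Nat.sub_self] at h1
  rw [ρ₀B_eq, s_last_eq (by omega), map_mul, map_inv τ, h1, hρ]
  group

theorem mu_last_of {μ : MulAut (ArtinB n)} (hn : 2 ≤ n)
    (hs : ∀ i < n - 1, μ (s n i) = (s n i)⁻¹) (hρ : μ (ρB n) = ρB n) :
    μ (s n (n - 1)) = δB n * s n (n - 1) := by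
  have h : ∀ m ≤ n - 1, (μ (blk n 0 m))⁻¹ * blk n 0 m = dl n m := by
    intro m
    induction m with
    | zero => intro _; simp [blk, dl_zero]
    | succ m ih =>
      intro hm
      rw [dl_succ (by omega), ← ih (by omega), blk_succ, map_mul, zero_add, hs m (by omega)]
      group
  rw [δB_eq hn, ← h _ le_rfl, s_last_eq (by omega), map_mul, map_inv μ, hρ]
  group

end BnAux

open BnAux in
/-- classification of automorphisms of `A[Bₙ]`, `n ≥ 5`, in the standard
generators, and the expressions of `T`, `τ`, `μ` in the standard generators. -/
theorem automorphism_standard_generators (n : ℕ) (hn : 5 ≤ n) :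
    (∀ φ : MulAut (ArtinB n), ∃ (x : ArtinB n) (ε p : ℤ), (ε = 1 ∨ ε = -1) ∧
      (((∀ i, 1 ≤ i → i ≤ n - 1 →
          conjComp x φ.toMonoidHom (rB n i) = rB n i ^ ε * ΔB n ^ p) ∧
        conjComp x φ.toMonoidHom (rB n n) =
          rB n n ^ ε * ΔB n ^ (-(p * ((n : ℤ) - 1)))) ∨
       ((∀ i, 1 ≤ i → i ≤ n - 1 →
          conjComp x φ.toMonoidHom (rB n i) = rB n i ^ ε * ΔB n ^ p) ∧
        conjComp x φ.toMonoidHom (rB n n) =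
          δB n ^ (-ε) * rB n n ^ (-ε) * ΔB n ^ (-(p * ((n : ℤ) - 1)))))) ∧
    (∀ T : MulAut (ArtinB n),
      ((∀ i < n, T (tB n i) = tB n i * ΔB n) ∧ T (ρB n) = ρB n) →
      (∀ i, 1 ≤ i → i ≤ n - 1 → T (rB n i) = rB n i * ΔB n) ∧
        T (rB n n) = rB n n * ΔB n ^ (-((n : ℤ) - 1))) ∧
    (∀ τ : MulAut (ArtinB n),
      ((∀ i < n, τ (tB n i) = (tB n (n - i))⁻¹) ∧ τ (ρB n) = (ρB n)⁻¹) →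
      (∀ i, 1 ≤ i → i ≤ n - 1 → τ (rB n i) = (rB n (n - i))⁻¹) ∧
        τ (rB n n) = ρ₀B n * (rB n n)⁻¹ * (ρ₀B n)⁻¹) ∧
    (∀ μ : MulAut (ArtinB n),
      ((∀ i < n, μ (tB n i) = (tB n i)⁻¹) ∧ μ (ρB n) = ρB n) →
      (∀ i, 1 ≤ i → i ≤ n - 1 → μ (rB n i) = (rB n i)⁻¹) ∧
        μ (rB n n) = δB n * rB n n) := by
  have hr : ∀ i, 1 ≤ i → rB n i = s n (i - 1) := fun i hi => by rw [s, Nat.sub_add_cancel hi]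
  have ht : ∀ i, 1 ≤ i → i ≤ n - 1 → tB n i = rB n i := fun i h1 h2 => by
    rw [tB, Nat.mod_eq_of_lt (by omega), if_neg (by omega)]
  have hrs : ∀ i < n - 1, s n i = tB n (i + 1) := fun i hi => (ht _ (by omega) (by omega)).symm
  rw [hr n (by omega)]
  refine ⟨fun φ => ?_, fun T hT => ?_, fun τ hτ => ?_, fun μ hμ => ?_⟩
  · obtain ⟨y, p, χ, ⟨h1, h2⟩, h⟩ := exists_conj_isTransv hn φ
    have e : ∀ g, conjComp y φ.toMonoidHom g = (MulAut.conj y * φ) g := fun g => rfl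
    have hdl := map_dl (φ := χ.toMonoidHom) h1 (q := n - 1) (by omega)
    change χ _ = _ at hdl
    have hn1 : ((n - 1 : ℕ) : ℤ) = n - 1 := by rw [Nat.cast_sub (by omega)]; simp
    rw [hn1] at hdl
    simp only [δB_eq (show 2 ≤ n by omega)]
    rcases h with (h | h) | h | h
    · refine ⟨y, 1, p, .inl rfl, .inl ⟨fun i hi hin => ?_, ?_⟩⟩
      · rw [e, h, hr i hi, h1 _ (by omega), zpow_one]
      · rw [e, h, h2, zpow_one]
    · refine ⟨y, -1, -p, .inr rfl, .inl ⟨fun i hi hin => ?_, ?_⟩⟩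
      · rw [e, h, hr i hi, MulAut.mul_apply, neg_s (by omega), map_inv χ, h1 _ (by omega),
          mul_ΔB_inv, zpow_neg_one]
      · rw [e, h, MulAut.mul_apply, neg_s (by omega), map_inv χ, h2, mul_ΔB_inv, zpow_neg_one]
        congr 2; ring
    · refine ⟨y, -1, -p, .inr rfl, .inr ⟨fun i hi hin => ?_, ?_⟩⟩
      · rw [e, h, hr i hi, MulAut.mul_apply, mu_s (by omega), map_inv χ, h1 _ (by omega),
          mul_ΔB_inv, zpow_neg_one]
      · rw [e, h, MulAut.mul_apply, mu_last (by omega), map_mul, hdl, h2, mul_ΔB_mul,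
          _root_.neg_neg,
          zpow_one, zpow_one]
        congr 2; ring
    · refine ⟨y, 1, p, .inl rfl, .inr ⟨fun i hi hin => ?_, ?_⟩⟩
      · rw [e, h, hr i hi, MulAut.mul_apply, mu_s (by omega), MulAut.mul_apply,
          map_inv (BnAux.neg n), neg_s (by omega), inv_inv, h1 _ (by omega), zpow_one]
      · rw [e, h, MulAut.mul_apply, mu_last (by omega), MulAut.mul_apply, map_mul,
          neg_dl (by omega), neg_s (by omega), map_mul, map_inv χ, map_inv χ, hdl, h2, mul_ΔB_inv,
          mul_ΔB_inv, mul_ΔB_mul, zpow_neg_one, zpow_neg_one]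
        congr 2; ring
  · have h : ∀ i, 1 ≤ i → i ≤ n - 1 → T (rB n i) = rB n i * ΔB n := fun i h1 h2 => by
      rw [← ht i h1 h2, hT.1 i (by omega)]
    exact ⟨h, transv_last (by omega) (fun i hi => h (i + 1) (by omega) (by omega)) hT.2⟩
  · have h : ∀ i, 1 ≤ i → i ≤ n - 1 → τ (rB n i) = (rB n (n - i))⁻¹ := fun i h1 h2 => by
      rw [← ht i h1 h2, hτ.1 i (by omega), ht _ (by omega) (by omega)]
    refine ⟨h, tau_last (by omega) (fun i hi => ?_) hτ.2⟩
    rw [s, h (i + 1) (by omega) (by omega), hr _ (by omega)]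
    congr 2; omega
  · have h : ∀ i, 1 ≤ i → i ≤ n - 1 → μ (rB n i) = (rB n i)⁻¹ := fun i h1 h2 => by
      rw [← ht i h1 h2, hμ.1 i (by omega)]
    exact ⟨h, mu_last_of (by omega) (fun i hi => h (i + 1) (by omega) (by omega)) hμ.2⟩
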